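/- Let e : ℝ → [0,∞) be a smooth, compactly supported function and let ζ ∈ (0, 1/5). Then there exist a vector field u ∈ C^ζ(ℝ × 𝕋²; ℝ²) and a pressure p ∈ L^∞(ℝ; C^{2ζ}(𝕋²)) such that (u, p) solves the 2D incompressible Euler equations in the sense of distributions, i.e. for every φ ∈ C_c^∞(ℝ × 𝕋²; ℝ²), ∫_ℝ ∫_{𝕋²} [ u · ∂_t φ + (u ⊗ u) : ∇φ + p (∇ · φ) ] dx dt = 0, and for every ψ ∈ C_c^∞(ℝ × 𝕋²), ∫_ℝ ∫_{𝕋²} u · ∇ψ dx dt = 0; moreover ∫_{𝕋²} |u(t,x)|² dx = e(t) for every t ∈ ℝ. -/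

import Mathlib

open Real MeasureTheory

noncomputable section

/-- Partial derivative of a scalar function in the `i`-th coordinate direction. -/
def pd2 (i : Fin 2) (f : (Fin 2 → ℝ) → ℝ) (x : Fin 2 → ℝ) : ℝ :=
  fderiv ℝ f x (Pi.single i 1)

/-- The fundamental domain `[0,2π]²` of the torus `𝕋² = (ℝ/2πℤ)²`. -/
def box2 : Set (Fin 2 → ℝ) := Set.Icc 0 (fun _ => 2 * Real.pi)

/-- `2π`-periodicity in each of the two spatial variables. -/
def Periodic2 {E : Type*} (f : (Fin 2 → ℝ) → E) : Prop :=
  ∀ (x : Fin 2 → ℝ) (i : Fin 2), f (x + Pi.single i (2 * Real.pi)) = f x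

open scoped ContDiff

set_option linter.unusedSectionVars false
set_option linter.unusedSimpArgs false

/-! ### Integrals depending smoothly on parameters -/

section ParametricIntegral

variable {G F : Type} [NormedAddCommGroup G] [NormedSpace ℝ G] [ProperSpace G]
  [NormedAddCommGroup F] [NormedSpace ℝ F] [CompleteSpace F]

lemma hasFDerivAt_integral_unit {f : G × ℝ → F} (hf : ContDiff ℝ 1 f) (z : G) :
    HasFDerivAt (fun z => ∫ θ in (0 : ℝ)..1, f (z, θ))
      (∫ θ in (0 : ℝ)..1, (fderiv ℝ f (z, θ)).comp (ContinuousLinearMap.inl ℝ G ℝ)) z := by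
  have hc : Continuous (fun y => (fderiv ℝ f y).comp (ContinuousLinearMap.inl ℝ G ℝ)) :=
    (hf.continuous_fderiv one_ne_zero).clm_comp continuous_const
  obtain ⟨C, hC⟩ := ((isCompact_closedBall z 1).prod (isCompact_Icc (a := (0:ℝ)) (b := 1))).exists_bound_of_continuousOn
    hc.continuousOn
  refine intervalIntegral.hasFDerivAt_integral_of_dominated_of_fderiv_le
    (F' := fun z θ => (fderiv ℝ f (z, θ)).comp (ContinuousLinearMap.inl ℝ G ℝ))
    (bound := fun _ => C)
    (Metric.closedBall_mem_nhds z one_pos) ?_ ?_ ?_ ?_ ?_ ?_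
  · exact Filter.Eventually.of_forall fun y =>
      (hf.continuous.comp (by fun_prop)).aestronglyMeasurable
  · exact (hf.continuous.comp (by fun_prop)).intervalIntegrable _ _
  · exact (hc.comp (by fun_prop : Continuous fun θ : ℝ => (z, θ))).aestronglyMeasurable
  · refine Filter.Eventually.of_forall fun θ hθ y hy => hC (y, θ) ⟨hy, ?_⟩
    rw [Set.uIoc_of_le zero_le_one] at hθ
    exact ⟨hθ.1.le, hθ.2⟩
  · exact intervalIntegrable_const
  · refine Filter.Eventually.of_forall fun θ _ y _ => ?_
    have h1 : HasFDerivAt f (fderiv ℝ f (y, θ)) (y, θ) :=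
      (hf.differentiable one_ne_zero (y, θ)).hasFDerivAt
    exact h1.comp y (hasFDerivAt_prodMk_left y θ)

lemma contDiff_integral_unit_nat (n : ℕ) : ∀ {F : Type} [NormedAddCommGroup F] [NormedSpace ℝ F]
    [CompleteSpace F] {f : G × ℝ → F}, ContDiff ℝ ∞ f →
    ContDiff ℝ n (fun z => ∫ θ in (0 : ℝ)..1, f (z, θ)) := by
  induction n with
  | zero =>
    intro F _ _ _ f hf
    rw [Nat.cast_zero, contDiff_zero]
    exact continuous_iff_continuousAt.2 fun z =>
      (hasFDerivAt_integral_unit (hf.of_le (by exact_mod_cast le_top)) z).continuousAt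
  | succ n ih =>
    intro F _ _ _ f hf
    have h1 := fun z => hasFDerivAt_integral_unit (hf.of_le (by exact_mod_cast le_top)) z
    have := (contDiff_succ_iff_fderiv (𝕜 := ℝ) (n := n)
      (f := fun z => ∫ θ in (0 : ℝ)..1, f (z, θ))).2 ⟨fun z => (h1 z).differentiableAt, by simp, ?_⟩
    · exact_mod_cast this
    · rw [show fderiv ℝ (fun z => ∫ θ in (0 : ℝ)..1, f (z, θ)) = _ from funext fun z => (h1 z).fderiv]
      apply ih (f := fun y => (fderiv ℝ f y).comp (ContinuousLinearMap.inl ℝ G ℝ))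
      exact ((hf.fderiv_right (m := ∞) (by simp)).clm_comp contDiff_const)

lemma contDiff_integral_unit {f : G × ℝ → F} (hf : ContDiff ℝ ∞ f) :
    ContDiff ℝ ∞ (fun z => ∫ θ in (0 : ℝ)..1, f (z, θ)) :=
  contDiff_infty.2 fun n => contDiff_integral_unit_nat n hf

end ParametricIntegral

/-! ### The ring of smooth functions that are periodic in the space variable -/

/-- The plane. -/
abbrev E2 : Type := Fin 2 → ℝ

/-- The `i`-th basis vector. -/
abbrev e2 (i : Fin 2) : E2 := Pi.single i 1

section Ring

variable (K : Type) [NormedAddCommGroup K] [NormedSpace ℝ K]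

/-- Smooth functions of a parameter in `K` and a point of the torus. -/
def PFsub : Subalgebra ℝ (K × E2 → ℝ) where
  carrier := {f | ContDiff ℝ ∞ f ∧ ∀ k x i, f (k, x + Pi.single i (2 * π)) = f (k, x)}
  mul_mem' := fun ha hb => ⟨ha.1.mul hb.1, fun k x i => by simp [ha.2, hb.2]⟩
  add_mem' := fun ha hb => ⟨ha.1.add hb.1, fun k x i => by simp [ha.2, hb.2]⟩
  algebraMap_mem' := fun r => ⟨contDiff_const, fun _ _ _ => rfl⟩

/-- Smooth functions of a parameter in `K` and a point of the torus, as a type. -/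
def PF : Type := PFsub K

instance : CommRing (PF K) := inferInstanceAs (CommRing (PFsub K))
instance : Algebra ℝ (PF K) := inferInstanceAs (Algebra ℝ (PFsub K))

variable {K}

/-- The underlying function. -/
def PF.fn (f : PF K) : K × E2 → ℝ := Subtype.val (p := fun g => g ∈ PFsub K) f

/-- A smooth periodic function from its underlying function. -/
def PF.mk (g : K × E2 → ℝ) (h₁ : ContDiff ℝ ∞ g)
    (h₂ : ∀ k x i, g (k, x + Pi.single i (2 * π)) = g (k, x)) : PF K :=
  Subtype.mk (p := fun g => g ∈ PFsub K) g ⟨h₁, h₂⟩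

instance : CoeFun (PF K) (fun _ => K × E2 → ℝ) := ⟨PF.fn⟩

namespace PF

@[ext] lemma ext {f g : PF K} (h : ∀ z, f z = g z) : f = g :=
  Subtype.ext (p := fun g => g ∈ PFsub K) (funext h)

@[simp] lemma mk_apply (g : K × E2 → ℝ) (h₁ h₂) (z) : (mk g h₁ h₂) z = g z := rfl

lemma smooth (f : PF K) : ContDiff ℝ ∞ (f : K × E2 → ℝ) :=
  (Subtype.property (p := fun g => g ∈ PFsub K) f).1
lemma diff (f : PF K) (z : K × E2) : HasFDerivAt (f : K × E2 → ℝ) (fderiv ℝ f z) z :=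
  (f.smooth.differentiable (by simp) z).hasFDerivAt
lemma cont (f : PF K) : Continuous (f : K × E2 → ℝ) := f.smooth.continuous
lemma per (f : PF K) (k : K) (x : E2) (i : Fin 2) : f (k, x + Pi.single i (2 * π)) = f (k, x) :=
  (Subtype.property (p := fun g => g ∈ PFsub K) f).2 k x i

@[simp] lemma add_apply (f g : PF K) (z) : (f + g) z = f z + g z := rfl
@[simp] lemma mul_apply (f g : PF K) (z) : (f * g) z = f z * g z := rfl
@[simp] lemma sub_apply (f g : PF K) (z) : (f - g) z = f z - g z := rfl
@[simp] lemma neg_apply (f : PF K) (z) : (-f) z = -f z := rfl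
@[simp] lemma zero_apply (z) : (0 : PF K) z = 0 := rfl
@[simp] lemma one_apply (z) : (1 : PF K) z = 1 := rfl
@[simp] lemma smul_apply (c : ℝ) (f : PF K) (z) : (c • f) z = c * f z := rfl
@[simp] lemma algebraMap_apply (c : ℝ) (z) : (algebraMap ℝ (PF K) c) z = c := rfl

/-- Evaluation at a point, as an algebra homomorphism. -/
def ev (z : K × E2) : PF K →ₐ[ℝ] ℝ where
  toFun f := f z
  map_one' := rfl
  map_mul' _ _ := rfl
  map_zero' := rfl
  map_add' _ _ := rfl
  commutes' _ := rfl

@[simp] lemma pow_apply (f : PF K) (n : ℕ) (z) : (f ^ n) z = f z ^ n := map_pow (ev z) f n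
@[simp] lemma sum_apply {ι : Type*} (s : Finset ι) (f : ι → PF K) (z) :
    (∑ i ∈ s, f i) z = ∑ i ∈ s, f i z := map_sum (ev z) f s

/-- The derivation in a constant direction. -/
def dv (v : K × E2) : Derivation ℝ (PF K) (PF K) :=
  Derivation.mk'
    { toFun := fun f => mk (fun z => fderiv ℝ f z v)
          ((f.smooth.fderiv_right (m := ∞) (by simp)).clm_apply contDiff_const) (fun k x i => by
        have h : (fun z : K × E2 => f (z + (0, Pi.single i (2 * π)))) = f := by
          ext ⟨k, x⟩; simpa using f.per k x i
        have := fderiv_comp_add_right (𝕜 := ℝ) (f := (f : K × E2 → ℝ)) (x := (k, x))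
          (0, Pi.single i (2 * π))
        rw [h] at this
        rw [this]; simp)
      map_add' := fun f g => by
        ext z
        change fderiv ℝ (f.fn + g.fn) z v = _
        rw [((f.diff z).add (g.diff z)).fderiv]; rfl
      map_smul' := fun c f => by
        ext z
        change fderiv ℝ (c • f.fn) z v = _
        rw [((f.diff z).const_smul c).fderiv]; rfl }
    (fun f g => by
      ext z
      change fderiv ℝ (f.fn * g.fn) z v = _
      rw [((f.diff z).mul (g.diff z)).fderiv]
      change f z * _ + g z * _ = f z * _ + g z * _
      rfl)

lemma dv_apply (v : K × E2) (f : PF K) (z) : dv v f z = fderiv ℝ f z v := rfl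

lemma dv_comm (v w : K × E2) (f : PF K) : dv v (dv w f) = dv w (dv v f) := by
  ext z
  have h2 : ∀ a, HasFDerivAt (fderiv ℝ (f : K × E2 → ℝ)) (fderiv ℝ (fderiv ℝ f) a) a := fun a =>
    ((f.smooth.fderiv_right (m := ∞) (by simp)).differentiable (by simp) a).hasFDerivAt
  have key : ∀ v w, dv v (dv w f) z = fderiv ℝ (fderiv ℝ f) z v w := by
    intro v w
    have h3 : HasFDerivAt (dv w f : K × E2 → ℝ) _ z := (h2 z).clm_apply (hasFDerivAt_const w z)
    rw [dv_apply, h3.fderiv]; simp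
  rw [key, key]
  exact second_derivative_symmetric (fun y => f.diff y) (h2 z) v w

lemma dv_add (v w : K × E2) (f : PF K) : dv (v + w) f = dv v f + dv w f := by
  ext z; simp [dv_apply]
lemma dv_smul (c : ℝ) (w : K × E2) (f : PF K) : dv (c • w) f = c • dv w f := by
  ext z; simp [dv_apply]
lemma dv_zero (f : PF K) : dv (0 : K × E2) f = 0 := by
  ext z; simp [dv_apply]

/-- Derivative in the `i`-th space direction. -/
abbrev d (i : Fin 2) : Derivation ℝ (PF K) (PF K) := dv (0, e2 i)

lemma dv_space (x : E2) (f : PF K) : dv ((0 : K), x) f = x 0 • d 0 f + x 1 • d 1 f := by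
  rw [← dv_smul, ← dv_smul, ← dv_add]
  congr 2
  simp only [Prod.smul_mk, smul_zero, Prod.mk_add_mk, add_zero]
  congr 1
  ext i; fin_cases i <;> simp

/-- Derivative along a line. -/
lemma hasDerivAt_line (f : PF K) (z v : K × E2) (s : ℝ) :
    HasDerivAt (fun s : ℝ => f (z + s • v)) (dv v f (z + s • v)) s := by
  have h1 : HasDerivAt (fun s : ℝ => z + s • v) v s := by
    simpa using ((hasDerivAt_id s).smul_const v).const_add z
  exact (f.diff _).comp_hasDerivAt s h1

/-! ### Composition -/

variable {K' : Type} [NormedAddCommGroup K'] [NormedSpace ℝ K']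

/-- The function `(k, x) ↦ f (A k + c, x + Y (k, x))`. -/
def compo (f : PF K) (A : K' →L[ℝ] K) (c : K) (Y : Fin 2 → PF K') : PF K' :=
  mk (fun z => f (A z.1 + c, z.2 + fun i => Y i z)) (by
    refine f.smooth.comp (ContDiff.prodMk (by fun_prop) (contDiff_snd.add ?_))
    exact contDiff_pi.2 fun i => (Y i).smooth) (fun k x i => by
    simp only [per]
    rw [add_right_comm, per])

@[simp] lemma compo_apply (f : PF K) (A : K' →L[ℝ] K) (c : K) (Y : Fin 2 → PF K') (z) :
    compo f A c Y z = f (A z.1 + c, z.2 + fun i => Y i z) := rfl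

lemma dv_compo (v : K' × E2) (f : PF K) (A : K' →L[ℝ] K) (c : K) (Y : Fin 2 → PF K') :
    dv v (compo f A c Y) = compo (dv (A v.1, 0) f) A c Y
      + ∑ j, compo (d j f) A c Y * (algebraMap ℝ _ (v.2 j) + dv v (Y j)) := by
  ext z
  have hY : HasFDerivAt (fun z : K' × E2 => fun i => Y i z)
      (ContinuousLinearMap.pi fun i => fderiv ℝ (Y i) z) z := hasFDerivAt_pi.2 fun i => (Y i).diff z
  have h1 : HasFDerivAt (fun z : K' × E2 => (A z.1 + c, z.2 + fun i => Y i z))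
      (((A.comp (ContinuousLinearMap.fst ℝ K' E2))).prod
        (ContinuousLinearMap.snd ℝ K' E2 + ContinuousLinearMap.pi fun i => fderiv ℝ (Y i) z)) z :=
    HasFDerivAt.prodMk ((A.hasFDerivAt.comp z hasFDerivAt_fst).add_const c)
      (hasFDerivAt_snd.add hY)
  have h2 : HasFDerivAt (compo f A c Y : K' × E2 → ℝ) _ z := (f.diff _).comp z h1
  rw [dv_apply, h2.fderiv]
  have h3 : (A v.1, v.2 + fun i => fderiv ℝ (Y i) z v) =
      (A v.1, (0 : E2)) + ((0 : K), v.2 + fun i => fderiv ℝ (Y i) z v) := by simp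
  change fderiv ℝ f _ (A v.1, v.2 + fun i => fderiv ℝ (Y i) z v) = _
  rw [h3, map_add]
  simp only [add_apply, compo_apply, mul_apply, Fin.sum_univ_two, algebraMap_apply]
  congr 1
  rw [← dv_apply, dv_space]
  simp only [add_apply, smul_apply, Pi.add_apply, dv_apply]
  ring

lemma compo_zero (A : K' →L[ℝ] K) (c : K) (Y : Fin 2 → PF K') :
    compo (0 : PF K) A c Y = 0 := rfl

/-- Composition with a smooth function of a real variable. -/
def comp1 (G : ℝ → ℝ) (hG : ContDiff ℝ ∞ G) (f : PF K) : PF K :=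
  mk (fun z => G (f z)) (hG.comp f.smooth) (fun k x i => by simp [per])

@[simp] lemma comp1_apply (G : ℝ → ℝ) (hG : ContDiff ℝ ∞ G) (f : PF K) (z) :
    comp1 G hG f z = G (f z) := rfl

lemma contDiff_deriv {G : ℝ → ℝ} (hG : ContDiff ℝ ∞ G) : ContDiff ℝ ∞ (deriv G) :=
  (contDiff_infty_iff_deriv.1 hG).2

lemma dv_comp1 (v : K × E2) (G : ℝ → ℝ) (hG : ContDiff ℝ ∞ G) (f : PF K) :
    dv v (comp1 G hG f) = comp1 (deriv G) (contDiff_deriv hG) f * dv v f := by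
  ext z
  have h : HasFDerivAt (comp1 G hG f : K × E2 → ℝ) (deriv G (f z) • fderiv ℝ f z) z :=
    ((hG.differentiable (by simp) (f z)).hasDerivAt).comp_hasFDerivAt z (f.diff z)
  rw [dv_apply, h.fderiv]; rfl

/-- A smooth function of the parameter only. -/
def ofK (g : K → ℝ) (hg : ContDiff ℝ ∞ g) : PF K :=
  mk (fun z => g z.1) (hg.comp contDiff_fst) (fun _ _ _ => rfl)

@[simp] lemma ofK_apply (g : K → ℝ) (hg : ContDiff ℝ ∞ g) (z) : ofK g hg z = g z.1 := rfl

lemma dv_ofK (v : K × E2) (g : K → ℝ) (hg : ContDiff ℝ ∞ g) (z) :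
    dv v (ofK g hg) z = fderiv ℝ g z.1 v.1 := by
  have h : HasFDerivAt (ofK g hg : K × E2 → ℝ) _ z :=
    ((hg.differentiable (by simp) z.1).hasFDerivAt).comp z hasFDerivAt_fst
  rw [dv_apply, h.fderiv]; rfl

lemma d_ofK (i : Fin 2) (g : K → ℝ) (hg : ContDiff ℝ ∞ g) : d i (ofK g hg) = 0 := by
  ext z; rw [dv_ofK]; simp

/-- A function with vanishing directional derivative is invariant. -/
lemma eq_of_dv_eq_zero {f : PF K} {v : K × E2} (h : dv v f = 0) (z : K × E2) (s : ℝ) :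
    f (z + s • v) = f z := by
  have := is_const_of_deriv_eq_zero (𝕜 := ℝ) (f := fun s : ℝ => f (z + s • v))
    (fun s => (hasDerivAt_line f z v s).differentiableAt)
    (fun s => by rw [(hasDerivAt_line f z v s).deriv, h]; rfl) s 0
  simpa using this

lemma abs_line_sub_le (f : PF K) (v : K × E2) (M : ℝ) (z : K × E2) {a b : ℝ} (hab : a ≤ b)
    (h : ∀ s ∈ Set.Icc a b, |dv v f (z + s • v)| ≤ M) :
    |f (z + b • v) - f (z + a • v)| ≤ M * (b - a) := by
  have := norm_image_sub_le_of_norm_deriv_le_segment' (f := fun s : ℝ => f (z + s • v))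
    (f' := fun s => dv v f (z + s • v)) (a := a) (b := b) (C := M)
    (fun s _ => (hasDerivAt_line f z v s).hasDerivWithinAt)
    (fun s hs => by simpa using h s ⟨hs.1, hs.2.le⟩) b ⟨hab, le_rfl⟩
  simpa using this

/-! ### Averages along a segment -/

section avg

variable [ProperSpace K]

private def avgAux (k : ℕ) (v : K × E2) (f : PF K) : PF K :=
  mk (fun z => ∫ θ in (0 : ℝ)..1, θ ^ k * f (z + θ • v)) (by
    refine contDiff_integral_unit (f := fun y : (K × E2) × ℝ => y.2 ^ k * f (y.1 + y.2 • v)) ?_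
    exact (contDiff_snd.pow k).mul (f.smooth.comp (by fun_prop))) (fun n x i => by
    refine intervalIntegral.integral_congr fun θ _ => ?_
    change θ ^ k * f (n + θ • v.1, x + Pi.single i (2 * π) + θ • v.2) =
      θ ^ k * f (n + θ • v.1, x + θ • v.2)
    rw [add_right_comm, per])

/-- The weighted average `∫₀¹ θ ^ k f (z + θ v) dθ`. -/
def avg (k : ℕ) (v : K × E2) : PF K →ₗ[ℝ] PF K where
  toFun := avgAux k v
  map_add' := fun f g => by
    ext z
    change (∫ θ in (0 : ℝ)..1, θ ^ k * (f (z + θ • v) + g (z + θ • v))) =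
      (∫ θ in (0 : ℝ)..1, θ ^ k * f (z + θ • v)) + (∫ θ in (0 : ℝ)..1, θ ^ k * g (z + θ • v))
    rw [← intervalIntegral.integral_add]
    · simp only [mul_add]
    · exact (Continuous.mul (by fun_prop) (f.cont.comp (by fun_prop))).intervalIntegrable _ _
    · exact (Continuous.mul (by fun_prop) (g.cont.comp (by fun_prop))).intervalIntegrable _ _
  map_smul' := fun c f => by
    ext z
    change (∫ θ in (0 : ℝ)..1, θ ^ k * (c * f (z + θ • v))) =
      c * (∫ θ in (0 : ℝ)..1, θ ^ k * f (z + θ • v))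
    rw [← intervalIntegral.integral_const_mul]
    congr 1; ext θ; ring

lemma avg_apply (k : ℕ) (v : K × E2) (f : PF K) (z) :
    avg k v f z = ∫ θ in (0 : ℝ)..1, θ ^ k * f (z + θ • v) := rfl

lemma dv_avg (w : K × E2) (k : ℕ) (v : K × E2) (f : PF K) : dv w (avg k v f) = avg k v (dv w f) := by
  ext z
  set F : (K × E2) × ℝ → ℝ := fun y => y.2 ^ k * f (y.1 + y.2 • v)
  have hF : ContDiff ℝ ∞ F := (contDiff_snd.pow k).mul (f.smooth.comp (by fun_prop))
  have h := hasFDerivAt_integral_unit (hF.of_le (by exact_mod_cast le_top)) z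
  have h' : HasFDerivAt (avg k v f : K × E2 → ℝ) _ z := h
  have hc : Continuous (fun θ : ℝ => (fderiv ℝ F (z, θ)).comp
      (ContinuousLinearMap.inl ℝ (K × E2) ℝ)) :=
    ((hF.continuous_fderiv (by simp)).comp (by fun_prop)).clm_comp continuous_const
  rw [dv_apply, h'.fderiv, ContinuousLinearMap.intervalIntegral_apply
    (hc.intervalIntegrable _ _), avg_apply]
  refine intervalIntegral.integral_congr fun θ _ => ?_
  have h1 : HasFDerivAt F (fderiv ℝ F (z, θ)) (z, θ) :=
    (hF.differentiable (by simp) _).hasFDerivAt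
  have h2 := h1.comp z (hasFDerivAt_prodMk_left (𝕜 := ℝ) z θ)
  have h3 : HasFDerivAt (fun y : K × E2 => θ ^ k * f (y + θ • v))
      (θ ^ k • fderiv ℝ f (z + θ • v)) z := by
    refine HasFDerivAt.const_mul ?_ _
    exact (hasFDerivAt_comp_add_right (θ • v)).2 (f.diff (z + θ • v))
  have h4 := h2.unique h3
  rw [h4]; rfl

/-- The mean value of a derivative in the direction of the average. -/
lemma avg_dv_self (v : K × E2) (f : PF K) (z) : avg 0 v (dv v f) z = f (z + v) - f z := by
  rw [avg_apply]
  simp only [pow_zero, one_mul]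
  rw [intervalIntegral.integral_eq_sub_of_hasDerivAt (f := fun θ : ℝ => f (z + θ • v))
    (fun θ _ => hasDerivAt_line f z v θ)]
  · simp
  · exact ((dv v f).cont.comp (by fun_prop)).intervalIntegrable _ _

lemma avg_one_dv_self (v : K × E2) (f : PF K) (z) :
    avg 1 v (dv v f) z = f (z + v) - avg 0 v f z := by
  have h := intervalIntegral.integral_eq_sub_of_hasDerivAt (a := 0) (b := 1)
    (f := fun θ : ℝ => θ * f (z + θ • v))
    (fun θ _ => (hasDerivAt_id θ).mul (hasDerivAt_line f z v θ))
    (Continuous.intervalIntegrable (by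
      refine Continuous.add (Continuous.mul (by fun_prop) (f.cont.comp (by fun_prop)))
        (Continuous.mul (by fun_prop) ((dv v f).cont.comp (by fun_prop)))) _ _)
  rw [intervalIntegral.integral_add] at h
  · simp only [id, one_mul, one_smul, zero_mul, sub_zero] at h
    rw [avg_apply, avg_apply, ← h]
    simp
  · exact Continuous.intervalIntegrable (Continuous.mul (by fun_prop) (f.cont.comp (by fun_prop))) _ _
  · exact Continuous.intervalIntegrable
      (Continuous.mul (by fun_prop) ((dv v f).cont.comp (by fun_prop))) _ _

lemma abs_avg_le (k : ℕ) (v : K × E2) (f : PF K) (z) {M : ℝ}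
    (h : ∀ θ ∈ Set.Icc (0 : ℝ) 1, |f (z + θ • v)| ≤ M) : |avg k v f z| ≤ M := by
  rw [avg_apply]
  have := intervalIntegral.norm_integral_le_of_norm_le_const (a := 0) (b := 1) (C := M)
    (f := fun θ : ℝ => θ ^ k * f (z + θ • v)) (fun θ hθ => by
      rw [Set.uIoc_of_le zero_le_one] at hθ
      have h1 := h θ ⟨hθ.1.le, hθ.2⟩
      rw [norm_mul, norm_pow]
      have h2 : ‖θ‖ ^ k ≤ 1 := pow_le_one₀ (norm_nonneg _) (by
        rw [Real.norm_eq_abs, abs_of_pos hθ.1]; exact hθ.2)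
      calc ‖θ‖ ^ k * ‖f (z + θ • v)‖ ≤ 1 * M :=
        mul_le_mul h2 h1 (norm_nonneg _) zero_le_one
        _ = M := one_mul M)
  simpa using this

end avg

end PF

end Ring

namespace PF

/-! ### Time integrals -/

/-- Direction of the first time variable. -/
abbrev es : (ℝ × ℝ) × E2 := ((1, 0), 0)
/-- Direction of the second time variable. -/
abbrev et : (ℝ × ℝ) × E2 := ((0, 1), 0)

/-- The integral `∫_t^s f(r,t,x) dr`. -/
def J (f : PF (ℝ × ℝ)) : PF (ℝ × ℝ) :=
  mk (fun z => (z.1.1 - z.1.2) * ∫ θ in (0 : ℝ)..1,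
      f ((z.1.2 + θ * (z.1.1 - z.1.2), z.1.2), z.2)) (by
    refine ContDiff.mul (by fun_prop) ?_
    refine contDiff_integral_unit (G := (ℝ × ℝ) × E2)
      (f := fun y : ((ℝ × ℝ) × E2) × ℝ =>
        f ((y.1.1.2 + y.2 * (y.1.1.1 - y.1.1.2), y.1.1.2), y.1.2)) ?_
    exact f.smooth.comp (by fun_prop)) (fun k x i => by simp only [per])

lemma J_apply (f : PF (ℝ × ℝ)) (s t : ℝ) (x : E2) :
    J f ((s, t), x) = ∫ r in t..s, f ((r, t), x) := by
  have h := intervalIntegral.smul_integral_comp_mul_add (a := 0) (b := 1)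
    (fun r => f ((r, t), x)) (s - t) t
  simp only [mul_zero, zero_add, mul_one, sub_add_cancel, smul_eq_mul] at h
  rw [← h]
  change (s - t) * _ = _
  congr 1
  refine intervalIntegral.integral_congr fun θ _ => ?_
  simp only
  rw [add_comm, mul_comm]

lemma J_diag (f : PF (ℝ × ℝ)) (t : ℝ) (x : E2) : J f ((t, t), x) = 0 := by
  rw [J_apply, intervalIntegral.integral_same]

lemma ds_J (f : PF (ℝ × ℝ)) : dv es (J f) = f := by
  ext ⟨⟨s, t⟩, x⟩
  have h1 := hasDerivAt_line (J f) ((0, t), x) es s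
  have hc : Continuous fun r : ℝ => f ((r, t), x) := f.cont.comp (by fun_prop)
  have h2 : HasDerivAt (fun s => ∫ r in t..s, f ((r, t), x)) (f ((s, t), x)) s :=
    intervalIntegral.integral_hasDerivAt_right (hc.intervalIntegrable _ _)
      (hc.stronglyMeasurableAtFilter _ _) hc.continuousAt
  have h3 : (fun s : ℝ => J f (((0, t), x) + s • es)) = fun s => ∫ r in t..s, f ((r, t), x) := by
    ext s; rw [← J_apply]; simp
  rw [h3] at h1
  have := h1.unique h2
  simpa using this

lemma J_unique {F f : PF (ℝ × ℝ)} (h : dv es F = f) (h0 : ∀ t x, F ((t, t), x) = 0) : F = J f := by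
  ext ⟨⟨s, t⟩, x⟩
  have h1 : dv es (F - J f) = 0 := by rw [map_sub, ds_J, h, sub_self]
  have h2 := eq_of_dv_eq_zero h1 ((t, t), x) (s - t)
  simp only [sub_apply, h0, J_diag] at h2
  simp only [Prod.smul_mk, smul_zero, Prod.mk_add_mk, smul_eq_mul, mul_one, mul_zero,
    add_sub_cancel, add_zero, sub_zero] at h2
  linarith

lemma J_add (f g : PF (ℝ × ℝ)) : J (f + g) = J f + J g :=
  (J_unique (by simp [ds_J]) (by simp [J_diag])).symm

lemma J_mul {f g : PF (ℝ × ℝ)} (hg : dv es g = 0) : J (f * g) = J f * g :=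
  (J_unique (by simp [ds_J, hg, mul_comm]) (by simp [J_diag])).symm

lemma d_J (i : Fin 2) (f : PF (ℝ × ℝ)) : d i (J f) = J (d i f) := by
  refine J_unique (by rw [dv_comm, ds_J]) fun t x => ?_
  have h1 := hasDerivAt_line (J f) ((t, t), x) (0, e2 i) 0
  have h2 : (fun s : ℝ => J f (((t, t), x) + s • ((0 : ℝ × ℝ), e2 i))) = fun _ => 0 := by
    ext s
    simp only [Prod.smul_mk, smul_zero, Prod.mk_add_mk, add_zero, J_diag]
  rw [h2] at h1
  simpa using h1.unique (hasDerivAt_const 0 (0 : ℝ))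

/-- Restriction to the diagonal `s = t`. -/
def diag (f : PF (ℝ × ℝ)) : PF (ℝ × ℝ) :=
  compo f ((ContinuousLinearMap.snd ℝ ℝ ℝ).prod (ContinuousLinearMap.snd ℝ ℝ ℝ)) 0 0

lemma diag_apply (f : PF (ℝ × ℝ)) (s t : ℝ) (x : E2) : diag f ((s, t), x) = f ((t, t), x) := by
  simp only [diag, compo_apply]
  congr 1
  ext i <;> simp

lemma ds_diag (f : PF (ℝ × ℝ)) : dv es (diag f) = 0 := by
  ext ⟨⟨s, t⟩, x⟩
  have h1 := hasDerivAt_line (diag f) ((s, t), x) es 0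
  have h2 : (fun r : ℝ => diag f (((s, t), x) + r • es)) = fun _ => f ((t, t), x) := by
    ext r
    simp [diag_apply]
  rw [h2] at h1
  simpa using h1.unique (hasDerivAt_const 0 _)

lemma dt_J (f : PF (ℝ × ℝ)) : dv et (J f) = J (dv et f) - diag f := by
  rw [eq_sub_iff_add_eq]
  refine J_unique (by rw [map_add, dv_comm, ds_J, ds_diag, add_zero]) fun t x => ?_
  have h1 := hasDerivAt_line (J f) ((t, t), x) (es + et) 0
  have h2 : (fun r : ℝ => J f (((t, t), x) + r • (es + et))) = fun _ => 0 := by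
    ext r
    simp [J_diag]
  rw [h2] at h1
  have h3 := h1.unique (hasDerivAt_const 0 (0 : ℝ))
  rw [dv_add, ds_J] at h3
  simp only [zero_smul, add_zero, add_apply] at h3
  rw [add_apply, diag_apply]
  linarith

lemma abs_J_le (f : PF (ℝ × ℝ)) {s t : ℝ} {x : E2} {M : ℝ}
    (h : ∀ r ∈ Set.uIcc s t, |f ((r, t), x)| ≤ M) : |J f ((s, t), x)| ≤ M * |s - t| := by
  rw [J_apply]
  have := intervalIntegral.norm_integral_le_of_norm_le_const (a := t) (b := s) (C := M)
    (f := fun r => f ((r, t), x)) fun r hr => h r (by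
      rw [Set.uIcc_comm]; exact Set.uIoc_subset_uIcc hr)
  exact this

/-! ### Mean values -/

variable {K : Type} [NormedAddCommGroup K] [NormedSpace ℝ K] [ProperSpace K]

/-- Mean value in the `i`-th space variable. -/
def mn (i : Fin 2) : PF K →ₗ[ℝ] PF K := avg 0 (0, (2 * π) • e2 i)

/-- Mean value in the space variables. -/
def mean : PF K →ₗ[ℝ] PF K := mn 0 ∘ₗ mn 1

lemma dv_mn (v : K × E2) (i : Fin 2) (f : PF K) : dv v (mn i f) = mn i (dv v f) := dv_avg _ _ _ _
lemma dv_mean (v : K × E2) (f : PF K) : dv v (mean f) = mean (dv v f) := by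
  simp only [mean, LinearMap.comp_apply, dv_mn]

lemma d_eq_smul (i : Fin 2) (h : ℝ) (f : PF K) : h • d i f = dv (0, h • e2 i) f := by
  rw [← dv_smul]; simp

lemma per' (f : PF K) (z : K × E2) (i : Fin 2) : f (z + (0, (2 * π) • e2 i)) = f z := by
  obtain ⟨k, x⟩ := z
  have := f.per k x i
  have h2 : (2 * π) • e2 i = Pi.single i (2 * π) := by
    rw [← Pi.single_smul]; simp
  rw [h2]
  simpa using this

lemma mn_d (i : Fin 2) (f : PF K) : mn i (d i f) = 0 := by
  have h : (2 * π) • mn i (d i f) = 0 := by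
    rw [← map_smul, d_eq_smul]
    ext z
    rw [mn, avg_dv_self, per', sub_self]; rfl
  exact (smul_eq_zero.1 h).resolve_left (by positivity)

lemma mean_d (i : Fin 2) (f : PF K) : mean (d i f) = 0 := by
  fin_cases i
  · change mn 0 (mn 1 (d 0 f)) = 0
    rw [← dv_mn, mn_d]
  · change mn 0 (mn 1 (d 1 f)) = 0
    rw [mn_d, map_zero]

lemma abs_mn_le (i : Fin 2) (f : PF K) (k : K) {M : ℝ} (h : ∀ x, |f (k, x)| ≤ M) (x : E2) :
    |mn i f (k, x)| ≤ M :=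
  abs_avg_le _ _ _ _ fun θ _ => by simpa using h _

lemma abs_mean_le (f : PF K) (k : K) {M : ℝ} (h : ∀ x, |f (k, x)| ≤ M) (x : E2) :
    |mean f (k, x)| ≤ M :=
  abs_mn_le 0 _ k (abs_mn_le 1 f k h) x

lemma mn_apply (i : Fin 2) (f : PF K) (z) :
    mn i f z = ∫ θ in (0 : ℝ)..1, f (z + θ • (0, (2 * π) • e2 i)) := by
  rw [mn, avg_apply]; simp

lemma unit_integral_swap {g : ℝ → ℝ → ℝ} (hg : Continuous (Function.uncurry g)) :
    ∫ x in (0 : ℝ)..1, ∫ y in (0 : ℝ)..1, g x y = ∫ y in (0 : ℝ)..1, ∫ x in (0 : ℝ)..1, g x y := by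
  simp only [intervalIntegral.integral_of_le zero_le_one]
  refine integral_integral_swap ?_
  rw [Measure.prod_restrict]
  refine IntegrableOn.mono_set (t := Set.Icc 0 1 ×ˢ Set.Icc 0 1) ?_
    (Set.prod_mono Set.Ioc_subset_Icc_self Set.Ioc_subset_Icc_self)
  exact hg.continuousOn.integrableOn_compact (isCompact_Icc.prod isCompact_Icc)

lemma mn_comm (f : PF K) : mn 1 (mn 0 f) = mn 0 (mn 1 f) := by
  ext z
  rw [mn_apply, mn_apply]
  simp only [mn_apply]
  rw [unit_integral_swap (g := fun θ θ' =>
    f (z + θ • (0, (2 * π) • e2 1) + θ' • (0, (2 * π) • e2 0)))]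
  · refine intervalIntegral.integral_congr fun θ _ => intervalIntegral.integral_congr fun θ' _ => ?_
    rw [add_right_comm]
  · exact f.cont.comp (by fun_prop)

lemma integral_box (f : PF K) (k : K) :
    ∫ x in Set.Icc (0 : E2) (fun _ => 2 * π), f (k, x) = (2 * π) ^ 2 * mean f (k, 0) := by
  have hmp := (volume_preserving_finTwoArrow ℝ).symm
  have hpre : (MeasurableEquiv.finTwoArrow (α := ℝ)).symm ⁻¹' Set.Icc (0 : E2) (fun _ => 2 * π) =
      Set.Icc 0 (2 * π) ×ˢ Set.Icc 0 (2 * π) := by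
    ext ⟨a, b⟩
    simp [MeasurableEquiv.finTwoArrow, Set.mem_Icc, Pi.le_def, Fin.forall_fin_two]
  have hitg : ∀ g : ℝ → ℝ, ∫ y in Set.Icc 0 (2 * π), g y = (2 * π) * ∫ θ in (0 : ℝ)..1, g (2 * π * θ) := by
    intro g
    rw [integral_Icc_eq_integral_Ioc, ← intervalIntegral.integral_of_le two_pi_pos.le]
    have := intervalIntegral.smul_integral_comp_mul_left (a := 0) (b := 1) g (2 * π)
    simpa using this.symm
  rw [← hmp.setIntegral_preimage_emb (MeasurableEquiv.measurableEmbedding _), hpre,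
    Measure.volume_eq_prod, setIntegral_prod, hitg]
  · simp only [hitg]
    rw [intervalIntegral.integral_const_mul, ← mul_assoc, ← pow_two]
    congr 1
    change _ = mn 0 (mn 1 f) (k, 0)
    rw [mn_apply]
    simp only [mn_apply]
    refine intervalIntegral.integral_congr fun θ _ => intervalIntegral.integral_congr fun θ' _ => ?_
    congr 1
    ext i
    · simp
    · fin_cases i <;> simp [MeasurableEquiv.finTwoArrow, mul_comm]
  · refine ContinuousOn.integrableOn_compact (isCompact_Icc.prod isCompact_Icc) ?_
    refine Continuous.continuousOn (f.cont.comp (continuous_const.prodMk ?_))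
    exact (ContinuousLinearEquiv.finTwoArrow ℝ ℝ).symm.continuous

/-- Primitive in the `i`-th space variable. -/
def prim (i : Fin 2) (f : PF K) : PF K := (2 * π) • avg 1 (0, (2 * π) • e2 i) f

lemma dv_prim (v : K × E2) (i : Fin 2) (f : PF K) : dv v (prim i f) = prim i (dv v f) := by
  simp only [prim, Derivation.map_smul, dv_avg]

lemma d_prim (i : Fin 2) (f : PF K) : d i (prim i f) = f - mn i f := by
  rw [dv_prim, prim, ← map_smul, d_eq_smul]
  ext z
  rw [avg_one_dv_self, per', sub_apply]; rfl

lemma abs_prim_le (i : Fin 2) (f : PF K) (k : K) {M : ℝ} (h : ∀ x, |f (k, x)| ≤ M) (x : E2) :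
    |prim i f (k, x)| ≤ 2 * π * M := by
  rw [prim, smul_apply, abs_mul, abs_of_pos two_pi_pos]
  exact mul_le_mul_of_nonneg_left (abs_avg_le _ _ _ _ fun θ _ => by simpa using h _) two_pi_pos.le

lemma prim_zero (i : Fin 2) : prim i (0 : PF K) = 0 := by simp [prim]

/-! ### Families of functions with uniform bounds on derivatives -/

variable {ι : Type} {K K' : Type} [NormedAddCommGroup K] [NormedSpace ℝ K]
  [NormedAddCommGroup K'] [NormedSpace ℝ K']

/-- Uniform bound for a family of functions, on given parameter sets. -/
def B0 (S : ι → Set K) (X : ι → ℝ) (f : ι → PF K) : Prop :=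
  ∃ C, 0 ≤ C ∧ ∀ i, ∀ k ∈ S i, ∀ x, |f i (k, x)| ≤ C * X i

/-- Uniform bounds for a family of functions and its space derivatives up to order `n`, where each
derivative costs a factor `L`. -/
def Big (S : ι → Set K) (L : ι → ℝ) : ℕ → (ι → ℝ) → (ι → PF K) → Prop
  | 0, X, f => B0 S X f
  | n + 1, X, f => B0 S X f ∧ ∀ j, Big S L n (L * X) (fun i => d j (f i))

section
variable {S : ι → Set K} {L : ι → ℝ} {X Y : ι → ℝ} {f g : ι → PF K} {n : ℕ}

lemma B0.mono (h : B0 S X f) {c : ℝ} (hc : 0 ≤ c) (hXY : ∀ i, X i ≤ c * Y i) : B0 S Y f := by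
  obtain ⟨C, hC, h⟩ := h
  refine ⟨C * c, by positivity, fun i k hk x => (h i k hk x).trans ?_⟩
  rw [mul_assoc]
  exact mul_le_mul_of_nonneg_left (hXY i) hC

lemma B0.add (hf : B0 S X f) (hg : B0 S X g) : B0 S X (f + g) := by
  obtain ⟨C, hC, hf⟩ := hf
  obtain ⟨C', hC', hg⟩ := hg
  refine ⟨C + C', by positivity, fun i k hk x => ?_⟩
  have h1 := abs_add_le (f i (k, x)) (g i (k, x))
  have h2 := hf i k hk x
  have h3 := hg i k hk x
  simp only [Pi.add_apply, add_apply]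
  linarith

lemma B0.mul (hf : B0 S X f) (hg : B0 S Y g) : B0 S (X * Y) (f * g) := by
  obtain ⟨C, hC, hf⟩ := hf
  obtain ⟨C', hC', hg⟩ := hg
  refine ⟨C * C', by positivity, fun i k hk x => ?_⟩
  simp only [Pi.mul_apply, mul_apply, abs_mul]
  calc _ ≤ (C * X i) * (C' * Y i) := mul_le_mul (hf i k hk x) (hg i k hk x) (abs_nonneg _)
        ((abs_nonneg _).trans (hf i k hk x))
    _ = _ := by ring

lemma Big.b0 (h : Big S L n X f) : B0 S X f := by
  cases n with
  | zero => exact h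
  | succ n => exact h.1

lemma Big.d (h : Big S L (n + 1) X f) (j : Fin 2) : Big S L n (L * X) (fun i => d j (f i)) := h.2 j

lemma Big.pred (h : Big S L (n + 1) X f) : Big S L n X f := by
  induction n generalizing X f with
  | zero => exact h.1
  | succ n ih => exact ⟨h.1, fun j => ih (h.2 j)⟩

lemma Big.of_le {m : ℕ} (h : Big S L n X f) (hmn : m ≤ n) : Big S L m X f := by
  induction n, hmn using Nat.le_induction with
  | base => exact h
  | succ n _ ih => exact ih h.pred

lemma Big.mono (h : Big S L n X f) (hL : ∀ i, 0 ≤ L i) {c : ℝ} (hc : 0 ≤ c)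
    (hXY : ∀ i, X i ≤ c * Y i) : Big S L n Y f := by
  induction n generalizing X Y f with
  | zero => exact B0.mono h hc hXY
  | succ n ih =>
    refine ⟨B0.mono h.1 hc hXY, fun j => ih (h.2 j) fun i => ?_⟩
    have := mul_le_mul_of_nonneg_left (hXY i) (hL i)
    simp only [Pi.mul_apply]
    linarith

lemma Big.mono_scale {L' : ι → ℝ} (h : Big S L n X f) (hX : ∀ i, 0 ≤ X i) (hL : ∀ i, 0 ≤ L i)
    (hLL : ∀ i, L i ≤ L' i) : Big S L' n X f := by
  induction n generalizing X f with
  | zero => exact h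
  | succ n ih =>
    refine ⟨h.1, fun j => ?_⟩
    have h1 : ∀ i, 0 ≤ (L * X) i := fun i => mul_nonneg (hL i) (hX i)
    refine Big.mono (ih (h.2 j) h1) (fun i => (hL i).trans (hLL i)) zero_le_one fun i => ?_
    simp only [Pi.mul_apply, one_mul]
    exact mul_le_mul_of_nonneg_right (hLL i) (hX i)

lemma Big.subset {S' : ι → Set K} (h : Big S L n X f) (hS : ∀ i, S' i ⊆ S i) :
    Big S' L n X f := by
  have hb : ∀ {X : ι → ℝ} {f : ι → PF K}, B0 S X f → B0 S' X f := by
    rintro X f ⟨C, hC, h⟩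
    exact ⟨C, hC, fun i k hk => h i k (hS i hk)⟩
  induction n generalizing X f with
  | zero => exact hb h
  | succ n ih => exact ⟨hb h.1, fun j => ih (h.2 j)⟩

/-- Pulling back a family along a map of index types. -/
lemma Big.comap {ι' : Type} (r : ι' → ι) (h : Big S L n X f) :
    Big (fun i => S (r i)) (fun i => L (r i)) n (fun i => X (r i)) (fun i => f (r i)) := by
  have hb : ∀ {X : ι → ℝ} {f : ι → PF K}, B0 S X f →
      B0 (fun i => S (r i)) (fun i => X (r i)) (fun i => f (r i)) := by
    rintro X f ⟨C, hC, h⟩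
    exact ⟨C, hC, fun i k hk => h (r i) k hk⟩
  induction n generalizing X f with
  | zero => exact hb h
  | succ n ih => exact ⟨hb h.1, fun j => ih (h.2 j)⟩

lemma Big.congr (h : Big S L n X f) (hX : X = Y) (hf : f = g) : Big S L n Y g := hX ▸ hf ▸ h

lemma Big.add (hf : Big S L n X f) (hg : Big S L n X g) : Big S L n X (f + g) := by
  induction n generalizing X f g with
  | zero => exact B0.add hf hg
  | succ n ih =>
    refine ⟨hf.1.add hg.1, fun j => (ih (hf.2 j) (hg.2 j)).congr rfl ?_⟩
    ext1 i; simp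

lemma Big.mul (hf : Big S L n X f) (hg : Big S L n Y g) : Big S L n (X * Y) (f * g) := by
  induction n generalizing X Y f g with
  | zero => exact B0.mul hf hg
  | succ n ih =>
    refine ⟨hf.1.mul hg.1, fun j => ?_⟩
    have h1 := ih hf.pred (hg.2 j)
    have h2 := ih (hf.2 j) hg.pred
    refine ((h1.congr (show _ = L * (X * Y) by ring) rfl).add
      (h2.congr (show _ = L * (X * Y) by ring) rfl)).congr rfl ?_
    ext1 i
    simp [mul_comm]

lemma Big.zero : Big S L n X (fun _ => 0) := by
  have hb : ∀ X : ι → ℝ, B0 S X (fun _ => 0) := fun X => ⟨0, le_rfl, fun i k _ x => by simp⟩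
  induction n generalizing X with
  | zero => exact hb X
  | succ n ih => exact ⟨hb X, fun j => ih.congr rfl (by ext1 i; simp)⟩

lemma Big.of_d_zero (hf : B0 S X f) (h : ∀ i j, PF.d j (f i) = 0) : Big S L n X f := by
  cases n with
  | zero => exact hf
  | succ n => exact ⟨hf, fun j => Big.zero.congr rfl (by ext1 i; rw [h])⟩

lemma Big.const (c : ι → ℝ) : Big S L n (fun i => |c i|) (fun i => algebraMap ℝ (PF K) (c i)) :=
  Big.of_d_zero ⟨1, zero_le_one, fun i k _ x => by simp⟩ fun i j => by
    rw [Derivation.map_algebraMap]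

lemma Big.neg (hf : Big S L n X f) : Big S L n X (-f) := by
  have hb : ∀ {X : ι → ℝ} {f : ι → PF K}, B0 S X f → B0 S X (-f) := by
    rintro X f ⟨C, hC, h⟩
    exact ⟨C, hC, fun i k hk x => by simpa using h i k hk x⟩
  induction n generalizing X f with
  | zero => exact hb hf
  | succ n ih => exact ⟨hb hf.1, fun j => (ih (hf.2 j)).congr rfl (by ext1 i; simp)⟩

lemma Big.sub (hf : Big S L n X f) (hg : Big S L n X g) : Big S L n X (f - g) := by
  rw [sub_eq_add_neg]; exact hf.add hg.neg

lemma Big.sum {κ : Type} (s : Finset κ) {F : κ → ι → PF K}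
    (h : ∀ j ∈ s, Big S L n X (F j)) : Big S L n X (fun i => ∑ j ∈ s, F j i) := by
  classical
  induction s using Finset.induction_on with
  | empty => simpa using Big.zero
  | insert a s ha ih =>
    have := (h a (Finset.mem_insert_self a s)).add
      (ih fun j hj => h j (Finset.mem_insert_of_mem hj))
    exact this.congr rfl (by ext1 i; simp [Finset.sum_insert ha])

/-- Composition with a fixed smooth function of one variable. -/
lemma Big.comp1 (G : ℝ → ℝ) (hG : ContDiff ℝ ∞ G) (hf : Big S L n 1 f) :
    Big S L n 1 (fun i => PF.comp1 G hG (f i)) := by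
  have hb : ∀ (G : ℝ → ℝ) (hG : ContDiff ℝ ∞ G), B0 S 1 (fun i => PF.comp1 G hG (f i)) := by
    intro G hG
    obtain ⟨C, hC, h⟩ := hf.b0
    obtain ⟨M, hM⟩ := (isCompact_Icc (a := -C) (b := C)).exists_bound_of_continuousOn
      hG.continuous.continuousOn
    refine ⟨|M|, abs_nonneg _, fun i k hk x => ?_⟩
    have h1 := h i k hk x
    simp only [Pi.one_apply, mul_one] at h1 ⊢
    exact (hM _ (abs_le.1 h1)).trans (le_abs_self _)
  induction n generalizing G with
  | zero => exact hb G hG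
  | succ n ih =>
    refine ⟨hb G hG, fun j => ?_⟩
    have h1 := (ih (deriv G) (contDiff_deriv hG) hf.pred).mul (hf.2 j)
    refine h1.congr (by ring) ?_
    ext1 i
    rw [dv_comp1]; rfl

lemma Big.compo {S' : ι → Set K'} {A : ι → K' →L[ℝ] K} {c : ι → K} {Y : ι → Fin 2 → PF K'}
    (hf : Big S L n X f) (hS : ∀ i, ∀ k ∈ S' i, A i k + c i ∈ S i)
    (hY : ∀ j l, Big S' L n 1 (fun i => PF.d j (Y i l))) :
    Big S' L n X (fun i => PF.compo (f i) (A i) (c i) (Y i)) := by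
  have hb : ∀ {X : ι → ℝ} {f : ι → PF K}, B0 S X f →
      B0 S' X (fun i => PF.compo (f i) (A i) (c i) (Y i)) := by
    rintro X f ⟨C, hC, h⟩
    exact ⟨C, hC, fun i k hk x => h i _ (hS i k hk) _⟩
  induction n generalizing X f with
  | zero => exact hb hf
  | succ n ih =>
    refine ⟨hb hf.1, fun j => ?_⟩
    have h1 : ∀ l, Big S' L n (L * X) (fun i => PF.compo (PF.d l (f i)) (A i) (c i) (Y i)) :=
      fun l => ih (hf.2 l) fun j l => (hY j l).pred
    have h2 : ∀ l, Big S' L n 1 (fun i => algebraMap ℝ (PF K') (e2 j l) + PF.d j (Y i l)) := by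
      intro l
      refine Big.add (Big.of_d_zero ⟨1, zero_le_one, fun i k _ x => ?_⟩ fun i j => ?_)
        (hY j l).pred
      · simp only [algebraMap_apply, e2, Pi.single_apply, Pi.one_apply]
        split_ifs <;> simp
      · rw [Derivation.map_algebraMap]
    refine (Big.sum (S := S') (L := L) (n := n) (X := L * X) Finset.univ (F := fun l i =>
      PF.compo (PF.d l (f i)) (A i) (c i) (Y i) * (algebraMap ℝ (PF K') (e2 j l) + PF.d j (Y i l)))
      fun l _ => ((h1 l).mul (h2 l)).congr (mul_one _) rfl).congr rfl ?_
    ext1 i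
    rw [dv_compo]
    simp only [map_zero]
    have : dv ((0 : K), (0 : E2)) (f i) = 0 := dv_zero (f i)
    rw [this, compo_zero, zero_add]

lemma Big.linear (T : ι → PF K → PF K') {S' : ι → Set K'}
    (hT : ∀ i j f, PF.d j (T i f) = T i (PF.d j f))
    (hb : ∀ i f M, (∀ k ∈ S i, ∀ x, |f (k, x)| ≤ M) → ∀ k ∈ S' i, ∀ x, |T i f (k, x)| ≤ Y i * M)
    (hf : Big S L n X f) : Big S' L n (Y * X) (fun i => T i (f i)) := by
  have hb : ∀ {X : ι → ℝ} {f : ι → PF K}, B0 S X f → B0 S' (Y * X) (fun i => T i (f i)) := by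
    rintro X f ⟨C, hC, h⟩
    refine ⟨C, hC, fun i k hk x => (hb i _ _ (h i) k hk x).trans ?_⟩
    simp only [Pi.mul_apply]
    linarith
  induction n generalizing X f with
  | zero => exact hb hf
  | succ n ih =>
    exact ⟨hb hf.1, fun j => (ih (hf.2 j)).congr (by ring) (by ext1 i; rw [hT])⟩

end

/-! ### Material derivatives -/

/-- The time derivative. -/
abbrev dt : Derivation ℝ (PF ℝ) (PF ℝ) := dv ((1 : ℝ), (0 : E2))

lemma d_comm (i j : Fin 2) (f : PF K) : d i (d j f) = d j (d i f) := dv_comm _ _ _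
lemma dt_d (j : Fin 2) (f : PF ℝ) : dt (d j f) = d j (dt f) := dv_comm _ _ _

/-- The material derivative along a velocity field. -/
def mat (u : Fin 2 → PF ℝ) : Derivation ℝ (PF ℝ) (PF ℝ) := dt + ∑ j, u j • d j

lemma mat_apply (u : Fin 2 → PF ℝ) (f : PF ℝ) :
    mat u f = dt f + (u 0 * d 0 f + u 1 * d 1 f) := by
  simp [mat, Fin.sum_univ_two]

lemma mat_d (u : Fin 2 → PF ℝ) (j : Fin 2) (f : PF ℝ) :
    mat u (d j f) = d j (mat u f) - (d j (u 0) * d 0 f + d j (u 1) * d 1 f) := by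
  simp only [mat_apply, map_add, Derivation.leibniz, smul_eq_mul, dt_d j, d_comm 0 j,
    d_comm 1 j]
  ring

/-- Uniform bounds for a family of functions and its material derivative, the latter costing a
factor `τ`. -/
def Cl (S : ι → Set ℝ) (L τ : ι → ℝ) (u : ι → Fin 2 → PF ℝ) (n : ℕ) (X : ι → ℝ)
    (f : ι → PF ℝ) : Prop :=
  Big S L (n + 1) X f ∧ Big S L n (τ * X) (fun i => mat (u i) (f i))

section
variable {S : ι → Set ℝ} {L τ : ι → ℝ} {u : ι → Fin 2 → PF ℝ} {X Y : ι → ℝ} {f g : ι → PF ℝ} {n : ℕ}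

lemma Cl.congr (h : Cl S L τ u n X f) (hX : X = Y) (hf : f = g) : Cl S L τ u n Y g := hX ▸ hf ▸ h

lemma Cl.of_le {m : ℕ} (h : Cl S L τ u n X f) (hmn : m ≤ n) : Cl S L τ u m X f :=
  ⟨h.1.of_le (by omega), h.2.of_le hmn⟩

lemma Cl.comap {ι' : Type} (r : ι' → ι) (h : Cl S L τ u n X f) :
    Cl (fun i => S (r i)) (fun i => L (r i)) (fun i => τ (r i)) (fun i => u (r i)) n
      (fun i => X (r i)) (fun i => f (r i)) := ⟨h.1.comap r, h.2.comap r⟩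

lemma Cl.subset {S' : ι → Set ℝ} (h : Cl S L τ u n X f) (hS : ∀ i, S' i ⊆ S i) :
    Cl S' L τ u n X f := ⟨h.1.subset hS, h.2.subset hS⟩

lemma Cl.mono (h : Cl S L τ u n X f) (hL : ∀ i, 0 ≤ L i) (hτ : ∀ i, 0 ≤ τ i) {c : ℝ} (hc : 0 ≤ c)
    (hXY : ∀ i, X i ≤ c * Y i) : Cl S L τ u n Y f :=
  ⟨h.1.mono hL hc hXY, h.2.mono hL hc fun i => by
    have := mul_le_mul_of_nonneg_left (hXY i) (hτ i)
    simp only [Pi.mul_apply]; linarith⟩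

lemma Cl.add (hf : Cl S L τ u n X f) (hg : Cl S L τ u n X g) : Cl S L τ u n X (f + g) :=
  ⟨hf.1.add hg.1, (hf.2.add hg.2).congr rfl (by ext1 i; simp)⟩

lemma Cl.neg (hf : Cl S L τ u n X f) : Cl S L τ u n X (-f) :=
  ⟨hf.1.neg, hf.2.neg.congr rfl (by ext1 i; simp)⟩

lemma Cl.sub (hf : Cl S L τ u n X f) (hg : Cl S L τ u n X g) : Cl S L τ u n X (f - g) := by
  rw [sub_eq_add_neg]; exact hf.add hg.neg

lemma Cl.mul (hf : Cl S L τ u n X f) (hg : Cl S L τ u n Y g) : Cl S L τ u n (X * Y) (f * g) := by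
  refine ⟨hf.1.mul hg.1, ?_⟩
  refine (((hf.1.pred.mul hg.2).congr (show _ = τ * (X * Y) by ring) rfl).add
    ((hf.2.mul hg.1.pred).congr (show _ = τ * (X * Y) by ring) rfl)).congr rfl ?_
  ext1 i
  simp [mul_comm]

lemma Cl.const (c : ι → ℝ) :
    Cl S L τ u n (fun i => |c i|) (fun i => algebraMap ℝ (PF ℝ) (c i)) :=
  ⟨Big.const c, Big.zero.congr rfl (by ext1 i; simp)⟩

lemma Cl.zero : Cl S L τ u n X (fun _ => 0) :=
  ⟨Big.zero, Big.zero.congr rfl (by ext1 i; simp)⟩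

lemma Cl.smul (c : ι → ℝ) (hc : ∀ i, 0 ≤ c i) (hf : Cl S L τ u n X f) :
    Cl S L τ u n (c * X) (fun i => c i • f i) :=
  ((Cl.const c).mul hf).congr (by ext1 i; simp [abs_of_nonneg (hc i)])
    (by ext1 i; simp [Algebra.smul_def])

lemma Cl.sum {κ : Type} (s : Finset κ) {F : κ → ι → PF ℝ}
    (h : ∀ j ∈ s, Cl S L τ u n X (F j)) : Cl S L τ u n X (fun i => ∑ j ∈ s, F j i) :=
  ⟨Big.sum s fun j hj => (h j hj).1, (Big.sum s fun j hj => (h j hj).2).congr rfl (by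
    ext1 i; simp)⟩

lemma Cl.comp1 (G : ℝ → ℝ) (hG : ContDiff ℝ ∞ G) (hf : Cl S L τ u n 1 f) :
    Cl S L τ u n 1 (fun i => PF.comp1 G hG (f i)) := by
  refine ⟨hf.1.comp1 G hG, ?_⟩
  refine ((Big.comp1 (deriv G) (contDiff_deriv hG) hf.1.pred).mul hf.2).congr (by ring) ?_
  ext1 i
  simp only [mat_apply, dv_comp1, Pi.mul_apply]
  ring

/-- Space derivatives lose a factor `L`. -/
lemma Cl.d (hu : ∀ j l, Big S L n τ (fun i => PF.d j (u i l)))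
    (hf : Cl S L τ u (n + 1) X f) (j : Fin 2) :
    Cl S L τ u n (L * X) (fun i => PF.d j (f i)) := by
  refine ⟨hf.1.2 j, ?_⟩
  have h1 := fun l => (hu j l).mul (hf.1.d l).pred
  refine (((hf.2.d j).congr (show _ = τ * (L * X) by ring) rfl).sub ((h1 0).add (h1 1))).congr
    rfl ?_
  ext1 i
  rw [mat_d]; rfl

end

/-! ### Steklov averages -/

section Steklov
variable {K : Type} [NormedAddCommGroup K] [NormedSpace ℝ K] [ProperSpace K]

/-- Average over a segment of length `h` in the `i`-th space direction. -/
def sa (h : ℝ) (i : Fin 2) : PF K →ₗ[ℝ] PF K := avg 0 (0, h • e2 i)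

/-- Average over a square of side `h`. -/
def sq (h : ℝ) : PF K →ₗ[ℝ] PF K := sa h 0 ∘ₗ sa h 1

/-- Iterated averages over squares of side `h`. -/
def st (h : ℝ) : ℕ → PF K → PF K
  | 0, f => f
  | n + 1, f => st h n (sq h f)

lemma dv_sa (v : K × E2) (h : ℝ) (i : Fin 2) (f : PF K) : dv v (sa h i f) = sa h i (dv v f) :=
  dv_avg _ _ _ _

lemma dv_sq (v : K × E2) (h : ℝ) (f : PF K) : dv v (sq h f) = sq h (dv v f) := by
  simp only [sq, LinearMap.comp_apply, dv_sa]

lemma dv_st (v : K × E2) (h : ℝ) (n : ℕ) (f : PF K) : dv v (st h n f) = st h n (dv v f) := by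
  induction n generalizing f with
  | zero => rfl
  | succ n ih => rw [st, st, ih, dv_sq]

lemma st_add (h : ℝ) (n : ℕ) (f g : PF K) : st h n (f + g) = st h n f + st h n g := by
  induction n generalizing f g with
  | zero => rfl
  | succ n ih => rw [st, st, st, map_add, ih]

lemma st_zero (h : ℝ) (n : ℕ) : st h n (0 : PF K) = 0 := by
  induction n with
  | zero => rfl
  | succ n ih => rw [st, map_zero, ih]

variable {k : K} {f g : PF K} {M F G h : ℝ}

lemma abs_sa_le (i : Fin 2) (hf : ∀ x, |f (k, x)| ≤ M) (x : E2) : |sa h i f (k, x)| ≤ M :=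
  abs_avg_le _ _ _ _ fun θ _ => by simpa using hf _

lemma abs_sq_le (hf : ∀ x, |f (k, x)| ≤ M) (x : E2) : |sq h f (k, x)| ≤ M :=
  abs_sa_le 0 (abs_sa_le 1 hf) x

lemma abs_st_le (n : ℕ) (hf : ∀ x, |f (k, x)| ≤ M) (x : E2) : |st h n f (k, x)| ≤ M := by
  induction n generalizing f with
  | zero => exact hf x
  | succ n ih => exact ih (abs_sq_le hf)

lemma smul_d_sa (i : Fin 2) (z : K × E2) :
    h * d i (sa h i f) z = f (z + (0, h • e2 i)) - f z := by
  rw [← smul_apply, dv_sa, ← map_smul, d_eq_smul, sa, avg_dv_self]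

lemma abs_d_sa_le (hh : 0 < h) (i : Fin 2) (hf : ∀ x, |f (k, x)| ≤ M) (x : E2) :
    |d i (sa h i f) (k, x)| ≤ 2 * h⁻¹ * M := by
  have h1 := smul_d_sa (f := f) (h := h) i (k, x)
  have h2 := hf x
  have h3 := hf (x + h • e2 i)
  have h4 : f ((k, x) + (0, h • e2 i)) = f (k, x + h • e2 i) := by simp
  have h5 : |h * d i (sa h i f) (k, x)| ≤ 2 * M := by
    rw [h1, h4]
    have := abs_sub (f (k, x + h • e2 i)) (f (k, x))
    linarith
  rw [abs_mul, abs_of_pos hh] at h5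
  calc |d i (sa h i f) (k, x)| = h⁻¹ * (h * |d i (sa h i f) (k, x)|) := by field_simp
    _ ≤ h⁻¹ * (2 * M) := mul_le_mul_of_nonneg_left h5 (by positivity)
    _ = _ := by ring

lemma abs_d_sq_le (hh : 0 < h) (i : Fin 2) (hf : ∀ x, |f (k, x)| ≤ M) (x : E2) :
    |d i (sq h f) (k, x)| ≤ 2 * h⁻¹ * M := by
  fin_cases i
  · exact abs_d_sa_le hh 0 (abs_sa_le 1 hf) x
  · change |d 1 (sa h 0 (sa h 1 f)) (k, x)| ≤ _
    rw [dv_sa]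
    exact abs_sa_le 0 (abs_d_sa_le hh 1 hf) x

lemma abs_shift_sub_le (hh : 0 ≤ h) (i : Fin 2) (hf : ∀ x, |d i f (k, x)| ≤ F) (x : E2) {θ : ℝ}
    (hθ : θ ∈ Set.Icc (0 : ℝ) 1) :
    |f ((k, x) + θ • ((0 : K), h • e2 i)) - f (k, x)| ≤ h * F := by
  have hF : 0 ≤ F := (abs_nonneg _).trans (hf 0)
  have := abs_line_sub_le f ((0 : K), h • e2 i) (h * F) (k, x) (a := 0) (b := θ) hθ.1
    (fun s _ => by
      rw [← d_eq_smul, smul_apply, abs_mul, abs_of_nonneg hh]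
      refine mul_le_mul_of_nonneg_left ?_ hh
      simpa using hf _)
  have h2 : h * F * θ ≤ h * F := by
    have := hθ.2
    have h0 : 0 ≤ h * F := by positivity
    nlinarith
  simp only [zero_smul, add_zero, sub_zero] at this
  exact this.trans h2

lemma abs_sa_comm_le (hh : 0 ≤ h) (i : Fin 2) (hf : ∀ x, |d i f (k, x)| ≤ F)
    (hg : ∀ x, |g (k, x)| ≤ G) (x : E2) :
    |(sa h i (f * g) - f * sa h i g) (k, x)| ≤ h * F * G := by
  have h1 : (sa h i (f * g) - f * sa h i g) (k, x) =
      sa h i ((f - algebraMap ℝ _ (f (k, x))) * g) (k, x) := by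
    rw [sub_mul, map_sub, ← Algebra.smul_def, map_smul]; rfl
  rw [h1]
  refine abs_avg_le _ _ _ _ fun θ hθ => ?_
  simp only [mul_apply, sub_apply, algebraMap_apply, abs_mul]
  refine mul_le_mul (abs_shift_sub_le hh i hf x hθ) ?_ (abs_nonneg _)
    (mul_nonneg hh ((abs_nonneg _).trans (hf 0)))
  simpa using hg _

lemma abs_sq_comm_le (hh : 0 ≤ h) (hf : ∀ i x, |d i f (k, x)| ≤ F)
    (hg : ∀ x, |g (k, x)| ≤ G) (x : E2) :
    |(sq h (f * g) - f * sq h g) (k, x)| ≤ 2 * h * F * G := by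
  have h1 : sq h (f * g) - f * sq h g = sa h 0 (sa h 1 (f * g) - f * sa h 1 g) +
      (sa h 0 (f * sa h 1 g) - f * sa h 0 (sa h 1 g)) := by
    rw [map_sub]; simp [sq]
  rw [h1, add_apply]
  have h2 := abs_sa_le (h := h) 0 (abs_sa_comm_le hh 1 (hf 1) hg) x
  have h3 := abs_sa_comm_le hh 0 (hf 0) (abs_sa_le (h := h) 1 hg) x
  refine (abs_add_le _ _).trans ?_
  linarith

lemma abs_st_comm_le (hh : 0 ≤ h) (n : ℕ) (hf : ∀ i x, |d i f (k, x)| ≤ F)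
    (hg : ∀ x, |g (k, x)| ≤ G) (x : E2) :
    |(st h n (f * g) - f * st h n g) (k, x)| ≤ 2 * n * (h * F * G) := by
  induction n generalizing g with
  | zero => simp [st]
  | succ n ih =>
    have h1 : st h (n + 1) (f * g) - f * st h (n + 1) g =
        st h n (sq h (f * g) - f * sq h g) + (st h n (f * sq h g) - f * st h n (sq h g)) := by
      have := st_add h n (sq h (f * g) - f * sq h g) (f * sq h g)
      rw [sub_add_cancel] at this
      simp only [st, this]
      ring
    rw [h1, add_apply]
    have h2 := abs_st_le (h := h) n (abs_sq_comm_le hh hf hg) x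
    have h3 := ih (abs_sq_le (h := h) hg)
    refine (abs_add_le _ _).trans ?_
    push_cast
    linarith

lemma abs_d_sa_comm_le (hh : 0 < h) (i : Fin 2) (hf : ∀ x, |d i f (k, x)| ≤ F)
    (hg : ∀ x, |g (k, x)| ≤ G) (x : E2) :
    |(d i (sa h i (f * g)) - f * d i (sa h i g)) (k, x)| ≤ F * G := by
  have h1 := smul_d_sa (f := f * g) (h := h) i (k, x)
  have h2 := smul_d_sa (f := g) (h := h) i (k, x)
  have h3 := abs_shift_sub_le hh.le i hf x (θ := 1) (by simp)
  have h4 : (k, x) + ((0 : K), h • e2 i) = (k, x + h • e2 i) := by simp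
  rw [one_smul, h4] at h3
  rw [h4] at h1 h2
  have h5 : h * (d i (sa h i (f * g)) - f * d i (sa h i g)) (k, x) =
      (f (k, x + h • e2 i) - f (k, x)) * g (k, x + h • e2 i) := by
    simp only [mul_apply, sub_apply] at h1 ⊢
    linear_combination h1 - f (k, x) * h2
  have h6 := mul_le_mul h3 (hg (x + h • e2 i)) (abs_nonneg _) ((abs_nonneg _).trans h3)
  rw [← abs_mul, ← h5, abs_mul, abs_of_pos hh, mul_assoc] at h6
  exact le_of_mul_le_mul_left h6 hh

lemma abs_d_sq_comm_le (hh : 0 < h) (hf : ∀ i x, |d i f (k, x)| ≤ F)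
    (hg : ∀ x, |g (k, x)| ≤ G) (j : Fin 2) (x : E2) :
    |(d j (sq h (f * g)) - f * d j (sq h g)) (k, x)| ≤ 3 * (F * G) := by
  have h0 : 2 * h⁻¹ * (h * F * G) = 2 * (F * G) := by field_simp
  have h0' : h * F * (2 * h⁻¹ * G) = 2 * (F * G) := by field_simp
  fin_cases j
  · have h1 : d 0 (sq h (f * g)) - f * d 0 (sq h g) =
        d 0 (sa h 0 (sa h 1 (f * g) - f * sa h 1 g)) +
        (d 0 (sa h 0 (f * sa h 1 g)) - f * d 0 (sa h 0 (sa h 1 g))) := by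
      simp [sq]
    change |(d 0 (sq h (f * g)) - f * d 0 (sq h g)) (k, x)| ≤ _
    rw [h1, add_apply]
    have h2 := abs_d_sa_le hh 0 (abs_sa_comm_le hh.le 1 (hf 1) hg) x
    have h3 := abs_d_sa_comm_le hh 0 (hf 0) (abs_sa_le (h := h) 1 hg) x
    refine (abs_add_le _ _).trans ?_
    linarith
  · have h1 : d 1 (sq h (f * g)) - f * d 1 (sq h g) =
        sa h 0 (d 1 (sa h 1 (f * g)) - f * d 1 (sa h 1 g)) +
        (sa h 0 (f * d 1 (sa h 1 g)) - f * sa h 0 (d 1 (sa h 1 g))) := by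
      simp [sq, d, dv_sa]
    change |(d 1 (sq h (f * g)) - f * d 1 (sq h g)) (k, x)| ≤ _
    rw [h1, add_apply]
    have h2 := abs_sa_le (h := h) 0 (abs_d_sa_comm_le hh 1 (hf 1) hg) x
    have h3 := abs_sa_comm_le hh.le 0 (hf 0) (abs_d_sa_le hh 1 hg) x
    refine (abs_add_le _ _).trans ?_
    linarith

lemma abs_d_st_comm_le (hh : 0 < h) (n : ℕ) (hf : ∀ i x, |d i f (k, x)| ≤ F)
    (hg : ∀ x, |g (k, x)| ≤ G) (j : Fin 2) (x : E2) :
    |(d j (st h (n + 1) (f * g)) - f * d j (st h (n + 1) g)) (k, x)| ≤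
      (4 * n + 3) * (F * G) := by
  have h0 : 2 * n * (h * F * (2 * h⁻¹ * G)) = 4 * n * (F * G) := by field_simp; ring
  have h1 : d j (st h (n + 1) (f * g)) - f * d j (st h (n + 1) g) =
      st h n (d j (sq h (f * g)) - f * d j (sq h g)) +
        (st h n (f * d j (sq h g)) - f * st h n (d j (sq h g))) := by
    have := st_add h n (d j (sq h (f * g)) - f * d j (sq h g)) (f * d j (sq h g))
    rw [sub_add_cancel] at this
    simp only [st, d, dv_st] at this ⊢
    rw [this]
    ring
  rw [h1, add_apply]
  have h2 := abs_st_le (h := h) n (abs_d_sq_comm_le hh hf hg j) x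
  have h3 := abs_st_comm_le hh.le n hf (abs_d_sq_le hh j hg) x
  refine (abs_add_le _ _).trans ?_
  linarith

lemma sa_one (i : Fin 2) : sa h i (1 : PF K) = 1 := by
  ext z
  rw [sa, avg_apply]
  simp

lemma st_one (n : ℕ) : st h n (1 : PF K) = 1 := by
  induction n with
  | zero => rfl
  | succ n ih => rw [st, sq, LinearMap.comp_apply, sa_one, sa_one, ih]

lemma abs_st_sub_le (hh : 0 ≤ h) (n : ℕ) (hf : ∀ i x, |d i f (k, x)| ≤ F) (x : E2) :
    |(st h n f - f) (k, x)| ≤ 2 * n * (h * F) := by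
  have := abs_st_comm_le (g := (1 : PF K)) (G := 1) hh n hf (fun x => by simp) x
  rw [st_one] at this
  simpa using this

end Steklov

section
variable {ι : Type} {K : Type} [NormedAddCommGroup K] [NormedSpace ℝ K] [ProperSpace K]
  {S : ι → Set K} {L : ι → ℝ} {X Y : ι → ℝ} {f g : ι → PF K}

lemma Big.st (hL : ∀ i, 0 < L i) (hf : B0 S X f) (n : ℕ) :
    Big S L n X (fun i => PF.st (L i)⁻¹ n (f i)) := by
  have hb : ∀ (n : ℕ) {X : ι → ℝ} {f : ι → PF K}, B0 S X f →
      B0 S X (fun i => PF.st (L i)⁻¹ n (f i)) := by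
    rintro n X f ⟨C, hC, h⟩
    exact ⟨C, hC, fun i k hk x => abs_st_le n (h i k hk) x⟩
  induction n generalizing X f with
  | zero => exact hf
  | succ n ih =>
    refine ⟨hb (n + 1) hf, fun j => ?_⟩
    refine (ih (X := L * X) (f := fun i => PF.d j (PF.sq (L i)⁻¹ (f i))) ?_).congr rfl ?_
    · obtain ⟨C, hC, h⟩ := hf
      refine ⟨2 * C, by positivity, fun i k hk x => ?_⟩
      refine (abs_d_sq_le (inv_pos.2 (hL i)) j (h i k hk) x).trans (le_of_eq ?_)
      rw [inv_inv, Pi.mul_apply]; ring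
    · ext1 i
      change _ = PF.d j (PF.st _ n (PF.sq _ (f i)))
      rw [PF.d, dv_st]

lemma B0.st_sub (hL : ∀ i, 0 < L i) (hf : ∀ j, B0 S X (fun i => PF.d j (f i))) (n : ℕ) :
    B0 S (L⁻¹ * X) (fun i => PF.st (L i)⁻¹ n (f i) - f i) := by
  obtain ⟨C, hC, h⟩ := hf 0
  obtain ⟨C', hC', h'⟩ := hf 1
  refine ⟨2 * n * (C + C'), by positivity, fun i k hk x => ?_⟩
  refine (abs_st_sub_le (inv_nonneg.2 (hL i).le) n (F := (C + C') * X i) ?_ x).trans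
    (le_of_eq (by simp only [Pi.mul_apply, Pi.inv_apply]; ring))
  intro j x
  have h1 := h i k hk x
  have h2 := h' i k hk x
  have h3 := abs_nonneg (d 0 (f i) (k, x))
  have h4 := abs_nonneg (d 1 (f i) (k, x))
  fin_cases j
  · exact h1.trans (by nlinarith)
  · exact h2.trans (by nlinarith)

lemma B0.st_comm (hL : ∀ i, 0 < L i) (hf : ∀ j, B0 S X (fun i => PF.d j (f i))) (hg : B0 S Y g)
    (n : ℕ) : B0 S (L⁻¹ * X * Y)
      (fun i => PF.st (L i)⁻¹ n (f i * g i) - f i * PF.st (L i)⁻¹ n (g i)) := by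
  obtain ⟨C, hC, h⟩ := hf 0
  obtain ⟨C', hC', h'⟩ := hf 1
  obtain ⟨D, hD, hg⟩ := hg
  refine ⟨2 * n * (C + C') * D, by positivity, fun i k hk x => ?_⟩
  refine (abs_st_comm_le (inv_nonneg.2 (hL i).le) n (F := (C + C') * X i) ?_ (hg i k hk) x).trans
    (le_of_eq (by simp only [Pi.mul_apply, Pi.inv_apply]; ring))
  intro j x
  have h1 := h i k hk x
  have h2 := h' i k hk x
  have h3 := abs_nonneg (d 0 (f i) (k, x))
  have h4 := abs_nonneg (d 1 (f i) (k, x))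
  fin_cases j
  · exact h1.trans (by nlinarith)
  · exact h2.trans (by nlinarith)

lemma B0.d_st_comm (hL : ∀ i, 0 < L i) (hf : ∀ j, B0 S X (fun i => PF.d j (f i)))
    (hg : B0 S Y g) (n : ℕ) (j : Fin 2) : B0 S (X * Y)
      (fun i => PF.d j (PF.st (L i)⁻¹ (n + 1) (f i * g i)) -
        f i * PF.d j (PF.st (L i)⁻¹ (n + 1) (g i))) := by
  obtain ⟨C, hC, h⟩ := hf 0
  obtain ⟨C', hC', h'⟩ := hf 1
  obtain ⟨D, hD, hg⟩ := hg
  refine ⟨(4 * n + 3) * (C + C') * D, by positivity, fun i k hk x => ?_⟩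
  refine (abs_d_st_comm_le (inv_pos.2 (hL i)) n (F := (C + C') * X i) ?_ (hg i k hk) j x).trans
    (le_of_eq (by simp only [Pi.mul_apply]; ring))
  intro j x
  have h1 := h i k hk x
  have h2 := h' i k hk x
  have h3 := abs_nonneg (d 0 (f i) (k, x))
  have h4 := abs_nonneg (d 1 (f i) (k, x))
  fin_cases j
  · exact h1.trans (by nlinarith)
  · exact h2.trans (by nlinarith)

end

section
variable {ι : Type} {K : Type} [NormedAddCommGroup K] [NormedSpace ℝ K]
  {S : ι → Set K} {L : ι → ℝ} {X Y : ι → ℝ} {f g : ι → PF K}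

lemma B0.le (h : B0 S X f) (hXY : ∀ i, X i ≤ Y i) : B0 S Y f :=
  h.mono zero_le_one fun i => by simpa using hXY i

lemma Big.le {n : ℕ} (h : Big S L n X f) (hL : ∀ i, 0 ≤ L i) (hXY : ∀ i, X i ≤ Y i) :
    Big S L n Y f :=
  h.mono hL zero_le_one fun i => by simpa using hXY i

lemma B0.neg (h : B0 S X f) : B0 S X (-f) := Big.neg (n := 0) (L := 0) h
lemma B0.sub (hf : B0 S X f) (hg : B0 S X g) : B0 S X (f - g) := Big.sub (n := 0) (L := 0) hf hg
lemma B0.congr (h : B0 S X f) (hX : X = Y) (hf : f = g) : B0 S Y g := hX ▸ hf ▸ h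
end

lemma le_of_fac {x y z : ℝ} (h : x = y * z) (hy : 0 ≤ y) (hz : z ≤ 1) : x ≤ y := by
  rw [h]; exact mul_le_of_le_one_right hy hz

/-- An Euler–Reynolds flow together with the parameters of the next perturbation: amplitude `sg`,
frequency `la`, scale separation `ep`, and the energy gap `dl` to be left over. -/
structure Stp (N : ℕ) where
  sg : ℝ
  la : ℝ
  ep : ℝ
  dl : ℝ
  lai : ℕ
  u : Fin 2 → PF ℝ
  p : PF ℝ
  r : PF ℝ
  s : PF ℝ
  E : ℝ → ℝ
  g : ℝ → ℝ
  sg_pos : 0 < sg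
  la_ge : 1 ≤ la
  ep_pos : 0 < ep
  ep_le : ep ≤ 1
  ep_le' : ep ≤ 1 / 8
  sg_le : sg ≤ la
  la_eq : la = 5 * lai
  tiny : la ^ 10 * ep ^ N ≤ sg
  tiny' : la ^ 10 * ep ^ N ≤ sg ^ 2
  div_u : d 0 (u 0) + d 1 (u 1) = 0
  eq0 : mat u (u 0) + d 0 p = d 0 r + d 1 s
  eq1 : mat u (u 1) + d 1 p = d 0 s - d 1 r
  u_le : ∀ i z, |u i z| ≤ la
  du_le : ∀ i j z, |d i (u j) z| ≤ sg * la * ep ^ 2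
  dp_le : ∀ i z, |d i p z| ≤ sg ^ 2 * la * ep
  r_le : ∀ z, |r z| ≤ sg ^ 2 / 80
  s_le : ∀ z, |s z| ≤ sg ^ 2 / 80
  dr_le : ∀ i z, |d i r z| ≤ sg ^ 2 * la * ep ^ 2
  ds_le : ∀ i z, |d i s z| ≤ sg ^ 2 * la * ep ^ 2
  mr_le : ∀ z, |mat u r z| ≤ sg ^ 3 * la * ep ^ 2
  ms_le : ∀ z, |mat u s z| ≤ sg ^ 3 * la * ep ^ 2
  g_eq : ∀ t, g t = E t - mean (u 0 ^ 2 + u 1 ^ 2) (t, 0)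
  g_nonneg : ∀ t, 0 ≤ g t
  g_le : ∀ t, g t ≤ 2 * sg ^ 2
  E_lip : ∀ t t', |E t - E t'| ≤ sg ^ 3 * la * ep ^ 2 * |t - t'|
  gap : ∀ t, sg ^ 2 / 2 ≤ g t ∨ ∀ x, r (t, x) = 0 ∧ s (t, x) = 0
  dl_pos : 0 < dl
  dl_le : dl ≤ sg ^ 2 / 8
  fin : ∃ T, ∀ t, T ≤ |t| → g t ≤ dl

namespace Stp
variable {N : ℕ}

/-- Number of derivatives under control. -/
abbrev lv (N : ℕ) : ℕ := N + 12

/-- The intermediate scale. -/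
def L (σ : Stp N) : ℝ := σ.la * σ.ep
def τ (σ : Stp N) : ℝ := σ.sg * σ.la
/-- Inverse of the length of the time slabs. -/
def μ (σ : Stp N) : ℝ := σ.sg * σ.la * σ.ep

/-- The mollified velocity. -/
def ub (σ : Stp N) (j : Fin 2) : PF ℝ := st σ.L⁻¹ (lv N + 1) (σ.u j)
/-- The high-frequency part of the velocity. -/
def vb (σ : Stp N) (j : Fin 2) : PF ℝ := σ.u j - σ.ub j

lemma la_pos (σ : Stp N) : 0 < σ.la := zero_lt_one.trans_le σ.la_ge
lemma L_pos (σ : Stp N) : 0 < σ.L := mul_pos σ.la_pos σ.ep_pos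
lemma τ_pos (σ : Stp N) : 0 < σ.τ := mul_pos σ.sg_pos σ.la_pos
lemma μ_pos (σ : Stp N) : 0 < σ.μ := mul_pos (mul_pos σ.sg_pos σ.la_pos) σ.ep_pos

lemma ep_pow_le (σ : Stp N) (k : ℕ) : σ.ep ^ k ≤ 1 := pow_le_one₀ σ.ep_pos.le σ.ep_le

/-- Drop powers of `ep`. -/
lemma drop (σ : Stp N) (k : ℕ) {x y : ℝ} (h : x = y * σ.ep ^ k) (hy : 0 ≤ y) : x ≤ y :=
  le_of_fac h hy (σ.ep_pow_le k)

abbrev U : Stp N → Set ℝ := fun _ => Set.univ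

lemma b0_of_le {X : Stp N → ℝ} {f : Stp N → PF ℝ} (h : ∀ σ z, |f σ z| ≤ X σ) : B0 U X f :=
  ⟨1, zero_le_one, fun σ k _ x => by simpa using h σ (k, x)⟩

lemma b0_du (i j : Fin 2) : B0 U (fun σ : Stp N => σ.sg * σ.la * σ.ep ^ 2)
    (fun σ => PF.d i (σ.u j)) := b0_of_le fun σ => σ.du_le i j

/-- The forcing term. -/
def F (σ : Stp N) (j : Fin 2) : PF ℝ := mat σ.u (σ.u j)

lemma b0_F (j : Fin 2) : B0 U (fun σ : Stp N => σ.sg ^ 2 * σ.la * σ.ep) (fun σ => σ.F j) := by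
  have hp := fun i => b0_of_le (N := N) fun σ => σ.dp_le i
  have he (σ : Stp N) : σ.sg ^ 2 * σ.la * σ.ep ^ 2 ≤ σ.sg ^ 2 * σ.la * σ.ep := by
    have h1 := σ.sg_pos; have h2 := σ.la_pos; have h3 := σ.ep_pos
    exact σ.drop 1 (by ring) (by positivity)
  have hr := fun i => (b0_of_le (N := N) fun σ => σ.dr_le i).le he
  have hs := fun i => (b0_of_le (N := N) fun σ => σ.ds_le i).le he
  fin_cases j
  · refine (((hr 0).add (hs 1)).sub (hp 0)).congr rfl ?_
    ext1 σ
    exact (eq_sub_of_add_eq σ.eq0).symm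
  · refine (((hs 0).sub (hr 1)).sub (hp 1)).congr rfl ?_
    ext1 σ
    exact (eq_sub_of_add_eq σ.eq1).symm

lemma F_eq (σ : Stp N) (j : Fin 2) :
    σ.F j = dt (σ.u j) + (σ.u 0 * d 0 (σ.u j) + σ.u 1 * d 1 (σ.u j)) := mat_apply _ _

lemma d_ub (σ : Stp N) (i j : Fin 2) : d i (σ.ub j) = st σ.L⁻¹ (lv N + 1) (d i (σ.u j)) :=
  dv_st _ _ _ _

lemma div_ub (σ : Stp N) : d 0 (σ.ub 0) + d 1 (σ.ub 1) = 0 := by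
  rw [d_ub, d_ub, ← st_add, σ.div_u, st_zero]

lemma big_dub (i j : Fin 2) : Big U (L (N := N)) (lv N + 1) (fun σ => σ.sg * σ.la * σ.ep ^ 2)
    (fun σ => PF.d i (σ.ub j)) :=
  (Big.st L_pos (b0_du i j) (lv N + 1)).congr rfl (by ext1 σ; rw [d_ub])

lemma big_ub (j : Fin 2) : Big U (L (N := N)) (lv N + 1) (fun σ => σ.la) (fun σ => σ.ub j) :=
  Big.st L_pos (b0_of_le fun σ => σ.u_le j) (lv N + 1)

lemma b0_dt_u (j : Fin 2) : B0 U (fun σ : Stp N => σ.la ^ 3) (fun σ => dt (σ.u j)) := by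
  have hu := fun i => b0_of_le (N := N) fun σ => σ.u_le i
  have h1 := fun i => ((hu i).mul (b0_du i j)).le (Y := fun σ : Stp N => σ.la ^ 3) fun σ => by
    have h1 := σ.sg_pos; have h2 := σ.la_pos; have h3 := σ.sg_le
    calc σ.la * (σ.sg * σ.la * σ.ep ^ 2) ≤ σ.la ^ 2 * σ.sg := σ.drop 2 (by ring) (by positivity)
      _ ≤ σ.la ^ 2 * σ.la := by gcongr
      _ = _ := by ring
  have h2 := (b0_F (N := N) j).le (Y := fun σ : Stp N => σ.la ^ 3) fun σ => by
    have h1 := σ.sg_pos; have h2 := σ.la_pos; have h3 := σ.sg_le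
    calc σ.sg ^ 2 * σ.la * σ.ep ≤ σ.sg ^ 2 * σ.la := σ.drop 1 (by ring) (by positivity)
      _ ≤ σ.la ^ 2 * σ.la := by gcongr
      _ = _ := by ring
  refine (h2.sub ((h1 0).add (h1 1))).congr rfl ?_
  ext1 σ
  simp [F_eq]

lemma big_dt_ub (j : Fin 2) : Big U (L (N := N)) (lv N + 1) (fun σ => σ.la ^ 3)
    (fun σ => dt (σ.ub j)) :=
  (Big.st L_pos (b0_dt_u j) (lv N + 1)).congr rfl (by ext1 σ; exact (dv_st _ _ _ _).symm)

lemma b0_vb (j : Fin 2) : B0 U (fun σ : Stp N => σ.sg * σ.ep) (fun σ => σ.vb j) := by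
  refine ((B0.st_sub L_pos (fun i => b0_du i j) (lv N + 1)).neg).congr ?_ ?_
  · ext1 σ
    have h2 := σ.la_pos.ne'; have h3 := σ.ep_pos.ne'
    simp only [Pi.mul_apply, Pi.inv_apply, L]
    field_simp
  · ext1 σ
    simp [vb, ub]

lemma b0_dvb (i j : Fin 2) : B0 U (fun σ : Stp N => σ.sg * σ.la * σ.ep ^ 2)
    (fun σ => PF.d i (σ.vb j)) :=
  ((b0_du i j).sub (big_dub i j).b0).congr rfl (by ext1 σ; simp [vb])

/-- The material derivative along the mollified velocity. -/
abbrev D (σ : Stp N) : Derivation ℝ (PF ℝ) (PF ℝ) := mat σ.ub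

lemma mat_u (σ : Stp N) (f : PF ℝ) :
    σ.D f = mat σ.u f - (σ.vb 0 * d 0 f + σ.vb 1 * d 1 f) := by
  simp only [mat_apply, vb]; ring

lemma b0_D_u (j : Fin 2) : B0 U (fun σ : Stp N => σ.sg ^ 2 * σ.la * σ.ep)
    (fun σ => σ.D (σ.u j)) := by
  have h1 := fun i => ((b0_vb i).mul (b0_du i j)).le
    (Y := fun σ : Stp N => σ.sg ^ 2 * σ.la * σ.ep) fun σ => by
      have h1 := σ.sg_pos; have h2 := σ.la_pos; have h3 := σ.ep_pos
      exact σ.drop 2 (by simp only [Pi.mul_apply]; ring) (by positivity)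
  have h2 := b0_F (N := N) j
  refine (h2.sub ((h1 0).add (h1 1))).congr rfl ?_
  ext1 σ
  simp [mat_u, F]

lemma D_ub_eq (σ : Stp N) (j : Fin 2) : σ.D (σ.ub j) = st σ.L⁻¹ (lv N + 1) (σ.F j) -
    ∑ k, (st σ.L⁻¹ (lv N + 1) (σ.u k * d k (σ.u j)) - σ.u k * st σ.L⁻¹ (lv N + 1) (d k (σ.u j)))
    - ∑ k, σ.vb k * st σ.L⁻¹ (lv N + 1) (d k (σ.u j)) := by
  have h : dt (σ.ub j) = st σ.L⁻¹ (lv N + 1) (dt (σ.u j)) := dv_st _ _ _ _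
  rw [mat_apply, h, F_eq, st_add, st_add, d_ub, d_ub]
  simp only [Fin.sum_univ_two, vb]
  ring

lemma b0_D_ub (j : Fin 2) : B0 U (fun σ : Stp N => σ.sg ^ 2 * σ.la * σ.ep)
    (fun σ => σ.D (σ.ub j)) := by
  have h1 := fun k => ((b0_vb k).mul (Big.st L_pos (b0_du k j) (lv N + 1)).b0).le
    (Y := fun σ : Stp N => σ.sg ^ 2 * σ.la * σ.ep) fun σ => by
      have h1 := σ.sg_pos; have h2 := σ.la_pos; have h3 := σ.ep_pos
      exact σ.drop 2 (by simp only [Pi.mul_apply]; ring) (by positivity)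
  have h2 := (Big.st L_pos (b0_F (N := N) j) (lv N + 1)).b0
  have h3 := fun k => (B0.st_comm L_pos (fun i => b0_du i k) (b0_du k j) (lv N + 1)).le
    (Y := fun σ : Stp N => σ.sg ^ 2 * σ.la * σ.ep) fun σ => by
      have h1 := σ.sg_pos; have h2 := σ.la_pos; have h3 := σ.ep_pos
      refine σ.drop 2 ?_ (by positivity)
      simp only [Pi.mul_apply, Pi.inv_apply, L]
      field_simp
  refine ((h2.sub ((h3 0).add (h3 1))).sub ((h1 0).add (h1 1))).congr rfl ?_
  ext1 σ
  simp only [D_ub_eq, Fin.sum_univ_two, Pi.add_apply, Pi.sub_apply, Pi.mul_apply]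

lemma b0_D_vb (j : Fin 2) : B0 U (fun σ : Stp N => σ.sg ^ 2 * σ.la * σ.ep)
    (fun σ => σ.D (σ.vb j)) :=
  ((b0_D_u j).sub (b0_D_ub j)).congr rfl (by ext1 σ; simp [vb])

lemma b0_D_dub (i j : Fin 2) : B0 U (fun σ : Stp N => (σ.sg * σ.la * σ.ep) ^ 2)
    (fun σ => σ.D (d i (σ.ub j))) := by
  have h1 := fun k => ((b0_vb k).mul ((Big.st L_pos (b0_du k j) (lv N + 1)).d i).b0).le
    (Y := fun σ : Stp N => (σ.sg * σ.la * σ.ep) ^ 2) fun σ => by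
      have h1 := σ.sg_pos; have h2 := σ.la_pos; have h3 := σ.ep_pos
      exact σ.drop 2 (by simp only [Pi.mul_apply, L]; ring) (by positivity)
  have h2 := ((Big.st L_pos (b0_F j) (lv N + 1)).d i).b0.le
    (Y := fun σ : Stp N => (σ.sg * σ.la * σ.ep) ^ 2) fun σ => by
      have h1 := σ.sg_pos; have h2 := σ.la_pos; have h3 := σ.ep_pos
      exact le_of_eq (by simp only [Pi.mul_apply, L]; ring)
  have h3 := fun k => (B0.d_st_comm L_pos (fun i => b0_du i k) (b0_du k j) (lv N) i).le
    (Y := fun σ : Stp N => (σ.sg * σ.la * σ.ep) ^ 2) fun σ => by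
      have h1 := σ.sg_pos; have h2 := σ.la_pos; have h3 := σ.ep_pos
      exact σ.drop 2 (by simp only [Pi.mul_apply]; ring) (by positivity)
  refine ((h2.sub ((h3 0).add (h3 1))).sub ((h1 0).add (h1 1))).congr rfl ?_
  ext1 σ
  have h : dt (σ.ub j) = st σ.L⁻¹ (lv N + 1) (dt (σ.u j)) := dv_st _ _ _ _
  have h' : ∀ k, d k (d i (σ.ub j)) = d i (st σ.L⁻¹ (lv N + 1) (d k (σ.u j))) := fun k => by
    rw [d_comm, d_ub]
  rw [mat_apply, dt_d, h, h', h']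
  simp only [F_eq, st_add, map_add, Pi.add_apply, Pi.sub_apply, Pi.mul_apply, vb]
  ring

end Stp

/-! ### Approximate flow maps -/

abbrev cfst : ℝ × ℝ →L[ℝ] ℝ := ContinuousLinearMap.fst ℝ ℝ ℝ
abbrev csnd : ℝ × ℝ →L[ℝ] ℝ := ContinuousLinearMap.snd ℝ ℝ ℝ

section
variable (v : Fin 2 → PF ℝ)

/-- Picard iterates for the backward displacement: `x + Yf v m (s, t, x)` approximates the position
at time `s` of the particle which is at `x` at time `t`. -/
def Yf : ℕ → Fin 2 → PF (ℝ × ℝ)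
  | 0 => 0
  | m + 1 => fun j => J (compo (v j) cfst 0 (Yf m))

/-- Pull-back by the second time variable. -/
def pt (f : PF ℝ) : PF (ℝ × ℝ) := compo f csnd 0 0

/-- The material derivative in the second time variable. -/
def mat2 : Derivation ℝ (PF (ℝ × ℝ)) (PF (ℝ × ℝ)) := dv et + ∑ j, pt (v j) • d j

lemma mat2_apply (f : PF (ℝ × ℝ)) :
    mat2 v f = dv et f + (pt (v 0) * d 0 f + pt (v 1) * d 1 f) := by
  simp [mat2, Fin.sum_univ_two]

/-- The error in the transport equation for the approximate flow. -/
def Ef (m : ℕ) (j : Fin 2) : PF (ℝ × ℝ) := mat2 v (Yf v m j) + pt (v j)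

lemma algebraMap_e2 {K : Type} [NormedAddCommGroup K] [NormedSpace ℝ K] (i j : Fin 2) :
    algebraMap ℝ (PF K) (e2 i j) = if i = j then 1 else 0 := by
  rw [e2, Pi.single_apply]
  split_ifs <;> simp_all

lemma d_compo {K K' : Type} [NormedAddCommGroup K] [NormedSpace ℝ K] [NormedAddCommGroup K']
    [NormedSpace ℝ K'] (i : Fin 2) (f : PF K) (A : K' →L[ℝ] K) (c : K) (Y : Fin 2 → PF K') :
    d i (compo f A c Y) = compo (d i f) A c Y + ∑ j, compo (d j f) A c Y * d i (Y j) := by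
  have : dv ((0 : K), (0 : E2)) f = 0 := dv_zero f
  simp only [d, dv_compo, map_zero, this, compo_zero, zero_add, algebraMap_e2, mul_add,
    Finset.sum_add_distrib]
  simp

lemma dt_compo_fst (f : PF ℝ) (Y : Fin 2 → PF (ℝ × ℝ)) :
    dv et (compo f cfst 0 Y) = ∑ j, compo (d j f) cfst 0 Y * dv et (Y j) := by
  have : dv ((0 : ℝ), (0 : E2)) f = 0 := dv_zero f
  simp [dv_compo, this, compo_zero]

lemma ds_compo_fst (f : PF ℝ) (Y : Fin 2 → PF (ℝ × ℝ)) :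
    dv es (compo f cfst 0 Y) =
      compo (dt f) cfst 0 Y + ∑ j, compo (d j f) cfst 0 Y * dv es (Y j) := by
  simp [dv_compo]

lemma d_pt (i : Fin 2) (f : PF ℝ) : d i (pt f) = pt (d i f) := by
  rw [pt, d_compo]; simp [pt]

lemma dt_pt (f : PF ℝ) : dv et (pt f) = pt (dt f) := by
  rw [pt, dv_compo]; simp [pt]

lemma ds_pt (f : PF ℝ) : dv es (pt f) = 0 := by
  have : dv ((0 : ℝ), (0 : E2)) f = 0 := dv_zero f
  rw [pt, dv_compo]; simp [this, compo_zero]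

lemma mat2_pt (f : PF ℝ) : mat2 v (pt f) = pt (mat v f) := by
  rw [mat2_apply, mat_apply, dt_pt, d_pt, d_pt]; rfl

lemma mat2_compo (f : PF ℝ) (m : ℕ) : mat2 v (compo f cfst 0 (Yf v m)) =
    ∑ k, compo (d k f) cfst 0 (Yf v m) * Ef v m k := by
  simp only [mat2_apply, dt_compo_fst, d_compo, Ef, Fin.sum_univ_two]
  ring

lemma mat2_J (f : PF (ℝ × ℝ)) : mat2 v (J f) = J (mat2 v f) - diag f := by
  have h := fun i => J_mul (f := d i f) (ds_pt (v i))
  simp only [mat2_apply, dt_J, d_J, J_add]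
  rw [mul_comm (pt (v 0)) (d 0 f), mul_comm (pt (v 1)) (d 1 f), h, h]
  ring

lemma diag_Yf (m : ℕ) (j : Fin 2) (t : ℝ) (x : E2) : Yf v m j ((t, t), x) = 0 := by
  cases m with
  | zero => rfl
  | succ m => exact J_diag _ _ _

lemma diag_compo (f : PF ℝ) (m : ℕ) : diag (compo f cfst 0 (Yf v m)) = pt f := by
  ext ⟨⟨s, t⟩, x⟩
  simp only [diag_apply, compo_apply, pt, diag_Yf]
  rfl

lemma Ef_zero (j : Fin 2) : Ef v 0 j = pt (v j) := by simp [Ef, Yf]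

lemma Ef_succ (m : ℕ) (j : Fin 2) : Ef v (m + 1) j =
    J (∑ k, compo (d k (v j)) cfst 0 (Yf v m) * Ef v m k) := by
  rw [Ef, Yf, mat2_J, mat2_compo, diag_compo, sub_add_cancel]

lemma diag_mul (f g : PF (ℝ × ℝ)) : diag (f * g) = diag f * diag g := rfl
lemma diag_add (f g : PF (ℝ × ℝ)) : diag (f + g) = diag f + diag g := rfl

lemma diag_Ef (m : ℕ) (j : Fin 2) : diag (Ef v (m + 1) j) = 0 := by
  ext ⟨⟨s, t⟩, x⟩
  rw [diag_apply, Ef_succ, J_diag]; rfl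

lemma mat2_Ef_succ (m : ℕ) (j : Fin 2) : mat2 v (Ef v (m + 1) j) =
    J (∑ k, ((∑ l, compo (d l (d k (v j))) cfst 0 (Yf v m) * Ef v m l) * Ef v m k +
      compo (d k (v j)) cfst 0 (Yf v m) * mat2 v (Ef v m k)))
    - ∑ k, pt (d k (v j)) * diag (Ef v m k) := by
  rw [Ef_succ, mat2_J]
  congr 1
  · congr 1
    simp only [map_sum, Derivation.leibniz, smul_eq_mul, mat2_compo]
    refine Finset.sum_congr rfl fun k _ => ?_
    ring
  · simp only [Fin.sum_univ_two, diag_add, diag_mul, diag_compo]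

/-- Restriction to a fixed first time. -/
def att (c : ℝ) (f : PF (ℝ × ℝ)) : PF ℝ := compo f (ContinuousLinearMap.inr ℝ ℝ ℝ) (c, 0) 0

lemma att_apply (c : ℝ) (f : PF (ℝ × ℝ)) (t : ℝ) (x : E2) : att c f (t, x) = f ((c, t), x) := by
  simp only [att, compo_apply]
  congr 1
  ext i <;> simp

lemma d_att (c : ℝ) (f : PF (ℝ × ℝ)) (i : Fin 2) : d i (att c f) = att c (d i f) := by
  rw [att, d_compo]; simp [att]

lemma dt_att (c : ℝ) (f : PF (ℝ × ℝ)) : dt (att c f) = att c (dv et f) := by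
  rw [att, dv_compo]; simp [att]

lemma att_pt (c : ℝ) (f : PF ℝ) : att c (pt f) = f := by
  ext ⟨t, x⟩
  rw [att_apply, pt, compo_apply]
  congr 1
  ext i <;> simp

lemma att_mul (c : ℝ) (f g : PF (ℝ × ℝ)) : att c (f * g) = att c f * att c g := rfl
lemma att_add (c : ℝ) (f g : PF (ℝ × ℝ)) : att c (f + g) = att c f + att c g := rfl

lemma mat_att (c : ℝ) (f : PF (ℝ × ℝ)) : mat v (att c f) = att c (mat2 v f) := by
  rw [mat_apply, mat2_apply, dt_att, d_att, d_att, att_add, att_add, att_mul, att_mul, att_pt,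
    att_pt]

end

section
variable {K K' : Type} [NormedAddCommGroup K] [NormedSpace ℝ K] [NormedAddCommGroup K']
    [NormedSpace ℝ K']

/-- Dependence of a composition on the displacement. -/
lemma abs_compo_sub_le (f : PF K) (A : K' →L[ℝ] K) (c : K) (Y Z : Fin 2 → PF K') (z : K' × E2)
    {F M : ℝ} (hF : ∀ j x, |d j f (A z.1 + c, x)| ≤ F) (hM : ∀ j, |(Y j - Z j) z| ≤ M) :
    |(compo f A c Y - compo f A c Z) z| ≤ 2 * F * M := by
  have h := abs_line_sub_le f ((0 : K), fun j => (Y j - Z j) z) (2 * F * M)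
    (A z.1 + c, z.2 + fun j => Z j z) zero_le_one (fun s _ => ?_)
  · simp only [one_smul, zero_smul, add_zero, sub_zero, mul_one] at h
    rw [sub_apply, compo_apply, compo_apply]
    convert h using 4
    ext1
    · simp
    · ext j; simp
  · rw [dv_space]
    simp only [add_apply, smul_apply]
    refine (abs_add_le _ _).trans ?_
    rw [abs_mul, abs_mul]
    have h0 : 0 ≤ M := (abs_nonneg _).trans (hM 0)
    have e1 : ((A z.1 + c, z.2 + fun j => Z j z) + s • ((0 : K), fun j => (Y j - Z j) z)) =
      (A z.1 + c, (z.2 + fun j => Z j z) + s • fun j => (Y j - Z j) z) := by simp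
    rw [e1]
    have h1 := mul_le_mul (hM 0) (hF 0 ((z.2 + fun j => Z j z) + s • fun j => (Y j - Z j) z))
      (abs_nonneg _) h0
    have h2 := mul_le_mul (hM 1) (hF 1 ((z.2 + fun j => Z j z) + s • fun j => (Y j - Z j) z))
      (abs_nonneg _) h0
    linarith
end

namespace Stp
variable {N : ℕ}

/-- The time slab around `l / μ`. -/
def sl (i : Stp N × ℤ) : Set ℝ := {t | |i.1.μ * t - i.2| ≤ 3 / 4}

def sl2 (i : Stp N × ℤ) : Set (ℝ × ℝ) := sl i ×ˢ sl i

/-- The centre of the slab. -/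
def tl (i : Stp N × ℤ) : ℝ := i.2 / i.1.μ

lemma tl_mem (i : Stp N × ℤ) : tl i ∈ sl i := by
  have := i.1.μ_pos.ne'
  simp only [sl, tl, Set.mem_ofPred_eq]
  rw [mul_div_cancel₀ _ this]; norm_num

lemma sl_convex {i : Stp N × ℤ} {s t r : ℝ} (hs : s ∈ sl i) (ht : t ∈ sl i)
    (hr : r ∈ Set.uIcc s t) : r ∈ sl i := by
  simp only [sl, Set.mem_ofPred_eq, abs_le] at *
  have hμ := i.1.μ_pos
  rcases Set.mem_uIcc.1 hr with h | h <;>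
    constructor <;> nlinarith [mul_le_mul_of_nonneg_left h.1 hμ.le, mul_le_mul_of_nonneg_left h.2 hμ.le]

lemma sl_dist {i : Stp N × ℤ} {s t : ℝ} (hs : s ∈ sl i) (ht : t ∈ sl i) :
    |s - t| ≤ 2 * (i.1.μ)⁻¹ := by
  have hμ := i.1.μ_pos
  rw [← div_eq_mul_inv, le_div_iff₀ hμ]
  have h : |s - t| * i.1.μ = |(s - t) * i.1.μ| := by rw [abs_mul, abs_of_pos hμ]
  rw [h]
  simp only [sl, Set.mem_ofPred_eq, abs_le] at *
  constructor <;> nlinarith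

section
variable {X : Stp N × ℤ → ℝ} {n : ℕ}

lemma big_J {Lf : Stp N × ℤ → ℝ} (hL : ∀ i, 0 ≤ Lf i) {f : Stp N × ℤ → PF (ℝ × ℝ)}
    (hf : Big sl2 Lf n X f) : Big sl2 Lf n (fun i => (i.1.μ)⁻¹ * X i) (fun i => J (f i)) := by
  refine (Big.linear (fun _ => J) (S' := sl2) (Y := fun i => 2 * (i.1.μ)⁻¹)
    (fun i j f => d_J j f) (fun i f M h k hk x => ?_) hf).mono hL zero_le_two fun i => ?_
  · obtain ⟨s, t⟩ := k
    have h0 : 0 ≤ M := (abs_nonneg _).trans (h _ hk x)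
    refine (abs_J_le _ fun r hr => h (r, t) ⟨sl_convex hk.1 hk.2 hr, hk.2⟩ x).trans ?_
    rw [mul_comm]
    exact mul_le_mul_of_nonneg_right (sl_dist hk.1 hk.2) h0
  · simp only [Pi.mul_apply]; linarith

lemma big_pt {Lf : Stp N × ℤ → ℝ} {f : Stp N × ℤ → PF ℝ} (hf : Big (fun _ => Set.univ) Lf n X f) :
    Big sl2 Lf n X (fun i => pt (f i)) :=
  hf.compo (fun _ _ _ => Set.mem_univ _) fun j l => Big.zero.congr rfl (by ext1 i; simp)

lemma big_att {Lf : Stp N × ℤ → ℝ} {f : Stp N × ℤ → PF (ℝ × ℝ)} (hf : Big sl2 Lf n X f) :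
    Big sl Lf n X (fun i => att (tl i) (f i)) :=
  (Big.linear (fun i => att (tl i)) (S' := sl) (Y := 1)
    (fun i j f => d_att _ f j) (fun i f M h k hk x => by
      rw [att_apply, Pi.one_apply, one_mul]; exact h _ ⟨tl_mem i, hk⟩ x) hf).congr
    (one_mul _) rfl

/-- Transfer of bounds from steps to slabs. -/
lemma big_sl {X : Stp N → ℝ} {f : Stp N → PF ℝ} (h : Big U L n X f) :
    Big sl (fun i => i.1.L) n (fun i => X i.1) (fun i => f i.1) :=
  (h.comap Prod.fst).subset fun _ => Set.subset_univ _

end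

lemma Lnn (i : Stp N × ℤ) : 0 ≤ i.1.L := i.1.L_pos.le

lemma big_dYf (m : ℕ) (j k : Fin 2) : Big sl2 (fun i : Stp N × ℤ => i.1.L) (lv N + 1)
    (fun i => i.1.ep) (fun i => d j (Yf i.1.ub m k)) := by
  induction m generalizing j k with
  | zero => exact Big.zero.congr rfl (by ext1 i; simp [Yf])
  | succ m ih =>
    have ih1 : ∀ j k, Big sl2 (fun i : Stp N × ℤ => i.1.L) (lv N + 1) 1
      (fun i => d j (Yf i.1.ub m k)) := fun j k => (ih j k).le Lnn fun i => i.1.ep_le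
    have h1 : ∀ l, Big sl2 (fun i : Stp N × ℤ => i.1.L) (lv N + 1)
        (fun i => i.1.sg * i.1.la * i.1.ep ^ 2)
        (fun i => compo (d l (i.1.ub k)) cfst 0 (Yf i.1.ub m)) := fun l =>
      Big.compo ((big_dub l k).comap (Prod.fst : Stp N × ℤ → Stp N))
        (fun _ _ _ => Set.mem_univ _) ih1
    have h2 := fun l => ((h1 l).mul (ih1 j l)).congr (mul_one _) rfl
    refine ((big_J Lnn ((h1 j).add ((h2 0).add (h2 1)))).congr ?_ ?_)
    · ext1 i
      have h1 := i.1.sg_pos.ne'; have h2 := i.1.la_pos.ne'; have h3 := i.1.ep_pos.ne'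
      simp only [μ]; field_simp
    · ext1 i
      simp only [Yf, d_J, d_compo, Fin.sum_univ_two]; rfl

lemma big_dYf_one (m : ℕ) (j k : Fin 2) : Big sl2 (fun i : Stp N × ℤ => i.1.L) (lv N + 1) 1
    (fun i => d j (Yf i.1.ub m k)) := (big_dYf m j k).le Lnn fun i => i.1.ep_le

lemma big_compo_Yf {X : Stp N → ℝ} {f : Stp N → PF ℝ} {n : ℕ} (hn : n ≤ lv N + 1)
    (h : Big U L n X f) (m : ℕ) : Big sl2 (fun i : Stp N × ℤ => i.1.L) n (fun i => X i.1)
      (fun i => compo (f i.1) cfst 0 (Yf i.1.ub m)) :=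
  Big.compo (h.comap (Prod.fst : Stp N × ℤ → Stp N)) (fun _ _ _ => Set.mem_univ _)
    fun j l => (big_dYf_one m j l).of_le hn

lemma big_Ef (m : ℕ) (j : Fin 2) : Big sl2 (fun i : Stp N × ℤ => i.1.L) (lv N + 1)
    (fun i => i.1.la * i.1.ep ^ m) (fun i => Ef i.1.ub m j) := by
  induction m generalizing j with
  | zero =>
    exact (big_pt ((big_ub j).comap (Prod.fst : Stp N × ℤ → Stp N))).congr (by simp)
      (by ext1 i; rw [Ef_zero])
  | succ m ih =>
    have h1 := fun l => (big_compo_Yf le_rfl (big_dub l j) m).mul (ih l)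
    refine (big_J Lnn ((h1 0).add (h1 1))).congr ?_ ?_
    · ext1 i
      have h1 := i.1.sg_pos.ne'; have h2 := i.1.la_pos.ne'; have h3 := i.1.ep_pos.ne'
      simp only [μ, Pi.mul_apply]; field_simp; ring
    · ext1 i
      rw [Ef_succ, Fin.sum_univ_two]; rfl

lemma big_D_ub (j : Fin 2) : Big U (L (N := N)) (lv N + 1) (fun σ => σ.la ^ 3)
    (fun σ => σ.D (σ.ub j)) := by
  have h1 := fun k => ((big_ub k).mul (big_dub k j)).le (Y := fun σ : Stp N => σ.la ^ 3)
    (fun σ => σ.L_pos.le) fun σ => by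
      have h1 := σ.sg_pos; have h2 := σ.la_pos; have h3 := σ.sg_le
      calc σ.la * (σ.sg * σ.la * σ.ep ^ 2) ≤ σ.la ^ 2 * σ.sg := σ.drop 2 (by ring) (by positivity)
        _ ≤ σ.la ^ 2 * σ.la := by gcongr
        _ = _ := by ring
  refine ((big_dt_ub j).add ((h1 0).add (h1 1))).congr rfl ?_
  ext1 σ
  rw [D, mat_apply]; rfl

lemma big_mat2_Ef (m : ℕ) (j : Fin 2) : Big sl2 (fun i : Stp N × ℤ => i.1.L) (lv N)
    (fun i => i.1.la ^ 3 * i.1.ep ^ m) (fun i => mat2 i.1.ub (Ef i.1.ub m j)) := by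
  induction m generalizing j with
  | zero =>
    exact ((big_pt ((big_D_ub j).comap (Prod.fst : Stp N × ℤ → Stp N))).pred).congr (by simp)
      (by ext1 i; rw [Ef_zero, mat2_pt])
  | succ m ih =>
    have h1 := fun k l => ((((big_compo_Yf le_self_add ((big_dub k j).d l) m).mul
      (big_Ef m l).pred).mul (big_Ef m k).pred)).le
      (Y := fun i : Stp N × ℤ => i.1.μ * (i.1.la ^ 3 * i.1.ep ^ (m + 1))) Lnn fun i => by
        have h1 := i.1.sg_pos; have h2 := i.1.la_pos; have h3 := i.1.ep_pos
        have h4 := i.1.μ_pos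
        refine i.1.drop (m + 1) ?_ (by positivity)
        simp only [Pi.mul_apply, μ, L]; ring
    have h2 := fun k => ((big_compo_Yf le_self_add ((big_dub k j).pred) m).mul (ih k)).le
      (Y := fun i : Stp N × ℤ => i.1.μ * (i.1.la ^ 3 * i.1.ep ^ (m + 1))) Lnn fun i => by
        simp only [Pi.mul_apply, μ]
        refine le_of_eq ?_
        ring
    have h3 : ∀ k, Big sl2 (fun i : Stp N × ℤ => i.1.L) (lv N)
        (fun i => i.1.la ^ 3 * i.1.ep ^ (m + 1))
        (fun i => pt (d k (i.1.ub j)) * diag (Ef i.1.ub m k)) := by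
      intro k
      cases m with
      | succ m => exact Big.zero.congr rfl (by ext1 i; rw [diag_Ef, mul_zero])
      | zero =>
        refine (((big_pt ((big_dub k j).comap (Prod.fst : Stp N × ℤ → Stp N))).pred.mul
          (big_pt ((big_ub k).comap (Prod.fst : Stp N × ℤ → Stp N))).pred).le Lnn
          fun i => ?_).congr rfl ?_
        · have h1 := i.1.sg_pos; have h2 := i.1.la_pos; have h3 := i.1.ep_pos
          have h4 := i.1.sg_le
          simp only [Pi.mul_apply]
          calc i.1.sg * i.1.la * i.1.ep ^ 2 * i.1.la ≤ i.1.sg * i.1.la * i.1.ep * i.1.la :=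
                i.1.drop 1 (by ring) (by positivity)
            _ ≤ i.1.la * i.1.la * i.1.ep * i.1.la := by gcongr
            _ = _ := by ring
        · ext1 i
          rw [Ef_zero]
          ext ⟨⟨s, t⟩, x⟩
          simp [diag_apply, pt]
    have h4 := fun k => (((h1 k 0).add (h1 k 1)).congr rfl rfl).add (h2 k)
    refine (((big_J Lnn ((h4 0).add (h4 1))).congr ?_ rfl).sub ((h3 0).add (h3 1))).congr rfl ?_
    · ext1 i
      rw [inv_mul_cancel_left₀ i.1.μ_pos.ne']
    · ext1 i
      rw [mat2_Ef_succ]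
      simp only [Fin.sum_univ_two, Pi.sub_apply, Pi.add_apply, Pi.mul_apply]
      congr 2
      ring

/-- Displacement of the backward flow from time `t` to the centre of the slab. -/
def Ψ (i : Stp N × ℤ) (j : Fin 2) : PF ℝ := att (tl i) (Yf i.1.ub (N + 2) j)

/-- Error in the transport equation for `Ψ`. -/
def er (i : Stp N × ℤ) (j : Fin 2) : PF ℝ := att (tl i) (Ef i.1.ub (N + 2) j)

lemma er_eq (i : Stp N × ℤ) (j : Fin 2) : er i j = i.1.D (Ψ i j) + i.1.ub j := by
  rw [er, Ef, att_add, ← mat_att, att_pt]; rfl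

abbrev CL (n : ℕ) (X : Stp N × ℤ → ℝ) (f : Stp N × ℤ → PF ℝ) : Prop :=
  Cl sl (fun i => i.1.L) (fun i => i.1.τ) (fun i => i.1.ub) n X f

lemma τnn (i : Stp N × ℤ) : 0 ≤ i.1.τ := i.1.τ_pos.le

lemma cl_er (j : Fin 2) : CL (N := N) (lv N) (fun i => i.1.sg * i.1.ep) (fun i => er i j) := by
  refine ⟨(big_att (big_Ef (N + 2) j)).le Lnn fun i => ?_,
    ((big_att (big_mat2_Ef (N + 2) j)).le Lnn fun i => ?_).congr rfl ?_⟩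
  · have h1 := i.1.sg_pos; have h2 := i.1.la_pos; have h3 := i.1.ep_pos
    have h4 := i.1.tiny
    calc i.1.la * i.1.ep ^ (N + 2) ≤ i.1.la * i.1.ep ^ N * i.1.ep :=
          i.1.drop 1 (by ring) (by positivity)
      _ ≤ i.1.la ^ 10 * i.1.ep ^ N * i.1.ep := by
          have : i.1.la ≤ i.1.la ^ 10 := le_self_pow₀ i.1.la_ge (by norm_num)
          gcongr
      _ ≤ _ := by gcongr
  · have h1 := i.1.sg_pos; have h2 := i.1.la_pos; have h3 := i.1.ep_pos
    have h4 := i.1.tiny'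
    simp only [Pi.mul_apply, τ]
    calc i.1.la ^ 3 * i.1.ep ^ (N + 2) ≤ i.1.la ^ 2 * i.1.ep ^ N * (i.1.la * i.1.ep) :=
          i.1.drop 1 (by ring) (by positivity)
      _ ≤ i.1.la ^ 10 * i.1.ep ^ N * (i.1.la * i.1.ep) := by
          have : i.1.la ^ 2 ≤ i.1.la ^ 10 := pow_le_pow_right₀ i.1.la_ge (by norm_num)
          gcongr
      _ ≤ i.1.sg ^ 2 * (i.1.la * i.1.ep) := by gcongr
      _ = _ := by ring
  · ext1 i
    exact (mat_att _ _ _).symm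

lemma big_dub' (j k : Fin 2) : Big sl (fun i : Stp N × ℤ => i.1.L) (lv N + 1)
    (fun i => i.1.sg * i.1.la * i.1.ep ^ 2) (fun i => d j (i.1.ub k)) := big_sl (big_dub j k)

lemma big_dub_τ (j k : Fin 2) : Big sl (fun i : Stp N × ℤ => i.1.L) (lv N + 1)
    (fun i => i.1.τ) (fun i => d j (i.1.ub k)) :=
  (big_dub' j k).le Lnn fun i => i.1.drop 2 (by simp only [τ]) i.1.τ_pos.le

lemma cl_dΨ (j k : Fin 2) : CL (N := N) (lv N - 1) (fun i => i.1.ep) (fun i => d j (Ψ i k)) := by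
  have hY : Big sl (fun i : Stp N × ℤ => i.1.L) (lv N + 1) (fun i => i.1.ep)
      (fun i => d j (Ψ i k)) :=
    (big_att (big_dYf (N + 2) j k)).congr rfl (by ext1 i; rw [Ψ, d_att])
  have hY' := fun l => (big_att (big_dYf_one (N := N) (N + 2) l k)).congr rfl
    (show _ = fun i => d l (Ψ i k) by ext1 i; rw [Ψ, d_att])
  refine ⟨hY.of_le (by simp [lv]), ?_⟩
  have h1 := ((cl_er (N := N) k).1.d j).le (Y := fun i => i.1.τ * i.1.ep) Lnn fun i => by
    have h1 := i.1.sg_pos; have h2 := i.1.la_pos; have h3 := i.1.ep_pos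
    exact i.1.drop 1 (by simp only [Pi.mul_apply, τ, L]; ring) (by simp only [τ]; positivity)
  have h0 : ∀ l, Big sl (fun i : Stp N × ℤ => i.1.L) (lv N + 1)
    (fun i => i.1.τ * i.1.ep) (fun i => d j (i.1.ub l)) := fun l => (big_dub' j l).le Lnn fun i => by
      have h1 := i.1.sg_pos; have h2 := i.1.la_pos; have h3 := i.1.ep_pos
      exact i.1.drop 1 (by simp only [τ]; ring) (by simp only [τ]; positivity)
  have h3 := fun l => ((h0 l).mul (hY' l)).congr (mul_one _) rfl
  refine ((h1.of_le (m := lv N - 1) (by simp [lv])).sub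
    (((h0 k).add ((h3 0).add (h3 1))).of_le (m := lv N - 1) (by simp [lv]))).congr rfl ?_
  ext1 i
  have := er_eq i k
  simp only [mat_d, Pi.sub_apply, Pi.add_apply, Pi.mul_apply, this, map_add]
  ring

lemma big_dΨ_one (j k : Fin 2) : Big sl (fun i : Stp N × ℤ => i.1.L) (lv N + 1) 1
    (fun i => d j (Ψ i k)) :=
  (big_att (big_dYf_one (N + 2) j k)).congr rfl (by ext1 i; rw [Ψ, d_att])

/-- Value at the centre of the slab, transported by the flow. -/
def tr (i : Stp N × ℤ) (f : PF ℝ) : PF ℝ := compo f 0 (tl i) (Ψ i)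

lemma d_tr (i : Stp N × ℤ) (f : PF ℝ) (j : Fin 2) :
    d j (tr i f) = tr i (d j f) + ∑ k, tr i (d k f) * d j (Ψ i k) := d_compo _ _ _ _ _

lemma D_tr (i : Stp N × ℤ) (f : PF ℝ) : i.1.D (tr i f) = ∑ k, tr i (d k f) * er i k := by
  have h : dv ((0 : ℝ), (0 : E2)) f = 0 := dv_zero f
  have h1 : dt (tr i f) = ∑ k, tr i (d k f) * dt (Ψ i k) := by
    simp [tr, dv_compo, h, compo_zero]
  simp only [D, mat_apply, h1, d_tr, er_eq, Fin.sum_univ_two]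
  ring

lemma cl_tr {X : Stp N → ℝ} (hX : ∀ σ, 0 ≤ X σ) {f : Stp N → PF ℝ} {n : ℕ} (hn : n ≤ lv N)
    (h : Big U L (n + 1) X f) : CL (N := N) n (fun i => X i.1) (fun i => tr i (f i.1)) := by
  have h1 : ∀ {n : ℕ} {X : Stp N → ℝ} {f : Stp N → PF ℝ}, n ≤ lv N + 1 → Big U L n X f →
      Big sl (fun i : Stp N × ℤ => i.1.L) n (fun i => X i.1) (fun i => tr i (f i.1)) :=
    fun hn h => Big.compo (h.comap (Prod.fst : Stp N × ℤ → Stp N)) (fun _ _ _ => Set.mem_univ _)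
      fun j l => (big_dΨ_one j l).of_le hn
  refine ⟨h1 (by omega) h, ?_⟩
  have h2 := fun k => ((h1 (by omega) (h.d k)).mul ((cl_er k).1.of_le (m := n) (by omega))).le
    (Y := (fun i => i.1.τ) * fun i : Stp N × ℤ => X i.1) Lnn fun i => by
      have h1 := hX i.1
      have h2 := i.1.τ_pos.le
      exact i.1.drop 2 (by simp only [Pi.mul_apply, τ, L]; ring)
        (by simp only [Pi.mul_apply]; positivity)
  refine ((h2 0).add (h2 1)).congr rfl ?_
  ext1 i
  simp only [D_tr, Fin.sum_univ_two, Pi.add_apply, Pi.mul_apply]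

end Stp

lemma J_sub (f g : PF (ℝ × ℝ)) : J (f - g) = J f - J g := by
  rw [eq_sub_iff_add_eq, ← J_add, sub_add_cancel]

lemma B0.unif {ι : Type} {K : Type} [NormedAddCommGroup K] [NormedSpace ℝ K] {S : ι → Set K}
    {X : ι → ℝ} {f : Fin 2 → ι → PF K} (h : ∀ j, B0 S X (f j)) (hX : ∀ i, 0 ≤ X i) :
    ∃ C, 0 ≤ C ∧ ∀ j i, ∀ k ∈ S i, ∀ x, |f j i (k, x)| ≤ C * X i := by
  choose C hC h using h
  refine ⟨C 0 + C 1, add_nonneg (hC 0) (hC 1), fun j i k hk x => (h j i k hk x).trans ?_⟩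
  refine mul_le_mul_of_nonneg_right ?_ (hX i)
  have := hC 0; have := hC 1
  fin_cases j <;> simp <;> linarith

namespace Stp
variable {N : ℕ}

lemma b0_compo_sub {q : Stp N → PF ℝ} {X : Stp N → ℝ} {W : Stp N × ℤ → ℝ} (hX : ∀ σ, 0 ≤ X σ)
    (hW : ∀ i, 0 ≤ W i)
    (hq : ∀ j, B0 U X (fun σ => d j (q σ))) {Y Z : Stp N × ℤ → Fin 2 → PF (ℝ × ℝ)}
    (hYZ : ∀ j, B0 sl2 W (fun i => Y i j - Z i j)) :
    B0 sl2 (fun i => X i.1 * W i) (fun i => compo (q i.1) cfst 0 (Y i) -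
      compo (q i.1) cfst 0 (Z i)) := by
  obtain ⟨C, hC, h⟩ := B0.unif hq hX
  obtain ⟨C', hC', h'⟩ := B0.unif hYZ hW
  refine ⟨2 * C * C', by positivity, fun i k hk x => ?_⟩
  refine (abs_compo_sub_le (q i.1) cfst 0 (Y i) (Z i) (k, x)
    (fun j x => h j i.1 _ (Set.mem_univ _) x) (fun j => h' j i k hk x)).trans (le_of_eq ?_)
  ring

lemma b0_Yf_sub (m : ℕ) (j : Fin 2) : B0 sl2 (fun i : Stp N × ℤ => i.1.la * (i.1.μ)⁻¹ * i.1.ep ^ m)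
    (fun i => Yf i.1.ub (m + 1) j - Yf i.1.ub m j) := by
  induction m generalizing j with
  | zero =>
    refine (big_J (n := 0) Lnn (big_compo_Yf (Nat.zero_le _) ((big_ub j).of_le (Nat.zero_le _))
      0)).b0.congr ?_ ?_
    · ext1 i; rw [pow_zero, mul_one, mul_comm]
    · ext1 i; simp [Yf]
  | succ m ih =>
    refine (big_J (n := 0) Lnn (b0_compo_sub (fun σ => ?_) (fun i => ?_)
      (fun k => (big_dub (N := N) k j).b0) ih)).b0.congr ?_ ?_
    · have h1 := σ.sg_pos; have h2 := σ.la_pos; positivity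
    · have h1 := i.1.μ_pos; have h2 := i.1.la_pos; have h3 := i.1.ep_pos; positivity
    · ext1 i
      have h1 := i.1.sg_pos.ne'; have h2 := i.1.la_pos.ne'; have h3 := i.1.ep_pos.ne'
      simp only [μ]; field_simp; ring
    · ext1 i
      simp only [Yf, J_sub]

/-- Variation of a function along the approximate flow. -/
lemma b0_sub_tr {q : Stp N → PF ℝ} {X : Stp N → ℝ} (hX : ∀ σ, 0 ≤ X σ)
    (hq : ∀ j, B0 U (fun σ => X σ * (σ.la * σ.ep ^ 2)) (fun σ => d j (q σ)))
    (hD : B0 U (fun σ => X σ * (σ.sg * σ.la * σ.ep ^ 2)) (fun σ => σ.D (q σ))) :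
    B0 sl (fun i : Stp N × ℤ => X i.1 * i.1.ep) (fun i => q i.1 - tr i (q i.1)) := by
  have h1 : ∀ k, B0 sl2 (fun i : Stp N × ℤ => i.1.sg * i.1.ep) (fun i =>
      compo (i.1.ub k) cfst 0 (Yf i.1.ub (N + 1)) - compo (i.1.ub k) cfst 0 (Yf i.1.ub (N + 2))) := by
    intro k
    have := b0_compo_sub (q := fun σ => σ.ub k) (X := fun σ : Stp N => σ.sg * σ.la * σ.ep ^ 2)
      (W := fun i : Stp N × ℤ => i.1.la * (i.1.μ)⁻¹ * i.1.ep ^ (N + 1))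
      (Y := fun i => Yf i.1.ub (N + 2)) (Z := fun i => Yf i.1.ub (N + 1)) (fun σ => ?_)
      (fun i => ?_) (fun j => (big_dub (N := N) j k).b0) (b0_Yf_sub (N + 1))
    · refine (this.le fun i => ?_).neg.congr rfl ?_
      · have h1 := i.1.sg_pos; have h2 := i.1.la_pos; have h3 := i.1.ep_pos
        have h4 := i.1.tiny
        have h5 : i.1.la ≤ i.1.la ^ 10 := le_self_pow₀ i.1.la_ge (by norm_num)
        calc _ = i.1.la * i.1.ep ^ N * i.1.ep * i.1.ep ^ 1 := by
              simp only [μ]; field_simp; ring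
          _ ≤ i.1.la * i.1.ep ^ N * i.1.ep := i.1.drop 1 rfl (by positivity)
          _ ≤ i.1.la ^ 10 * i.1.ep ^ N * i.1.ep := by gcongr
          _ ≤ _ := by gcongr
      · ext1 i; simp
    · have h1 := σ.sg_pos; have h2 := σ.la_pos; positivity
    · have h1 := i.1.μ_pos; have h2 := i.1.la_pos; have h3 := i.1.ep_pos; positivity
  have h2 := fun k => ((big_compo_Yf (n := 0) (Nat.zero_le _) (hq k) (N + 2)).b0.mul (h1 k)).le
    (Y := fun i : Stp N × ℤ => X i.1 * (i.1.sg * i.1.la * i.1.ep ^ 2)) fun i => by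
      have h1 := i.1.sg_pos; have h2 := i.1.la_pos; have h3 := i.1.ep_pos; have h4 := hX i.1
      exact i.1.drop 1 (by simp only [Pi.mul_apply]; ring) (by positivity)
  have h3 := (big_compo_Yf (n := 0) (Nat.zero_le _) hD (N + 2)).b0
  suffices h : B0 sl (fun i : Stp N × ℤ => X i.1 * i.1.ep) (fun i => tr i (q i.1) - q i.1) from
    h.neg.congr rfl (by ext1 i; simp)
  refine (big_att (big_J (n := 0) Lnn (h3.add ((h2 0).add (h2 1))))).b0.congr ?_ ?_
  · ext1 i
    have h1 := i.1.sg_pos.ne'; have h2 := i.1.la_pos.ne'; have h3 := i.1.ep_pos.ne'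
    simp only [μ]; field_simp
  · ext1 i
    have h4 : J ((fun i : Stp N × ℤ => compo (i.1.D (q i.1)) cfst 0 (Yf i.1.ub (N + 2))) i +
      ((compo (d 0 (q i.1)) cfst 0 (Yf i.1.ub (N + 2)) * (compo (i.1.ub 0) cfst 0 (Yf i.1.ub (N + 1))
         - compo (i.1.ub 0) cfst 0 (Yf i.1.ub (N + 2)))) +
      (compo (d 1 (q i.1)) cfst 0 (Yf i.1.ub (N + 2)) * (compo (i.1.ub 1) cfst 0 (Yf i.1.ub (N + 1))
         - compo (i.1.ub 1) cfst 0 (Yf i.1.ub (N + 2)))))) =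
      compo (q i.1) cfst 0 (Yf i.1.ub (N + 2)) - pt (q i.1) := by
      symm
      refine J_unique ?_ fun t x => ?_
      · rw [map_sub, ds_pt, sub_zero, ds_compo_fst]
        have h5 : ∀ k, dv es (Yf i.1.ub (N + 2) k) = compo (i.1.ub k) cfst 0 (Yf i.1.ub (N + 1)) :=
          fun k => ds_J _
        have h6 : ∀ Y : Fin 2 → PF (ℝ × ℝ), compo (i.1.D (q i.1)) cfst 0 Y =
          compo (dt (q i.1)) cfst 0 Y + (compo (i.1.ub 0) cfst 0 Y * compo (d 0 (q i.1)) cfst 0 Y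
            + compo (i.1.ub 1) cfst 0 Y * compo (d 1 (q i.1)) cfst 0 Y) := fun Y => by
          rw [D, mat_apply]; rfl
        simp only [h5, h6, Fin.sum_univ_two]
        ring
      · have h5 : (fun j => Yf i.1.ub (N + 2) j ((t, t), x)) = (0 : E2) := by
          ext j; simp [diag_Yf]
        simp only [pt, sub_apply, compo_apply, h5]
        rw [sub_eq_zero]
        congr 1
    have h5 := congrArg (att (tl i)) h4
    refine h5.trans ?_
    have h6 : ∀ f g, att (tl i) (f - g) = att (tl i) f - att (tl i) g := fun _ _ => rfl
    rw [h6, att_pt]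
    congr 1
    ext ⟨t, x⟩
    simp only [att_apply, compo_apply, tr, Ψ]
    simp

lemma b0_D_tr {X : Stp N → ℝ} {f : Stp N → PF ℝ} (h : Big U L 1 X f) :
    B0 sl (fun i : Stp N × ℤ => X i.1 * (i.1.τ * i.1.ep ^ 2)) (fun i => i.1.D (tr i (f i.1))) := by
  have h2 := fun k => (((Big.compo (n := 0) ((h.d k).comap (Prod.fst : Stp N × ℤ → Stp N))
    (S' := sl) (A := fun _ => 0) (c := tl) (Y := Ψ) (fun _ _ _ => Set.mem_univ _)
    fun j l => (big_dΨ_one j l).of_le (Nat.zero_le _)).b0).mul (cl_er k).1.b0)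
  refine ((h2 0).add (h2 1)).congr ?_ ?_
  · ext1 i; simp only [Pi.mul_apply, τ, L]; ring
  · ext1 i
    simp only [D_tr, Fin.sum_univ_two]
    rfl

/-- Estimates for the difference between a function and its mollified and transported version. -/
lemma cl_mismatch {q : Stp N → PF ℝ} {X : Stp N → ℝ} (hX : ∀ σ, 0 ≤ X σ) (h0 : B0 U X q)
    (hq : ∀ j, B0 U (fun σ => X σ * (σ.la * σ.ep ^ 2)) (fun σ => d j (q σ)))
    (hD : B0 U (fun σ => X σ * (σ.sg * σ.la * σ.ep ^ 2)) (fun σ => σ.D (q σ))) :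
    Cl sl (fun i : Stp N × ℤ => i.1.la) (fun i => i.1.τ) (fun i => i.1.ub) 0
      (fun i => X i.1 * i.1.ep)
      (fun i => q i.1 - tr i (st i.1.L⁻¹ (lv N + 1) (q i.1))) := by
  have h1 := cl_tr (n := 0) hX (Nat.zero_le _) ((Big.st L_pos h0 (lv N + 1)).of_le (by simp))
  have hU : ∀ {X : Stp N → ℝ} {f : Stp N → PF ℝ}, B0 U X f →
    B0 sl (fun i : Stp N × ℤ => X i.1) (fun i => f i.1) := fun h => big_sl (n := 0) h
  refine ⟨⟨?_, fun j => ?_⟩, ?_⟩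
  · have h2 := B0.st_sub L_pos hq (lv N + 1)
    have h3 : B0 sl (fun i : Stp N × ℤ => X i.1 * i.1.ep)
        (fun i => tr i (st i.1.L⁻¹ (lv N + 1) (q i.1) - q i.1)) := by
      refine (Big.compo (n := 0) (L := fun i => i.1.L)
        (Big.comap (n := 0) (L := L) (Prod.fst : Stp N × ℤ → Stp N) h2)
        (fun _ _ _ => Set.mem_univ _) fun j l => (big_dΨ_one j l).of_le (Nat.zero_le _)).b0.congr
        ?_ rfl
      ext1 i
      have h2 := i.1.la_pos.ne'; have h3 := i.1.ep_pos.ne'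
      simp only [Pi.mul_apply, Pi.inv_apply, L]; field_simp
    refine ((b0_sub_tr hX hq hD).sub h3).congr rfl ?_
    ext1 i
    have h6 : ∀ f g, tr i (f - g) = tr i f - tr i g := fun _ _ => rfl
    simp only [Pi.sub_apply, h6]
    abel
  · refine (((hU (hq j)).le fun i => ?_).sub ((h1.1.d j).b0.le fun i => ?_)).congr rfl ?_
    · have h2 := i.1.la_pos; have h3 := i.1.ep_pos; have h4 := hX i.1
      exact i.1.drop 1 (by simp only [Pi.mul_apply]; ring) (by simp only [Pi.mul_apply]; positivity)
    · simp only [Pi.mul_apply, L]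
      exact le_of_eq (by ring)
    · ext1 i; simp
  · refine (((hU hD).le fun i => ?_).sub ((b0_D_tr ((Big.st L_pos h0 (lv N + 1)).of_le
      (by simp))).le fun i => ?_)).congr rfl ?_
    · have h1 := i.1.sg_pos; have h2 := i.1.la_pos; have h3 := i.1.ep_pos; have h4 := hX i.1
      exact i.1.drop 1 (by simp only [Pi.mul_apply, τ]; ring)
        (by simp only [Pi.mul_apply, τ]; positivity)
    · have h1 := i.1.sg_pos; have h2 := i.1.la_pos; have h3 := i.1.ep_pos; have h4 := hX i.1
      exact i.1.drop 1 (by simp only [Pi.mul_apply, τ]; ring)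
        (by simp only [Pi.mul_apply, τ]; positivity)
    · ext1 i; simp

end Stp

/-- Constants. -/
abbrev C (x : ℝ) : PF ℝ := algebraMap ℝ (PF ℝ) x

lemma d_C (j : Fin 2) (x : ℝ) : d j (C x) = 0 := Derivation.map_algebraMap _ _
lemma mat_C (u : Fin 2 → PF ℝ) (x : ℝ) : mat u (C x) = 0 := Derivation.map_algebraMap _ _

/-! ### Functions supported in a set of times -/

/-- Vanishing outside a set of times. -/
def Sup (S : Set ℝ) (f : PF ℝ) : Prop := ∀ t ∉ S, ∀ x, f (t, x) = 0

section
variable {S : Set ℝ} {f g : PF ℝ}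

lemma Sup.zero : Sup S 0 := fun _ _ _ => rfl
lemma Sup.add (hf : Sup S f) (hg : Sup S g) : Sup S (f + g) := fun t ht x => by
  simp [hf t ht x, hg t ht x]
lemma Sup.neg (hf : Sup S f) : Sup S (-f) := fun t ht x => by simp [hf t ht x]
lemma Sup.mul (hf : Sup S f) (g : PF ℝ) : Sup S (g * f) := fun t ht x => by simp [hf t ht x]

lemma Sup.dv (hS : IsClosed S) (hf : Sup S f) (v : ℝ × E2) : Sup S (dv v f) := by
  intro t ht x
  rw [dv_apply]
  have h : f.fn =ᶠ[nhds (t, x)] fun _ => 0 := by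
    have h1 : {z : ℝ × E2 | z.1 ∈ Sᶜ} ∈ nhds (t, x) :=
      (hS.isOpen_compl.preimage continuous_fst).mem_nhds ht
    filter_upwards [h1] with z hz
    exact hf z.1 hz z.2
  rw [h.fderiv_eq]; simp

lemma Sup.mat (hS : IsClosed S) (hf : Sup S f) (u : Fin 2 → PF ℝ) : Sup S (mat u f) := by
  rw [mat_apply]
  exact (hf.dv hS _).add (((hf.dv hS _).mul _).add ((hf.dv hS _).mul _))
end

/-- Families in a class `Cl` which are supported in the given sets of times. -/
def Cs {ι : Type} (S : ι → Set ℝ) (L τ : ι → ℝ) (u : ι → Fin 2 → PF ℝ) (n : ℕ) (X : ι → ℝ)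
    (f : ι → PF ℝ) : Prop := Cl S L τ u n X f ∧ ∀ i, Sup (S i) (f i)

section
variable {ι : Type} {S : ι → Set ℝ} {L τ : ι → ℝ} {u : ι → Fin 2 → PF ℝ} {X Y : ι → ℝ}
  {f g : ι → PF ℝ} {n : ℕ}

lemma Cl.bdd (hL : ∀ i, 0 ≤ L i) (hτ : ∀ i, 0 ≤ τ i) {c : ι → ℝ} {M : ℝ} (hM : 0 ≤ M)
    (hc : ∀ i, |c i| ≤ M) : Cl S L τ u n 1 (fun i => C (c i)) :=
  (Cl.const c).mono hL hτ (c := M) hM fun i => by simpa using hc i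

lemma Cl.le (h : Cl S L τ u n X f) (hL : ∀ i, 0 ≤ L i) (hτ : ∀ i, 0 ≤ τ i)
    (hXY : ∀ i, X i ≤ Y i) : Cl S L τ u n Y f :=
  h.mono hL hτ zero_le_one fun i => by simpa using hXY i

lemma Cl.mono_scale {L' : ι → ℝ} (h : Cl S L τ u n X f) (hX : ∀ i, 0 ≤ X i) (hL : ∀ i, 0 ≤ L i)
    (hτ : ∀ i, 0 ≤ τ i) (hLL : ∀ i, L i ≤ L' i) : Cl S L' τ u n X f :=
  ⟨h.1.mono_scale hX hL hLL, h.2.mono_scale (fun i => mul_nonneg (hτ i) (hX i)) hL hLL⟩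

lemma Cs.congr (h : Cs S L τ u n X f) (hX : X = Y) (hf : f = g) : Cs S L τ u n Y g := hX ▸ hf ▸ h
lemma Cs.le (h : Cs S L τ u n X f) (hL : ∀ i, 0 ≤ L i) (hτ : ∀ i, 0 ≤ τ i)
    (hXY : ∀ i, X i ≤ Y i) : Cs S L τ u n Y f := ⟨h.1.le hL hτ hXY, h.2⟩
lemma Cs.of_le {m : ℕ} (h : Cs S L τ u n X f) (hmn : m ≤ n) : Cs S L τ u m X f :=
  ⟨h.1.of_le hmn, h.2⟩
lemma Cs.zero : Cs S L τ u n X (fun _ => 0) := ⟨Cl.zero, fun _ => Sup.zero⟩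
lemma Cs.add (hf : Cs S L τ u n X f) (hg : Cs S L τ u n X g) : Cs S L τ u n X (f + g) :=
  ⟨hf.1.add hg.1, fun i => (hf.2 i).add (hg.2 i)⟩
lemma Cs.neg (hf : Cs S L τ u n X f) : Cs S L τ u n X (-f) := ⟨hf.1.neg, fun i => (hf.2 i).neg⟩
lemma Cs.sub (hf : Cs S L τ u n X f) (hg : Cs S L τ u n X g) : Cs S L τ u n X (f - g) := by
  rw [sub_eq_add_neg]; exact hf.add hg.neg
lemma Cs.mul (hf : Cs S L τ u n X f) (hg : Cl S L τ u n Y g) : Cs S L τ u n (Y * X) (g * f) :=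
  ⟨hg.mul hf.1, fun i => (hf.2 i).mul _⟩
lemma Cs.mul_one (hf : Cs S L τ u n X f) (hg : Cl S L τ u n 1 g) : Cs S L τ u n X (g * f) :=
  (hf.mul hg).congr (one_mul _) rfl
lemma Cs.d (hu : ∀ j l, Big S L n τ (fun i => PF.d j (u i l))) (hS : ∀ i, IsClosed (S i))
    (hf : Cs S L τ u (n + 1) X f) (j : Fin 2) : Cs S L τ u n (L * X) (fun i => PF.d j (f i)) :=
  ⟨hf.1.d hu j, fun i => (hf.2 i).dv (hS i) _⟩
lemma Cs.mono_scale {L' : ι → ℝ} (h : Cs S L τ u n X f) (hX : ∀ i, 0 ≤ X i) (hL : ∀ i, 0 ≤ L i)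
    (hτ : ∀ i, 0 ≤ τ i) (hLL : ∀ i, L i ≤ L' i) : Cs S L' τ u n X f :=
  ⟨h.1.mono_scale hX hL hτ hLL, h.2⟩
end

/-! ### Oscillations -/

/-- A plane wave in deformed coordinates: `c`, `s` are the cosine and sine of `la` times a phase
with gradient `n` and material derivative `g`. -/
structure Ph (la : ℝ) (u : Fin 2 → PF ℝ) where
  c : PF ℝ
  s : PF ℝ
  g : PF ℝ
  n : Fin 2 → PF ℝ
  k : Fin 2 → ℝ
  sq : c * c + s * s = 1
  dc : ∀ j, d j c = -(C la * (n j * s))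
  ds : ∀ j, d j s = C la * (n j * c)
  Dc : mat u c = -(C la * (g * s))
  Ds : mat u s = C la * (g * c)
  curl : d 0 (n 1) = d 1 (n 0)

namespace Ph
variable {la : ℝ} {u : Fin 2 → PF ℝ}

/-- Product of waves, adding the frequencies. -/
def add (P Q : Ph la u) : Ph la u where
  c := P.c * Q.c - P.s * Q.s
  s := P.s * Q.c + P.c * Q.s
  g := P.g + Q.g
  n j := P.n j + Q.n j
  k j := P.k j + Q.k j
  sq := by linear_combination (Q.c ^ 2 + Q.s ^ 2) * P.sq + Q.sq
  dc j := by simp only [map_sub, Derivation.leibniz, smul_eq_mul, P.dc, Q.dc, P.ds, Q.ds]; ring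
  ds j := by simp only [map_add, Derivation.leibniz, smul_eq_mul, P.dc, Q.dc, P.ds, Q.ds]; ring
  Dc := by simp only [map_sub, Derivation.leibniz, smul_eq_mul, P.Dc, Q.Dc, P.Ds, Q.Ds]; ring
  Ds := by simp only [map_add, Derivation.leibniz, smul_eq_mul, P.Dc, Q.Dc, P.Ds, Q.Ds]; ring
  curl := by simp only [map_add, P.curl, Q.curl]

/-- Complex conjugation. -/
def neg (P : Ph la u) : Ph la u where
  c := P.c
  s := -P.s
  g := -P.g
  n j := -P.n j
  k j := -P.k j
  sq := by linear_combination P.sq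
  dc j := by rw [P.dc]; ring
  ds j := by rw [map_neg, P.ds]; ring
  Dc := by rw [P.Dc]; ring
  Ds := by rw [map_neg, P.Ds]; ring
  curl := by simp only [map_neg, P.curl]

lemma c_le (P : Ph la u) (z : ℝ × E2) : |P.c z| ≤ 1 := by
  have h := congrArg (fun f : PF ℝ => f z) P.sq
  simp only [add_apply, mul_apply, one_apply] at h
  rw [abs_le]; constructor <;> nlinarith [sq_nonneg (P.s z)]

lemma s_le (P : Ph la u) (z : ℝ × E2) : |P.s z| ≤ 1 := by
  have h := congrArg (fun f : PF ℝ => f z) P.sq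
  simp only [add_apply, mul_apply, one_apply] at h
  rw [abs_le]; constructor <;> nlinarith [sq_nonneg (P.c z)]

end Ph

/-- The inverse of `B ↦ S k` on symmetric matrices. -/
def osS (k : Fin 2 → ℝ) (B : Fin 2 → PF ℝ) (i j : Fin 2) : PF ℝ :=
  C ((k 0 ^ 2 + k 1 ^ 2)⁻¹ * k j) * B i + C ((k 0 ^ 2 + k 1 ^ 2)⁻¹ * k i) * B j
    - C ((k 0 ^ 2 + k 1 ^ 2)⁻¹ ^ 2 * (k i * k j)) * (C (k 0) * B 0 + C (k 1) * B 1)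

lemma osS_symm (k : Fin 2 → ℝ) (B : Fin 2 → PF ℝ) (i j : Fin 2) : osS k B i j = osS k B j i := by
  simp only [osS, mul_comm (k i) (k j)]; ring

lemma osS_k {k : Fin 2 → ℝ} (hk : k 0 ^ 2 + k 1 ^ 2 ≠ 0) (B : Fin 2 → PF ℝ) (i : Fin 2) :
    osS k B i 0 * C (k 0) + osS k B i 1 * C (k 1) = B i := by
  have h : C (k 0 ^ 2 + k 1 ^ 2) * C ((k 0 ^ 2 + k 1 ^ 2)⁻¹) = 1 := by
    rw [← map_mul, mul_inv_cancel₀ hk, map_one]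
  simp only [osS, C, map_mul, map_pow, map_add] at h ⊢
  have h' : (algebraMap ℝ (PF ℝ) (k 0) ^ 2 + algebraMap ℝ (PF ℝ) (k 1) ^ 2) *
      algebraMap ℝ (PF ℝ) (k 0 ^ 2 + k 1 ^ 2)⁻¹ = 1 := by simpa using h
  fin_cases i <;> simp only [Fin.zero_eta, Fin.mk_one, Fin.isValue]
  · linear_combination (B 0 - algebraMap ℝ (PF ℝ) (k 0 ^ 2 + k 1 ^ 2)⁻¹ *
      algebraMap ℝ (PF ℝ) (k 0) * (algebraMap ℝ (PF ℝ) (k 0) * B 0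
        + algebraMap ℝ (PF ℝ) (k 1) * B 1)) * h'
  · linear_combination (B 1 - algebraMap ℝ (PF ℝ) (k 0 ^ 2 + k 1 ^ 2)⁻¹ *
      algebraMap ℝ (PF ℝ) (k 1) * (algebraMap ℝ (PF ℝ) (k 0) * B 0
        + algebraMap ℝ (PF ℝ) (k 1) * B 1)) * h'

lemma C_mul (x : ℝ) (f : PF ℝ) : C x * f = x • f := (Algebra.smul_def x f).symm

/-- Symbol of the cosine part after one integration by parts. -/
def osB {la : ℝ} {u : Fin 2 → PF ℝ} (P : Ph la u) (B B' : Fin 2 → PF ℝ) (i : Fin 2) : PF ℝ :=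
  C la⁻¹ * (d 0 (osS P.k B' i 0) + d 1 (osS P.k B' i 1))
    - (osS P.k B i 0 * (P.n 0 - C (P.k 0)) + osS P.k B i 1 * (P.n 1 - C (P.k 1)))

/-- Symbol of the sine part after one integration by parts. -/
def osB' {la : ℝ} {u : Fin 2 → PF ℝ} (P : Ph la u) (B B' : Fin 2 → PF ℝ) (i : Fin 2) : PF ℝ :=
  -(C la⁻¹ * (d 0 (osS P.k B i 0) + d 1 (osS P.k B i 1)))
    - (osS P.k B' i 0 * (P.n 0 - C (P.k 0)) + osS P.k B' i 1 * (P.n 1 - C (P.k 1)))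

/-- Stress gained in one integration by parts. -/
def osT {la : ℝ} {u : Fin 2 → PF ℝ} (P : Ph la u) (B B' : Fin 2 → PF ℝ) (i j : Fin 2) : PF ℝ :=
  C la⁻¹ * (osS P.k B i j * P.s - osS P.k B' i j * P.c)

lemma osT_symm {la : ℝ} {u : Fin 2 → PF ℝ} (P : Ph la u) (B B' : Fin 2 → PF ℝ) (i j : Fin 2) :
    osT P B B' i j = osT P B B' j i := by
  simp only [osT, osS_symm P.k _ i j]

lemma osc_step {la : ℝ} (hla : la ≠ 0) {u : Fin 2 → PF ℝ} (P : Ph la u)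
    (hk : P.k 0 ^ 2 + P.k 1 ^ 2 ≠ 0) (B B' : Fin 2 → PF ℝ) (i : Fin 2) :
    B i * P.c + B' i * P.s = (d 0 (osT P B B' i 0) + d 1 (osT P B B' i 1))
      + (osB P B B' i * P.c + osB' P B B' i * P.s) := by
  have h1 := osS_k hk B i
  have h2 := osS_k hk B' i
  have h3 : C la⁻¹ * C la = 1 := by rw [← map_mul, inv_mul_cancel₀ hla, map_one]
  simp only [osT, osB, osB', map_sub, Derivation.leibniz, smul_eq_mul, P.dc, P.ds, d_C]
  generalize d 0 (osS P.k B i 0) = a0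
  generalize d 1 (osS P.k B i 1) = a1
  generalize d 0 (osS P.k B' i 0) = b0
  generalize d 1 (osS P.k B' i 1) = b1
  generalize osS P.k B i 0 = p0 at *
  generalize osS P.k B i 1 = p1 at *
  generalize osS P.k B' i 0 = q0 at *
  generalize osS P.k B' i 1 = q1 at *
  generalize C la⁻¹ = l' at *
  generalize C la = l at *
  generalize C (P.k 0) = k0 at *
  generalize C (P.k 1) = k1 at *
  linear_combination -P.c * h1 - P.s * h2 - (p0 * P.n 0 * P.c + p1 * P.n 1 * P.c
    + q0 * P.n 0 * P.s + q1 * P.n 1 * P.s) * h3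

/-- Hypotheses under which oscillations can be integrated by parts. -/
structure Osc {ι : Type} (S : ι → Set ℝ) (la ep τ : ι → ℝ) (u : ι → Fin 2 → PF ℝ)
    (P : ∀ i, Ph (la i) (u i)) (m : ℕ) : Prop where
  closed : ∀ i, IsClosed (S i)
  la_pos : ∀ i, 0 < la i
  ep_pos : ∀ i, 0 < ep i
  ep_le : ∀ i, ep i ≤ 1
  τ_nonneg : ∀ i, 0 ≤ τ i
  k_le : ∀ i j, |(P i).k j| ≤ 2
  k_ge : ∀ i, 1 / 20 ≤ (P i).k 0 ^ 2 + (P i).k 1 ^ 2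
  n_sub : ∀ j, Cl S (la * ep) τ u m ep (fun i => (P i).n j - C ((P i).k j))
  du : ∀ j l, Big S (la * ep) m τ (fun i => d j (u i l))
  g_le : B0 S (fun i => τ i / la i) (fun i => (P i).g)

namespace Osc
variable {ι : Type} {S : ι → Set ℝ} {la ep τ : ι → ℝ} {u : ι → Fin 2 → PF ℝ}
    {P : ∀ i, Ph (la i) (u i)} {m n : ℕ} {X : ι → ℝ} {B B' : ι → Fin 2 → PF ℝ}

section
variable (H : Osc S la ep τ u P m)
include H

lemma k_ne (i : ι) : (P i).k 0 ^ 2 + (P i).k 1 ^ 2 ≠ 0 := by have := H.k_ge i; positivity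

lemma L_nonneg (i : ι) : 0 ≤ (la * ep) i := (mul_pos (H.la_pos i) (H.ep_pos i)).le

lemma kinv_le (i : ι) : |((P i).k 0 ^ 2 + (P i).k 1 ^ 2)⁻¹| ≤ 20 := by
  have := H.k_ge i
  rw [abs_of_nonneg (by positivity)]
  rw [inv_le_comm₀ (by linarith) (by norm_num)]; linarith

lemma bdd {c : ι → ℝ} {M : ℝ} (hM : 0 ≤ M) (hc : ∀ i, |c i| ≤ M) :
    Cl S (la * ep) τ u n 1 (fun i => C (c i)) := Cl.bdd H.L_nonneg H.τ_nonneg hM hc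

lemma cs_osS (hB : ∀ j, Cs S (la * ep) τ u n X (fun i => B i j)) (a b : Fin 2) :
    Cs S (la * ep) τ u n X (fun i => osS (P i).k (B i) a b) := by
  have h1 : ∀ a, Cl S (la * ep) τ u n 1
      (fun i => C (((P i).k 0 ^ 2 + (P i).k 1 ^ 2)⁻¹ * (P i).k a)) := fun a =>
    H.bdd (M := 20 * 2) (by norm_num) fun i => by
      rw [abs_mul]; exact mul_le_mul (H.kinv_le i) (H.k_le i a) (abs_nonneg _) (by norm_num)
  have h2 : Cl S (la * ep) τ u n 1
      (fun i => C (((P i).k 0 ^ 2 + (P i).k 1 ^ 2)⁻¹ ^ 2 * ((P i).k a * (P i).k b))) :=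
    H.bdd (M := 20 ^ 2 * (2 * 2)) (by norm_num) fun i => by
      rw [abs_mul, abs_pow, abs_mul]
      exact mul_le_mul (pow_le_pow_left₀ (abs_nonneg _) (H.kinv_le i) 2)
        (mul_le_mul (H.k_le i a) (H.k_le i b) (abs_nonneg _) (by norm_num)) (by positivity)
        (by norm_num)
  have h3 : ∀ j, Cl S (la * ep) τ u n 1 (fun i => C ((P i).k j)) := fun j =>
    H.bdd (M := 2) (by norm_num) fun i => H.k_le i j
  exact (((hB a).mul_one (h1 b)).add ((hB b).mul_one (h1 a))).sub
    ((((hB 0).mul_one (h3 0)).add ((hB 1).mul_one (h3 1))).mul_one h2)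

lemma cs_smul_d {f : ι → PF ℝ} (hn : n ≤ m) (hf : Cs S (la * ep) τ u (n + 1) X f) (j : Fin 2) :
    Cs S (la * ep) τ u n (ep * X) (fun i => C (la i)⁻¹ * d j (f i)) := by
  have h := hf.d (fun j l => (H.du j l).of_le hn) H.closed j
  refine ⟨((h.1.smul (fun i => (la i)⁻¹) fun i => (inv_pos.2 (H.la_pos i)).le).congr ?_ ?_),
    fun i => (h.2 i).mul _⟩
  · ext i; have := (H.la_pos i).ne'; simp only [Pi.mul_apply]; field_simp
  · ext1 i; exact (C_mul _ _).symm

lemma cs_osB (hn : n ≤ m) (hB : ∀ j, Cs S (la * ep) τ u (n + 1) X (fun i => B i j))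
    (hB' : ∀ j, Cs S (la * ep) τ u (n + 1) X (fun i => B' i j)) (a : Fin 2) :
    Cs S (la * ep) τ u n (ep * X) (fun i => osB (P i) (B i) (B' i) a) ∧
    Cs S (la * ep) τ u n (ep * X) (fun i => osB' (P i) (B i) (B' i) a) := by
  have h1 : ∀ {B : ι → Fin 2 → PF ℝ}, (∀ j, Cs S (la * ep) τ u (n + 1) X (fun i => B i j)) →
      ∀ j, Cs S (la * ep) τ u n (ep * X) (fun i => C (la i)⁻¹ * d j (osS (P i).k (B i) a j)) :=
    fun hB j => H.cs_smul_d hn (H.cs_osS hB a j) j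
  have h2 : ∀ {B : ι → Fin 2 → PF ℝ}, (∀ j, Cs S (la * ep) τ u (n + 1) X (fun i => B i j)) →
      ∀ j, Cs S (la * ep) τ u n (ep * X)
        (fun i => osS (P i).k (B i) a j * ((P i).n j - C ((P i).k j))) := fun hB j =>
    (((H.cs_osS hB a j).of_le n.le_succ).mul ((H.n_sub j).of_le hn)).congr rfl
      (by ext1 i; simp only [Pi.mul_apply, mul_comm])
  constructor
  · refine (((h1 hB' 0).add (h1 hB' 1)).sub ((h2 hB 0).add (h2 hB 1))).congr rfl ?_
    ext1 i; simp only [Pi.sub_apply, Pi.add_apply, osB]; ring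
  · refine (((h1 hB 0).add (h1 hB 1)).neg.sub ((h2 hB' 0).add (h2 hB' 1))).congr rfl ?_
    ext1 i; simp only [Pi.sub_apply, Pi.add_apply, Pi.neg_apply, osB']; ring

lemma cl_n (hn : n ≤ m) (j : Fin 2) : Cl S (la * ep) τ u n 1 (fun i => (P i).n j) := by
  refine ((((H.n_sub j).of_le hn).le H.L_nonneg H.τ_nonneg H.ep_le).add
    (H.bdd (M := 2) (by norm_num) fun i => H.k_le i j)).congr rfl ?_
  ext1 i; simp

lemma big_c : Big S la 1 1 (fun i => (P i).c) ∧ Big S la 1 1 (fun i => (P i).s) := by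
  have hc : B0 S 1 (fun i => (P i).c) := ⟨1, by norm_num, fun i z _ x => by simpa using (P i).c_le (z, x)⟩
  have hs : B0 S 1 (fun i => (P i).s) := ⟨1, by norm_num, fun i z _ x => by simpa using (P i).s_le (z, x)⟩
  have hla : B0 S la (fun i => C (la i)) :=
    (Big.const (L := 0) (n := 0) la).b0.le fun i => (abs_of_pos (H.la_pos i)).le
  refine ⟨⟨hc, fun j => ?_⟩, ⟨hs, fun j => ?_⟩⟩
  · refine ((hla.mul ((H.cl_n (Nat.zero_le _) j).1.b0.mul hs)).neg.congr ?_ ?_)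
    · simp
    · ext1 i; simp only [Pi.neg_apply, Pi.mul_apply, (P i).dc]
  · refine ((hla.mul ((H.cl_n (Nat.zero_le _) j).1.b0.mul hc)).congr ?_ ?_)
    · simp
    · ext1 i; simp only [Pi.mul_apply, (P i).ds]

lemma cl_c : Cl S la τ u 0 1 (fun i => (P i).c) ∧ Cl S la τ u 0 1 (fun i => (P i).s) := by
  have hla : B0 S la (fun i => C (la i)) :=
    (Big.const (L := 0) (n := 0) la).b0.le fun i => (abs_of_pos (H.la_pos i)).le
  have e : la * ((fun i => τ i / la i) * 1) = τ * 1 := by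
    ext i; have := (H.la_pos i).ne'; simp only [Pi.mul_apply, Pi.one_apply]; field_simp
  refine ⟨⟨H.big_c.1, (hla.mul (H.g_le.mul H.big_c.2.b0)).neg.congr e ?_⟩,
    ⟨H.big_c.2, (hla.mul (H.g_le.mul H.big_c.1.b0)).congr e ?_⟩⟩
  · ext1 i; simp only [Pi.neg_apply, Pi.mul_apply, (P i).Dc]
  · ext1 i; simp only [Pi.mul_apply, (P i).Ds]

lemma final {f : ι → PF ℝ} (hX : ∀ i, 0 ≤ X i) (hf : Cs S (la * ep) τ u n X f) :
    Cs S la τ u 0 X f :=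
  (hf.of_le (Nat.zero_le _)).mono_scale hX H.L_nonneg H.τ_nonneg fun i =>
    mul_le_of_le_one_right (H.la_pos i).le (H.ep_le i)

lemma cs_osT (hX : ∀ i, 0 ≤ X i) (hB : ∀ j, Cs S (la * ep) τ u n X (fun i => B i j))
    (hB' : ∀ j, Cs S (la * ep) τ u n X (fun i => B' i j)) (a b : Fin 2) :
    Cs S la τ u 0 (fun i => (la i)⁻¹ * X i) (fun i => osT (P i) (B i) (B' i) a b) := by
  have h := ((H.final hX (H.cs_osS hB a b)).mul_one H.cl_c.2).sub
    ((H.final hX (H.cs_osS hB' a b)).mul_one H.cl_c.1)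
  refine ⟨((h.1.smul (fun i => (la i)⁻¹) fun i => (inv_pos.2 (H.la_pos i)).le).congr rfl ?_),
    fun i => ?_⟩
  · ext1 i; simp only [osT, ← C_mul, Pi.sub_apply, Pi.mul_apply]; ring
  · have := (h.2 i).mul (C (la i)⁻¹)
    simpa only [osT, Pi.sub_apply, Pi.mul_apply, mul_comm] using this

/-- Repeated integration by parts. -/
lemma main (N : ℕ) : ∀ {X : ι → ℝ} {B B' : ι → Fin 2 → PF ℝ}, (∀ i, 0 ≤ X i) → n + N ≤ m + 1 →
    (∀ j, Cs S (la * ep) τ u (n + N) X (fun i => B i j)) →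
    (∀ j, Cs S (la * ep) τ u (n + N) X (fun i => B' i j)) →
    ∃ T : ι → Fin 2 → Fin 2 → PF ℝ, ∃ Q Q' : ι → Fin 2 → PF ℝ,
      (∀ i a b, T i a b = T i b a) ∧
      (∀ a b, Cs S la τ u 0 (fun i => (la i)⁻¹ * X i) (fun i => T i a b)) ∧
      (∀ a, Cs S (la * ep) τ u n (ep ^ N * X) (fun i => Q i a)) ∧
      (∀ a, Cs S (la * ep) τ u n (ep ^ N * X) (fun i => Q' i a)) ∧
      ∀ i a, B i a * (P i).c + B' i a * (P i).s = (d 0 (T i a 0) + d 1 (T i a 1))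
        + (Q i a * (P i).c + Q' i a * (P i).s) := by
  induction N with
  | zero =>
    intro X B B' hX hm hB hB'
    refine ⟨fun _ _ _ => 0, B, B', fun _ _ _ => rfl, fun a b => Cs.zero, ?_, ?_, fun i a => by simp⟩
    · simpa using hB
    · simpa using hB'
  | succ N ih =>
    intro X B B' hX hm hB hB'
    have hs := H.cs_osB (n := n + N) (by omega) hB hB'
    have hX' : ∀ i, 0 ≤ (ep * X) i := fun i => mul_nonneg (H.ep_pos i).le (hX i)
    obtain ⟨T, Q, Q', hT, hTb, hQ, hQ', he⟩ := ih (X := ep * X) hX' (by omega)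
      (fun j => (hs j).1) (fun j => (hs j).2)
    refine ⟨fun i a b => osT (P i) (B i) (B' i) a b + T i a b, Q, Q', fun i a b => ?_,
      fun a b => ?_, fun a => (hQ a).congr (by rw [pow_succ, mul_assoc]) rfl,
      fun a => (hQ' a).congr (by rw [pow_succ, mul_assoc]) rfl, fun i a => ?_⟩
    · simp only [osT_symm (P i) (B i) (B' i) a b, hT i a b]
    · refine (H.cs_osT hX hB hB' a b).add ((hTb a b).le (fun i => (H.la_pos i).le) H.τ_nonneg
        fun i => ?_)
      exact mul_le_mul_of_nonneg_left (mul_le_of_le_one_left (hX i) (H.ep_le i))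
        (inv_pos.2 (H.la_pos i)).le
    · rw [osc_step (H.la_pos i).ne' (P i) (H.k_ne i) (B i) (B' i) a, he i a]
      simp only [map_add]; ring
end
end Osc

/-! ### Plane waves -/

lemma int_lin_per (m : Fin 2 → ℤ) (x : E2) (i : Fin 2) :
    ∑ j, (m j : ℝ) * (x + (Pi.single i (2 * π) : E2)) j = ∑ j, (m j : ℝ) * x j + m i * (2 * π) := by
  fin_cases i <;> simp [Fin.sum_univ_two] <;> ring

def cosP (m : Fin 2 → ℤ) : PF ℝ :=
  mk (fun z => Real.cos (∑ j, (m j : ℝ) * z.2 j)) (by fun_prop) (fun k x i => by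
    exact (congrArg Real.cos (int_lin_per m x i)).trans (Real.cos_add_int_mul_two_pi _ _))

def sinP (m : Fin 2 → ℤ) : PF ℝ :=
  mk (fun z => Real.sin (∑ j, (m j : ℝ) * z.2 j)) (by fun_prop) (fun k x i => by
    exact (congrArg Real.sin (int_lin_per m x i)).trans (Real.sin_add_int_mul_two_pi _ _))

lemma cosP_apply (m : Fin 2 → ℤ) (z) : cosP m z = Real.cos (∑ j, (m j : ℝ) * z.2 j) := rfl
lemma sinP_apply (m : Fin 2 → ℤ) (z) : sinP m z = Real.sin (∑ j, (m j : ℝ) * z.2 j) := rfl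

lemma hasFDerivAt_int_lin (m : Fin 2 → ℤ) (z : ℝ × E2) :
    HasFDerivAt (fun z : ℝ × E2 => ∑ j, (m j : ℝ) * z.2 j)
      (∑ j, (m j : ℝ) • (ContinuousLinearMap.proj (R := ℝ) (φ := fun _ : Fin 2 => ℝ) j).comp
        (ContinuousLinearMap.snd ℝ ℝ E2)) z := by
  refine HasFDerivAt.fun_sum fun j _ => ?_
  exact (((ContinuousLinearMap.proj (R := ℝ) (φ := fun _ : Fin 2 => ℝ) j).comp
    (ContinuousLinearMap.snd ℝ ℝ E2)).hasFDerivAt).const_mul _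

lemma d_cosP (m : Fin 2 → ℤ) (j : Fin 2) : d j (cosP m) = -(C (m j) * sinP m) := by
  ext z
  have h := (hasFDerivAt_int_lin m z).cos
  rw [dv_apply, show (cosP m).fn = fun z : ℝ × E2 => Real.cos (∑ j, (m j : ℝ) * z.2 j)
    from rfl, h.fderiv]
  fin_cases j <;> simp [sinP_apply, Fin.sum_univ_two, -map_intCast] <;> ring

lemma d_sinP (m : Fin 2 → ℤ) (j : Fin 2) : d j (sinP m) = C (m j) * cosP m := by
  ext z
  have h := (hasFDerivAt_int_lin m z).sin
  rw [dv_apply, show (sinP m).fn = fun z : ℝ × E2 => Real.sin (∑ j, (m j : ℝ) * z.2 j)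
    from rfl, h.fderiv]
  fin_cases j <;> simp [cosP_apply, Fin.sum_univ_two, -map_intCast] <;> ring

/-- Five times the directions of the waves, depending on the parity of the time slab. -/
def kv (b : Bool) (κ : Fin 3) : Fin 2 → ℤ :=
  if b then ![![5, 0], ![3, 4], ![3, -4]] κ else ![![0, 5], ![4, 3], ![-4, 3]] κ

lemma kv_abs : ∀ b κ j, |kv b κ j| ≤ 5 := by decide
lemma kv_sq : ∀ b κ, kv b κ 0 ^ 2 + kv b κ 1 ^ 2 = 25 := by decide
lemma kv_add : ∀ b b' κ κ', 2 ≤ (kv b κ 0 + kv b' κ' 0) ^ 2 + (kv b κ 1 + kv b' κ' 1) ^ 2 := by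
  decide
lemma kv_sub : ∀ b b' κ κ', (b, κ) ≠ (b', κ') →
    2 ≤ (kv b κ 0 - kv b' κ' 0) ^ 2 + (kv b κ 1 - kv b' κ' 1) ^ 2 := by
  decide

/-- Index of a wave: number of the time slab, number of the direction. -/
abbrev WI : Type := ℤ × Fin 3

/-- Parity and direction of a wave. -/
def key (I : WI) : Bool × Fin 3 := (decide (Even I.1), I.2)

def kz (I : WI) : Fin 2 → ℤ := kv (key I).1 (key I).2

def kR (I : WI) (j : Fin 2) : ℝ := kz I j / 5

lemma kR_abs (I : WI) (j : Fin 2) : |kR I j| ≤ 1 := by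
  rw [kR, abs_div, div_le_one (by norm_num)]
  have := kv_abs (key I).1 (key I).2 j
  rw [show |(5 : ℝ)| = 5 by norm_num]
  exact_mod_cast this

lemma kR_sq (I : WI) : kR I 0 ^ 2 + kR I 1 ^ 2 = 1 := by
  have : (kz I 0 : ℝ) ^ 2 + kz I 1 ^ 2 = 25 := by exact_mod_cast kv_sq (key I).1 (key I).2
  simp only [kR]; linear_combination this / 25

lemma kR_add (I J : WI) : 1 / 20 ≤ (kR I 0 + kR J 0) ^ 2 + (kR I 1 + kR J 1) ^ 2 := by
  have : (2 : ℝ) ≤ (kz I 0 + kz J 0) ^ 2 + (kz I 1 + kz J 1) ^ 2 := by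
    exact_mod_cast kv_add (key I).1 (key J).1 (key I).2 (key J).2
  simp only [kR]; linarith

lemma kR_sub {I J : WI} (h : key I ≠ key J) :
    1 / 20 ≤ (kR I 0 - kR J 0) ^ 2 + (kR I 1 - kR J 1) ^ 2 := by
  have : (2 : ℝ) ≤ (kz I 0 - kz J 0) ^ 2 + (kz I 1 - kz J 1) ^ 2 := by
    exact_mod_cast kv_sub (key I).1 (key J).1 (key I).2 (key J).2 h
  simp only [kR]; linarith

namespace Stp
variable {N : ℕ}

lemma tr_mul (i : Stp N × ℤ) (f g : PF ℝ) : tr i (f * g) = tr i f * tr i g := rfl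
lemma tr_add (i : Stp N × ℤ) (f g : PF ℝ) : tr i (f + g) = tr i f + tr i g := rfl
lemma tr_neg (i : Stp N × ℤ) (f : PF ℝ) : tr i (-f) = -tr i f := rfl
lemma tr_C (i : Stp N × ℤ) (x : ℝ) : tr i (C x) = C x := rfl

lemma C_lai_kz (σ : Stp N) (I : WI) (b : Fin 2) :
    C (((σ.lai : ℤ) * kz I b : ℤ) : ℝ) = C σ.la * C (kR I b) := by
  rw [← map_mul, σ.la_eq, kR]
  congr 1
  push_cast
  ring

/-- The phases of the waves. -/
def ph (σ : Stp N) (I : WI) : Ph σ.la σ.ub where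
  c := tr (σ, I.1) (cosP fun j => σ.lai * kz I j)
  s := tr (σ, I.1) (sinP fun j => σ.lai * kz I j)
  g := ∑ b, C (kR I b) * er (σ, I.1) b
  n j := C (kR I j) + ∑ b, C (kR I b) * d j (Ψ (σ, I.1) b)
  k := kR I
  sq := by
    rw [← tr_mul, ← tr_mul, ← tr_add]
    refine Eq.trans (congrArg (tr (σ, I.1)) ?_) (show tr (σ, I.1) 1 = 1 from rfl)
    ext z
    simp only [add_apply, mul_apply, one_apply, cosP_apply, sinP_apply]
    linear_combination Real.cos_sq_add_sin_sq (∑ j, (((σ.lai : ℤ) * kz I j : ℤ) : ℝ) * z.2 j)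
  dc j := by
    simp only [d_tr, d_cosP, tr_neg, tr_mul, tr_C, Fin.sum_univ_two, C_lai_kz]
    ring
  ds j := by
    simp only [d_tr, d_sinP, tr_mul, tr_C, Fin.sum_univ_two, C_lai_kz]
    ring
  Dc := by
    have h := D_tr (σ, I.1) (cosP fun j => σ.lai * kz I j)
    rw [D] at h
    simp only [h, d_cosP, tr_neg, tr_mul, tr_C, Fin.sum_univ_two, C_lai_kz]
    ring
  Ds := by
    have h := D_tr (σ, I.1) (sinP fun j => σ.lai * kz I j)
    rw [D] at h
    simp only [h, d_sinP, tr_mul, tr_C, Fin.sum_univ_two, C_lai_kz]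
    ring
  curl := by
    simp only [map_add, d_C, Fin.sum_univ_two, Derivation.leibniz, smul_eq_mul, d_comm 0 1, mul_zero,
      add_zero]

/-- Index of an oscillating term: sum of two waves, difference of two waves, or one wave. -/
abbrev XI : Type := WI × WI × Fin 3

/-- The phases of the oscillating terms. -/
def phx (x : Stp N × XI) : Ph x.1.la x.1.ub :=
  if x.2.2.2 = 0 then (ph x.1 x.2.1).add (ph x.1 x.2.2.1)
  else if x.2.2.2 = 1 ∧ key x.2.1 ≠ key x.2.2.1 then (ph x.1 x.2.1).add (ph x.1 x.2.2.1).neg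
  else ph x.1 x.2.1

/-- Properties of phases used below. -/
lemma phx_cases (x : Stp N × XI) (Q : Ph x.1.la x.1.ub → Prop)
    (h0 : Q ((ph x.1 x.2.1).add (ph x.1 x.2.2.1)))
    (h1 : key x.2.1 ≠ key x.2.2.1 → Q ((ph x.1 x.2.1).add (ph x.1 x.2.2.1).neg))
    (h2 : Q (ph x.1 x.2.1)) : Q (phx x) := by
  rw [phx]; split_ifs with h h'
  exacts [h0, h1 h'.2, h2]

/-! ### Energy balance -/

lemma dt_energy (σ : Stp N) : dt (mean (σ.u 0 ^ 2 + σ.u 1 ^ 2)) = -mean (C 2 * (d 0 (σ.u 0) * σ.r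
    + d 0 (σ.u 1) * σ.s + d 1 (σ.u 0) * σ.s - d 1 (σ.u 1) * σ.r)) := by
  have h : dt (σ.u 0 ^ 2 + σ.u 1 ^ 2) =
      d 0 (C 2 * (σ.u 0 * σ.r + σ.u 1 * σ.s) - (σ.u 0 * (σ.u 0 ^ 2 + σ.u 1 ^ 2 + C 2 * σ.p)))
      + d 1 (C 2 * (σ.u 0 * σ.s - σ.u 1 * σ.r) - (σ.u 1 * (σ.u 0 ^ 2 + σ.u 1 ^ 2 + C 2 * σ.p)))
      - C 2 * (d 0 (σ.u 0) * σ.r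
    + d 0 (σ.u 1) * σ.s + d 1 (σ.u 0) * σ.s - d 1 (σ.u 1) * σ.r) := by
    have h0 := σ.eq0
    have h1 := σ.eq1
    have h2 := σ.div_u
    have h3 : C 2 = (2 : PF ℝ) := map_ofNat (algebraMap ℝ (PF ℝ)) 2
    simp only [mat_apply] at h0 h1
    simp only [pow_two, map_add, map_sub, Derivation.leibniz, smul_eq_mul, d_C, mul_zero, add_zero]
    simp only [h3]
    linear_combination 2 * σ.u 0 * h0 + 2 * σ.u 1 * h1
      + (σ.u 0 ^ 2 + σ.u 1 ^ 2 + 2 * σ.p) * h2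
  rw [dv_mean, h, map_sub, map_add, mean_d, mean_d, zero_add, zero_sub]

lemma abs_dt_energy_le (σ : Stp N) (z) :
    |dt (mean (σ.u 0 ^ 2 + σ.u 1 ^ 2)) z| ≤ σ.sg ^ 3 * σ.la * σ.ep ^ 2 / 10 := by
  rw [dt_energy, neg_apply, abs_neg]
  refine abs_mean_le _ z.1 (fun x => ?_) z.2
  have h : ∀ i j, |d i (σ.u j) (z.1, x) * σ.r (z.1, x)| ≤ σ.sg * σ.la * σ.ep ^ 2 * (σ.sg ^ 2 / 80) ∧
      |d i (σ.u j) (z.1, x) * σ.s (z.1, x)| ≤ σ.sg * σ.la * σ.ep ^ 2 * (σ.sg ^ 2 / 80) := fun i j => by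
    have h1 := σ.du_le i j (z.1, x)
    rw [abs_mul, abs_mul]
    exact ⟨mul_le_mul h1 (σ.r_le _) (abs_nonneg _) ((abs_nonneg _).trans h1),
      mul_le_mul h1 (σ.s_le _) (abs_nonneg _) ((abs_nonneg _).trans h1)⟩
  simp only [mul_apply, sub_apply, add_apply, algebraMap_apply]
  have a1 := abs_le.1 (h 0 0).1
  have a2 := abs_le.1 (h 0 1).2
  have a3 := abs_le.1 (h 1 0).2
  have a4 := abs_le.1 (h 1 1).1
  rw [abs_le]
  constructor <;> nlinarith

lemma g_lip (σ : Stp N) (t t' : ℝ) :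
    |σ.g t - σ.g t'| ≤ 2 * (σ.sg ^ 3 * σ.la * σ.ep ^ 2) * |t - t'| := by
  wlog h : t' ≤ t generalizing t t'
  · rw [abs_sub_comm, abs_sub_comm t]; exact this _ _ (not_le.1 h).le
  have h1 := abs_line_sub_le (mean (σ.u 0 ^ 2 + σ.u 1 ^ 2)) (1, 0)
    (σ.sg ^ 3 * σ.la * σ.ep ^ 2 / 10) (0, 0) h (fun s _ => σ.abs_dt_energy_le _)
  simp only [Prod.smul_mk, smul_eq_mul, mul_one, smul_zero, Prod.mk_add_mk, zero_add] at h1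
  have h2 := σ.E_lip t t'
  rw [σ.g_eq, σ.g_eq]
  rw [abs_of_nonneg (sub_nonneg.2 h)] at *
  have h3 : 0 ≤ σ.sg ^ 3 * σ.la * σ.ep ^ 2 * (t - t') := by
    have := σ.sg_pos; have := σ.la_pos; have := sub_nonneg.2 h; positivity
  rw [abs_le] at *
  constructor <;> nlinarith

lemma sl_dist_tl {i : Stp N × ℤ} {t : ℝ} (ht : t ∈ sl i) : |t - tl i| ≤ 3 / 4 * (i.1.μ)⁻¹ := by
  have hμ := i.1.μ_pos
  rw [← div_eq_mul_inv, le_div_iff₀ hμ, tl]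
  have h : |t - i.2 / i.1.μ| * i.1.μ = |(t - i.2 / i.1.μ) * i.1.μ| := by rw [abs_mul, abs_of_pos hμ]
  rw [h, sub_mul, div_mul_cancel₀ _ hμ.ne', mul_comm]
  exact ht

lemma g_sub_le {i : Stp N × ℤ} {t : ℝ} (ht : t ∈ sl i) :
    |i.1.g t - i.1.g (tl i)| ≤ 3 / 2 * (i.1.sg ^ 2 * i.1.ep) := by
  have h1 := i.1.g_lip t (tl i)
  have h2 := sl_dist_tl ht
  have hs := i.1.sg_pos; have hl := i.1.la_pos; have he := i.1.ep_pos
  refine h1.trans ((mul_le_mul_of_nonneg_left h2 (by positivity)).trans (le_of_eq ?_))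
  rw [μ]; field_simp; ring

/-- The energy density carried by the waves of a time slab. -/
def gam (i : Stp N × ℤ) : ℝ := max (i.1.g (tl i) - i.1.dl) 0

lemma gam_nonneg (i : Stp N × ℤ) : 0 ≤ gam i := le_max_right _ _
lemma gam_le (i : Stp N × ℤ) : gam i ≤ 2 * i.1.sg ^ 2 :=
  max_le (by have := i.1.g_le (tl i); have := i.1.dl_pos; linarith) (by positivity)

/-- The time slab, if its waves do not vanish. -/
def asl (i : Stp N × ℤ) : Set ℝ := {t | t ∈ sl i ∧ gam i ≠ 0}

lemma asl_subset (i : Stp N × ℤ) : asl i ⊆ sl i := fun _ h => h.1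

lemma sl_closed (i : Stp N × ℤ) : IsClosed (sl i) :=
  isClosed_le (by fun_prop) continuous_const

lemma asl_closed (i : Stp N × ℤ) : IsClosed (asl i) := by
  by_cases h : gam i = 0
  · convert isClosed_empty using 1; ext t; simp [asl, h]
  · convert sl_closed i using 1; ext t; simp [asl, h]

/-- Inverse of half the energy density. -/
def cf (i : Stp N × ℤ) : ℝ := if i.1.sg ^ 2 / 4 ≤ i.1.g (tl i) then 2 / gam i else 0

lemma gam_ge {i : Stp N × ℤ} (h : i.1.sg ^ 2 / 4 ≤ i.1.g (tl i)) : i.1.sg ^ 2 / 8 ≤ gam i :=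
  le_max_of_le_left (by have := i.1.dl_le; linarith)

lemma gam_cf {i : Stp N × ℤ} (h : i.1.sg ^ 2 / 4 ≤ i.1.g (tl i)) : gam i / 2 * cf i = 1 := by
  have h1 := gam_ge h
  have h2 := i.1.sg_pos
  have : 0 < gam i := lt_of_lt_of_le (by positivity) h1
  rw [cf, if_pos h]; field_simp

lemma cf_nonneg (i : Stp N × ℤ) : 0 ≤ cf i := by
  rw [cf]; split_ifs
  · have := gam_nonneg i; positivity
  · exact le_rfl

lemma cf_le (i : Stp N × ℤ) : cf i * i.1.sg ^ 2 ≤ 16 := by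
  rw [cf]; split_ifs with h
  · have h1 := gam_ge h
    have h2 := i.1.sg_pos
    have : 0 < gam i := lt_of_lt_of_le (by positivity) h1
    rw [div_mul_eq_mul_div, div_le_iff₀ this]; linarith
  · norm_num

lemma rs_zero {i : Stp N × ℤ} (h : ¬ i.1.sg ^ 2 / 4 ≤ i.1.g (tl i)) {t : ℝ} (ht : t ∈ sl i) (x : E2) :
    i.1.r (t, x) = 0 ∧ i.1.s (t, x) = 0 := by
  rcases i.1.gap t with h1 | h1
  · exfalso
    have h2 := abs_le.1 (g_sub_le ht)
    have h3 := mul_le_mul_of_nonneg_left i.1.ep_le' (sq_nonneg i.1.sg)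
    have : 0 < i.1.sg ^ 2 := pow_pos i.1.sg_pos 2
    linarith
  · exact h1 x
end Stp

/-! ### The partition of unity in time -/

def step1 (s : ℝ) : ℝ := Real.smoothTransition (2 * s - 1 / 2)
def chi (s : ℝ) : ℝ := Real.cos (π / 2 * step1 s) * Real.cos (π / 2 * step1 (-s))

lemma contDiff_chi : ContDiff ℝ ∞ chi := by
  have h : ContDiff ℝ ∞ step1 := Real.smoothTransition.contDiff.comp (by fun_prop)
  exact ((contDiff_const.mul h).cos).mul ((contDiff_const.mul (h.comp contDiff_neg)).cos)

lemma step1_zero {s : ℝ} (h : s ≤ 1 / 4) : step1 s = 0 :=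
  Real.smoothTransition.zero_of_nonpos (by linarith)
lemma step1_one {s : ℝ} (h : 3 / 4 ≤ s) : step1 s = 1 :=
  Real.smoothTransition.one_of_one_le (by linarith)

lemma chi_zero {s : ℝ} (h : 3 / 4 ≤ |s|) : chi s = 0 := by
  rw [chi]
  rcases le_abs.1 h with h | h <;> simp [step1_one h]

lemma smoothTransition_symm (x : ℝ) :
    Real.smoothTransition x + Real.smoothTransition (1 - x) = 1 := by
  have h := Real.smoothTransition.pos_denom x
  rw [Real.smoothTransition, Real.smoothTransition, sub_sub_cancel]
  rw [add_comm (expNegInvGlue (1 - x)), ← add_div, div_self h.ne']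

lemma chi_sq {s : ℝ} (h : s ∈ Set.Icc (0 : ℝ) 1) : chi s ^ 2 + chi (s - 1) ^ 2 = 1 := by
  have h1 : step1 (-s) = 0 := step1_zero (by linarith [h.1])
  have h2 : step1 (s - 1) = 0 := step1_zero (by linarith [h.2])
  have h3 : step1 (-(s - 1)) = 1 - step1 s := by
    have h := smoothTransition_symm (2 * s - 1 / 2)
    rw [step1, step1, show 2 * -(s - 1) - 1 / 2 = 1 - (2 * s - 1 / 2) by ring]; linarith
  rw [chi, chi, h1, h2, h3, mul_zero, Real.cos_zero, mul_one, one_mul,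
    show π / 2 * (1 - step1 s) = π / 2 - π / 2 * step1 s by ring, Real.cos_pi_div_two_sub]
  exact Real.cos_sq_add_sin_sq _

lemma chi_compact : HasCompactSupport chi :=
  HasCompactSupport.intro (isCompact_Icc (a := -(3 / 4 : ℝ)) (b := 3 / 4)) fun s hs => chi_zero (by
    by_contra h
    exact hs (abs_le.1 (not_le.1 h).le))

namespace Stp
variable {N : ℕ}

/-! ### Amplitudes -/

/-- A rescaled bump function in time. -/
def bmp (h : ℝ → ℝ) (hh : ContDiff ℝ ∞ h) (i : Stp N × ℤ) : PF ℝ :=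
  ofK (fun t => h (i.1.μ * t - i.2)) (hh.comp (by fun_prop))

lemma bmp_apply (h : ℝ → ℝ) (hh : ContDiff ℝ ∞ h) (i : Stp N × ℤ) (z) :
    bmp h hh i z = h (i.1.μ * z.1 - i.2) := rfl

lemma D_bmp (h : ℝ → ℝ) (hh : ContDiff ℝ ∞ h) (i : Stp N × ℤ) :
    i.1.D (bmp h hh i) = C i.1.μ * bmp (deriv h) (contDiff_deriv hh) i := by
  rw [mat_apply, bmp, d_ofK, d_ofK, mul_zero, mul_zero, add_zero, add_zero]
  ext z
  rw [dv_ofK]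
  have h1 : HasDerivAt (fun t => h (i.1.μ * t - i.2))
      (deriv h (i.1.μ * z.1 - i.2) * i.1.μ) z.1 := by
    have := (hh.differentiable (by simp) (i.1.μ * z.1 - i.2)).hasDerivAt
    exact this.comp z.1 (((hasDerivAt_id z.1).const_mul i.1.μ).sub_const _ |>.congr_deriv (by simp))
  rw [h1.hasFDerivAt.fderiv]
  simp [bmp_apply, mul_comm]

lemma bmp_big (h : ℝ → ℝ) (hh : ContDiff ℝ ∞ h) (hc : HasCompactSupport h) (n : ℕ) :
    Big sl (fun i : Stp N × ℤ => i.1.L) n 1 (bmp h hh) := by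
  obtain ⟨M, hM⟩ := hc.exists_bound_of_continuous hh.continuous
  refine Big.of_d_zero ⟨M, (norm_nonneg _).trans (hM 0), fun i k _ x => ?_⟩ fun i j => d_ofK _ _ _
  simpa [bmp_apply] using hM (i.1.μ * k - i.2)

lemma μ_le_τ (σ : Stp N) : σ.μ ≤ σ.τ := by
  rw [μ, τ]; exact mul_le_of_le_one_right (mul_pos σ.sg_pos σ.la_pos).le σ.ep_le

lemma bmp_bigD (h : ℝ → ℝ) (hh : ContDiff ℝ ∞ h) (hc : HasCompactSupport h) (n : ℕ) :
    Big sl (fun i : Stp N × ℤ => i.1.L) n (fun i => i.1.μ) (fun i => i.1.D (bmp h hh i)) := by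
  refine ((Big.const (S := sl) (fun i : Stp N × ℤ => i.1.μ)).mul
    (bmp_big (deriv h) (contDiff_deriv hh) hc.deriv n)).congr ?_ ?_
  · ext i; simp [abs_of_pos i.1.μ_pos]
  · ext1 i; exact (D_bmp h hh i).symm

lemma cl_bmp (h : ℝ → ℝ) (hh : ContDiff ℝ ∞ h) (hc : HasCompactSupport h) (n : ℕ) :
    CL (N := N) n 1 (bmp h hh) :=
  ⟨bmp_big h hh hc _, (bmp_bigD h hh hc n).le Lnn fun i => by simpa using μ_le_τ i.1⟩

lemma cl_D_bmp (h : ℝ → ℝ) (hh : ContDiff ℝ ∞ h) (hc : HasCompactSupport h) (n : ℕ) :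
    CL (N := N) n (fun i => i.1.μ) (fun i => i.1.D (bmp h hh i)) := by
  refine ((Cl.const (fun i : Stp N × ℤ => i.1.μ)).mul
    (cl_bmp (deriv h) (contDiff_deriv hh) hc.deriv n)).congr ?_ ?_
  · ext i; simp [abs_of_pos i.1.μ_pos]
  · ext1 i; exact (D_bmp h hh i).symm

/-- Normalized transported component of the stress. -/
def nst (q : Stp N → PF ℝ) (i : Stp N × ℤ) : PF ℝ :=
  C (cf i) * tr i (st i.1.L⁻¹ (lv N + 1) (q i.1))

lemma abs_nst_le {q : Stp N → PF ℝ} (hq : ∀ σ z, |q σ z| ≤ σ.sg ^ 2 / 80) (i z) :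
    |nst q i z| ≤ 1 / 5 := by
  have h : |tr i (st i.1.L⁻¹ (lv N + 1) (q i.1)) z| ≤ i.1.sg ^ 2 / 80 :=
    abs_st_le (lv N + 1) (fun x => hq i.1 _) _
  rw [nst, mul_apply, abs_mul, algebraMap_apply, abs_of_nonneg (cf_nonneg i)]
  have h1 := mul_le_mul_of_nonneg_left h (cf_nonneg i)
  have h2 := cf_le i
  linarith

lemma b0_of_sg {q : Stp N → PF ℝ} (hq : ∀ σ z, |q σ z| ≤ σ.sg ^ 2 / 80) :
    B0 U (fun σ => σ.sg ^ 2) q :=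
  b0_of_le fun σ z => (hq σ z).trans (by linarith [sq_nonneg σ.sg])

lemma cl_nst {q : Stp N → PF ℝ} (hq : ∀ σ z, |q σ z| ≤ σ.sg ^ 2 / 80) : CL (lv N) 1 (nst q) := by
  have h1 := cl_tr (fun σ => sq_nonneg σ.sg) le_rfl (Big.st (L := L) L_pos (b0_of_sg hq) (lv N + 1))
  refine ((Cl.const cf).mul h1).mono Lnn τnn (c := 16) (by norm_num) fun i => ?_
  simpa [abs_of_nonneg (cf_nonneg i)] using cf_le i

lemma cl_D_nst {q : Stp N → PF ℝ} (hq : ∀ σ z, |q σ z| ≤ σ.sg ^ 2 / 80) :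
    CL (lv N - 1) (fun i => i.1.μ) (fun i => i.1.D (nst q i)) := by
  have h1 : ∀ k, CL (lv N - 1) (fun i => i.1.L * i.1.sg ^ 2)
      (fun i => tr i (d k (st i.1.L⁻¹ (lv N + 1) (q i.1)))) := fun k =>
    cl_tr (X := fun σ => σ.L * σ.sg ^ 2)
      (fun σ => mul_nonneg σ.L_pos.le (sq_nonneg σ.sg)) (Nat.sub_le _ _)
      (((Big.st (L := L) L_pos (b0_of_sg hq) (lv N + 1)).d k).of_le (by simp [lv]))
  have h2 : CL (lv N - 1) (fun i => i.1.L * i.1.sg ^ 2 * (i.1.sg * i.1.ep))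
      (fun i => i.1.D (tr i (st i.1.L⁻¹ (lv N + 1) (q i.1)))) :=
    (Cl.sum Finset.univ fun k _ => (h1 k).mul ((cl_er k).of_le (Nat.sub_le _ _))).congr rfl
      (by ext1 i; simp only [D_tr]; rfl)
  refine (((Cl.const cf).mul h2).congr rfl (g := fun i => i.1.D (nst q i)) ?_).mono Lnn τnn
    (c := 16) (by norm_num) fun i => ?_
  · ext1 i
    rw [nst, Derivation.leibniz, mat_C, smul_zero, add_zero]; rfl
  · have h3 := cf_le i
    have h4 := i.1.μ_pos
    have h5 := i.1.ep_le
    have h6 := i.1.ep_pos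
    have h7 : i.1.L * i.1.sg = i.1.μ := by rw [L, μ]; ring
    simp only [Pi.mul_apply, abs_of_nonneg (cf_nonneg i)]
    calc cf i * (i.1.L * i.1.sg ^ 2 * (i.1.sg * i.1.ep))
        = cf i * i.1.sg ^ 2 * (i.1.μ * i.1.ep) := by rw [← h7]; ring
      _ ≤ 16 * (i.1.μ * 1) := mul_le_mul h3 (by gcongr) (by positivity) (by norm_num)
      _ = _ := by ring

/-- Families over all waves. -/
abbrev CW (n : ℕ) (X : Stp N × WI → ℝ) (f : Stp N × WI → PF ℝ) : Prop :=
  Cl (fun w => sl (w.1, w.2.1)) (fun w => w.1.L) (fun w => w.1.τ) (fun w => w.1.ub) n X f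

lemma CL.wave {n : ℕ} {X : Stp N → ℝ} {f : Stp N × ℤ → PF ℝ} (h : CL n (fun i => X i.1) f) :
    CW n (fun w => X w.1) (fun w => f (w.1, w.2.1)) :=
  h.comap (fun w : Stp N × WI => (w.1, w.2.1))

lemma LW (w : Stp N × WI) : 0 ≤ w.1.L := w.1.L_pos.le
lemma τW (w : Stp N × WI) : 0 ≤ w.1.τ := w.1.τ_pos.le

def sgnI (I : WI) : ℝ := if Even I.1 then 1 else -1
def cα (I : WI) : ℝ := ![7 / 16, 25 / 32, 25 / 32] I.2
def cβ (I : WI) : ℝ := sgnI I * ![25 / 16, -(25 / 32), -(25 / 32)] I.2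
def cγ (I : WI) : ℝ := ![0, 25 / 24, -(25 / 24)] I.2

lemma cα_le (I : WI) : |cα I| ≤ 2 := by
  rcases I with ⟨l, κ⟩; fin_cases κ <;> simp [cα, abs_le] <;> norm_num
lemma cβ_le (I : WI) : |cβ I| ≤ 2 := by
  rcases I with ⟨l, κ⟩; simp only [cβ, sgnI]; split_ifs <;> fin_cases κ <;> simp [abs_le] <;> norm_num
lemma cγ_le (I : WI) : |cγ I| ≤ 2 := by
  rcases I with ⟨l, κ⟩; fin_cases κ <;> simp [cγ, abs_le] <;> norm_num

/-- The normalized square of the amplitude. -/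
def ya (w : Stp N × WI) : PF ℝ :=
  C (cα w.2) + (C (cβ w.2) * nst Stp.r (w.1, w.2.1) + C (cγ w.2) * nst Stp.s (w.1, w.2.1))

lemma ya_ge (w : Stp N × WI) (z) : 1 / 8 ≤ ya w z := by
  have h1 := abs_le.1 (abs_nst_le Stp.r_le (w.1, w.2.1) z)
  have h2 := abs_le.1 (abs_nst_le Stp.s_le (w.1, w.2.1) z)
  rcases w with ⟨σ, l, κ⟩
  simp only [ya, add_apply, mul_apply, algebraMap_apply, cα, cβ, cγ, sgnI]
  split_ifs <;> fin_cases κ <;> simp <;> linarith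

lemma cl_ya : CW (N := N) (lv N) 1 ya := by
  have hr : CW (N := N) (lv N) 1 (fun w => nst Stp.r (w.1, w.2.1)) :=
    CL.wave (X := 1) (cl_nst Stp.r_le)
  have hs : CW (N := N) (lv N) 1 (fun w => nst Stp.s (w.1, w.2.1)) :=
    CL.wave (X := 1) (cl_nst Stp.s_le)
  refine (Cl.bdd LW τW zero_le_two (c := fun w => cα w.2) fun w => cα_le w.2).add (Cl.add ?_ ?_)
  · exact ((Cl.bdd LW τW zero_le_two (c := fun w => cβ w.2) fun w => cβ_le w.2).mul hr).congr
      (one_mul _) rfl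
  · exact ((Cl.bdd LW τW zero_le_two (c := fun w => cγ w.2) fun w => cγ_le w.2).mul hs).congr
      (one_mul _) rfl

lemma cl_D_ya : CW (N := N) (lv N - 1) (fun w => w.1.μ) (fun w => w.1.D (ya w)) := by
  have hr : CW (N := N) (lv N - 1) (fun w => w.1.μ) (fun w => w.1.D (nst Stp.r (w.1, w.2.1))) :=
    CL.wave (X := μ) (cl_D_nst Stp.r_le)
  have hs : CW (N := N) (lv N - 1) (fun w => w.1.μ) (fun w => w.1.D (nst Stp.s (w.1, w.2.1))) :=
    CL.wave (X := μ) (cl_D_nst Stp.s_le)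
  refine (((Cl.bdd LW τW zero_le_two (c := fun w => cβ w.2) fun w => cβ_le w.2).mul hr).add
    ((Cl.bdd LW τW zero_le_two (c := fun w => cγ w.2) fun w => cγ_le w.2).mul hs)).congr
      (one_mul _) ?_
  ext1 w
  simp only [ya, map_add, mat_C, Derivation.leibniz, smul_eq_mul, mul_zero, add_zero, zero_add]
  rfl

/-- A smooth function which is the square root on `[1/16, ∞)`. -/
def srt (y : ℝ) : ℝ := √(y * Real.smoothTransition (32 * y - 1)
  + (1 - Real.smoothTransition (32 * y - 1)))

lemma srt_sq {y : ℝ} (h : 1 / 16 ≤ y) : srt y * srt y = y := by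
  rw [srt, Real.smoothTransition.one_of_one_le (by linarith), Real.mul_self_sqrt] <;> linarith

lemma contDiff_srt : ContDiff ℝ ∞ srt := by
  have h : ContDiff ℝ ∞ fun y : ℝ => Real.smoothTransition (32 * y - 1) :=
    Real.smoothTransition.contDiff.comp (by fun_prop)
  refine ContDiff.sqrt ((contDiff_id.mul h).add (contDiff_const.sub h)) fun y => ?_
  refine ne_of_gt ?_
  have h0 := Real.smoothTransition.nonneg (32 * y - 1)
  have h1 := Real.smoothTransition.le_one (32 * y - 1)
  rcases le_or_gt y (1 / 32) with hy | hy
  · simp [Real.smoothTransition.zero_of_nonpos (show 32 * y - 1 ≤ 0 by linarith)]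
  · nlinarith

/-- The amplitude of a wave without its cutoff. -/
def amp0 (w : Stp N × WI) : PF ℝ := C (√(gam (w.1, w.2.1))) * comp1 srt contDiff_srt (ya w)

/-- The amplitude of a wave. -/
def amp (w : Stp N × WI) : PF ℝ := bmp chi contDiff_chi (w.1, w.2.1) * amp0 w

lemma sqrt_gam_le (i : Stp N × ℤ) : |√(gam i)| ≤ 2 * i.1.sg := by
  rw [abs_of_nonneg (Real.sqrt_nonneg _)]
  refine Real.sqrt_le_iff.2 ⟨by linarith [i.1.sg_pos], ?_⟩
  have := gam_le i; nlinarith [sq_nonneg i.1.sg]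

lemma cl_gam {n : ℕ} : CW (N := N) n (fun w => w.1.sg) (fun w => C (√(gam (w.1, w.2.1)))) :=
  (Cl.const _).mono LW τW zero_le_two fun w => sqrt_gam_le (w.1, w.2.1)

lemma cl_amp0 : CW (N := N) (lv N) (fun w => w.1.sg) amp0 :=
  (cl_gam.mul (cl_ya.comp1 srt contDiff_srt)).congr (mul_one _) rfl

lemma cl_D_amp0 : CW (N := N) (lv N - 1) (fun w => w.1.sg * w.1.μ) (fun w => w.1.D (amp0 w)) := by
  refine (cl_gam.mul (((cl_ya.of_le (Nat.sub_le _ _)).comp1 _ (contDiff_deriv contDiff_srt)).mul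
    cl_D_ya)).congr ?_ ?_
  · ext w; simp
  · ext1 w
    simp only [amp0, Derivation.leibniz, mat_C, smul_eq_mul, mul_zero, add_zero, Pi.mul_apply]
    congr 1
    simp only [mat_apply, dt, d, dv_comp1]
    ring

lemma cl_bmpW {n : ℕ} : CW (N := N) n 1 (fun w => bmp chi contDiff_chi (w.1, w.2.1)) :=
  CL.wave (X := 1) (cl_bmp _ contDiff_chi chi_compact n)

lemma cl_amp : CW (N := N) (lv N) (fun w => w.1.sg) amp :=
  (cl_bmpW.mul cl_amp0).congr (one_mul _) rfl

lemma cl_D_amp : CW (N := N) (lv N - 1) (fun w => w.1.sg * w.1.μ) (fun w => w.1.D (amp w)) := by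
  have h1 : CW (N := N) (lv N - 1) (fun w => w.1.μ)
      (fun w => w.1.D (bmp chi contDiff_chi (w.1, w.2.1))) :=
    CL.wave (X := μ) (cl_D_bmp _ contDiff_chi chi_compact _)
  refine ((cl_bmpW.mul cl_D_amp0).add (((cl_amp0.of_le (Nat.sub_le _ _)).mul h1).congr (by
    ext w; simp) rfl)).congr (one_mul _) ?_
  ext1 w
  simp only [amp, Derivation.leibniz, smul_eq_mul, Pi.add_apply, Pi.mul_apply]

lemma amp_sup (w : Stp N × WI) : Sup (asl (w.1, w.2.1)) (amp w) := by
  intro t ht x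
  rw [amp, mul_apply, bmp_apply]
  by_cases h : gam (w.1, w.2.1) = 0
  · simp [amp0, h]
  · rw [chi_zero, zero_mul]
    by_contra h1
    exact ht ⟨(not_le.1 h1).le, h⟩

end Stp

lemma Sup.inter {S S' : Set ℝ} {f g : PF ℝ} (hf : Sup S f) (hg : Sup S' g) :
    Sup (S ∩ S') (f * g) := by
  intro t ht x
  rw [mul_apply]
  by_cases h : t ∈ S
  · rw [hg t (fun h' => ht ⟨h, h'⟩), mul_zero]
  · rw [hf t h, zero_mul]

namespace Stp
variable {N : ℕ}

/-! ### Symbols of the waves -/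

/-- Families over all waves, supported in the active time slabs. -/
abbrev CS (n : ℕ) (X : Stp N × WI → ℝ) (f : Stp N × WI → PF ℝ) : Prop :=
  Cs (fun w => asl (w.1, w.2.1)) (fun w => w.1.L) (fun w => w.1.τ) (fun w => w.1.ub) n X f

lemma CW.act {n : ℕ} {X : Stp N × WI → ℝ} {f : Stp N × WI → PF ℝ} (h : CW n X f) :
    Cl (fun w => asl (w.1, w.2.1)) (fun w => w.1.L) (fun w => w.1.τ) (fun w => w.1.ub) n X f :=
  h.subset fun w => asl_subset (w.1, w.2.1)

lemma du_act (n : ℕ) (hn : n ≤ lv N + 1) (j l : Fin 2) :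
    Big (fun w : Stp N × WI => asl (w.1, w.2.1)) (fun w => w.1.L) n (fun w => w.1.τ)
      (fun w => d j (w.1.ub l)) :=
  (((big_dub_τ j l).of_le hn).comap (fun w : Stp N × WI => (w.1, w.2.1))).subset
    fun w => asl_subset (w.1, w.2.1)

lemma CS.dj {n : ℕ} (hn : n ≤ lv N + 1) {X : Stp N × WI → ℝ} {f : Stp N × WI → PF ℝ}
    (h : CS (n + 1) X f) (j : Fin 2) : CS n (fun w => w.1.L * X w) (fun w => d j (f w)) :=
  Cs.d (du_act n hn) (fun w => asl_closed (w.1, w.2.1)) h j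

lemma cs_amp : CS (N := N) (lv N) (fun w => w.1.sg) amp := ⟨CW.act cl_amp, amp_sup⟩
lemma cs_D_amp : CS (N := N) (lv N - 1) (fun w => w.1.sg * w.1.μ) (fun w => w.1.D (amp w)) :=
  ⟨CW.act cl_D_amp, fun w => (amp_sup w).mat (asl_closed _) _⟩

lemma cl_dΨW (b j : Fin 2) : CW (N := N) (lv N - 1) (fun w => w.1.ep)
    (fun w => d j (Ψ (w.1, w.2.1) b)) := CL.wave (X := ep) (cl_dΨ j b)

/-- The deviation of the gradient of a phase from the constant direction. -/
def nm (j : Fin 2) (w : Stp N × WI) : PF ℝ := ∑ b, C (kR w.2 b) * d j (Ψ (w.1, w.2.1) b)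

lemma ph_n (w : Stp N × WI) (j : Fin 2) : (ph w.1 w.2).n j = C (kR w.2 j) + nm j w := rfl

lemma cl_kR {n : ℕ} (j : Fin 2) : CW (N := N) n 1 (fun w => C (kR w.2 j)) :=
  Cl.bdd LW τW zero_le_one fun w => kR_abs w.2 j

lemma cl_nm (j : Fin 2) : CW (N := N) (lv N - 1) (fun w => w.1.ep) (nm j) :=
  Cl.sum Finset.univ fun b _ => ((cl_kR b).mul (cl_dΨW b j)).congr (one_mul _) rfl

lemma cl_n (j : Fin 2) : CW (N := N) (lv N - 1) 1 (fun w => (ph w.1 w.2).n j) :=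
  (cl_kR j).add ((cl_nm j).le LW τW fun w => w.1.ep_le)

lemma cl_dn (j l : Fin 2) : CW (N := N) (lv N - 2) (fun w => w.1.L * w.1.ep)
    (fun w => d l ((ph w.1 w.2).n j)) := by
  have h : CW (N := N) (lv N - 2) (fun w => w.1.L * w.1.ep) (fun w => d l (nm j w)) :=
    Cl.d (fun j l => ((big_dub_τ j l).of_le (by simp [lv])).comap
      (fun w : Stp N × WI => (w.1, w.2.1))) (n := lv N - 2)
      ((cl_nm j).of_le (by simp [lv])) l
  refine h.congr rfl ?_
  ext1 w
  rw [ph_n, map_add, d_C, zero_add]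

lemma cl_g : CW (N := N) (lv N) (fun w => w.1.sg * w.1.ep) (fun w => (ph w.1 w.2).g) :=
  Cl.sum Finset.univ fun b _ => ((cl_kR b).mul
    (CL.wave (X := fun σ => σ.sg * σ.ep) (cl_er b))).congr (one_mul _) rfl

def fs (j : Fin 2) (w : Stp N × WI) : PF ℝ := C w.1.la⁻¹ * d j (amp w)
def fs' (j : Fin 2) (w : Stp N × WI) : PF ℝ := -((ph w.1 w.2).n j * amp w)
def es (w : Stp N × WI) : PF ℝ := C w.1.la⁻¹ * (d 0 (d 0 (amp w)) + d 1 (d 1 (amp w)))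
  + C w.1.la * ((1 - ((ph w.1 w.2).n 0 ^ 2 + (ph w.1 w.2).n 1 ^ 2)) * amp w)
def es' (w : Stp N × WI) : PF ℝ :=
  -(2 * ((ph w.1 w.2).n 0 * d 0 (amp w) + (ph w.1 w.2).n 1 * d 1 (amp w))
    + (d 0 ((ph w.1 w.2).n 0) + d 1 ((ph w.1 w.2).n 1)) * amp w)
def ps (w : Stp N × WI) : PF ℝ := C w.1.la⁻¹ * w.1.D (amp w)
def qs (w : Stp N × WI) : PF ℝ := -((ph w.1 w.2).g * amp w)

lemma cl_la {n : ℕ} : CW (N := N) n (fun w => w.1.la) (fun w => C w.1.la) :=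
  (Cl.const _).le LW τW fun w => (abs_of_pos w.1.la_pos).le
lemma cl_lai {n : ℕ} : CW (N := N) n (fun w => w.1.la⁻¹) (fun w => C w.1.la⁻¹) :=
  (Cl.const _).le LW τW fun w => (abs_of_pos (inv_pos.2 w.1.la_pos)).le

lemma cs_damp (j : Fin 2) : CS (N := N) (lv N - 1) (fun w => w.1.L * w.1.sg)
    (fun w => d j (amp w)) :=
  CS.dj (n := lv N - 1) (by simp [lv]) (cs_amp.of_le (by simp [lv])) j

lemma cs_fs_ep (j : Fin 2) : CS (N := N) (lv N - 1) (fun w => w.1.ep * w.1.sg) (fs j) :=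
  ((cs_damp j).mul (CW.act cl_lai)).congr (by
    ext w; have := w.1.la_pos.ne'; simp only [Pi.mul_apply, L]; field_simp) rfl

lemma cs_fs (j : Fin 2) : CS (N := N) (lv N - 1) (fun w => w.1.sg) (fs j) :=
  (cs_fs_ep j).le LW τW fun w => mul_le_of_le_one_left w.1.sg_pos.le w.1.ep_le

lemma cs_fs' (j : Fin 2) : CS (N := N) (lv N - 1) (fun w => w.1.sg) (fs' j) :=
  ((cs_amp.of_le (Nat.sub_le _ _)).mul_one (CW.act (cl_n j))).neg

lemma cs_es : CS (N := N) (lv N - 2) (fun w => w.1.la * w.1.ep * w.1.sg) es := by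
  refine Cs.add (f := fun w => C w.1.la⁻¹ * (d 0 (d 0 (amp w)) + d 1 (d 1 (amp w)))) ?_ ?_
  · have h : ∀ j, CS (N := N) (lv N - 2) (fun w => w.1.L * (w.1.L * w.1.sg))
        (fun w => d j (d j (amp w))) := fun j =>
      CS.dj (n := lv N - 2) (by simp [lv]) ((cs_damp j).of_le (by simp [lv])) j
    refine (((h 0).add (h 1)).mul (CW.act cl_lai)).le LW τW fun w => ?_
    have h1 := w.1.la_pos
    have h2 := w.1.ep_pos
    have h3 := w.1.sg_pos
    have h4 := w.1.ep_le
    simp only [Pi.mul_apply, L]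
    calc _ = w.1.la * w.1.ep * w.1.sg * w.1.ep := by field_simp
      _ ≤ _ := mul_le_of_le_one_right (by positivity) h4
  · have h1 : CW (N := N) (lv N - 2) (fun w => w.1.ep)
        (fun w => 1 - ((ph w.1 w.2).n 0 ^ 2 + (ph w.1 w.2).n 1 ^ 2)) := by
      have h2 : ∀ j, CW (N := N) (lv N - 2) (fun w => w.1.ep)
          (fun w => (C (kR w.2 j) + (ph w.1 w.2).n j) * nm j w) := fun j =>
        (((cl_kR j).add (cl_n j)).mul (cl_nm j)).congr (one_mul _) rfl |>.of_le (by simp [lv])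
      refine ((h2 0).add (h2 1)).neg.congr rfl ?_
      ext1 w
      have h3 : C (kR w.2 0) ^ 2 + C (kR w.2 1) ^ 2 = 1 := by
        rw [← map_pow, ← map_pow, ← map_add, kR_sq, map_one]
      simp only [Pi.neg_apply, Pi.add_apply, ph_n]
      linear_combination h3
    refine (((cs_amp.of_le (Nat.sub_le _ _)).mul (CW.act h1)).mul (CW.act cl_la)).congr ?_ rfl
    ext w; simp only [Pi.mul_apply]; ring

lemma cs_es' : CS (N := N) (lv N - 2) (fun w => w.1.la * w.1.ep * w.1.sg) es' := by
  have h1 : ∀ j, CS (N := N) (lv N - 2) (fun w => w.1.la * w.1.ep * w.1.sg)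
      (fun w => (ph w.1 w.2).n j * d j (amp w)) := fun j =>
    ((cs_damp j).mul_one (CW.act (cl_n j))).of_le (by simp [lv])
  have h2 : ∀ j, CS (N := N) (lv N - 2) (fun w => w.1.la * w.1.ep * w.1.sg)
      (fun w => d j ((ph w.1 w.2).n j) * amp w) := fun j =>
    ((cs_amp.of_le (Nat.sub_le _ _)).mul (CW.act (cl_dn j j))).le LW τW fun w => by
      have h1 := w.1.la_pos
      have h2 := w.1.ep_pos
      have h3 := w.1.sg_pos
      have h4 := w.1.ep_le
      simp only [Pi.mul_apply, L]
      calc _ = w.1.la * w.1.ep * w.1.sg * w.1.ep := by ring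
        _ ≤ _ := mul_le_of_le_one_right (by positivity) h4
  refine (((((h1 0).add (h1 1)).add ((h1 0).add (h1 1))).add ((h2 0).add (h2 1))).neg).congr rfl ?_
  ext1 w
  simp only [es', Pi.neg_apply, Pi.add_apply]
  ring

lemma cs_ps : CS (N := N) (lv N - 1) (fun w => w.1.sg ^ 2 * w.1.ep) ps :=
  (cs_D_amp.mul (CW.act cl_lai)).congr (by
    ext w; have := w.1.la_pos.ne'; simp only [Pi.mul_apply, μ]; field_simp) rfl

lemma cs_qs : CS (N := N) (lv N - 1) (fun w => w.1.sg ^ 2 * w.1.ep) qs :=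
  (((cs_amp.mul (CW.act cl_g)).of_le (Nat.sub_le _ _)).neg).congr (by
    ext w; simp only [Pi.mul_apply]; ring) rfl

/-- Symbols of the linear terms. -/
def ls (i : Fin 2) (w : Stp N × WI) : PF ℝ :=
  ![-(d 1 (ps w) + C w.1.la * ((ph w.1 w.2).n 1 * qs w)),
    d 0 (ps w) + C w.1.la * ((ph w.1 w.2).n 0 * qs w)] i
def ls' (i : Fin 2) (w : Stp N × WI) : PF ℝ :=
  ![-(d 1 (qs w) - C w.1.la * ((ph w.1 w.2).n 1 * ps w)),
    d 0 (qs w) - C w.1.la * ((ph w.1 w.2).n 0 * ps w)] i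

lemma cs_dpq {f : Stp N × WI → PF ℝ} (h : CS (lv N - 1) (fun w => w.1.sg ^ 2 * w.1.ep) f)
    (j : Fin 2) : CS (lv N - 2) (fun w => w.1.la * w.1.ep * w.1.sg ^ 2) (fun w => d j (f w)) :=
  (CS.dj (n := lv N - 2) (by simp [lv]) (h.of_le (by simp [lv])) j).le LW τW fun w => by
    have h1 := w.1.la_pos
    have h2 := w.1.ep_pos
    have h3 := w.1.sg_pos
    have h4 := w.1.ep_le
    simp only [L]
    calc _ = w.1.la * w.1.ep * w.1.sg ^ 2 * w.1.ep := by ring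
      _ ≤ _ := mul_le_of_le_one_right (by positivity) h4

lemma cs_npq {f : Stp N × WI → PF ℝ} (h : CS (lv N - 1) (fun w => w.1.sg ^ 2 * w.1.ep) f)
    (j : Fin 2) : CS (lv N - 2) (fun w => w.1.la * w.1.ep * w.1.sg ^ 2)
      (fun w => C w.1.la * ((ph w.1 w.2).n j * f w)) :=
  (((h.mul_one (CW.act (cl_n j))).mul (CW.act cl_la)).of_le (by simp [lv])).congr (by
    ext w; simp only [Pi.mul_apply]; ring) rfl

lemma cs_ls (i : Fin 2) : CS (N := N) (lv N - 2) (fun w => w.1.la * w.1.ep * w.1.sg ^ 2) (ls i) := by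
  fin_cases i
  · exact ((cs_dpq cs_ps 1).add (cs_npq cs_qs 1)).neg
  · exact (cs_dpq cs_ps 0).add (cs_npq cs_qs 0)

lemma cs_ls' (i : Fin 2) :
    CS (N := N) (lv N - 2) (fun w => w.1.la * w.1.ep * w.1.sg ^ 2) (ls' i) := by
  fin_cases i
  · exact ((cs_dpq cs_qs 1).sub (cs_npq cs_ps 1)).neg
  · exact (cs_dpq cs_qs 0).sub (cs_npq cs_ps 0)

/-! ### Oscillating terms -/

/-- First wave and second wave of an oscillating term. -/
def wI (x : Stp N × XI) : Stp N × WI := (x.1, x.2.1)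
def wJ (x : Stp N × XI) : Stp N × WI := (x.1, x.2.2.1)

/-- Times at which both waves are active. -/
def xS (x : Stp N × XI) : Set ℝ := asl (x.1, x.2.1.1) ∩ asl (x.1, x.2.2.1.1)

lemma xS_closed (x : Stp N × XI) : IsClosed (xS x) := (asl_closed _).inter (asl_closed _)

abbrev CX (n : ℕ) (X : Stp N × XI → ℝ) (f : Stp N × XI → PF ℝ) : Prop :=
  Cs xS (fun x => x.1.L) (fun x => x.1.τ) (fun x => x.1.ub) n X f

lemma LX (x : Stp N × XI) : 0 ≤ x.1.L := x.1.L_pos.le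
lemma τX (x : Stp N × XI) : 0 ≤ x.1.τ := x.1.τ_pos.le

lemma CW.fst {n : ℕ} {X : Stp N × WI → ℝ} {f : Stp N × WI → PF ℝ} (h : CW n X f) :
    Cl xS (fun x => x.1.L) (fun x => x.1.τ) (fun x => x.1.ub) n
      (fun x => X (wI x)) (fun x => f (wI x)) :=
  (h.comap wI).subset fun _ => Set.inter_subset_left.trans (asl_subset _)

lemma CW.snd {n : ℕ} {X : Stp N × WI → ℝ} {f : Stp N × WI → PF ℝ} (h : CW n X f) :
    Cl xS (fun x => x.1.L) (fun x => x.1.τ) (fun x => x.1.ub) n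
      (fun x => X (wJ x)) (fun x => f (wJ x)) :=
  (h.comap wJ).subset fun _ => Set.inter_subset_right.trans (asl_subset _)

lemma CS.prod {n : ℕ} {X Y : Stp N → ℝ} {f g : Stp N × WI → PF ℝ}
    (hf : CS n (fun w => X w.1) f) (hg : CS n (fun w => Y w.1) g) :
    CX n (fun x => X x.1 * Y x.1) (fun x => f (wI x) * g (wJ x)) :=
  ⟨((hf.1.comap wI).subset (fun _ => Set.inter_subset_left)).mul
    ((hg.1.comap wJ).subset (fun _ => Set.inter_subset_right)),
    fun x => (hf.2 (wI x)).inter (hg.2 (wJ x))⟩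

/-- Indicators of the three kinds of oscillating terms. -/
def i0 (x : XI) : ℝ := if x.2.2 = 0 then 1 else 0
def i1 (x : XI) : ℝ := if x.2.2 = 1 ∧ key x.1 ≠ key x.2.1 then 1 else 0
def i2 (x : XI) : ℝ := if x.2.2 = 2 ∧ x.1 = x.2.1 then 1 else 0

lemma phx_n (x : Stp N × XI) (j : Fin 2) : (phx x).n j - C ((phx x).k j) =
    nm j (wI x) + C (i0 x.2 - i1 x.2) * nm j (wJ x) := by
  have e : ∀ I : WI, (ph x.1 I).k j = kR I j := fun _ => rfl
  have e' : ∀ I : WI, (ph x.1 I).n j = C (kR I j) + nm j (x.1, I) := fun _ => rfl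
  rw [phx, i0, i1]
  split_ifs with h h1 <;>
    simp only [Ph.add, Ph.neg, e', e, wI, wJ, map_add, map_neg, map_sub, map_one, map_zero]
  · simp [h] at h1
  all_goals ring

lemma i01_le (x : XI) : |i0 x - i1 x| ≤ 2 := by
  rw [i0, i1]; split_ifs <;> norm_num
lemma i0_le (x : XI) : |i0 x| ≤ 1 := by rw [i0]; split_ifs <;> norm_num
lemma i1_le (x : XI) : |i1 x| ≤ 1 := by rw [i1]; split_ifs <;> norm_num
lemma i2_le (x : XI) : |i2 x| ≤ 1 := by rw [i2]; split_ifs <;> norm_num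

lemma osc (N : ℕ) : Osc (xS (N := N)) (fun x => x.1.la) (fun x => x.1.ep) (fun x => x.1.τ)
    (fun x => x.1.ub) phx (lv N - 1) where
  closed := xS_closed
  la_pos x := x.1.la_pos
  ep_pos x := x.1.ep_pos
  ep_le x := x.1.ep_le
  τ_nonneg := τX
  k_le x j := by
    have h1 := abs_le.1 (kR_abs x.2.1 j)
    have h2 := abs_le.1 (kR_abs x.2.2.1 j)
    refine phx_cases x (fun Q => |Q.k j| ≤ 2) ?_ (fun _ => ?_) ?_ <;>
      simp only [Ph.add, Ph.neg, ph, abs_le] <;> constructor <;> linarith [h1.1, h1.2, h2.1, h2.2]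
  k_ge x := by
    refine phx_cases x (fun Q => 1 / 20 ≤ Q.k 0 ^ 2 + Q.k 1 ^ 2) (kR_add _ _) (fun h => ?_) ?_
    · simpa only [Ph.add, Ph.neg, ph, ← sub_eq_add_neg] using kR_sub h
    · change 1 / 20 ≤ kR x.2.1 0 ^ 2 + kR x.2.1 1 ^ 2
      rw [kR_sq]; norm_num
  n_sub j := by
    refine ((cl_nm j).fst.add (((Cl.bdd LX τX zero_le_two fun x => i01_le x.2).mul
      (cl_nm j).snd).congr (one_mul _) rfl)).congr rfl ?_
    ext1 x
    rw [phx_n]; rfl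
  du j l := (((big_dub_τ j l).of_le (by simp [lv])).comap
    (fun x : Stp N × XI => (x.1, x.2.1.1))).subset
      fun x => Set.inter_subset_left.trans (asl_subset _)
  g_le := by
    have h0 : B0 (xS (N := N)) (fun x => x.1.sg) (fun x => (ph x.1 x.2.1).g) :=
      (((cl_g (N := N)).fst.le LX τX fun x =>
        mul_le_of_le_one_right x.1.sg_pos.le x.1.ep_le).1.b0)
    have h1 : B0 (xS (N := N)) (fun x => x.1.sg) (fun x => C (i0 x.2 - i1 x.2) * (ph x.1 x.2.2.1).g) :=
      (((Cl.bdd LX τX zero_le_two fun x => i01_le x.2).mul ((cl_g (N := N)).snd.le LX τX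
        (Y := fun x => x.1.sg) fun x =>
        mul_le_of_le_one_right x.1.sg_pos.le x.1.ep_le)).congr (one_mul _) rfl).1.b0
    refine (h0.add h1).congr ?_ ?_
    · ext x; have := x.1.la_pos.ne'; simp only [τ]; field_simp
    · ext1 x
      change (ph x.1 x.2.1).g + C (i0 x.2 - i1 x.2) * (ph x.1 x.2.2.1).g = (phx x).g
      rw [phx, i0, i1]
      split_ifs with h h1 <;>
        simp only [Ph.add, Ph.neg, map_sub, map_one, map_zero]
      · simp [h] at h1
      all_goals ring

/-- Cosine symbols of the oscillating terms. -/
def xB (j : Fin 2) (x : Stp N × XI) : PF ℝ :=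
  C (i0 x.2) * (C (-1 / 2) * (es (wI x) * fs j (wJ x) - es' (wI x) * fs' j (wJ x)))
  + (C (i1 x.2) * (C (-1 / 2) * (es (wI x) * fs j (wJ x) + es' (wI x) * fs' j (wJ x)))
  + C (i2 x.2) * ls j (wI x))

/-- Sine symbols of the oscillating terms. -/
def xB' (j : Fin 2) (x : Stp N × XI) : PF ℝ :=
  C (i0 x.2) * (C (-1 / 2) * (es (wI x) * fs' j (wJ x) + es' (wI x) * fs j (wJ x)))
  + (C (i1 x.2) * (C (-1 / 2) * (es' (wI x) * fs j (wJ x) - es (wI x) * fs' j (wJ x)))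
  + C (i2 x.2) * ls' j (wI x))

lemma CX.bdd_mul {n : ℕ} {X : Stp N × XI → ℝ} {f : Stp N × XI → PF ℝ} (h : CX n X f)
    {c : Stp N × XI → ℝ} (hc : ∀ x, |c x| ≤ 1) : CX n X (fun x => C (c x) * f x) :=
  h.mul_one (Cl.bdd LX τX zero_le_one hc)

lemma CX.half {n : ℕ} {X : Stp N × XI → ℝ} {f : Stp N × XI → PF ℝ} (h : CX n X f)
    {c : Stp N × XI → ℝ} (hc : ∀ x, |c x| ≤ 1) : CX n X (fun x => C (c x) * (C (-1 / 2) * f x)) :=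
  (h.bdd_mul (c := fun _ => -1 / 2) fun _ => by norm_num [abs_le]).bdd_mul hc

lemma cx_lin {n : ℕ} {X : Stp N → ℝ} {f : Stp N × WI → PF ℝ} (h : CS n (fun w => X w.1) f) :
    CX n (fun x => X x.1) (fun x => C (i2 x.2) * f (wI x)) := by
  refine ⟨(Cl.bdd LX τX zero_le_one (c := fun x => i2 x.2) fun x => i2_le x.2).mul
    ((h.1.comap wI).subset fun _ => Set.inter_subset_left) |>.congr (one_mul _) rfl, fun x => ?_⟩
  by_cases hx : x.2.2.2 = 2 ∧ x.2.1 = x.2.2.1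
  · have : xS x = asl (x.1, x.2.1.1) := by rw [xS, ← hx.2, Set.inter_self]
    rw [this]; exact (h.2 (wI x)).mul _
  · simp only [i2, hx, if_false, map_zero, zero_mul]; exact Sup.zero

/-- The size of the symbols. -/
def xX (σ : Stp N) : ℝ := σ.la * σ.ep * σ.sg ^ 2

lemma xX_nonneg (σ : Stp N) : 0 ≤ xX σ := by
  have := σ.la_pos; have := σ.ep_pos; rw [xX]; positivity

lemma cx_ef {e f : Stp N × WI → PF ℝ} (he : CS (lv N - 2) (fun w => w.1.la * w.1.ep * w.1.sg) e)
    (hf : CS (lv N - 1) (fun w => w.1.sg) f) :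
    CX (lv N - 2) (fun x => xX x.1) (fun x => e (wI x) * f (wJ x)) :=
  (CS.prod (X := fun σ => σ.la * σ.ep * σ.sg) (Y := fun σ => σ.sg) he
    (hf.of_le (by simp [lv]))).congr (by ext x; simp only [xX]; ring) rfl

lemma cx_xB (j : Fin 2) : CX (N := N) (lv N - 2) (fun x => xX x.1) (xB j) :=
  Cs.add (CX.half (Cs.sub (cx_ef cs_es (cs_fs j)) (cx_ef cs_es' (cs_fs' j))) fun x => i0_le x.2)
    (Cs.add (CX.half (Cs.add (cx_ef cs_es (cs_fs j)) (cx_ef cs_es' (cs_fs' j))) fun x => i1_le x.2)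
      (cx_lin (X := xX) (cs_ls j)))

lemma cx_xB' (j : Fin 2) : CX (N := N) (lv N - 2) (fun x => xX x.1) (xB' j) :=
  Cs.add (CX.half (Cs.add (cx_ef cs_es (cs_fs' j)) (cx_ef cs_es' (cs_fs j))) fun x => i0_le x.2)
    (Cs.add (CX.half (Cs.sub (cx_ef cs_es' (cs_fs j)) (cx_ef cs_es (cs_fs' j))) fun x => i1_le x.2)
      (cx_lin (X := xX) (cs_ls' j)))

/-- Inversion of the divergence of the oscillating terms up to a small remainder. -/
lemma exists_xT (N : ℕ) : ∃ T : Stp N × XI → Fin 2 → Fin 2 → PF ℝ, ∃ Q Q' : Stp N × XI → Fin 2 → PF ℝ,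
    (∀ x a b, T x a b = T x b a) ∧
    (∀ a b, Cs xS (fun x => x.1.la) (fun x => x.1.τ) (fun x => x.1.ub) 0
      (fun x => x.1.sg ^ 2 * x.1.ep) (fun x => T x a b)) ∧
    (∀ a, CX 10 (fun x => x.1.ep ^ N * xX x.1) (fun x => Q x a)) ∧
    (∀ a, CX 10 (fun x => x.1.ep ^ N * xX x.1) (fun x => Q' x a)) ∧
    ∀ x a, xB a x * (phx x).c + xB' a x * (phx x).s = (d 0 (T x a 0) + d 1 (T x a 1))
      + (Q x a * (phx x).c + Q' x a * (phx x).s) := by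
  have h0 : 10 + N = lv N - 2 := by simp [lv]; omega
  obtain ⟨T, Q, Q', hT, hb, hQ, hQ', h⟩ := (osc N).main (n := 10) N (X := fun x => xX x.1)
    (B := fun x j => xB j x) (B' := fun x j => xB' j x) (fun x => xX_nonneg x.1)
    (by simp [lv]; omega) (fun j => by rw [h0]; exact cx_xB j) (fun j => by rw [h0]; exact cx_xB' j)
  refine ⟨T, Q, Q', hT, fun a b => (hb a b).congr ?_ rfl, hQ, hQ', h⟩
  ext x
  have := x.1.la_pos.ne'
  simp only [xX]; field_simp

/-! ### Identities for single waves and pairs of waves -/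

lemma lai_la (σ : Stp N) : C σ.la⁻¹ * C σ.la = 1 := by
  rw [← map_mul, inv_mul_cancel₀ σ.la_pos.ne', map_one]

/-- Stream function of a wave. -/
def psw (w : Stp N × WI) : PF ℝ := C w.1.la⁻¹ * (amp w * (ph w.1 w.2).c)

lemma d_psw (w : Stp N × WI) (j : Fin 2) :
    d j (psw w) = fs j w * (ph w.1 w.2).c + fs' j w * (ph w.1 w.2).s := by
  have h := lai_la w.1
  simp only [psw, fs, fs', Derivation.leibniz, smul_eq_mul, d_C, Ph.dc]
  linear_combination (-((ph w.1 w.2).n j * amp w * (ph w.1 w.2).s)) * h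

lemma lap_psw (w : Stp N × WI) : d 0 (d 0 (psw w)) + d 1 (d 1 (psw w)) =
    (es w * (ph w.1 w.2).c + es' w * (ph w.1 w.2).s) - C w.1.la ^ 2 * psw w := by
  have h := lai_la w.1
  have h2 : d 0 ((ph w.1 w.2).n 1) = d 1 ((ph w.1 w.2).n 0) := (ph w.1 w.2).curl
  simp only [d_psw]
  simp only [psw, fs, fs', es, es', map_add, map_neg, Derivation.leibniz, smul_eq_mul, d_C, Ph.dc,
    Ph.ds]
  linear_combination (-(2 : PF ℝ) * 0 - ((ph w.1 w.2).n 0 * d 0 (amp w) +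
    (ph w.1 w.2).n 1 * d 1 (amp w)) * (ph w.1 w.2).s
    + C w.1.la * amp w * (ph w.1 w.2).c) * h

lemma D_psw (w : Stp N × WI) :
    w.1.D (psw w) = ps w * (ph w.1 w.2).c + qs w * (ph w.1 w.2).s := by
  have h := lai_la w.1
  simp only [psw, ps, qs, Derivation.leibniz, smul_eq_mul, mat_C, Ph.Dc]
  linear_combination (-((ph w.1 w.2).g * amp w * (ph w.1 w.2).s)) * h

lemma ls_eq (w : Stp N × WI) : ls 0 w * (ph w.1 w.2).c + ls' 0 w * (ph w.1 w.2).s =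
    -d 1 (w.1.D (psw w)) ∧ ls 1 w * (ph w.1 w.2).c + ls' 1 w * (ph w.1 w.2).s =
    d 0 (w.1.D (psw w)) := by
  rw [D_psw]
  constructor <;>
  · simp only [ls, ls', Matrix.cons_val_zero, Matrix.cons_val_one, map_add, Derivation.leibniz,
      smul_eq_mul, Ph.dc, Ph.ds]
    ring

/-- Low frequency part of the tensor square of a wave. -/
def Lo (w : Stp N × WI) (i j : Fin 2) : PF ℝ :=
  C (1 / 2) * ![![fs 1 w * fs 1 w + fs' 1 w * fs' 1 w, -(fs 0 w * fs 1 w + fs' 0 w * fs' 1 w)],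
    ![-(fs 0 w * fs 1 w + fs' 0 w * fs' 1 w), fs 0 w * fs 0 w + fs' 0 w * fs' 0 w]] i j

/-- Low frequency part of the pressure of a wave. -/
def Po (w : Stp N × WI) : PF ℝ :=
  C (1 / 4) * (fs 0 w * fs 0 w + fs 1 w * fs 1 w + (fs' 0 w * fs' 0 w + fs' 1 w * fs' 1 w)
    + amp w * amp w)

lemma low_eq (w : Stp N × WI) (i : Fin 2) : C (-1 / 2) * (es w * fs i w + es' w * fs' i w) =
    d 0 (Lo w i 0) + d 1 (Lo w i 1) - d i (Po w) := by
  have h := lai_la w.1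
  have h2 : d 0 ((ph w.1 w.2).n 1) = d 1 ((ph w.1 w.2).n 0) := (ph w.1 w.2).curl
  have h3 : C (1 / 2) = (2 * C (1 / 4) : PF ℝ) := by
    rw [← map_ofNat (algebraMap ℝ (PF ℝ)) 2, ← map_mul]; norm_num
  have h4 : C (-1 / 2) = (-2 * C (1 / 4) : PF ℝ) := by
    rw [← map_ofNat (algebraMap ℝ (PF ℝ)) 2, ← map_neg, ← map_mul]; norm_num
  have h5 (j : Fin 2) : d j (2 : PF ℝ) = 0 := by simpa using (d j).map_natCast 2
  fin_cases i
  · simp only [Lo, Po, Fin.zero_eta, Fin.mk_one, Fin.isValue, Matrix.cons_val_zero,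
      Matrix.cons_val_one, Matrix.cons_val', Matrix.cons_val_fin_one]
    simp only [fs, fs', es, es', map_add, map_neg, Derivation.leibniz, smul_eq_mul, d_C, h3, h4,
      d_comm 1 0, h2, h5]
    linear_combination (-(2 * C (1 / 4) * (1 - ((ph w.1 w.2).n 0 ^ 2 + (ph w.1 w.2).n 1 ^ 2)) * amp w
      * d 0 (amp w))) * h
  · simp only [Lo, Po, Fin.zero_eta, Fin.mk_one, Fin.isValue, Matrix.cons_val_zero,
      Matrix.cons_val_one, Matrix.cons_val', Matrix.cons_val_fin_one]
    simp only [fs, fs', es, es', map_add, map_neg, Derivation.leibniz, smul_eq_mul, d_C, h3, h4,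
      d_comm 1 0, h2, h5]
    linear_combination (-(2 * C (1 / 4) * (1 - ((ph w.1 w.2).n 0 ^ 2 + (ph w.1 w.2).n 1 ^ 2)) * amp w
      * d 1 (amp w))) * h

lemma amp_mul_zero {σ : Stp N} {I J : WI} (h : key I = key J) (hne : I ≠ J) :
    xS (σ, I, J, (0 : Fin 3)) = ∅ := by
  rw [Set.eq_empty_iff_forall_notMem]
  rintro t ⟨h1, h2⟩
  have a1 : |σ.μ * t - (I.1 : ℝ)| ≤ 3 / 4 := asl_subset _ h1
  have a2 : |σ.μ * t - (J.1 : ℝ)| ≤ 3 / 4 := asl_subset _ h2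
  rw [abs_le] at a1 a2
  rcases I with ⟨l, κ⟩
  rcases J with ⟨m, κ'⟩
  simp only [key, Prod.mk.injEq, decide_eq_decide] at h
  have hlm : l ≠ m := fun e => hne (by rw [e, h.2])
  have h3 : ((l - m : ℤ) : ℝ) ≤ 3 / 2 := by push_cast; linarith [a1.1, a2.2]
  have h4 : (-(3 / 2) : ℝ) ≤ ((l - m : ℤ) : ℝ) := by push_cast; linarith [a1.2, a2.1]
  have h5 : l - m < 2 := by
    have : ((l - m : ℤ) : ℝ) < ((2 : ℤ) : ℝ) := by push_cast at *; linarith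
    exact_mod_cast this
  have h6 : -2 < l - m := by
    have : ((-2 : ℤ) : ℝ) < ((l - m : ℤ) : ℝ) := by push_cast at *; linarith
    exact_mod_cast this
  have h7 := h.1
  rw [Int.even_iff, Int.even_iff] at h7
  omega

lemma mul_eq_zero_of_key {σ : Stp N} {I J : WI} (h : key I = key J) (hne : I ≠ J) {f g : PF ℝ}
    (hf : Sup (asl (σ, I.1)) f) (hg : Sup (asl (σ, J.1)) g) : f * g = 0 := by
  have h1 := Sup.inter hf hg
  have h2 : asl (σ, I.1) ∩ asl (σ, J.1) = ∅ := amp_mul_zero h hne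
  ext ⟨t, x⟩
  rw [h2] at h1
  exact h1 t (Set.notMem_empty _) x

set_option maxHeartbeats 1000000 in
/-- Product of two waves as a sum of single waves. -/
lemma pair_eq (σ : Stp N) (I J : WI) (j : Fin 2) :
    ∑ κ : Fin 3, (xB j (σ, I, J, κ) * (phx (σ, I, J, κ)).c + xB' j (σ, I, J, κ) * (phx (σ, I, J, κ)).s)
    = -((es (σ, I) * (ph σ I).c + es' (σ, I) * (ph σ I).s) *
        (fs j (σ, J) * (ph σ J).c + fs' j (σ, J) * (ph σ J).s))
      + if I = J then C (1 / 2) * (es (σ, I) * fs j (σ, I) + es' (σ, I) * fs' j (σ, I))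
        + (ls j (σ, I) * (ph σ I).c + ls' j (σ, I) * (ph σ I).s) else 0 := by
  have h3 : (1 : PF ℝ) = 2 * C (1 / 2) := by
    rw [← map_ofNat (algebraMap ℝ (PF ℝ)) 2, ← map_mul]; norm_num
  have h4 : C (-1 / 2) = -C (1 / 2) := by
    rw [← map_neg]; norm_num
  have c0 : C 0 = 0 := map_zero _
  have c1 : C 1 = 1 := map_one _
  have h02 : (2 : Fin 3) ≠ 0 := by decide
  have h12 : (2 : Fin 3) ≠ 1 := by decide
  have h01 : (1 : Fin 3) ≠ 2 := by decide
  rcases eq_or_ne (key I) (key J) with hk | hk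
  · rcases eq_or_ne I J with rfl | hne
    · have hs := (ph σ I).sq
      simp only [Fin.sum_univ_three, xB, xB', phx, i0, i1, i2, wI, wJ, if_true, ne_eq, not_true,
        and_false, if_false, one_ne_zero, h02, h12, h01, zero_ne_one, and_true, c0, c1, Ph.add,
        h4, false_and, Fin.isValue, Ne.symm h02]
      linear_combination (es (σ, I) * fs j (σ, I) * (ph σ I).c ^ 2 + es' (σ, I) * fs' j (σ, I) * (ph σ I).s ^ 2
        + (es (σ, I) * fs' j (σ, I) + es' (σ, I) * fs j (σ, I)) * (ph σ I).s * (ph σ I).c) * h3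
        + C (1 / 2) * (es (σ, I) * fs j (σ, I) + es' (σ, I) * fs' j (σ, I)) * hs
    · have z1 := mul_eq_zero_of_key hk hne (cs_es.2 (σ, I)) ((cs_fs j).2 (σ, J))
      have z2 := mul_eq_zero_of_key hk hne (cs_es.2 (σ, I)) ((cs_fs' j).2 (σ, J))
      have z3 := mul_eq_zero_of_key hk hne (cs_es'.2 (σ, I)) ((cs_fs j).2 (σ, J))
      have z4 := mul_eq_zero_of_key hk hne (cs_es'.2 (σ, I)) ((cs_fs' j).2 (σ, J))
      simp only [Fin.sum_univ_three, xB, xB', phx, i0, i1, i2, wI, wJ, if_true, ne_eq, hk, hne,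
        not_true, and_false, if_false, c0, zero_mul, z1, z2, z3, z4, mul_zero, add_zero, sub_zero]
      linear_combination (ph σ I).c * (ph σ J).c * z1 + (ph σ I).c * (ph σ J).s * z2
        + (ph σ I).s * (ph σ J).c * z3 + (ph σ I).s * (ph σ J).s * z4
  · have hne : I ≠ J := fun e => hk (by rw [e])
    simp only [Fin.sum_univ_three, xB, xB', phx, i0, i1, i2, wI, wJ, if_true, ne_eq, hk, hne,
      not_false_eq_true, and_false, if_false, one_ne_zero, h02, h12, h01, zero_ne_one, and_true,
      c0, c1, Ph.add, Ph.neg, h4, false_and, Fin.isValue, Ne.symm h02]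
    linear_combination ((es (σ, I) * (ph σ I).c + es' (σ, I) * (ph σ I).s) *
        (fs j (σ, J) * (ph σ J).c + fs' j (σ, J) * (ph σ J).s)) * h3

/-! ### Sums of waves -/

/-- Bound for the indices of the time intervals which carry waves. -/
def Mx (σ : Stp N) : ℤ := ⌈σ.μ * |σ.fin.choose|⌉ + 3
def ZF (σ : Stp N) : Finset ℤ := Finset.Icc (-Mx σ) (Mx σ)
def WF (σ : Stp N) : Finset WI := ZF σ ×ˢ Finset.univ
def XF (σ : Stp N) : Finset XI := WF σ ×ˢ (WF σ ×ˢ Finset.univ)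

/-- At each time, at most `M` of the sets are active. -/
def Cnt {κ : Type} (S : Stp N × κ → Set ℝ) (M : ℕ) : Prop :=
  ∀ σ t, ∃ A : Finset κ, A.card ≤ M ∧ ∀ k, t ∈ S (σ, k) → k ∈ A

lemma sl_mem {σ : Stp N} {l : ℤ} {t : ℝ} (h : t ∈ sl (σ, l)) : l = ⌊σ.μ * t⌋ ∨ l = ⌊σ.μ * t⌋ + 1 := by
  have h1 : |σ.μ * t - (l : ℝ)| ≤ 3 / 4 := h
  rw [abs_le] at h1
  have h2 := Int.floor_le (σ.μ * t)
  have h3 := Int.lt_floor_add_one (σ.μ * t)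
  have h4 : ⌊σ.μ * t⌋ < l + 1 := by
    have : ((⌊σ.μ * t⌋ : ℤ) : ℝ) < ((l + 1 : ℤ) : ℝ) := by push_cast; linarith [h1.2]
    exact_mod_cast this
  have h5 : l < ⌊σ.μ * t⌋ + 2 := by
    have : (l : ℝ) < ((⌊σ.μ * t⌋ + 2 : ℤ) : ℝ) := by push_cast; linarith [h1.1]
    exact_mod_cast this
  omega

lemma cnt_sl : Cnt (N := N) sl 2 := fun σ t =>
  ⟨{⌊σ.μ * t⌋, ⌊σ.μ * t⌋ + 1}, Finset.card_le_two, fun k hk => by simpa using sl_mem hk⟩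

lemma cnt_W : Cnt (N := N) (fun w : Stp N × WI => asl (w.1, w.2.1)) 6 := fun σ t => by
  obtain ⟨A, hA, h⟩ := cnt_sl σ t
  refine ⟨A ×ˢ Finset.univ, ?_, fun k hk => ?_⟩
  · rw [Finset.card_product, Finset.card_univ, Fintype.card_fin]; omega
  · rw [Finset.mem_product]
    exact ⟨h _ (asl_subset _ hk), Finset.mem_univ _⟩

lemma cnt_X : Cnt (N := N) xS 108 := fun σ t => by
  obtain ⟨A, hA, h⟩ := cnt_W σ t
  refine ⟨A ×ˢ (A ×ˢ Finset.univ), ?_, fun k hk => ?_⟩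
  · rw [Finset.card_product, Finset.card_product, Finset.card_univ, Fintype.card_fin]
    nlinarith
  · simp only [Finset.mem_product]
    exact ⟨h _ hk.1, h _ hk.2, Finset.mem_univ _⟩

/-- Families on all of time. -/
abbrev CU (X : Stp N → ℝ) (f : Stp N → PF ℝ) : Prop :=
  Cl U (fun σ => σ.la) (fun σ => σ.τ) (fun σ => σ.ub) 0 X f

lemma laU (σ : Stp N) : 0 ≤ σ.la := σ.la_pos.le
lemma τU (σ : Stp N) : 0 ≤ σ.τ := σ.τ_pos.le

lemma CU.mk {X : Stp N → ℝ} {f : Stp N → PF ℝ} (h0 : B0 U X f)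
    (h1 : ∀ j, B0 U (fun σ => σ.la * X σ) (fun σ => d j (f σ)))
    (h2 : B0 U (fun σ => σ.τ * X σ) (fun σ => σ.D (f σ))) : CU X f := ⟨⟨h0, h1⟩, h2⟩

section
variable {κ : Type} {S : Stp N × κ → Set ℝ} {M : ℕ} {X : Stp N → ℝ} {f : Stp N × κ → PF ℝ}

lemma total_b0 [DecidableEq κ] (F : Stp N → Finset κ) (hc : Cnt S M) (hX : ∀ σ, 0 ≤ X σ)
    (hf : B0 S (fun i => X i.1) f) (hs : ∀ i, Sup (S i) (f i)) :
    B0 U X (fun σ => ∑ k ∈ F σ, f (σ, k)) := by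
  obtain ⟨C, hC, h⟩ := hf
  refine ⟨M * C, by positivity, fun σ t _ x => ?_⟩
  obtain ⟨A, hA, hk⟩ := hc σ t
  have e : (∑ k ∈ F σ, f (σ, k)) (t, x) = ∑ k ∈ F σ, f (σ, k) (t, x) := by
    induction F σ using Finset.induction_on with
    | empty => rfl
    | insert a s ha ih => rw [Finset.sum_insert ha, Finset.sum_insert ha, add_apply, ih]
  have h1 (k : κ) : |f (σ, k) (t, x)| ≤ C * X σ := by
    by_cases ht : t ∈ S (σ, k)
    · exact h _ t ht x
    · rw [hs _ t ht x, abs_zero]; exact mul_nonneg hC (hX σ)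
  calc |(∑ k ∈ F σ, f (σ, k)) (t, x)| ≤ ∑ k ∈ F σ, |f (σ, k) (t, x)| := by
        rw [e]; exact Finset.abs_sum_le_sum_abs _ _
    _ = ∑ k ∈ F σ ∩ A, |f (σ, k) (t, x)| := by
        refine (Finset.sum_subset Finset.inter_subset_left fun k hkF hkn => ?_).symm
        have : t ∉ S (σ, k) := fun ht => hkn (Finset.mem_inter.2 ⟨hkF, hk k ht⟩)
        rw [hs _ t this x, abs_zero]
    _ ≤ ∑ _k ∈ F σ ∩ A, C * X σ := Finset.sum_le_sum fun k _ => h1 k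
    _ = ((F σ ∩ A).card : ℝ) * (C * X σ) := by rw [Finset.sum_const, nsmul_eq_mul]
    _ ≤ M * (C * X σ) := by
        refine mul_le_mul_of_nonneg_right ?_ (mul_nonneg hC (hX σ))
        exact_mod_cast (Finset.card_le_card Finset.inter_subset_right).trans hA
    _ = M * C * X σ := by ring

lemma total [DecidableEq κ] (F : Stp N → Finset κ) (hS : ∀ i, IsClosed (S i)) (hc : Cnt S M) (hX : ∀ σ, 0 ≤ X σ)
    (hf : Cs S (fun i => i.1.la) (fun i => i.1.τ) (fun i => i.1.ub) 0 (fun i => X i.1) f) :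
    CU X (fun σ => ∑ k ∈ F σ, f (σ, k)) := by
  refine CU.mk (total_b0 F hc hX hf.1.1.b0 hf.2) (fun j => ?_) ?_
  · simp only [map_sum]
    exact total_b0 (f := fun i => d j (f i)) (X := fun σ => σ.la * X σ) F hc
      (fun σ => mul_nonneg (laU σ) (hX σ)) ((hf.1.1.d j).congr rfl rfl) fun i => (hf.2 i).dv (hS i) _
  · simp only [map_sum]
    exact total_b0 (f := fun i => i.1.D (f i)) (X := fun σ => σ.τ * X σ) F hc
      (fun σ => mul_nonneg (τU σ) (hX σ)) (hf.1.2.congr rfl rfl) fun i => (hf.2 i).mat (hS i) _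
end

lemma total_W {X : Stp N → ℝ} {f : Stp N × WI → PF ℝ} (hX : ∀ σ, 0 ≤ X σ)
    (hf : Cs (fun w => asl (w.1, w.2.1)) (fun w => w.1.la) (fun w => w.1.τ) (fun w => w.1.ub) 0
      (fun w => X w.1) f) : CU X (fun σ => ∑ I ∈ WF σ, f (σ, I)) :=
  total WF (fun _ => asl_closed _) cnt_W hX hf

lemma total_X {X : Stp N → ℝ} {f : Stp N × XI → PF ℝ} (hX : ∀ σ, 0 ≤ X σ)
    (hf : Cs xS (fun w => w.1.la) (fun w => w.1.τ) (fun w => w.1.ub) 0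
      (fun w => X w.1) f) : CU X (fun σ => ∑ x ∈ XF σ, f (σ, x)) :=
  total XF xS_closed cnt_X hX hf

/-! ### The stream function of the perturbation -/

/-- The stream function of the perturbation. -/
def psi (σ : Stp N) : PF ℝ := ∑ I ∈ WF σ, psw (σ, I)

lemma sum_pair {κ R : Type} [DecidableEq κ] [CommRing R] (s : Finset κ) (e f h : κ → R) :
    ∑ I ∈ s, ∑ J ∈ s, (-(e I * f J) + if I = J then h I else 0) =
      -((∑ I ∈ s, e I) * ∑ J ∈ s, f J) + ∑ I ∈ s, h I := by
  simp only [Finset.sum_add_distrib, Finset.sum_neg_distrib, Finset.sum_ite_eq, Finset.sum_mul_sum]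
  congr 1
  exact Finset.sum_congr rfl fun I hI => if_pos hI

lemma psi_eq (σ : Stp N) (j : Fin 2) :
    -((d 0 (d 0 σ.psi) + d 1 (d 1 σ.psi) + C σ.la ^ 2 * σ.psi) * d j σ.psi) +
      ![-d 1 (σ.D σ.psi), d 0 (σ.D σ.psi)] j =
    ∑ x ∈ XF σ, (xB j (σ, x) * (phx (σ, x)).c + xB' j (σ, x) * (phx (σ, x)).s)
      + (d 0 (∑ I ∈ WF σ, Lo (σ, I) j 0) + d 1 (∑ I ∈ WF σ, Lo (σ, I) j 1)
        - d j (∑ I ∈ WF σ, Po (σ, I))) := by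
  have h1 : d 0 (d 0 σ.psi) + d 1 (d 1 σ.psi) + C σ.la ^ 2 * σ.psi =
      ∑ I ∈ WF σ, (es (σ, I) * (ph σ I).c + es' (σ, I) * (ph σ I).s) := by
    simp only [psi, map_sum, Finset.mul_sum, ← Finset.sum_add_distrib]
    refine Finset.sum_congr rfl fun I _ => ?_
    rw [lap_psw]; ring
  have h2 : d j σ.psi = ∑ I ∈ WF σ, (fs j (σ, I) * (ph σ I).c + fs' j (σ, I) * (ph σ I).s) := by
    simp only [psi, map_sum]
    exact Finset.sum_congr rfl fun I _ => d_psw _ _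
  have h3 : ![-d 1 (σ.D σ.psi), d 0 (σ.D σ.psi)] j =
      ∑ I ∈ WF σ, (ls j (σ, I) * (ph σ I).c + ls' j (σ, I) * (ph σ I).s) := by
    fin_cases j
    · simp only [psi, map_sum, Fin.zero_eta, Matrix.cons_val_zero, ← Finset.sum_neg_distrib]
      exact Finset.sum_congr rfl fun I _ => (ls_eq (σ, I)).1.symm
    · simp only [psi, map_sum, Fin.mk_one, Matrix.cons_val_one]
      exact Finset.sum_congr rfl fun I _ => (ls_eq (σ, I)).2.symm
  have h4 : d 0 (∑ I ∈ WF σ, Lo (σ, I) j 0) + d 1 (∑ I ∈ WF σ, Lo (σ, I) j 1)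
        - d j (∑ I ∈ WF σ, Po (σ, I)) =
      ∑ I ∈ WF σ, C (-1 / 2) * (es (σ, I) * fs j (σ, I) + es' (σ, I) * fs' j (σ, I)) := by
    simp only [map_sum, ← Finset.sum_add_distrib, ← Finset.sum_sub_distrib]
    exact Finset.sum_congr rfl fun I _ => (low_eq (σ, I) j).symm
  have h5 : C (-1 / 2) = -C (1 / 2) := by rw [← map_neg]; norm_num
  have h6 : ∑ x ∈ XF σ, (xB j (σ, x) * (phx (σ, x)).c + xB' j (σ, x) * (phx (σ, x)).s) =
      ∑ I ∈ WF σ, ∑ J ∈ WF σ, ∑ κ : Fin 3, (xB j (σ, I, J, κ) * (phx (σ, I, J, κ)).c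
        + xB' j (σ, I, J, κ) * (phx (σ, I, J, κ)).s) := by
    rw [XF, Finset.sum_product]
    exact Finset.sum_congr rfl fun I _ => by rw [Finset.sum_product]
  rw [h1, h2, h3, h4, h6]
  simp only [pair_eq]
  rw [sum_pair, Finset.sum_add_distrib (f := fun I => C (1 / 2) * (es (σ, I) * fs j (σ, I)
    + es' (σ, I) * fs' j (σ, I)))]
  simp only [h5, neg_mul, Finset.sum_neg_distrib]
  ring

/-! ### Classes of the pieces of the new stress -/

lemma CU.le {X Y : Stp N → ℝ} {f : Stp N → PF ℝ} (h : CU X f) (hXY : ∀ σ, X σ ≤ Y σ) : CU Y f :=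
  Cl.le h laU τU hXY

lemma CU.mul_le {X Y Z : Stp N → ℝ} {f g : Stp N → PF ℝ} (hf : CU X f) (hg : CU Y g)
    (h : ∀ σ, X σ * Y σ ≤ Z σ) : CU Z (f * g) := CU.le (Cl.mul hf hg) h

lemma cl_ph : Cl (fun w : Stp N × WI => asl (w.1, w.2.1)) (fun w => w.1.la) (fun w => w.1.τ)
    (fun w => w.1.ub) 0 1 (fun w => (ph w.1 w.2).c) ∧
    Cl (fun w : Stp N × WI => asl (w.1, w.2.1)) (fun w => w.1.la) (fun w => w.1.τ)
    (fun w => w.1.ub) 0 1 (fun w => (ph w.1 w.2).s) := by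
  let r : Stp N × WI → Stp N × XI := fun w => (w.1, w.2, w.2, 2)
  have h := (osc N).cl_c
  exact ⟨(h.1.comap r).subset fun w t ht => ⟨ht, ht⟩, (h.2.comap r).subset fun w t ht => ⟨ht, ht⟩⟩

/-- Passage to the fine scale. -/
lemma CS.final {n : ℕ} {X : Stp N × WI → ℝ} {f : Stp N × WI → PF ℝ} (hX : ∀ w, 0 ≤ X w)
    (hf : CS n X f) : Cs (fun w => asl (w.1, w.2.1)) (fun w => w.1.la) (fun w => w.1.τ)
      (fun w => w.1.ub) 0 X f :=
  (hf.of_le (Nat.zero_le _)).mono_scale hX LW τW fun w =>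
    mul_le_of_le_one_right w.1.la_pos.le w.1.ep_le

lemma CX.final {n : ℕ} {X : Stp N × XI → ℝ} {f : Stp N × XI → PF ℝ} (hX : ∀ w, 0 ≤ X w)
    (hf : CX n X f) : Cs xS (fun w => w.1.la) (fun w => w.1.τ) (fun w => w.1.ub) 0 X f :=
  (hf.of_le (Nat.zero_le _)).mono_scale hX LX τX fun w =>
    mul_le_of_le_one_right w.1.la_pos.le w.1.ep_le

lemma sg_nn (σ : Stp N) : 0 ≤ σ.sg := σ.sg_pos.le

lemma cu_dpsi (j : Fin 2) : CU (N := N) (fun σ => σ.sg) (fun σ => d j σ.psi) := by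
  have h := total_W (N := N) (X := fun σ => σ.sg) sg_nn ((((CS.final (N := N) (fun w => sg_nn w.1) (cs_fs j)).mul_one cl_ph.1)).add
    ((CS.final (fun w => sg_nn w.1) (cs_fs' j)).mul_one cl_ph.2))
  refine h.congr rfl ?_
  ext1 σ
  simp only [psi, map_sum]
  refine Finset.sum_congr rfl fun I _ => ?_
  rw [d_psw]
  simp only [Pi.add_apply, Pi.mul_apply]; ring

lemma cu_psi : CU (N := N) (fun σ => σ.la⁻¹ * σ.sg) psi := by
  have h1 := CS.final (N := N) (fun w => mul_nonneg (inv_nonneg.2 w.1.la_pos.le) (sg_nn w.1))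
    (Cs.mul cs_amp (CW.act cl_lai))
  have h := total_W (X := fun σ => σ.la⁻¹ * σ.sg) (fun σ => mul_nonneg (inv_nonneg.2 (laU σ)) (sg_nn σ)) (h1.mul_one cl_ph.1)
  refine h.congr rfl ?_
  ext1 σ
  refine Finset.sum_congr rfl fun I _ => ?_
  simp only [psw, Pi.mul_apply]; ring

lemma cu_vb (j : Fin 2) : CU (N := N) (fun σ => σ.sg * σ.ep) (fun σ => σ.vb j) := by
  refine CU.mk (b0_vb j) (fun i => (b0_dvb i j).le fun σ => ?_) ((b0_D_vb j).le fun σ => ?_)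
  · have h1 := σ.sg_pos; have h2 := σ.la_pos; have h3 := σ.ep_pos
    exact σ.drop 1 (by ring) (by positivity)
  · rw [τ]; exact le_of_eq (by ring)

lemma cu_dub (i j : Fin 2) : CU (N := N) (fun σ => σ.sg * σ.la * σ.ep ^ 2) (fun σ => d i (σ.ub j)) := by
  have h := big_dub (N := N) i j
  have hX (σ : Stp N) : 0 ≤ σ.sg * σ.la * σ.ep ^ 2 :=
    mul_nonneg (mul_nonneg (sg_nn σ) (laU σ)) (sq_nonneg _)
  refine ⟨(h.of_le (by simp [lv])).mono_scale hX (fun σ => σ.L_pos.le) fun σ =>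
    mul_le_of_le_one_right σ.la_pos.le σ.ep_le, (b0_D_dub i j).le fun σ => ?_⟩
  simp only [Pi.mul_apply, τ]; exact le_of_eq (by ring)

lemma b0_D_of_mat {q : Stp N → PF ℝ} (h1 : ∀ j σ z, |d j (q σ) z| ≤ σ.sg ^ 2 * σ.la * σ.ep ^ 2)
    (h2 : ∀ σ z, |mat σ.u (q σ) z| ≤ σ.sg ^ 3 * σ.la * σ.ep ^ 2) :
    B0 U (fun σ : Stp N => σ.sg ^ 3 * σ.la * σ.ep ^ 2) (fun σ => σ.D (q σ)) := by
  have h3 := fun i => ((b0_vb (N := N) i).mul (b0_of_le (h1 i))).le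
    (Y := fun σ : Stp N => σ.sg ^ 3 * σ.la * σ.ep ^ 2) fun σ => by
      have h1 := σ.sg_pos; have h2 := σ.la_pos; have h3 := σ.ep_pos
      exact σ.drop 1 (by simp only [Pi.mul_apply]; ring) (by positivity)
  refine ((b0_of_le h2).sub ((h3 0).add (h3 1))).congr rfl ?_
  ext1 σ
  simp [mat_u]

/-! ### Old stress against the mean flow of the waves -/

/-- Indicator of the time intervals on which the old stress may be present. -/
def onn (i : Stp N × ℤ) : ℝ := if i.1.sg ^ 2 / 4 ≤ i.1.g (tl i) then 1 else 0

lemma gam_cf_eq (i : Stp N × ℤ) : gam i / 2 * cf i = onn i := by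
  rw [onn]; split_ifs with h
  · exact gam_cf h
  · rw [cf, if_neg h, mul_zero]

def cut (i : Stp N × ℤ) : PF ℝ := bmp chi contDiff_chi i * bmp chi contDiff_chi i

lemma cut_sup (i : Stp N × ℤ) : Sup (sl i) (cut i) := fun t ht x => by
  have h : ¬ |i.1.μ * t - (i.2 : ℝ)| ≤ 3 / 4 := ht
  rw [cut, mul_apply, bmp_apply, chi_zero (not_le.1 h).le, mul_zero]

/-- Difference of a quantity and its localised transported approximations. -/
def mism (q : Stp N → PF ℝ) (i : Stp N × ℤ) : PF ℝ :=
  C (onn i) * (cut i * (q i.1 - tr i (st i.1.L⁻¹ (lv N + 1) (q i.1))))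

lemma laZ (i : Stp N × ℤ) : 0 ≤ i.1.la := i.1.la_pos.le

lemma cu_mism {q : Stp N → PF ℝ} (h0 : ∀ σ z, |q σ z| ≤ σ.sg ^ 2 / 80)
    (h1 : ∀ j σ z, |d j (q σ) z| ≤ σ.sg ^ 2 * σ.la * σ.ep ^ 2)
    (h2 : ∀ σ z, |mat σ.u (q σ) z| ≤ σ.sg ^ 3 * σ.la * σ.ep ^ 2) :
    CU (fun σ => σ.sg ^ 2 * σ.ep) (fun σ => ∑ l ∈ ZF σ, mism q (σ, l)) := by
  have hm := cl_mismatch (X := fun σ : Stp N => σ.sg ^ 2) (fun σ => sq_nonneg _) (b0_of_sg h0)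
    (fun j => (b0_of_le (h1 j)).le fun σ => le_of_eq (by ring))
    ((b0_D_of_mat h1 h2).le fun σ => le_of_eq (by ring))
  have hb : Cl sl (fun i : Stp N × ℤ => i.1.la) (fun i => i.1.τ) (fun i => i.1.ub) 0 1
      (bmp chi contDiff_chi) :=
    (cl_bmp chi contDiff_chi chi_compact 0).mono_scale (fun _ => zero_le_one)
      (fun i => i.1.L_pos.le) (fun i => i.1.τ_pos.le) fun i => mul_le_of_le_one_right (laZ i) i.1.ep_le
  have ho : Cl sl (fun i : Stp N × ℤ => i.1.la) (fun i => i.1.τ) (fun i => i.1.ub) 0 1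
      (fun i => C (onn i)) := Cl.bdd laZ (fun i => i.1.τ_pos.le) zero_le_one fun i => by
    rw [onn]; split_ifs <;> norm_num
  refine total (f := mism q) ZF sl_closed cnt_sl (fun σ => mul_nonneg (sq_nonneg _) σ.ep_pos.le)
    ⟨(ho.mul ((hb.mul hb).mul hm)).congr ?_ rfl, fun i => ?_⟩
  · ext i; simp
  · refine Sup.mul ?_ _
    rw [mul_comm]
    exact (cut_sup i).mul _

lemma mem_ZF {σ : Stp N} {t : ℝ} (h : σ.dl < σ.g t) {l : ℤ} (hl : l = ⌊σ.μ * t⌋ ∨ l = ⌊σ.μ * t⌋ + 1) :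
    l ∈ ZF σ := by
  have ht : |t| ≤ |σ.fin.choose| := by
    by_contra hc
    have := σ.fin.choose_spec t ((le_abs_self _).trans (not_le.1 hc).le)
    linarith
  have h1 : |σ.μ * t| ≤ σ.μ * |σ.fin.choose| := by
    rw [abs_mul, abs_of_pos σ.μ_pos]; exact mul_le_mul_of_nonneg_left ht σ.μ_pos.le
  rw [abs_le] at h1
  have h2 := Int.le_ceil (σ.μ * |σ.fin.choose|)
  have h3 : ⌊σ.μ * t⌋ ≤ ⌈σ.μ * |σ.fin.choose|⌉ := by
    have := (Int.floor_le (σ.μ * t)).trans (h1.2.trans h2)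
    exact_mod_cast this
  have h4 : -⌈σ.μ * |σ.fin.choose|⌉ ≤ ⌊σ.μ * t⌋ := Int.le_floor.2 (by push_cast; linarith)
  rw [ZF, Finset.mem_Icc, Mx]
  omega

lemma sum_apply' {κ : Type} (s : Finset κ) (f : κ → PF ℝ) (z : ℝ × E2) :
    (∑ k ∈ s, f k) z = ∑ k ∈ s, f k z := by
  classical
  induction s using Finset.induction_on with
  | empty => rfl
  | insert a s ha ih => rw [Finset.sum_insert ha, Finset.sum_insert ha, add_apply, ih]

lemma sum_cut {σ : Stp N} {t : ℝ} (h : σ.dl < σ.g t) (x : E2) : ∑ l ∈ ZF σ, cut (σ, l) (t, x) = 1 := by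
  have hs : ({⌊σ.μ * t⌋, ⌊σ.μ * t⌋ + 1} : Finset ℤ) ⊆ ZF σ := by
    intro l hl
    exact mem_ZF h (by simpa using hl)
  rw [← Finset.sum_subset hs]
  · rw [Finset.sum_pair (by simp)]
    simp only [cut, mul_apply, bmp_apply]
    have := chi_sq (s := σ.μ * t - ⌊σ.μ * t⌋) ⟨by linarith [Int.floor_le (σ.μ * t)],
      by linarith [Int.lt_floor_add_one (σ.μ * t)]⟩
    push_cast
    rw [← sub_sub]
    linarith
  · intro l _ hl
    refine cut_sup (σ, l) t (fun hm => hl ?_) x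
    simpa using sl_mem hm

lemma sum_onn_cut {q : Stp N → PF ℝ} (hq : ∀ σ t, σ.sg ^ 2 / 2 ≤ σ.g t ∨ ∀ x, q σ (t, x) = 0)
    (hq' : ∀ (σ : Stp N) (l : ℤ), ¬ σ.sg ^ 2 / 4 ≤ σ.g (tl (σ, l)) → ∀ t ∈ sl (σ, l), ∀ x, q σ (t, x) = 0)
    (σ : Stp N) : q σ = ∑ l ∈ ZF σ, C (onn (σ, l)) * (cut (σ, l) * q σ) := by
  ext ⟨t, x⟩
  rw [sum_apply']
  rcases eq_or_ne (q σ (t, x)) 0 with h0 | h0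
  · simp [h0]
  have hg : σ.dl < σ.g t := by
    rcases hq σ t with h | h
    · have h1 := σ.dl_le; have h2 := pow_pos σ.sg_pos 2; linarith
    · exact absurd (h x) h0
  have h1 (l : ℤ) : (C (onn (σ, l)) * (cut (σ, l) * q σ)) (t, x) = cut (σ, l) (t, x) * q σ (t, x) := by
    simp only [mul_apply, algebraMap_apply]
    by_cases hm : t ∈ sl (σ, l)
    · have : σ.sg ^ 2 / 4 ≤ σ.g (tl (σ, l)) := by
        by_contra hc
        exact h0 (hq' σ l hc t hm x)
      rw [onn, if_pos this, one_mul]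
    · rw [cut_sup (σ, l) t hm x]; ring
  simp only [h1]
  rw [← Finset.sum_mul, sum_cut hg, one_mul]

lemma amp_sq (w : Stp N × WI) : C (1 / 2) * (amp w * amp w) =
    cut (w.1, w.2.1) * (C (gam (w.1, w.2.1) / 2) * ya w) := by
  ext z
  have h1 : √(gam (w.1, w.2.1)) * √(gam (w.1, w.2.1)) = gam (w.1, w.2.1) :=
    Real.mul_self_sqrt (gam_nonneg _)
  have h2 : srt (ya w z) * srt (ya w z) = ya w z := srt_sq (by linarith [ya_ge w z])
  simp only [amp, amp0, cut, mul_apply, algebraMap_apply]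
  change 1 / 2 * (_ * (_ * srt (ya w z)) * (_ * (_ * srt (ya w z)))) = _
  linear_combination (1 / 2 * (bmp chi contDiff_chi (w.1, w.2.1) z) ^ 2) *
    (srt (ya w z) * srt (ya w z) * h1 + gam (w.1, w.2.1) * h2)

/-- Error in the low frequency part of a wave. -/
def Er (a b : Fin 2) (w : Stp N × WI) : PF ℝ :=
  fs a w * fs b w + amp w * amp w * (nm a w * (ph w.1 w.2).n b + C (kR w.2 a) * nm b w)

/-- Isotropic part of the mean stress of the waves. -/
def Ziso (σ : Stp N) : PF ℝ := ∑ l ∈ ZF σ, cut (σ, l) * C (gam (σ, l) / 2)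

lemma d_cut (i : Stp N × ℤ) (j : Fin 2) : d j (cut i) = 0 := by
  rw [cut, Derivation.leibniz, bmp, d_ofK]; simp

lemma d_Ziso (σ : Stp N) (j : Fin 2) : d j (Ziso σ) = 0 := by
  rw [Ziso, map_sum]
  refine Finset.sum_eq_zero fun l _ => ?_
  rw [Derivation.leibniz, d_cut, d_C]; simp

lemma cu_Er (a b : Fin 2) :
    CU (N := N) (fun σ => σ.sg ^ 2 * σ.ep) (fun σ => ∑ I ∈ WF σ, Er a b (σ, I)) := by
  have hn : lv N - 1 ≤ lv N := Nat.sub_le _ _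
  have h1 : CS (N := N) (lv N - 1) (fun w => w.1.sg ^ 2 * w.1.ep) (fun w => fs a w * fs b w) :=
    ((cs_fs b).mul (cs_fs_ep a).1).congr (by ext w; simp only [Pi.mul_apply]; ring) rfl
  have h2 : CS (N := N) (lv N - 1) (fun w => w.1.sg ^ 2) (fun w => amp w * amp w) :=
    ((cs_amp.of_le hn).mul (cs_amp.of_le hn).1).congr (by ext w; simp only [Pi.mul_apply]; ring) rfl
  have h3 : CW (N := N) (lv N - 1) (fun w => w.1.ep)
      (fun w => nm a w * (ph w.1 w.2).n b + C (kR w.2 a) * nm b w) :=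
    (((cl_nm a).mul (cl_n b)).congr (mul_one _) rfl).add
      (((cl_kR a).mul (cl_nm b)).congr (one_mul _) rfl)
  have h4 : CS (N := N) (lv N - 1) (fun w => w.1.sg ^ 2 * w.1.ep) (Er a b) :=
    h1.add ((h2.mul (CW.act h3)).congr (by ext w; simp only [Pi.mul_apply]; ring)
      (by ext1 w; simp only [Pi.mul_apply]; ring))
  exact total_W (X := fun σ => σ.sg ^ 2 * σ.ep) (fun σ => mul_nonneg (sq_nonneg _) σ.ep_pos.le)
    (CS.final (fun w => mul_nonneg (sq_nonneg _) w.1.ep_pos.le) h4)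

lemma sum_WF {R : Type} [AddCommMonoid R] (σ : Stp N) (f : WI → R) :
    ∑ I ∈ WF σ, f I = ∑ l ∈ ZF σ, (f (l, 0) + f (l, 1) + f (l, 2)) := by
  rw [WF, Finset.sum_product]
  exact Finset.sum_congr rfl fun l _ => Fin.sum_univ_three _

lemma fs'_mul (a b : Fin 2) (w : Stp N × WI) : fs a w * fs b w + fs' a w * fs' b w =
    C (kR w.2 a * kR w.2 b) * (amp w * amp w) + Er a b w := by
  simp only [fs', Er, ph_n, map_mul]; ring

/-- The directions of one family of waves resolve the prescribed stress. -/
lemma sum_dir (σ : Stp N) (l : ℤ) :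
    (∑ κ : Fin 3, C (kR (l, κ) 1 * kR (l, κ) 1) * ya (σ, l, κ) = 1 - nst Stp.r (σ, l)) ∧
    (∑ κ : Fin 3, C (kR (l, κ) 0 * kR (l, κ) 1) * ya (σ, l, κ) = nst Stp.s (σ, l)) ∧
    (∑ κ : Fin 3, C (kR (l, κ) 0 * kR (l, κ) 0) * ya (σ, l, κ) = 1 + nst Stp.r (σ, l)) := by
  by_cases hl : Even l <;>
  · simp only [Fin.sum_univ_three, ya, kR, kz, kv, key, cα, cβ, cγ, sgnI, hl]
    refine ⟨?_, ?_, ?_⟩ <;>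
    · ext z
      simp
      ring

lemma amp_dir (σ : Stp N) (l : ℤ) (k : Fin 3 → ℝ) :
    ∑ κ : Fin 3, C (1 / 2) * (C (k κ) * (amp (σ, l, κ) * amp (σ, l, κ))) =
      cut (σ, l) * (C (gam (σ, l) / 2) * ∑ κ : Fin 3, C (k κ) * ya (σ, l, κ)) := by
  rw [Finset.mul_sum, Finset.mul_sum]
  refine Finset.sum_congr rfl fun κ _ => ?_
  have := amp_sq (σ, l, κ)
  simp only at this
  linear_combination C (k κ) * this

lemma nst_onn (q : Stp N → PF ℝ) (i : Stp N × ℤ) :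
    C (gam i / 2) * nst q i = C (onn i) * tr i (st i.1.L⁻¹ (lv N + 1) (q i.1)) := by
  rw [nst, ← mul_assoc, ← map_mul, gam_cf_eq]

lemma r_eq_sum (σ : Stp N) : σ.r = ∑ l ∈ ZF σ, C (onn (σ, l)) * (cut (σ, l) * σ.r) :=
  sum_onn_cut (q := Stp.r) (fun σ t => (σ.gap t).imp id fun h x => (h x).1)
    (fun σ l hl _ ht x => (rs_zero (i := (σ, l)) hl ht x).1) σ
lemma s_eq_sum (σ : Stp N) : σ.s = ∑ l ∈ ZF σ, C (onn (σ, l)) * (cut (σ, l) * σ.s) :=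
  sum_onn_cut (q := Stp.s) (fun σ t => (σ.gap t).imp id fun h x => (h x).2)
    (fun σ l hl _ ht x => (rs_zero (i := (σ, l)) hl ht x).2) σ

lemma low_dir (σ : Stp N) (k : WI → ℝ) (E : WI → PF ℝ) :
    ∑ I ∈ WF σ, C (1 / 2) * (C (k I) * (amp (σ, I) * amp (σ, I)) + E I) =
      ∑ l ∈ ZF σ, cut (σ, l) * (C (gam (σ, l) / 2) * ∑ κ : Fin 3, C (k (l, κ)) * ya (σ, l, κ)) +
        C (1 / 2) * ∑ I ∈ WF σ, E I := by
  rw [Finset.mul_sum, sum_WF, sum_WF, ← Finset.sum_add_distrib]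
  refine Finset.sum_congr rfl fun l _ => ?_
  rw [← amp_dir, Fin.sum_univ_three]; ring

lemma low_r (σ : Stp N) : σ.r + ∑ I ∈ WF σ, Lo (σ, I) 0 0 =
    ∑ l ∈ ZF σ, mism Stp.r (σ, l) + Ziso σ + C (1 / 2) * ∑ I ∈ WF σ, Er 1 1 (σ, I) := by
  have h := low_dir σ (fun I => kR I 1 * kR I 1) fun I => Er 1 1 (σ, I)
  have e : ∀ I, Lo (σ, I) 0 0 = C (1 / 2) * (C (kR I 1 * kR I 1) * (amp (σ, I) * amp (σ, I)) + Er 1 1 (σ, I)) :=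
    fun I => by rw [← fs'_mul 1 1 (σ, I)]; rfl
  simp only [e]
  rw [h, ← add_assoc]
  congr 1
  nth_rw 1 [r_eq_sum σ]
  rw [Ziso, ← Finset.sum_add_distrib, ← Finset.sum_add_distrib]
  refine Finset.sum_congr rfl fun l _ => ?_
  rw [(sum_dir σ l).1, mism]
  linear_combination (-cut (σ, l)) * nst_onn Stp.r (σ, l)

lemma low_r' (σ : Stp N) : -σ.r + ∑ I ∈ WF σ, Lo (σ, I) 1 1 =
    -∑ l ∈ ZF σ, mism Stp.r (σ, l) + Ziso σ + C (1 / 2) * ∑ I ∈ WF σ, Er 0 0 (σ, I) := by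
  have h := low_dir σ (fun I => kR I 0 * kR I 0) fun I => Er 0 0 (σ, I)
  have e : ∀ I, Lo (σ, I) 1 1 = C (1 / 2) * (C (kR I 0 * kR I 0) * (amp (σ, I) * amp (σ, I)) + Er 0 0 (σ, I)) :=
    fun I => by rw [← fs'_mul 0 0 (σ, I)]; rfl
  simp only [e]
  rw [h, ← add_assoc]
  congr 1
  nth_rw 1 [r_eq_sum σ]
  rw [Ziso, ← Finset.sum_neg_distrib, ← Finset.sum_neg_distrib, ← Finset.sum_add_distrib, ← Finset.sum_add_distrib]
  refine Finset.sum_congr rfl fun l _ => ?_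
  rw [(sum_dir σ l).2.2, mism]
  linear_combination (cut (σ, l)) * nst_onn Stp.r (σ, l)

lemma low_s (σ : Stp N) : σ.s + ∑ I ∈ WF σ, Lo (σ, I) 0 1 =
    ∑ l ∈ ZF σ, mism Stp.s (σ, l) - C (1 / 2) * ∑ I ∈ WF σ, Er 0 1 (σ, I) := by
  have h := low_dir σ (fun I => kR I 0 * kR I 1) fun I => Er 0 1 (σ, I)
  have e : ∀ I, Lo (σ, I) 0 1 = -(C (1 / 2) * (C (kR I 0 * kR I 1) * (amp (σ, I) * amp (σ, I)) + Er 0 1 (σ, I))) :=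
    fun I => by rw [← fs'_mul 0 1 (σ, I), ← mul_neg]; rfl
  simp only [e]
  rw [Finset.sum_neg_distrib, h, neg_add, ← add_assoc, sub_eq_add_neg]
  congr 1
  nth_rw 1 [s_eq_sum σ]
  rw [← Finset.sum_neg_distrib, ← Finset.sum_add_distrib]
  refine Finset.sum_congr rfl fun l _ => ?_
  rw [(sum_dir σ l).2.1, mism]
  linear_combination (-cut (σ, l)) * nst_onn Stp.s (σ, l)

lemma Lo_symm (w : Stp N × WI) : Lo w 1 0 = Lo w 0 1 := rfl

end Stp

/-- The velocity field of a stream function. -/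
def curl (f : PF ℝ) : Fin 2 → PF ℝ := ![-d 1 f, d 0 f]

lemma div_curl (f : PF ℝ) : d 0 (curl f 0) + d 1 (curl f 1) = 0 := by
  simp [curl, d_comm 1 0]

section
variable (v w : Fin 2 → PF ℝ) (f : PF ℝ) (l : ℝ)

/-- Pressure generated by a stream function. -/
def Qp : PF ℝ := C (1 / 2) * (d 0 f * d 0 f + d 1 f * d 1 f + C l ^ 2 * (f * f))

lemma C_half : (C (1 / 2) : PF ℝ) * 2 = 1 := by
  rw [← map_ofNat (algebraMap ℝ (PF ℝ)) 2, ← map_mul]; norm_num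

/-- Quadratic self-interaction of a stream function. -/
lemma curl_quad (j : Fin 2) : curl f 0 * d 0 (curl f j) + curl f 1 * d 1 (curl f j) =
    d j (Qp f l) - (d 0 (d 0 f) + d 1 (d 1 f) + C l ^ 2 * f) * d j f := by
  have h := C_half
  fin_cases j <;>
  · simp [curl, Qp, Derivation.leibniz, d_C, d_comm 1 0, Derivation.leibniz_pow, -one_div]
    first
    | linear_combination (-(d 0 f * d 0 (d 0 f) + d 1 f * d 0 (d 1 f) + C l ^ 2 * f * d 0 f)) * h
    | linear_combination (-(d 0 f * d 0 (d 1 f) + d 1 f * d 1 (d 1 f) + C l ^ 2 * f * d 1 f)) * h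

lemma curl_div (j : Fin 2) : curl f 0 * d 0 (curl f j) + curl f 1 * d 1 (curl f j) =
    d 0 (curl f 0 * curl f j) + d 1 (curl f 1 * curl f j) := by
  simp only [Derivation.leibniz, smul_eq_mul]
  linear_combination (-curl f j) * div_curl f

variable {v w}
lemma pert_lin (hv : d 0 (v 0) + d 1 (v 1) = 0) :
    mat v (curl f 0) + (curl f 0 * d 0 (v 0) + curl f 1 * d 1 (v 0)) = curl (mat v f) 0 +
      (d 0 (2 * (f * d 1 (v 0))) + d 1 (2 * (f * d 1 (v 1)))) ∧
    mat v (curl f 1) + (curl f 0 * d 0 (v 1) + curl f 1 * d 1 (v 1)) = curl (mat v f) 1 +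
      (d 0 (2 * (f * d 1 (v 1))) - d 1 (2 * (f * d 0 (v 1)))) := by
  have h0 : d 0 (d 0 (v 0)) + d 0 (d 1 (v 1)) = 0 := by rw [← map_add, hv, map_zero]
  have h1 : d 0 (d 1 (v 0)) + d 1 (d 1 (v 1)) = 0 := by rw [d_comm 0 1, ← map_add, hv, map_zero]
  have e2 : ∀ j : Fin 2, d j (2 : PF ℝ) = 0 := fun j => by
    rw [← map_ofNat (algebraMap ℝ (PF ℝ)) 2]; exact d_C _ _
  constructor
  · simp only [curl, Matrix.cons_val_zero, Matrix.cons_val_one, map_neg, mat_d]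
    simp only [Derivation.leibniz, smul_eq_mul, e2, d_comm 1 0]
    linear_combination (-d 1 f) * hv - 2 * f * h1
  · simp only [curl, Matrix.cons_val_zero, Matrix.cons_val_one, map_neg, mat_d]
    simp only [Derivation.leibniz, smul_eq_mul, e2, d_comm 1 0]
    linear_combination (-d 0 f) * hv

lemma pert_cross (hw : d 0 (w 0) + d 1 (w 1) = 0) (j : Fin 2) :
    w 0 * d 0 (curl f j) + w 1 * d 1 (curl f j) + (curl f 0 * d 0 (w j) + curl f 1 * d 1 (w j)) =
      d 0 (w 0 * curl f j + curl f 0 * w j) + d 1 (w 1 * curl f j + curl f 1 * w j) := by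
  simp only [map_add, Derivation.leibniz, smul_eq_mul]
  linear_combination (-curl f j) * hw - w j * div_curl f

/-- Crude inverse of the divergence of symmetric fields with vanishing mean. -/
def anti (G : Fin 2 → PF ℝ) : Fin 2 → Fin 2 → PF ℝ :=
  ![![prim 0 (G 0), prim 1 (mn 0 (G 0)) + prim 0 (mn 1 (G 1))],
    ![prim 1 (mn 0 (G 0)) + prim 0 (mn 1 (G 1)), prim 1 (G 1)]]

lemma div_anti {G : Fin 2 → PF ℝ} (h : ∀ j, mean (G j) = 0) (j : Fin 2) :
    d 0 (anti G j 0) + d 1 (anti G j 1) = G j := by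
  have h0 : mn 1 (mn 0 (G 0)) = 0 := by rw [mn_comm]; exact h 0
  have h1 : mn 0 (mn 1 (G 1)) = 0 := h 1
  have e0 : d 1 (prim 0 (mn 1 (G 1))) = 0 := by
    rw [dv_prim, dv_mn, mn_d, prim_zero]
  have e1 : d 0 (prim 1 (mn 0 (G 0))) = 0 := by
    rw [dv_prim, dv_mn, mn_d, prim_zero]
  fin_cases j
  · simp only [anti, Fin.zero_eta, Matrix.cons_val_zero, Matrix.cons_val_one, map_add, d_prim, e0, e1, h0]; ring
  · simp only [anti, Fin.mk_one, Matrix.cons_val_zero, Matrix.cons_val_one, map_add, d_prim, e0, e1, h1]; ring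

end
namespace Stp
variable {N : ℕ}

/-! ### The crude remainder -/

lemma la9_ep (σ : Stp N) : σ.la ^ 9 * σ.ep ^ N ≤ 1 := by
  have h1 := σ.la_pos
  have h : σ.la * (σ.la ^ 9 * σ.ep ^ N) ≤ σ.la * 1 := by linarith [σ.tiny, σ.sg_le, show σ.la * (σ.la ^ 9 * σ.ep ^ N) = σ.la ^ 10 * σ.ep ^ N by ring]
  exact le_of_mul_le_mul_left h h1

lemma epN_le (σ : Stp N) : σ.ep ^ N * xX σ ≤ σ.sg ^ 2 * σ.ep := by
  have h1 := σ.la_pos; have h2 := σ.ep_pos; have h3 := σ.sg_pos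
  have h4 : σ.la ≤ σ.la ^ 9 := le_self_pow₀ σ.la_ge (by norm_num)
  have h5 : σ.la * σ.ep ^ N ≤ 1 := (mul_le_mul_of_nonneg_right h4 (by positivity)).trans σ.la9_ep
  calc σ.ep ^ N * xX σ = (σ.la * σ.ep ^ N) * (σ.sg ^ 2 * σ.ep) := by rw [xX]; ring
    _ ≤ 1 * (σ.sg ^ 2 * σ.ep) := mul_le_mul_of_nonneg_right h5 (by positivity)
    _ = _ := one_mul _

lemma epN_le' (σ : Stp N) : σ.la ^ 2 * (σ.ep ^ N * xX σ) ≤ σ.τ * (σ.sg ^ 2 * σ.ep) := by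
  have h1 := σ.la_pos; have h2 := σ.ep_pos; have h3 := σ.sg_pos
  have h4 : σ.la ^ 3 * σ.ep ^ N ≤ σ.la ^ 10 * σ.ep ^ N :=
    mul_le_mul_of_nonneg_right (pow_le_pow_right₀ σ.la_ge (by norm_num)) (by positivity)
  have h6 : σ.sg ≤ σ.sg * σ.la := le_mul_of_one_le_right h3.le σ.la_ge
  calc σ.la ^ 2 * (σ.ep ^ N * xX σ) = (σ.la ^ 3 * σ.ep ^ N) * (σ.sg ^ 2 * σ.ep) := by rw [xX]; ring
    _ ≤ σ.τ * (σ.sg ^ 2 * σ.ep) :=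
      mul_le_mul_of_nonneg_right (h4.trans (σ.tiny.trans h6)) (by positivity)

lemma cu_op {Op : PF ℝ → PF ℝ} (hc : ∀ v f, dv v (Op f) = Op (dv v f))
    (hb : ∀ (f : PF ℝ) k M, (∀ x, |f (k, x)| ≤ M) → ∀ x, |Op f (k, x)| ≤ 2 * π * M)
    {f : Stp N → PF ℝ} (hf : CU (fun σ => σ.ep ^ N * xX σ) f) :
    CU (fun σ => σ.sg ^ 2 * σ.ep) (fun σ => Op (f σ)) := by
  have hop : ∀ {X : Stp N → ℝ} {f : Stp N → PF ℝ}, B0 U X f → B0 U X (fun σ => Op (f σ)) := by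
    rintro X f ⟨C, hC, h⟩
    refine ⟨2 * π * C, by positivity, fun σ k hk x => ?_⟩
    rw [mul_assoc]
    exact hb _ _ _ (h σ k hk) x
  have h0 : B0 U (fun σ : Stp N => σ.ep ^ N * xX σ) f := hf.1.b0
  have h1 : ∀ j, B0 U (fun σ : Stp N => σ.la * (σ.ep ^ N * xX σ)) (fun σ => d j (f σ)) := fun j =>
    hf.1.d j
  have h2 : B0 U (fun σ : Stp N => σ.τ * (σ.ep ^ N * xX σ)) (fun σ => σ.D (f σ)) := hf.2
  have hq : ∀ σ : Stp N, 0 ≤ σ.ep ^ N * xX σ := fun σ =>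
    mul_nonneg (pow_nonneg σ.ep_pos.le _) (xX_nonneg σ)
  have hub : ∀ j, B0 U (fun σ : Stp N => σ.la) (fun σ => σ.ub j) := fun j => (big_ub j).b0
  have h3 : ∀ {g : Stp N → Fin 2 → PF ℝ}, (∀ j, B0 U (fun σ : Stp N => σ.la * (σ.ep ^ N * xX σ))
      (fun σ => g σ j)) → B0 U (fun σ : Stp N => σ.la ^ 2 * (σ.ep ^ N * xX σ))
      (fun σ => σ.ub 0 * g σ 0 + σ.ub 1 * g σ 1) := fun hg =>
    (((hub 0).mul (hg 0)).add ((hub 1).mul (hg 1))).congr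
      (by ext σ; simp only [Pi.mul_apply]; ring) rfl
  have h4 : B0 U (fun σ : Stp N => σ.la ^ 2 * (σ.ep ^ N * xX σ)) (fun σ => dt (f σ)) := by
    refine ((h2.le fun σ => ?_).sub (h3 (g := fun σ j => d j (f σ)) h1)).congr rfl ?_
    · refine mul_le_mul_of_nonneg_right ?_ (hq σ)
      rw [τ, pow_two]; exact mul_le_mul_of_nonneg_right σ.sg_le (laU σ)
    · ext1 σ; simp [mat_apply]
  have h5 : ∀ j, B0 U (fun σ : Stp N => σ.la * (σ.ep ^ N * xX σ)) (fun σ => d j (Op (f σ))) :=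
    fun j => (hop (h1 j)).congr rfl (by ext1 σ; exact (hc _ _).symm)
  have h6 : B0 U (fun σ : Stp N => σ.la ^ 2 * (σ.ep ^ N * xX σ)) (fun σ => dt (Op (f σ))) :=
    (hop h4).congr rfl (by ext1 σ; exact (hc _ _).symm)
  refine CU.mk ((hop h0).le epN_le) (fun j => (h5 j).le fun σ =>
    mul_le_mul_of_nonneg_left (epN_le σ) (laU σ)) ?_
  refine ((h6.add (h3 (g := fun σ j => d j (Op (f σ))) h5)).le epN_le').congr rfl ?_
  ext1 σ; simp [mat_apply]

lemma cu_prim (i : Fin 2) {f : Stp N → PF ℝ} (hf : CU (fun σ => σ.ep ^ N * xX σ) f) :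
    CU (fun σ => σ.sg ^ 2 * σ.ep) (fun σ => prim i (f σ)) :=
  cu_op (fun v f => dv_prim v i f) (fun f k _ h x => abs_prim_le i f k h x) hf

lemma cu_prim_mn (i j : Fin 2) {f : Stp N → PF ℝ} (hf : CU (fun σ => σ.ep ^ N * xX σ) f) :
    CU (fun σ => σ.sg ^ 2 * σ.ep) (fun σ => prim i (mn j (f σ))) :=
  cu_op (Op := fun f => prim i (mn j f)) (fun v f => by rw [dv_prim, dv_mn])
    (fun f k _ h x => abs_prim_le i _ k (abs_mn_le j f k h) x) hf

lemma cu_anti {G : Stp N → Fin 2 → PF ℝ} (hG : ∀ j, CU (fun σ => σ.ep ^ N * xX σ) (fun σ => G σ j))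
    (a b : Fin 2) : CU (fun σ => σ.sg ^ 2 * σ.ep) (fun σ => anti (G σ) a b) := by
  have h := (cu_prim_mn 1 0 (hG 0)).add (cu_prim_mn 0 1 (hG 1))
  fin_cases a <;> fin_cases b
  · exact cu_prim 0 (hG 0)
  · exact h
  · exact h
  · exact cu_prim 1 (hG 1)

lemma anti_zero_at {G : Fin 2 → PF ℝ} {t : ℝ} (h : ∀ j x, G j (t, x) = 0) (a b : Fin 2) (x : E2) :
    anti G a b (t, x) = 0 := by
  have h1 : ∀ i (f : PF ℝ), (∀ x, f (t, x) = 0) → ∀ x, prim i f (t, x) = 0 := fun i f hf x => by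
    have := abs_prim_le i f t (M := 0) (fun x => by simp [hf x]) x
    simpa using this
  have h2 : ∀ i (f : PF ℝ), (∀ x, f (t, x) = 0) → ∀ x, mn i f (t, x) = 0 := fun i f hf x => by
    have := abs_mn_le i f t (M := 0) (fun x => by simp [hf x]) x
    simpa using this
  have h3 : (prim 1 (mn 0 (G 0)) + prim 0 (mn 1 (G 1))) (t, x) = 0 := by
    rw [add_apply, h1 _ _ (h2 _ _ (h 0)), h1 _ _ (h2 _ _ (h 1)), add_zero]
  fin_cases a <;> fin_cases b
  · exact h1 _ _ (h 0) x
  · exact h3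
  · exact h3
  · exact h1 _ _ (h 1) x

/-! ### The new velocity and stress -/

/-- The perturbation. -/
def wv (σ : Stp N) (j : Fin 2) : PF ℝ := curl σ.psi j

/-- The new velocity. -/
def uv (σ : Stp N) (j : Fin 2) : PF ℝ := σ.u j + σ.wv j

/-- Some wave is active at time `t`. -/
def Act (σ : Stp N) (t : ℝ) : Prop := ∃ l, t ∈ asl (σ, l)

lemma cu_wv (j : Fin 2) : CU (N := N) (fun σ => σ.sg) (fun σ => σ.wv j) := by
  fin_cases j
  · exact (cu_dpsi 1).neg
  · exact cu_dpsi 0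

lemma psi_act {σ : Stp N} {t : ℝ} (h : ¬ σ.Act t) (x : E2) : σ.psi (t, x) = 0 := by
  rw [psi, sum_apply']
  refine Finset.sum_eq_zero fun I _ => ?_
  have h1 := cs_amp.2 (σ, I) t (fun hh => h ⟨_, hh⟩) x
  rw [psw, mul_apply, mul_apply, h1]; ring

lemma mism_act {σ : Stp N} {t : ℝ} (h : ¬ σ.Act t) (q : Stp N → PF ℝ) (l : ℤ) (x : E2) :
    mism q (σ, l) (t, x) = 0 := by
  rw [mism, mul_apply, mul_apply, algebraMap_apply]
  by_cases hs : t ∈ sl (σ, l)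
  · have hg : gam (σ, l) = 0 := by
      by_contra hc; exact h ⟨l, hs, hc⟩
    have : onn (σ, l) = 0 := by rw [← gam_cf_eq, hg]; ring
    rw [this]; ring
  · rw [cut_sup (σ, l) t hs x]; ring

lemma dpsi_act {σ : Stp N} {t : ℝ} (h : ¬ σ.Act t) (j : Fin 2) (x : E2) : d j σ.psi (t, x) = 0 := by
  rw [psi, map_sum, sum_apply']
  refine Finset.sum_eq_zero fun I _ => ?_
  have h1 := cs_fs (N := N) j
  have h2 := cs_fs' (N := N) j
  rw [d_psw, add_apply, mul_apply, mul_apply, h1.2 (σ, I) t (fun hh => h ⟨_, hh⟩) x,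
    h2.2 (σ, I) t (fun hh => h ⟨_, hh⟩) x]; ring

lemma wv_act {σ : Stp N} {t : ℝ} (h : ¬ σ.Act t) (j : Fin 2) (x : E2) : σ.wv j (t, x) = 0 := by
  fin_cases j
  · change (-d 1 σ.psi) (t, x) = 0
    rw [neg_apply, dpsi_act h, neg_zero]
  · exact dpsi_act h 0 x

lemma Er_act {σ : Stp N} {t : ℝ} (h : ¬ σ.Act t) (a b : Fin 2) (I : WI) (x : E2) :
    Er a b (σ, I) (t, x) = 0 := by
  have h1 := cs_amp.2 (σ, I) t (fun hh => h ⟨_, hh⟩) x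
  have h2 := (cs_fs (N := N) a).2 (σ, I) t (fun hh => h ⟨_, hh⟩) x
  simp [Er, h1, h2]

lemma sum_act {κ : Type} {s : Finset κ} {f : κ → PF ℝ} {z : ℝ × E2} (h : ∀ k, f k z = 0) :
    (∑ k ∈ s, f k) z = 0 := by
  rw [sum_apply']; exact Finset.sum_eq_zero fun k _ => h k

lemma div_vb (σ : Stp N) : d 0 (σ.vb 0) + d 1 (σ.vb 1) = 0 := by
  have h1 := σ.div_u
  have h2 := σ.div_ub
  simp only [vb, map_sub]
  linear_combination h1 - h2

/-- Sum of the oscillating terms. -/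
def osum (σ : Stp N) (j : Fin 2) : PF ℝ :=
  ∑ x ∈ XF σ, (xB j (σ, x) * (phx (σ, x)).c + xB' j (σ, x) * (phx (σ, x)).s)

/-- Pressure correction. -/
def dpr (σ : Stp N) : PF ℝ := Qp σ.psi σ.la - ∑ I ∈ WF σ, Po (σ, I)

lemma quad_eq (σ : Stp N) (j : Fin 2) :
    curl (σ.D σ.psi) j + (σ.wv 0 * d 0 (σ.wv j) + σ.wv 1 * d 1 (σ.wv j)) =
      d j σ.dpr + (σ.osum j + (d 0 (∑ I ∈ WF σ, Lo (σ, I) j 0) + d 1 (∑ I ∈ WF σ, Lo (σ, I) j 1))) := by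
  have h1 := psi_eq σ j
  have h2 := curl_quad σ.psi σ.la j
  change curl (σ.D σ.psi) j + (curl σ.psi 0 * d 0 (curl σ.psi j) + curl σ.psi 1 * d 1 (curl σ.psi j)) = _
  rw [dpr, map_sub, osum]
  have h3 : ![-d 1 (σ.D σ.psi), d 0 (σ.D σ.psi)] j = curl (σ.D σ.psi) j := rfl
  rw [h3] at h1
  linear_combination h1 + h2

lemma mean_curl (f : PF ℝ) (j : Fin 2) : mean (curl f j) = 0 := by
  fin_cases j
  · change mean (-d 1 f) = 0
    rw [← neg_zero, ← mean_d 1 f]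
    exact map_neg _ _
  · exact mean_d 0 f

lemma mean_osum (σ : Stp N) (j : Fin 2) : mean (σ.osum j) = 0 := by
  have h1 := quad_eq σ j
  have h2 := curl_div σ.psi j
  change σ.wv 0 * d 0 (σ.wv j) + σ.wv 1 * d 1 (σ.wv j) = _ at h2
  rw [h2] at h1
  have h4 := congrArg mean h1
  simp only [map_add, map_sub, mean_d, mean_curl] at h4
  linear_combination -h4

/-- The new stress, before the trace is removed. -/
def nst' (σ : Stp N) (S : Fin 2 → Fin 2 → PF ℝ) (G : Fin 2 → PF ℝ) : Fin 2 → Fin 2 → PF ℝ :=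
  let o := ∑ l ∈ ZF σ, mism Stp.s (σ, l) - C (1 / 2) * ∑ I ∈ WF σ, Er 0 1 (σ, I)
    + 2 * (σ.psi * d 1 (σ.ub 1)) + (σ.vb 0 * σ.wv 1 + σ.wv 0 * σ.vb 1) + (S 0 1 + anti G 0 1)
  ![![∑ l ∈ ZF σ, mism Stp.r (σ, l) + C (1 / 2) * ∑ I ∈ WF σ, Er 1 1 (σ, I)
      + 2 * (σ.psi * d 1 (σ.ub 0)) + (σ.vb 0 * σ.wv 0 + σ.wv 0 * σ.vb 0) + (S 0 0 + anti G 0 0), o],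
    ![o, -∑ l ∈ ZF σ, mism Stp.r (σ, l) + C (1 / 2) * ∑ I ∈ WF σ, Er 0 0 (σ, I)
      - 2 * (σ.psi * d 0 (σ.ub 1)) + (σ.vb 1 * σ.wv 1 + σ.wv 1 * σ.vb 1) + (S 1 1 + anti G 1 1)]]

lemma mat_split (σ : Stp N) (j : Fin 2) : mat σ.uv (σ.uv j) = mat σ.u (σ.u j) +
    (σ.D (σ.wv j) + (σ.wv 0 * d 0 (σ.ub j) + σ.wv 1 * d 1 (σ.ub j))) +
    (σ.vb 0 * d 0 (σ.wv j) + σ.vb 1 * d 1 (σ.wv j) + (σ.wv 0 * d 0 (σ.vb j) + σ.wv 1 * d 1 (σ.vb j)))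
    + (σ.wv 0 * d 0 (σ.wv j) + σ.wv 1 * d 1 (σ.wv j)) := by
  simp only [mat_apply, uv, vb, map_add, map_sub]; ring

lemma momentum (σ : Stp N) {S : Fin 2 → Fin 2 → PF ℝ} {G : Fin 2 → PF ℝ} (hS : S 1 0 = S 0 1)
    (hG : ∀ j, σ.osum j = d 0 (S j 0) + d 1 (S j 1) + G j) (j : Fin 2) :
    mat σ.uv (σ.uv j) + d j (σ.p - σ.dpr) = d 0 (nst' σ S G j 0) + d 1 (nst' σ S G j 1) := by
  have hm : ∀ j, mean (G j) = 0 := fun j => by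
    have h := congrArg mean (hG j)
    simp only [map_add, mean_d, mean_osum] at h
    linear_combination -h
  have ha := div_anti hm j
  have hq := quad_eq σ j
  have hc := pert_cross σ.psi σ.div_vb j
  have hl := pert_lin (v := σ.ub) σ.psi σ.div_ub
  have hs := mat_split σ j
  have hg := hG j
  have hr := congrArg (d 0) (low_r σ)
  have hr' := congrArg (d 1) (low_r' σ)
  have hs0 := congrArg (d 0) (low_s σ)
  have hs1 := congrArg (d 1) (low_s σ)
  have hz : ∀ I : WI, Lo (σ, I) 1 0 = Lo (σ, I) 0 1 := fun I => Lo_symm _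
  have ea : anti G 1 0 = anti G 0 1 := rfl
  change σ.vb 0 * d 0 (σ.wv j) + σ.vb 1 * d 1 (σ.wv j) + (σ.wv 0 * d 0 (σ.vb j) + σ.wv 1 * d 1 (σ.vb j)) =
    d 0 (σ.vb 0 * σ.wv j + σ.wv 0 * σ.vb j) + d 1 (σ.vb 1 * σ.wv j + σ.wv 1 * σ.vb j) at hc
  rw [hs, map_sub]
  fin_cases j
  · have h1 := hl.1
    have c1 : σ.vb 1 * σ.wv 0 + σ.wv 1 * σ.vb 0 = σ.vb 0 * σ.wv 1 + σ.wv 0 * σ.vb 1 := by ring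
    change σ.D (σ.wv 0) + (σ.wv 0 * d 0 (σ.ub 0) + σ.wv 1 * d 1 (σ.ub 0)) = _ at h1
    have e0 := σ.eq0
    simp only [Fin.zero_eta, nst', Matrix.cons_val_zero, Matrix.cons_val_one, c1] at *
    simp only [map_add, map_sub, map_neg, d_Ziso] at *
    linear_combination e0 + h1 + hc + hq + hg - ha + hr + hs1
  · have h1 := hl.2
    change σ.D (σ.wv 1) + (σ.wv 0 * d 0 (σ.ub 1) + σ.wv 1 * d 1 (σ.ub 1)) = _ at h1
    have e1 := σ.eq1
    simp only [Fin.mk_one, nst', Matrix.cons_val_zero, Matrix.cons_val_one, hz, ea, hS] at *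
    simp only [map_add, map_sub, map_neg, d_Ziso] at *
    linear_combination e1 + h1 + hc + hq + hg - ha + hs0 + hr'

lemma CU.mulc {X : Stp N → ℝ} {f : Stp N → PF ℝ} (h : CU X f) (c : ℝ) :
    CU X (fun σ => C c * f σ) :=
  ((Cl.bdd laU τU (abs_nonneg c) fun _ => le_rfl).mul h).congr (one_mul _) rfl

lemma CU.mul' {X Y Z : Stp N → ℝ} {f g : Stp N → PF ℝ} (hf : CU X f) (hg : CU Y g)
    (h : ∀ σ, X σ * Y σ ≤ Z σ) : CU Z (fun σ => f σ * g σ) := CU.mul_le hf hg h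

lemma cu_lapsi : CU (N := N) (fun σ => σ.sg) (fun σ => C σ.la * σ.psi) := by
  have h : CU (N := N) (fun σ => |σ.la|) (fun σ => C σ.la) := Cl.const _
  have h1 := CU.mul' (Z := fun σ => σ.sg) h cu_psi fun σ => by
    have := σ.la_pos.ne'
    rw [abs_of_pos σ.la_pos, mul_inv_cancel_left₀ this]
  exact h1

lemma cu_dpr : CU (N := N) (fun σ => σ.sg ^ 2) dpr := by
  have h2 (σ : Stp N) : σ.sg * σ.sg ≤ σ.sg ^ 2 := (pow_two _).ge
  have hd (j : Fin 2) : CU (N := N) (fun σ => σ.sg ^ 2) (fun σ => d j σ.psi * d j σ.psi) :=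
    CU.mul' (cu_dpsi j) (cu_dpsi j) h2
  have hl : CU (N := N) (fun σ => σ.sg ^ 2) (fun σ => C σ.la ^ 2 * (σ.psi * σ.psi)) :=
    (CU.mul' cu_lapsi cu_lapsi h2).congr rfl (by ext1 σ; ring)
  have hq : CU (N := N) (fun σ => σ.sg ^ 2) (fun σ => Qp σ.psi σ.la) :=
    CU.mulc (((hd 0).add (hd 1)).add hl) (1 / 2)
  have hn : lv N - 1 ≤ lv N := Nat.sub_le _ _
  have hc {f g : Stp N × WI → PF ℝ} (hf : CS (N := N) (lv N - 1) (fun w => w.1.sg) f)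
      (hg : CS (N := N) (lv N - 1) (fun w => w.1.sg) g) :
      CS (N := N) (lv N - 1) (fun w => w.1.sg ^ 2) (fun w => f w * g w) :=
    (hg.mul hf.1).congr (by ext w; simp only [Pi.mul_apply]; ring) rfl
  have ha := cs_amp.of_le hn
  have hp : CS (N := N) (lv N - 1) (fun w => w.1.sg ^ 2) Po :=
    ((((hc (cs_fs 0) (cs_fs 0)).add (hc (cs_fs 1) (cs_fs 1))).add
      ((hc (cs_fs' 0) (cs_fs' 0)).add (hc (cs_fs' 1) (cs_fs' 1)))).add (hc ha ha)).mul_one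
      (Cl.bdd LW τW (zero_le_one) (c := fun _ => 1 / 4) fun _ => by norm_num [abs_le])
  exact hq.sub (total_W (X := fun σ => σ.sg ^ 2) (fun σ => sq_nonneg _)
    (CS.final (fun w => sq_nonneg _) hp))

lemma nst'_symm (σ : Stp N) (S : Fin 2 → Fin 2 → PF ℝ) (G : Fin 2 → PF ℝ) :
    nst' σ S G 1 0 = nst' σ S G 0 1 := rfl

theorem exists_stress (N : ℕ) : ∃ A : Stp N → Fin 2 → Fin 2 → PF ℝ,
    (∀ σ, A σ 1 0 = A σ 0 1) ∧ (∀ a b, CU (fun σ => σ.sg ^ 2 * σ.ep) (fun σ => A σ a b)) ∧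
    (∀ σ t, ¬ σ.Act t → ∀ a b x, A σ a b (t, x) = 0) ∧
    ∀ σ j, mat σ.uv (σ.uv j) + d j (σ.p - σ.dpr) = d 0 (A σ j 0) + d 1 (A σ j 1) := by
  obtain ⟨T, Q, Q', hT, hb, hQ, hQ', h⟩ := exists_xT N
  let S : Stp N → Fin 2 → Fin 2 → PF ℝ := fun σ a b => ∑ x ∈ XF σ, T (σ, x) a b
  let G : Stp N → Fin 2 → PF ℝ := fun σ a =>
    ∑ x ∈ XF σ, (Q (σ, x) a * (phx (σ, x)).c + Q' (σ, x) a * (phx (σ, x)).s)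
  have hnn (σ : Stp N) : 0 ≤ σ.sg ^ 2 * σ.ep := mul_nonneg (sq_nonneg _) σ.ep_pos.le
  have hnx (σ : Stp N) : 0 ≤ σ.ep ^ N * xX σ := mul_nonneg (pow_nonneg σ.ep_pos.le _) (xX_nonneg σ)
  have hS (a b) : CU (N := N) (fun σ => σ.sg ^ 2 * σ.ep) (fun σ => S σ a b) :=
    total_X (X := fun σ => σ.sg ^ 2 * σ.ep) (f := fun x => T x a b) hnn (hb a b)
  have hcs := (osc N).cl_c
  have hGs (a) : Cs xS (fun x => x.1.la) (fun x => x.1.τ) (fun x => x.1.ub) 0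
      (fun x => x.1.ep ^ N * xX x.1)
      (fun x : Stp N × XI => Q x a * (phx x).c + Q' x a * (phx x).s) :=
 by
    have h1 := (CX.final (fun x => hnx x.1) (hQ a)).mul_one hcs.1
    have h2 := (CX.final (fun x => hnx x.1) (hQ' a)).mul_one hcs.2
    have h3 := h1.add h2
    refine Cs.congr h3 rfl ?_
    ext1 x; simp only [Pi.add_apply, Pi.mul_apply]; ring
  have hG (a) : CU (fun σ : Stp N => σ.ep ^ N * xX σ) (fun σ => G σ a) :=
    total_X (X := fun σ : Stp N => σ.ep ^ N * xX σ)
      (f := fun x => Q x a * (phx x).c + Q' x a * (phx x).s) hnx (hGs a)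
  have hpu (i j : Fin 2) : CU (fun σ : Stp N => σ.sg ^ 2 * σ.ep)
      (fun σ => 2 * (σ.psi * d i (σ.ub j))) := by
    have h1 : CU (fun σ : Stp N => σ.sg ^ 2 * σ.ep) (fun σ => σ.psi * d i (σ.ub j)) := by
      have h := CU.mul' (Z := fun σ : Stp N => σ.sg ^ 2 * σ.ep) cu_psi (cu_dub i j) fun σ => by
        have h1 := σ.sg_pos; have h2 := σ.la_pos; have h3 := σ.ep_pos
        exact σ.drop 1 (by field_simp) (by positivity)
      exact h
    have h2 := h1.add h1
    refine Cl.congr h2 rfl ?_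
    ext1 σ
    simp only [Pi.add_apply]; ring
  have hvw (i j : Fin 2) : CU (fun σ : Stp N => σ.sg ^ 2 * σ.ep)
      (fun σ => σ.vb i * σ.wv j + σ.wv i * σ.vb j) := by
    have h1 (i j : Fin 2) : CU (fun σ : Stp N => σ.sg ^ 2 * σ.ep) (fun σ => σ.vb i * σ.wv j) :=
      CU.mul' (cu_vb i) (cu_wv j) fun σ => le_of_eq (by ring)
    exact ((h1 i j).add (h1 j i)).congr rfl
      (by ext1 σ; simp only [Pi.add_apply]; rw [mul_comm (σ.wv i)])
  have hE (a b) := CU.mulc (cu_Er (N := N) a b) (1 / 2)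
  have hmr : CU (fun σ : Stp N => σ.sg ^ 2 * σ.ep) (fun σ => ∑ l ∈ ZF σ, mism Stp.r (σ, l)) :=
    cu_mism Stp.r_le (fun j σ => σ.dr_le j) Stp.mr_le
  have hms : CU (fun σ : Stp N => σ.sg ^ 2 * σ.ep) (fun σ => ∑ l ∈ ZF σ, mism Stp.s (σ, l)) :=
    cu_mism Stp.s_le (fun j σ => σ.ds_le j) Stp.ms_le
  have hA (a b) := cu_anti hG a b
  have hO : CU (fun σ : Stp N => σ.sg ^ 2 * σ.ep) (fun σ => nst' σ (S σ) (G σ) 0 1) :=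
    (((hms.sub (hE 0 1)).add (hpu 1 1)).add (hvw 0 1)).add ((hS 0 1).add (hA 0 1))
  refine ⟨fun σ => nst' σ (S σ) (G σ), fun σ => nst'_symm _ _ _, fun a b => ?_, fun σ t hn a b x => ?_,
    fun σ j => momentum σ ?_ (fun j => ?_) j⟩
  · fin_cases a <;> fin_cases b
    · exact (((hmr.add (hE 1 1)).add (hpu 1 0)).add (hvw 0 0)).add ((hS 0 0).add (hA 0 0))
    · exact hO
    · exact hO
    · exact (((hmr.neg.add (hE 0 0)).sub (hpu 0 1)).add (hvw 1 1)).add ((hS 1 1).add (hA 1 1))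
  · have hx : ∀ y : XI, t ∉ xS (σ, y) := fun y hy => hn ⟨_, hy.1⟩
    have hS0 : ∀ a b, S σ a b (t, x) = 0 := fun a b => sum_act fun y => (hb a b).2 (σ, y) t (hx y) x
    have hG0 : ∀ a x, G σ a (t, x) = 0 := fun a x => sum_act fun y => (hGs a).2 (σ, y) t (hx y) x
    have hA0 := anti_zero_at (G := G σ) hG0
    have hm : ∀ q : Stp N → PF ℝ, (∑ l ∈ ZF σ, mism q (σ, l)) (t, x) = 0 := fun q =>
      sum_act fun l => mism_act hn q l x
    have he : ∀ a b, (∑ I ∈ WF σ, Er a b (σ, I)) (t, x) = 0 := fun a b =>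
      sum_act fun I => Er_act hn a b I x
    have hw := fun j => wv_act hn j x
    have hp := psi_act hn x
    fin_cases a <;> fin_cases b <;>
      simp [nst', hS0, hA0, hm, he, hw, hp]
  · exact Finset.sum_congr rfl fun x _ => hT _ _ _
  · simp only [osum, S, G, map_sum, ← Finset.sum_add_distrib]
    exact Finset.sum_congr rfl fun x _ => h _ _

/-! ### Energy of the perturbation -/

/-- Symbols of the oscillating part of the energy density. -/
def yB (x : Stp N × XI) : PF ℝ :=
  C (i0 x.2) * (C (1 / 2) * (amp (wI x) * amp (wJ x))) +
    C (i1 x.2) * (C (1 / 2) * (amp (wI x) * amp (wJ x)))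

lemma cx_yB : CX (N := N) (lv N) (fun x => x.1.sg ^ 2) yB := by
  have h : CX (N := N) (lv N) (fun x => x.1.sg ^ 2) (fun x => amp (wI x) * amp (wJ x)) :=
    (CS.prod (X := fun σ => σ.sg) (Y := fun σ => σ.sg) cs_amp cs_amp).congr
      (by ext x; ring) rfl
  have h2 := h.bdd_mul (c := fun _ => 1 / 2) fun _ => by norm_num [abs_le]
  exact Cs.add (h2.bdd_mul fun x => i0_le x.2) (h2.bdd_mul fun x => i1_le x.2)

lemma amp_pair (σ : Stp N) (I J : WI) :
    ∑ κ : Fin 3, yB (σ, I, J, κ) * (phx (σ, I, J, κ)).c =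
      -(-(amp (σ, I) * (ph σ I).c) * (amp (σ, J) * (ph σ J).c))
      + if I = J then -(C (1 / 2) * (amp (σ, I) * amp (σ, I))) else 0 := by
  have h3 := C_half
  have c0 : C 0 = 0 := map_zero _
  have c1 : C 1 = 1 := map_one _
  have h02 : (2 : Fin 3) ≠ 0 := by decide
  have h12 : (2 : Fin 3) ≠ 1 := by decide
  have h01 : (1 : Fin 3) ≠ 2 := by decide
  rcases eq_or_ne (key I) (key J) with hk | hk
  · rcases eq_or_ne I J with rfl | hne
    · have hs := (ph σ I).sq
      simp only [Fin.sum_univ_three, yB, phx, i0, i1, wI, wJ, if_true, ne_eq, not_true,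
        and_false, if_false, one_ne_zero, h02, h12, h01, zero_ne_one, and_true, c0, c1, Ph.add,
        false_and, Fin.isValue, Ne.symm h02]
      linear_combination amp (σ, I) ^ 2 * (ph σ I).c ^ 2 * h3 - C (1 / 2) * amp (σ, I) ^ 2 * hs
    · have z1 := mul_eq_zero_of_key hk hne (cs_amp.2 (σ, I)) (cs_amp.2 (σ, J))
      simp only [Fin.sum_univ_three, yB, phx, i0, i1, wI, wJ, if_true, ne_eq, hk, hne,
        not_true, and_false, if_false, c0, zero_mul, z1, mul_zero, add_zero, sub_zero]
      linear_combination -(ph σ I).c * (ph σ J).c * z1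
  · have hne : I ≠ J := fun h => hk (by rw [h])
    simp only [Fin.sum_univ_three, yB, phx, i0, i1, wI, wJ, if_true, ne_eq, hk, hne, not_false_eq_true,
      true_and, and_true, and_false, false_and, if_false, one_ne_zero, h02, h12, h01, zero_ne_one, c0, c1,
      Ph.add, Ph.neg, Fin.isValue, Ne.symm h02]
    linear_combination amp (σ, I) * amp (σ, J) * (ph σ I).c * (ph σ J).c * h3

lemma psi_sq (σ : Stp N) : C σ.la ^ 2 * (σ.psi * σ.psi) =
    ∑ x ∈ XF σ, yB (σ, x) * (phx (σ, x)).c + ∑ I ∈ WF σ, C (1 / 2) * (amp (σ, I) * amp (σ, I)) := by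
  have h1 : C σ.la * σ.psi = ∑ I ∈ WF σ, amp (σ, I) * (ph σ I).c := by
    have : C σ.la * C σ.la⁻¹ = (1 : PF ℝ) := by
      rw [← map_mul, mul_inv_cancel₀ σ.la_pos.ne', map_one]
    rw [psi, Finset.mul_sum]
    refine Finset.sum_congr rfl fun I _ => ?_
    rw [psw]
    linear_combination amp (σ, I) * (ph σ I).c * this
  have h6 : ∑ x ∈ XF σ, yB (σ, x) * (phx (σ, x)).c =
      ∑ I ∈ WF σ, ∑ J ∈ WF σ, ∑ κ : Fin 3, yB (σ, I, J, κ) * (phx (σ, I, J, κ)).c := by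
    rw [XF, Finset.sum_product]
    exact Finset.sum_congr rfl fun I _ => by rw [Finset.sum_product]
  have h7 := sum_pair (WF σ) (fun I => -(amp (σ, I) * (ph σ I).c))
    (fun I => amp (σ, I) * (ph σ I).c) (fun I => -(C (1 / 2) * (amp (σ, I) * amp (σ, I))))
  rw [h6]
  simp only [amp_pair]
  rw [h7]
  simp only [Finset.sum_neg_distrib]
  linear_combination (C σ.la * σ.psi + ∑ I ∈ WF σ, amp (σ, I) * (ph σ I).c) * h1

lemma amp_total (σ : Stp N) : ∑ I ∈ WF σ, C (1 / 2) * (amp (σ, I) * amp (σ, I)) = 2 * Ziso σ := by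
  have h := low_dir σ (fun I => kR I 0 * kR I 0 + kR I 1 * kR I 1) fun _ => 0
  have hk (I : WI) : kR I 0 * kR I 0 + kR I 1 * kR I 1 = 1 := by
    linear_combination kR_sq I
  simp only [hk, map_one, one_mul, add_zero, Finset.sum_const_zero, mul_zero] at h
  rw [h, Ziso, Finset.mul_sum]
  refine Finset.sum_congr rfl fun l _ => ?_
  obtain ⟨h1, -, h3⟩ := sum_dir σ l
  have h4 : ∑ κ : Fin 3, ya (σ, l, κ) = 2 := by
    have h5 : ∑ κ : Fin 3, ya (σ, l, κ) = ∑ κ : Fin 3, C (kR (l, κ) 1 * kR (l, κ) 1) * ya (σ, l, κ)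
        + ∑ κ : Fin 3, C (kR (l, κ) 0 * kR (l, κ) 0) * ya (σ, l, κ) := by
      rw [← Finset.sum_add_distrib]
      refine Finset.sum_congr rfl fun κ _ => ?_
      rw [← add_mul, ← map_add, add_comm, hk, map_one, one_mul]
    rw [h5, h1, h3]; ring
  rw [h4]; ring

lemma b0_mean {X : Stp N → ℝ} {f : Stp N → PF ℝ} (h : B0 U X f) : B0 U X (fun σ => mean (f σ)) := by
  obtain ⟨C, hC, h⟩ := h
  exact ⟨C, hC, fun σ t ht x => abs_mean_le _ _ (h σ t ht) x⟩

lemma ep_sg_nn (σ : Stp N) : 0 ≤ σ.sg ^ 2 * σ.ep := mul_nonneg (sq_nonneg _) σ.ep_pos.le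

lemma mean_of_d_zero {f : PF ℝ} (h : ∀ j, d j f = 0) : mean f = f := by
  have hm (j : Fin 2) : mn j f = f := by
    have h1 := d_prim j f
    rw [dv_prim, h j, prim_zero] at h1
    exact (sub_eq_zero.1 h1.symm).symm
  rw [mean, LinearMap.comp_apply, hm, hm]

lemma b0_osc : B0 U (fun σ : Stp N => σ.sg ^ 2 * σ.ep)
    (fun σ => mean (∑ x ∈ XF σ, yB (σ, x) * (phx (σ, x)).c)) := by
  obtain ⟨T, Q, Q', -, -, hQ, hQ', h⟩ := (osc N).main (n := lv N - 1) 1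
    (X := fun x => x.1.sg ^ 2) (B := fun x _ => yB x) (B' := fun x _ => 0) (fun x => sq_nonneg _)
    le_rfl (fun _ => cx_yB) (fun _ => Cs.zero)
  have hq : ∀ {Q : Stp N × XI → PF ℝ}, CX (N := N) (lv N - 1)
      ((fun x => x.1.ep) ^ 1 * fun x => x.1.sg ^ 2) Q → CX (lv N - 1) (fun x => x.1.sg ^ 2 * x.1.ep) Q :=
    fun hQ => hQ.congr (by ext x; simp only [Pi.mul_apply, Pi.pow_apply]; ring) rfl
  have hs : Cs xS (fun x => x.1.la) (fun x => x.1.τ) (fun x => x.1.ub) 0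
      (fun x => x.1.sg ^ 2 * x.1.ep)
      (fun x : Stp N × XI => Q x 0 * (phx x).c + Q' x 0 * (phx x).s) := by
    have h1 := (CX.final (fun x => ep_sg_nn x.1) (hq (hQ 0))).mul_one (osc N).cl_c.1
    have h2 := (CX.final (fun x => ep_sg_nn x.1) (hq (hQ' 0))).mul_one (osc N).cl_c.2
    have h3 := h1.add h2
    refine Cs.congr h3 rfl ?_
    ext1 x; simp only [Pi.add_apply, Pi.mul_apply]; ring
  have h3 := total_X (X := fun σ : Stp N => σ.sg ^ 2 * σ.ep)
    (f := fun x => Q x 0 * (phx x).c + Q' x 0 * (phx x).s) ep_sg_nn hs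
  have h4 := b0_mean h3.1.b0
  refine B0.congr h4 rfl ?_
  ext1 σ
  have e : ∑ x ∈ XF σ, yB (σ, x) * (phx (σ, x)).c = d 0 (∑ x ∈ XF σ, T (σ, x) 0 0) +
      d 1 (∑ x ∈ XF σ, T (σ, x) 0 1) +
      ∑ x ∈ XF σ, (Q (σ, x) 0 * (phx (σ, x)).c + Q' (σ, x) 0 * (phx (σ, x)).s) := by
    simp only [map_sum, ← Finset.sum_add_distrib]
    refine Finset.sum_congr rfl fun x _ => ?_
    have := h (σ, x) 0
    linear_combination this
  rw [e, map_add, map_add, mean_d, mean_d, add_zero, zero_add]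

/-- Kinetic energy of the perturbation. -/
def wsq (σ : Stp N) : PF ℝ := σ.wv 0 * σ.wv 0 + σ.wv 1 * σ.wv 1

lemma b0_lap : B0 U (fun σ : Stp N => σ.la * σ.ep * σ.sg)
    (fun σ => d 0 (d 0 σ.psi) + d 1 (d 1 σ.psi) + C σ.la ^ 2 * σ.psi) := by
  have hn (σ : Stp N) : 0 ≤ σ.la * σ.ep * σ.sg :=
    mul_nonneg (mul_nonneg (laU σ) σ.ep_pos.le) (sg_nn σ)
  have hs : Cs (fun w => asl (w.1, w.2.1)) (fun w => w.1.la) (fun w => w.1.τ) (fun w => w.1.ub) 0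
      (fun w => w.1.la * w.1.ep * w.1.sg)
      (fun w : Stp N × WI => es w * (ph w.1 w.2).c + es' w * (ph w.1 w.2).s) := by
    have h1 := (CS.final (N := N) (fun w => hn w.1) cs_es).mul_one cl_ph.1
    have h2 := (CS.final (N := N) (fun w => hn w.1) cs_es').mul_one cl_ph.2
    have h3 := h1.add h2
    refine Cs.congr h3 rfl ?_
    ext1 x; simp only [Pi.add_apply, Pi.mul_apply]; ring
  have h3 := total_W (X := fun σ : Stp N => σ.la * σ.ep * σ.sg)
    (f := fun w : Stp N × WI => es w * (ph w.1 w.2).c + es' w * (ph w.1 w.2).s) hn hs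
  have h4 := h3.1.b0
  refine B0.congr h4 rfl ?_
  ext1 σ
  simp only [psi, map_sum, Finset.mul_sum, ← Finset.sum_add_distrib]
  refine Finset.sum_congr rfl fun I _ => ?_
  have := lap_psw (σ, I)
  linear_combination -this

/-- The energy of the perturbation is the prescribed one up to a small error. -/
lemma b0_wsq : B0 U (fun σ : Stp N => σ.sg ^ 2 * σ.ep) (fun σ => mean (wsq σ) - 2 * Ziso σ) := by
  have h1 : B0 U (fun σ : Stp N => σ.sg ^ 2 * σ.ep)
      (fun σ => mean (σ.psi * (d 0 (d 0 σ.psi) + d 1 (d 1 σ.psi) + C σ.la ^ 2 * σ.psi))) := by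
    have h := cu_psi.1.b0.mul (b0_lap (N := N))
    refine b0_mean (h.congr ?_ rfl)
    ext σ
    have := σ.la_pos.ne'
    simp only [Pi.mul_apply]; field_simp
  have h2 := b0_osc.sub h1
  refine B0.congr h2 rfl ?_
  ext1 σ
  have e : wsq σ = d 0 (σ.psi * d 0 σ.psi) + d 1 (σ.psi * d 1 σ.psi)
      - σ.psi * (d 0 (d 0 σ.psi) + d 1 (d 1 σ.psi) + C σ.la ^ 2 * σ.psi)
      + C σ.la ^ 2 * (σ.psi * σ.psi) := by
    simp only [wsq, wv, curl, Matrix.cons_val_zero, Matrix.cons_val_one, Derivation.leibniz, smul_eq_mul]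
    ring
  have hz : mean (2 * Ziso σ) = 2 * Ziso σ := by
    refine mean_of_d_zero fun j => ?_
    rw [two_mul, map_add, d_Ziso, add_zero]
  rw [psi_sq, amp_total] at e
  simp only [Pi.sub_apply]
  rw [e, map_add, map_sub, map_add, map_add, mean_d, mean_d, hz]; ring

/-- The perturbation is almost orthogonal to the old velocity. -/
lemma b0_uw : B0 U (fun σ : Stp N => σ.sg ^ 2 * σ.ep)
    (fun σ => mean (σ.u 0 * σ.wv 0 + σ.u 1 * σ.wv 1)) := by
  have h1 (i j) := cu_psi.1.b0.mul (b0_du (N := N) i j)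
  refine (b0_mean (((h1 1 0).sub (h1 0 1)).le fun σ => ?_)).congr rfl ?_
  · have h1 := σ.sg_pos; have h2 := σ.la_pos; have h3 := σ.ep_pos
    exact σ.drop 1 (by simp only [Pi.mul_apply]; field_simp) (by positivity)
  · ext1 σ
    have e : σ.u 0 * σ.wv 0 + σ.u 1 * σ.wv 1 = d 0 (σ.u 1 * σ.psi) - d 1 (σ.u 0 * σ.psi)
        + (σ.psi * d 1 (σ.u 0) - σ.psi * d 0 (σ.u 1)) := by
      simp only [wv, curl, Matrix.cons_val_zero, Matrix.cons_val_one, Derivation.leibniz, smul_eq_mul]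
      ring
    rw [e, map_add, map_sub, mean_d, mean_d]
    simp

/-! ### The inductive step -/

lemma mem_ZF_of_gam {σ : Stp N} {l : ℤ} (h : gam (σ, l) ≠ 0) : σ.dl < σ.g (tl (σ, l)) ∧ l ∈ ZF σ := by
  have h1 : σ.dl < σ.g (tl (σ, l)) := by
    by_contra hc
    exact h (max_eq_right (by linarith [not_lt.1 hc]))
  refine ⟨h1, mem_ZF h1 (Or.inl ?_)⟩
  have : σ.μ * tl (σ, l) = l := by
    rw [tl]; field_simp [σ.μ_pos.ne']
  rw [this, Int.floor_intCast]

lemma cut_nonneg (i : Stp N × ℤ) (z : ℝ × E2) : 0 ≤ cut i z := by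
  rw [cut, mul_apply]; exact mul_self_nonneg _

lemma sum_cut_pair (σ : Stp N) (t : ℝ) (x : E2) :
    cut (σ, ⌊σ.μ * t⌋) (t, x) + cut (σ, ⌊σ.μ * t⌋ + 1) (t, x) = 1 := by
  simp only [cut, mul_apply, bmp_apply]
  have := chi_sq (s := σ.μ * t - ⌊σ.μ * t⌋) ⟨by linarith [Int.floor_le (σ.μ * t)],
    by linarith [Int.lt_floor_add_one (σ.μ * t)]⟩
  push_cast
  rw [← sub_sub]
  linarith

lemma Ziso_apply (σ : Stp N) (t : ℝ) (x : E2) : (2 * Ziso σ) (t, x) =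
    cut (σ, ⌊σ.μ * t⌋) (t, x) * gam (σ, ⌊σ.μ * t⌋) +
      cut (σ, ⌊σ.μ * t⌋ + 1) (t, x) * gam (σ, ⌊σ.μ * t⌋ + 1) := by
  have h1 : (2 * Ziso σ) (t, x) = ∑ l ∈ ZF σ, cut (σ, l) (t, x) * gam (σ, l) := by
    rw [Ziso, two_mul, add_apply, sum_apply', ← Finset.sum_add_distrib]
    refine Finset.sum_congr rfl fun l _ => ?_
    rw [mul_apply, algebraMap_apply]; ring
  rw [h1, ← Finset.sum_pair (f := fun l => cut (σ, l) (t, x) * gam (σ, l)) (by simp)]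
  have h2 : ∀ l, l ∉ ZF σ → cut (σ, l) (t, x) * gam (σ, l) = 0 := fun l hl => by
    by_contra hc
    exact hl (mem_ZF_of_gam fun h => hc (by rw [h, mul_zero])).2
  have h3 : ∀ l, l ∉ ({⌊σ.μ * t⌋, ⌊σ.μ * t⌋ + 1} : Finset ℤ) → cut (σ, l) (t, x) * gam (σ, l) = 0 :=
    fun l hl => by
      rw [cut_sup (σ, l) t (fun hm => hl (by simpa using sl_mem hm)) x, zero_mul]
  exact (Finset.sum_union_eq_left (s₁ := ZF σ) (s₂ := {⌊σ.μ * t⌋, ⌊σ.μ * t⌋ + 1})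
    fun l _ h => h2 l h).symm.trans (Finset.sum_union_eq_right fun l _ h => h3 l h)

lemma gap_act {σ : Stp N} {t : ℝ} (h : σ.Act t) (x : E2) :
    |σ.g t - (2 * Ziso σ) (t, x) - σ.dl| ≤ 3 / 2 * (σ.sg ^ 2 * σ.ep) := by
  obtain ⟨l₀, hl₀, hg₀⟩ := h
  have h0 := abs_le.1 (g_sub_le hl₀)
  have h1 := (mem_ZF_of_gam hg₀).1
  have key : ∀ l, |cut (σ, l) (t, x) * (σ.g t - σ.dl - gam (σ, l))| ≤
      cut (σ, l) (t, x) * (3 / 2 * (σ.sg ^ 2 * σ.ep)) := fun l => by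
    by_cases hl : t ∈ sl (σ, l)
    · have h2 := abs_le.1 (g_sub_le hl)
      rw [abs_mul, abs_of_nonneg (cut_nonneg _ _)]
      refine mul_le_mul_of_nonneg_left ?_ (cut_nonneg _ _)
      simp only at h0 h2
      rw [gam]
      rcases max_cases (σ.g (tl (σ, l)) - σ.dl) 0 with ⟨h, h'⟩ | ⟨h, h'⟩ <;> rw [h, abs_le] <;>
        constructor <;> linarith
    · rw [cut_sup (σ, l) t hl x]; simp
  have hs := sum_cut_pair σ t x
  have e : σ.g t - (2 * Ziso σ) (t, x) - σ.dl =
      cut (σ, ⌊σ.μ * t⌋) (t, x) * (σ.g t - σ.dl - gam (σ, ⌊σ.μ * t⌋)) +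
      cut (σ, ⌊σ.μ * t⌋ + 1) (t, x) * (σ.g t - σ.dl - gam (σ, ⌊σ.μ * t⌋ + 1)) := by
    rw [Ziso_apply]; linear_combination (-(σ.g t - σ.dl)) * hs
  rw [e]
  refine (abs_add_le _ _).trans ((add_le_add (key _) (key _)).trans (le_of_eq ?_))
  rw [← add_mul, hs, one_mul]

lemma gap_not_act {σ : Stp N} {t : ℝ} (h : ¬ σ.Act t) :
    σ.g t ≤ σ.dl + 3 / 2 * (σ.sg ^ 2 * σ.ep) := by
  set l : ℤ := round (σ.μ * t)
  have hl : t ∈ sl (σ, l) := by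
    have := abs_sub_round (σ.μ * t)
    change |σ.μ * t - (l : ℝ)| ≤ 3 / 4
    linarith
  have h1 : gam (σ, l) = 0 := by
    by_contra hc; exact h ⟨l, hl, hc⟩
  have h2 := abs_le.1 (g_sub_le hl)
  have h3 := le_max_left (σ.g (tl (σ, l)) - σ.dl) 0
  change _ ≤ gam (σ, l) at h3
  rw [h1] at h3
  simp only at h2
  linarith

/-- The new energy gap. -/
def g' (σ : Stp N) (t : ℝ) : ℝ := σ.E t - mean (σ.uv 0 ^ 2 + σ.uv 1 ^ 2) (t, 0)

lemma g'_eq (σ : Stp N) (t : ℝ) : σ.g' t = σ.g t - mean (wsq σ) (t, 0)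
    - 2 * mean (σ.u 0 * σ.wv 0 + σ.u 1 * σ.wv 1) (t, 0) := by
  have e : σ.uv 0 ^ 2 + σ.uv 1 ^ 2 = σ.u 0 ^ 2 + σ.u 1 ^ 2 + wsq σ +
      ((σ.u 0 * σ.wv 0 + σ.u 1 * σ.wv 1) + (σ.u 0 * σ.wv 0 + σ.u 1 * σ.wv 1)) := by
    simp only [uv, wsq]; ring
  rw [g', σ.g_eq, e]
  simp only [map_add mean, add_apply]
  ring

lemma mean_zero_at {f : PF ℝ} {t : ℝ} (h : ∀ x, f (t, x) = 0) : mean f (t, 0) = 0 := by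
  have := abs_mean_le f t (M := 0) (fun x => by rw [h, abs_zero]) 0
  exact abs_nonpos_iff.1 this

lemma g'_not_act {σ : Stp N} {t : ℝ} (h : ¬ σ.Act t) : σ.g' t = σ.g t := by
  rw [g'_eq, mean_zero_at, mean_zero_at]
  · ring
  · intro x; simp [add_apply, mul_apply, wv_act h]
  · intro x; simp [wsq, add_apply, mul_apply, wv_act h]

theorem exists_gap (N : ℕ) : ∃ K : ℝ, 1 ≤ K ∧ ∀ σ : Stp N, K * (σ.sg ^ 2 * σ.ep) ≤ σ.dl →
    (∀ t, 0 ≤ σ.g' t) ∧ (∀ t, σ.g' t ≤ 2 * σ.dl) ∧ ∀ t, σ.dl / 2 ≤ σ.g' t ∨ ¬ σ.Act t := by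
  obtain ⟨K1, hK1, h1⟩ := b0_wsq (N := N)
  obtain ⟨K2, hK2, h2⟩ := b0_uw (N := N)
  refine ⟨2 * (3 / 2 + K1 + 2 * K2), by linarith, fun σ hσ => ?_⟩
  have hA : ∀ t, σ.Act t → |σ.g' t - σ.dl| ≤ σ.dl / 2 := fun t ht => by
    have h3 := abs_le.1 (gap_act ht 0)
    have h4 := abs_le.1 (h1 σ t (Set.mem_univ _) 0)
    have h5 := abs_le.1 (h2 σ t (Set.mem_univ _) 0)
    rw [sub_apply] at h4
    rw [g'_eq, abs_le]
    constructor <;> linarith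
  have hB : ∀ t, ¬ σ.Act t → σ.g' t ≤ 2 * σ.dl := fun t ht => by
    rw [g'_not_act ht]
    have := gap_not_act ht
    have := ep_sg_nn σ
    have : 0 ≤ (K1 + 2 * K2) * (σ.sg ^ 2 * σ.ep) := mul_nonneg (by positivity) this
    linarith [σ.dl_pos]
  have hd := σ.dl_pos
  refine ⟨fun t => ?_, fun t => ?_, fun t => ?_⟩ <;> by_cases ht : σ.Act t
  · linarith [(abs_le.1 (hA t ht)).1]
  · rw [g'_not_act ht]; exact σ.g_nonneg t
  · linarith [(abs_le.1 (hA t ht)).2]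
  · exact hB t ht
  · left; linarith [(abs_le.1 (hA t ht)).1]
  · exact Or.inr ht

lemma uv_div (σ : Stp N) : d 0 (σ.uv 0) + d 1 (σ.uv 1) = 0 := by
  have h1 := div_curl σ.psi
  have h2 := σ.div_u
  simp only [uv, wv, map_add]
  linear_combination h1 + h2

lemma mat_uv (σ : Stp N) (f : PF ℝ) :
    mat σ.uv f = σ.D f + ((σ.vb 0 * d 0 f + σ.vb 1 * d 1 f) + (σ.wv 0 * d 0 f + σ.wv 1 * d 1 f)) := by
  simp only [mat_apply, vb, uv]; ring

/-- What is known about the new stress and its derivatives. -/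
structure Bd (σ : Stp N) (K : ℝ) (f : PF ℝ) : Prop where
  le : ∀ z, |f z| ≤ K * (σ.sg ^ 2 * σ.ep)
  d_le : ∀ i z, |d i f z| ≤ K * (σ.sg ^ 2 * σ.ep * σ.la)
  m_le : ∀ z, |mat σ.uv f z| ≤ K * (σ.sg ^ 3 * σ.ep * σ.la)

lemma B0.exists_le {X : Stp N → ℝ} {f : Stp N → PF ℝ} (h : B0 U X f) :
    ∃ K, 0 ≤ K ∧ ∀ σ z, |f σ z| ≤ K * X σ := by
  obtain ⟨K, hK, h⟩ := h
  exact ⟨K, hK, fun σ z => h σ z.1 (Set.mem_univ _) z.2⟩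

lemma CU.exists_le {X : Stp N → ℝ} {f : Stp N → PF ℝ} (h : CU X f) (hX : ∀ σ, 0 ≤ X σ) :
    ∃ K, 0 ≤ K ∧ ∀ σ, (∀ z, |f σ z| ≤ K * X σ) ∧ ∀ i z, |d i (f σ) z| ≤ K * (σ.la * X σ) := by
  obtain ⟨K, hK, h1⟩ := B0.exists_le h.1.b0
  obtain ⟨K0, hK0, h2⟩ := B0.exists_le (h.1.d 0).b0
  obtain ⟨K1, hK1, h3⟩ := B0.exists_le (h.1.d 1).b0
  refine ⟨K + K0 + K1, by positivity, fun σ => ⟨fun z => (h1 σ z).trans ?_, fun i z => ?_⟩⟩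
  · exact mul_le_mul_of_nonneg_right (by linarith) (hX σ)
  · have hn := mul_nonneg σ.la_pos.le (hX σ)
    fin_cases i
    · exact (h2 σ z).trans (mul_le_mul_of_nonneg_right (by linarith) hn)
    · exact (h3 σ z).trans (mul_le_mul_of_nonneg_right (by linarith) hn)

lemma CU.exists_bd {f : Stp N → PF ℝ} (h : CU (fun σ => σ.sg ^ 2 * σ.ep) f) :
    ∃ K : ℝ, 0 ≤ K ∧ ∀ σ : Stp N, σ.Bd K (f σ) := by
  obtain ⟨K, hK, h1⟩ := h.exists_le ep_sg_nn
  have hm : B0 U (fun σ : Stp N => σ.sg ^ 3 * σ.ep * σ.la) (fun σ => mat σ.uv (f σ)) := by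
    have h2 : B0 U (fun σ : Stp N => σ.sg ^ 3 * σ.ep * σ.la) (fun σ => σ.D (f σ)) :=
      h.2.congr (by ext σ; simp only [Pi.mul_apply, τ]; ring) rfl
    have h3 (j : Fin 2) : B0 U (fun σ : Stp N => σ.sg ^ 3 * σ.ep * σ.la)
        (fun σ => σ.vb j * d j (f σ)) := by
      have h := (b0_vb j).mul (h.1.d j).b0
      have h' := h.le (Y := fun σ : Stp N => σ.sg ^ 3 * σ.ep * σ.la) fun σ => by
        have h1 := σ.sg_pos; have h2 := σ.la_pos; have h3 := σ.ep_pos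
        exact σ.drop 1 (by simp only [Pi.mul_apply]; ring) (by positivity)
      exact h'
    have h4 (j : Fin 2) : B0 U (fun σ : Stp N => σ.sg ^ 3 * σ.ep * σ.la)
        (fun σ => σ.wv j * d j (f σ)) := by
      have h := (cu_wv j).1.b0.mul (h.1.d j).b0
      exact B0.congr h (by ext σ; simp only [Pi.mul_apply]; ring) rfl
    have h5 := h2.add (((h3 0).add (h3 1)).add ((h4 0).add (h4 1)))
    refine B0.congr h5 rfl ?_
    ext1 σ
    rw [mat_uv]; rfl
  obtain ⟨K', hK', h2⟩ := B0.exists_le hm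
  refine ⟨K + K', by positivity, fun σ => ⟨fun z => ((h1 σ).1 z).trans ?_,
    fun i z => ((h1 σ).2 i z).trans ?_, fun z => (h2 σ z).trans ?_⟩⟩
  · exact mul_le_mul_of_nonneg_right (by linarith) (ep_sg_nn σ)
  · rw [mul_comm σ.la]
    exact mul_le_mul_of_nonneg_right (by linarith) (mul_nonneg (ep_sg_nn σ) σ.la_pos.le)
  · have h1 := σ.sg_pos; have h2 := σ.la_pos; have h3 := σ.ep_pos
    exact mul_le_mul_of_nonneg_right (by linarith) (by positivity)

lemma Bd.mono {σ : Stp N} {K K' : ℝ} {f : PF ℝ} (h : σ.Bd K f) (hK : K ≤ K') : σ.Bd K' f := by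
  have h1 := σ.sg_pos; have h2 := σ.la_pos; have h3 := σ.ep_pos
  exact ⟨fun z => (h.le z).trans (mul_le_mul_of_nonneg_right hK (by positivity)),
    fun i z => (h.d_le i z).trans (mul_le_mul_of_nonneg_right hK (by positivity)),
    fun z => (h.m_le z).trans (mul_le_mul_of_nonneg_right hK (by positivity))⟩

/-- The outcome of one step of the construction. -/
structure Out (σ : Stp N) (K : ℝ) (u : Fin 2 → PF ℝ) (p r s : PF ℝ) : Prop where
  div_u : d 0 (u 0) + d 1 (u 1) = 0
  eq0 : mat u (u 0) + d 0 p = d 0 r + d 1 s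
  eq1 : mat u (u 1) + d 1 p = d 0 s - d 1 r
  u_sub : ∀ i z, |u i z - σ.u i z| ≤ K * σ.sg
  du_sub : ∀ i j z, |d i (u j) z - d i (σ.u j) z| ≤ K * (σ.sg * σ.la)
  p_sub : ∀ z, |p z - σ.p z| ≤ K * σ.sg ^ 2
  dp_sub : ∀ i z, |d i p z - d i σ.p z| ≤ K * (σ.sg ^ 2 * σ.la)
  rs_le : ∀ z, |r z| ≤ K * (σ.sg ^ 2 * σ.ep) ∧ |s z| ≤ K * (σ.sg ^ 2 * σ.ep)
  drs_le : ∀ i z, |d i r z| ≤ K * (σ.sg ^ 2 * σ.ep * σ.la) ∧ |d i s z| ≤ K * (σ.sg ^ 2 * σ.ep * σ.la)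
  mrs_le : ∀ z, |mat u r z| ≤ K * (σ.sg ^ 3 * σ.ep * σ.la) ∧ |mat u s z| ≤ K * (σ.sg ^ 3 * σ.ep * σ.la)
  g_nonneg : ∀ t, 0 ≤ σ.E t - mean (u 0 ^ 2 + u 1 ^ 2) (t, 0)
  g_le : ∀ t, σ.E t - mean (u 0 ^ 2 + u 1 ^ 2) (t, 0) ≤ 2 * σ.dl
  gap : ∀ t, σ.dl / 2 ≤ σ.E t - mean (u 0 ^ 2 + u 1 ^ 2) (t, 0) ∨ ∀ x, r (t, x) = 0 ∧ s (t, x) = 0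

theorem exists_out (N : ℕ) : ∃ K : ℝ, 1 ≤ K ∧ ∀ σ : Stp N, K * (σ.sg ^ 2 * σ.ep) ≤ σ.dl →
    ∃ u p r s, σ.Out K u p r s := by
  obtain ⟨A, hA1, hA2, hA3, hA4⟩ := exists_stress N
  obtain ⟨K0, hK0, hg⟩ := exists_gap N
  have hr : CU (N := N) (fun σ => σ.sg ^ 2 * σ.ep) (fun σ => C (1 / 2) * (A σ 0 0 - A σ 1 1)) :=
    CU.mulc ((hA2 0 0).sub (hA2 1 1)) _
  have hs : CU (N := N) (fun σ => σ.sg ^ 2 * σ.ep) (fun σ => A σ 0 1) := hA2 0 1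
  have hq : CU (N := N) (fun σ => σ.sg ^ 2) (fun σ => -(σ.dpr + C (1 / 2) * (A σ 0 0 + A σ 1 1))) := by
    have h1 : CU (N := N) (fun σ => σ.sg ^ 2) (fun σ => C (1 / 2) * (A σ 0 0 + A σ 1 1)) :=
      CU.le (CU.mulc ((hA2 0 0).add (hA2 1 1)) _) fun σ => by
        have h1 := σ.sg_pos
        exact σ.drop 1 (by ring) (by positivity)
    exact (cu_dpr.add h1).neg
  obtain ⟨K1, hK1, h1⟩ := hr.exists_bd
  obtain ⟨K2, hK2, h2⟩ := hs.exists_bd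
  obtain ⟨K3, hK3, h3⟩ := hq.exists_le fun σ => sq_nonneg _
  obtain ⟨K4, hK4, h4⟩ := (cu_wv (N := N) 0).exists_le sg_nn
  obtain ⟨K5, hK5, h5⟩ := (cu_wv (N := N) 1).exists_le sg_nn
  refine ⟨K0 + K1 + K2 + K3 + K4 + K5, by linarith, fun σ hσ => ?_⟩
  set K := K0 + K1 + K2 + K3 + K4 + K5 with hK
  have he := ep_sg_nn σ
  obtain ⟨g1, g2, g3⟩ := hg σ ((mul_le_mul_of_nonneg_right (by linarith) he).trans hσ)
  have b1 := (h1 σ).mono (show K1 ≤ K by linarith)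
  have b2 := (h2 σ).mono (show K2 ≤ K by linarith)
  have hsg := σ.sg_pos
  have hla := σ.la_pos
  have hw : ∀ j, (∀ z, |σ.wv j z| ≤ K * σ.sg) ∧ ∀ i z, |d i (σ.wv j) z| ≤ K * (σ.sg * σ.la) := by
    intro j
    have key : ∀ {K' : ℝ} {f : PF ℝ}, K' ≤ K → ((∀ z, |f z| ≤ K' * σ.sg) ∧
        ∀ i z, |d i f z| ≤ K' * (σ.la * σ.sg)) → (∀ z, |f z| ≤ K * σ.sg) ∧
        ∀ i z, |d i f z| ≤ K * (σ.sg * σ.la) := fun hk h =>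
      ⟨fun z => (h.1 z).trans (mul_le_mul_of_nonneg_right hk hsg.le), fun i z => by
        rw [mul_comm σ.sg]
        exact (h.2 i z).trans (mul_le_mul_of_nonneg_right hk (by positivity))⟩
    fin_cases j
    · exact key (by linarith) (h4 σ)
    · exact key (by linarith) (h5 σ)
  have hh := C_half
  have hd (f : PF ℝ) (j : Fin 2) : d j (C (1 / 2) * f) = C (1 / 2) * d j f := by
    rw [Derivation.leibniz, d_C]; simp
  refine ⟨σ.uv, σ.p - (σ.dpr + C (1 / 2) * (A σ 0 0 + A σ 1 1)),
    C (1 / 2) * (A σ 0 0 - A σ 1 1), A σ 0 1, uv_div σ, ?_, ?_, ?_, ?_, ?_, ?_, ?_, ?_, ?_, g1, g2, ?_⟩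
  · have := hA4 σ 0
    rw [map_sub] at this ⊢
    rw [map_add (d 0), hd, hd, map_sub, map_add]
    linear_combination this - d 0 (A σ 0 0) * hh
  · have := hA4 σ 1
    rw [hA1] at this
    rw [map_sub] at this ⊢
    rw [map_add (d 1), hd, hd, map_sub, map_add]
    linear_combination this - d 1 (A σ 1 1) * hh
  · intro i z
    have := (hw i).1 z
    simpa only [uv, add_apply, add_sub_cancel_left] using this
  · intro i j z
    have := (hw j).2 i z
    simpa only [uv, map_add, add_apply, add_sub_cancel_left] using this
  · intro z
    have := (h3 σ).1 z
    rw [sub_eq_add_neg σ.p, add_apply, add_sub_cancel_left]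
    exact this.trans (mul_le_mul_of_nonneg_right (by linarith) (sq_nonneg _))
  · intro i z
    have := (h3 σ).2 i z
    rw [sub_eq_add_neg σ.p, map_add, add_apply, add_sub_cancel_left, mul_comm _ σ.la]
    exact this.trans (mul_le_mul_of_nonneg_right (by linarith) (by positivity))
  · exact fun z => ⟨b1.le z, b2.le z⟩
  · exact fun i z => ⟨b1.d_le i z, b2.d_le i z⟩
  · exact fun z => ⟨b1.m_le z, b2.m_le z⟩
  · intro t
    refine (g3 t).imp id fun h x => ⟨?_, hA3 σ t h 0 1 x⟩
    rw [mul_apply, sub_apply, hA3 σ t h, hA3 σ t h, sub_zero, mul_zero]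

end Stp

/-- An admissible choice of parameters for all steps. -/
structure Par (N : ℕ) (K : ℝ) (E : ℝ → ℝ) where
  sg : ℕ → ℝ
  la : ℕ → ℝ
  ep : ℕ → ℝ
  lai : ℕ → ℕ
  sg_pos : ∀ q, 0 < sg q
  la_ge : ∀ q, 1 ≤ la q
  ep_pos : ∀ q, 0 < ep q
  ep_le : ∀ q, ep q ≤ 1 / 8
  sg_le : ∀ q, sg q ≤ la q
  la_eq : ∀ q, la q = 5 * lai q
  tiny : ∀ q, la q ^ 10 * ep q ^ N ≤ sg q
  tiny' : ∀ q, la q ^ 10 * ep q ^ N ≤ sg q ^ 2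
  sg_sq : ∀ q, sg (q + 1) ^ 2 ≤ sg q ^ 2 / 8
  stress : ∀ q, 80 * K * (sg q ^ 2 * ep q) ≤ sg (q + 1) ^ 2
  vel : ∀ q, 2 * K * (sg q * la q) ≤ sg (q + 1) * la (q + 1) * ep (q + 1) ^ 2
  pres : ∀ q, 2 * K * (sg q ^ 2 * la q) ≤ sg (q + 1) ^ 2 * la (q + 1) * ep (q + 1)
  E_nonneg : ∀ t, 0 ≤ E t
  E_le : ∀ t, E t ≤ 2 * sg 0 ^ 2
  E_lip : ∀ q t t', |E t - E t'| ≤ sg q ^ 3 * la q * ep q ^ 2 * |t - t'|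
  E_supp : ∃ T, ∀ t, T ≤ |t| → E t = 0

namespace Par
variable {N : ℕ} {K : ℝ} {E : ℝ → ℝ}

/-- Compatibility of a flow with the parameters. -/
structure Fits (P : Par N K E) (q : ℕ) (σ : Stp N) : Prop where
  sg : σ.sg = P.sg q
  la : σ.la = P.la q
  ep : σ.ep = P.ep q
  dl : σ.dl = P.sg (q + 1) ^ 2
  E : σ.E = E

lemma sg_succ_le (P : Par N K E) (q : ℕ) : P.sg (q + 1) ≤ P.sg q := by
  have h1 := P.sg_sq q
  have h2 := P.sg_pos q
  exact abs_le_of_sq_le_sq' (by nlinarith [pow_pos h2 2]) h2.le |>.2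

lemma fin_of (P : Par N K E) {g : ℝ → ℝ} (hg : ∀ t, g t ≤ E t) (q : ℕ) :
    ∃ T, ∀ t, T ≤ |t| → g t ≤ P.sg (q + 1) ^ 2 := by
  obtain ⟨T, hT⟩ := P.E_supp
  exact ⟨T, fun t ht => (hg t).trans (by rw [hT t ht]; exact sq_nonneg _)⟩

lemma mean_nonneg {f : PF ℝ} (t : ℝ) (h : ∀ x, 0 ≤ f (t, x)) : 0 ≤ mean f (t, 0) := by
  have h1 := integral_box f t
  have h2 : 0 ≤ ∫ x in Set.Icc (0 : E2) (fun _ => 2 * π), f (t, x) :=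
    integral_nonneg fun x => h x
  rw [h1] at h2
  exact nonneg_of_mul_nonneg_right h2 (by positivity)

theorem exists_start (P : Par N K E) : ∃ σ : Stp N, P.Fits 0 σ ∧ ∀ j, σ.u j = 0 ∧ σ.p = 0 := by
  have hs := P.sg_pos 0
  have hl : 0 < P.la 0 := zero_lt_one.trans_le (P.la_ge 0)
  have he := P.ep_pos 0
  refine ⟨{
    sg := P.sg 0, la := P.la 0, ep := P.ep 0, dl := P.sg 1 ^ 2, lai := P.lai 0,
    u := fun _ => 0, p := 0, r := 0, s := 0, E := E, g := E,
    sg_pos := P.sg_pos 0,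
    la_ge := P.la_ge 0,
    ep_pos := P.ep_pos 0,
    ep_le := (P.ep_le 0).trans (by norm_num),
    ep_le' := P.ep_le 0,
    sg_le := P.sg_le 0,
    la_eq := P.la_eq 0,
    tiny := P.tiny 0,
    tiny' := P.tiny' 0,
    div_u := by simp,
    eq0 := by simp,
    eq1 := by simp,
    u_le := fun i z => by simpa using hl.le,
    du_le := fun i j z => by simpa using by positivity,
    dp_le := fun i z => by simpa using by positivity,
    r_le := fun z => by simpa using by positivity,
    s_le := fun z => by simpa using by positivity,
    dr_le := fun i z => by simpa using by positivity,
    ds_le := fun i z => by simpa using by positivity,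
    mr_le := fun z => by simpa using by positivity,
    ms_le := fun z => by simpa using by positivity,
    g_eq := fun t => by simp,
    g_nonneg := P.E_nonneg,
    g_le := P.E_le,
    E_lip := P.E_lip 0,
    gap := fun t => Or.inr fun x => by simp,
    dl_pos := pow_pos (P.sg_pos 1) 2,
    dl_le := P.sg_sq 0,
    fin := P.fin_of (fun _ => le_rfl) 0 }, ⟨rfl, rfl, rfl, rfl, rfl⟩, fun j => ⟨rfl, rfl⟩⟩

theorem exists_next (P : Par N K E) (hK : 1 ≤ K)
    (h : ∀ σ : Stp N, K * (σ.sg ^ 2 * σ.ep) ≤ σ.dl → ∃ u p r s, σ.Out K u p r s)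
    {q : ℕ} {σ : Stp N} (hσ : P.Fits q σ) :
    ∃ ρ : Stp N, P.Fits (q + 1) ρ ∧ σ.Out K ρ.u ρ.p ρ.r ρ.s := by
  have hs := σ.sg_pos
  have hl := σ.la_pos
  have he := σ.ep_pos
  have he1 := σ.ep_le
  have hs' := P.sg_pos (q + 1)
  have hl' : 0 < P.la (q + 1) := zero_lt_one.trans_le (P.la_ge (q + 1))
  have he' := P.ep_pos (q + 1)
  have hst := P.stress q
  have hve := P.vel q
  have hpr := P.pres q
  have hss := P.sg_succ_le q
  rw [← hσ.sg, ← hσ.ep] at hst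
  rw [← hσ.sg, ← hσ.la] at hve hpr
  rw [← hσ.sg] at hss
  have hA : 0 < σ.sg ^ 2 * σ.ep := by positivity
  have hA' : K * (σ.sg ^ 2 * σ.ep) ≤ P.sg (q + 1) ^ 2 / 80 := by linarith
  have hla : 2 * K * σ.la ≤ P.la (q + 1) * P.ep (q + 1) ^ 2 := by
    have : P.sg (q + 1) * (P.la (q + 1) * P.ep (q + 1) ^ 2) ≤
        σ.sg * (P.la (q + 1) * P.ep (q + 1) ^ 2) := mul_le_mul_of_nonneg_right hss (by positivity)
    refine le_of_mul_le_mul_left ?_ hs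
    calc _ = 2 * K * (σ.sg * σ.la) := by ring
      _ ≤ _ := hve
      _ = P.sg (q + 1) * (P.la (q + 1) * P.ep (q + 1) ^ 2) := by ring
      _ ≤ _ := this
  obtain ⟨u, p, r, s, o⟩ := h σ (by rw [hσ.dl]; linarith [sq_nonneg (P.sg (q + 1))])
  have hE : σ.E = E := hσ.E
  have og := o.g_nonneg; have ogl := o.g_le; have ogg := o.gap
  rw [hE, hσ.dl] at ogl ogg
  rw [hE] at og
  have hsub : ∀ {x y a b : ℝ}, |x - y| ≤ a → |y| ≤ b → |x| ≤ b + a := fun h1 h2 => by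
    rw [abs_le] at *; constructor <;> linarith
  have hd : ∀ {x : ℝ}, x ≤ K * (σ.sg ^ 2 * σ.ep * σ.la) →
      x ≤ P.sg (q + 1) ^ 2 * P.la (q + 1) * P.ep (q + 1) ^ 2 := fun hx => by
    refine hx.trans ?_
    have h1 : σ.la ≤ 2 * K * σ.la := by nlinarith
    calc K * (σ.sg ^ 2 * σ.ep * σ.la) = (K * (σ.sg ^ 2 * σ.ep)) * σ.la := by ring
      _ ≤ (P.sg (q + 1) ^ 2) * (P.la (q + 1) * P.ep (q + 1) ^ 2) :=
        mul_le_mul (by linarith [sq_nonneg (P.sg (q + 1))]) (h1.trans hla) hl.le (sq_nonneg _)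
      _ = _ := by ring
  have hm : ∀ {x : ℝ}, x ≤ K * (σ.sg ^ 3 * σ.ep * σ.la) →
      x ≤ P.sg (q + 1) ^ 3 * P.la (q + 1) * P.ep (q + 1) ^ 2 := fun hx => by
    refine hx.trans ?_
    have h1 : σ.sg * σ.la ≤ 2 * K * (σ.sg * σ.la) := by nlinarith [mul_pos hs hl]
    calc K * (σ.sg ^ 3 * σ.ep * σ.la) = (K * (σ.sg ^ 2 * σ.ep)) * (σ.sg * σ.la) := by ring
      _ ≤ (P.sg (q + 1) ^ 2) * (P.sg (q + 1) * P.la (q + 1) * P.ep (q + 1) ^ 2) :=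
        mul_le_mul (by linarith [sq_nonneg (P.sg (q + 1))]) (h1.trans hve) (by positivity) (sq_nonneg _)
      _ = _ := by ring
  refine ⟨{
    sg := P.sg (q + 1), la := P.la (q + 1), ep := P.ep (q + 1), dl := P.sg (q + 1 + 1) ^ 2,
    lai := P.lai (q + 1), u := u, p := p, r := r, s := s, E := E,
    g := fun t => E t - mean (u 0 ^ 2 + u 1 ^ 2) (t, 0),
    sg_pos := hs',
    la_ge := P.la_ge _,
    ep_pos := he',
    ep_le := (P.ep_le _).trans (by norm_num),
    ep_le' := P.ep_le _,
    sg_le := P.sg_le _,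
    la_eq := P.la_eq _,
    tiny := P.tiny _,
    tiny' := P.tiny' _,
    div_u := o.div_u,
    eq0 := o.eq0,
    eq1 := o.eq1,
    u_le := fun i z => (hsub (o.u_sub i z) (σ.u_le i z)).trans ?_,
    du_le := fun i j z => (hsub (o.du_sub i j z) (σ.du_le i j z)).trans ?_,
    dp_le := fun i z => (hsub (o.dp_sub i z) (σ.dp_le i z)).trans ?_,
    r_le := fun z => (o.rs_le z).1.trans hA',
    s_le := fun z => (o.rs_le z).2.trans hA',
    dr_le := fun i z => hd (o.drs_le i z).1,
    ds_le := fun i z => hd (o.drs_le i z).2,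
    mr_le := fun z => hm (o.mrs_le z).1,
    ms_le := fun z => hm (o.mrs_le z).2,
    g_eq := fun t => rfl,
    g_nonneg := og,
    g_le := ogl,
    E_lip := P.E_lip _,
    gap := ogg,
    dl_pos := pow_pos (P.sg_pos _) 2,
    dl_le := P.sg_sq _,
    fin := P.fin_of (fun t => sub_le_self _ (mean_nonneg _ fun x => ?_)) _ },
    ⟨rfl, rfl, rfl, rfl, rfl⟩, o⟩
  · have h1 : P.la (q + 1) * P.ep (q + 1) ^ 2 ≤ P.la (q + 1) :=
      mul_le_of_le_one_right hl'.le (pow_le_one₀ he'.le ((P.ep_le _).trans (by norm_num)))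
    have h2 : K * σ.sg ≤ K * σ.la := mul_le_mul_of_nonneg_left σ.sg_le (by linarith)
    have h3 : σ.la ≤ K * σ.la := le_mul_of_one_le_left hl.le hK
    linarith
  · have h1 : σ.sg * σ.la * σ.ep ^ 2 ≤ σ.sg * σ.la := σ.drop 2 rfl (by positivity)
    have h2 : σ.sg * σ.la ≤ K * (σ.sg * σ.la) := le_mul_of_one_le_left (by positivity) hK
    linarith
  · have h1 : σ.sg ^ 2 * σ.la * σ.ep ≤ σ.sg ^ 2 * σ.la := σ.drop 1 (by ring) (by positivity)
    have h2 : σ.sg ^ 2 * σ.la ≤ K * (σ.sg ^ 2 * σ.la) := le_mul_of_one_le_left (by positivity) hK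
    linarith
  · rw [add_apply, pow_two, pow_two, mul_apply, mul_apply]
    exact add_nonneg (mul_self_nonneg _) (mul_self_nonneg _)

theorem exists_seq (P : Par N K E) (hK : 1 ≤ K)
    (h : ∀ σ : Stp N, K * (σ.sg ^ 2 * σ.ep) ≤ σ.dl → ∃ u p r s, σ.Out K u p r s) :
    ∃ σ : ℕ → Stp N, (∀ q, P.Fits q (σ q)) ∧ (∀ j, (σ 0).u j = 0) ∧ (σ 0).p = 0 ∧
      ∀ q, (σ q).Out K (σ (q + 1)).u (σ (q + 1)).p (σ (q + 1)).r (σ (q + 1)).s := by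
  obtain ⟨σ0, h0, h0'⟩ := P.exists_start
  choose! F hF hF' using fun q (σ : Stp N) (hσ : P.Fits q σ) => P.exists_next hK h hσ
  let σ : ℕ → Stp N := fun q => Nat.rec σ0 (fun q σ => F q σ) q
  have hfit : ∀ q, P.Fits q (σ q) := fun q => by
    induction q with
    | zero => exact h0
    | succ q ih => exact hF q _ ih
  exact ⟨σ, hfit, fun j => (h0' j).1, (h0' 0).2, fun q => hF' q _ (hfit q)⟩

end Par

/-! ### Choice of the parameters -/

lemma mul_exp_le {C M A B : ℝ} (hC : C ≤ M) (h : M + A ≤ B) : C * exp A ≤ exp B := by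
  have h1 : C ≤ exp M := by linarith [add_one_le_exp M]
  calc C * exp A ≤ exp M * exp A := mul_le_mul_of_nonneg_right h1 (exp_pos A).le
    _ = exp (M + A) := (exp_add _ _).symm
    _ ≤ exp B := exp_le_exp.2 h

lemma exp_pow' (x : ℝ) (n : ℕ) : exp x ^ n = exp (n * x) := (exp_nat_mul x n).symm

lemma ceil_exp_le {v : ℝ} (hv : 0 ≤ v) :
    5 * exp v ≤ 5 * (⌈exp v⌉₊ : ℝ) ∧ 5 * (⌈exp v⌉₊ : ℝ) ≤ 10 * exp v := by
  have h1 := Nat.le_ceil (exp v)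
  have h2 := (Nat.ceil_lt_add_one (exp_pos v).le).le
  have h3 := one_le_exp hv
  constructor <;> linarith

set_option maxHeartbeats 1600000 in
theorem exists_par {ζ : ℝ} (hζ : 0 < ζ) (hζ' : ζ < 1 / 5) :
    ∃ N : ℕ, ∀ K : ℝ, 1 ≤ K → ∀ E : ℝ → ℝ, (∀ t, 0 ≤ E t) → (∃ B, ∀ t, E t ≤ B) →
      (∃ L, ∀ t t', |E t - E t'| ≤ L * |t - t'|) → (∃ T, ∀ t, T ≤ |t| → E t = 0) →
      ∃ P : Par N K E, ∃ A, 0 < A ∧ ∀ q, P.sg q * P.la q ^ ζ ≤ A * (1 / 2) ^ q := by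
  obtain ⟨β, hβ1, hβ2⟩ := exists_between hζ'
  have hβ0 : 0 < β := hζ.trans hβ1
  obtain ⟨b, hb1, hb2⟩ := exists_between (show (1 : ℝ) < 5 * (1 - β) / 4 by linarith)
  obtain ⟨κ, hκ⟩ : ∃ κ, κ = (b - 1) * (2 / 5) := ⟨_, rfl⟩
  have hb0 : 0 < b - 1 := by linarith
  have hκ0 : 0 < κ := by rw [hκ]; positivity
  have hb54 : b ≤ 5 / 4 := by linarith
  have hκ1 : κ ≤ 1 / 10 := by rw [hκ]; linarith
  have c1 : 0 < 2 * β * (b - 1) := by positivity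
  have c2 : 0 < κ - 2 * β * (b - 1) := by rw [hκ]; nlinarith
  have c3 : 0 < (b - 1) * (1 - β) - 2 * κ * b := by
    rw [hκ]
    have := mul_pos hb0 (show 0 < 1 - β - 4 * b / 5 by linarith)
    linarith
  have c4 : 0 < (b - 1) * (1 - 2 * β) - κ * b := by
    rw [hκ]
    have := mul_pos hb0 (show 0 < 1 - 2 * β - 2 * b / 5 by linarith)
    linarith
  have c5 : 0 < 1 - 3 * β - 2 * κ := by linarith
  have c6 : 0 < (β - ζ) * (b - 1) := mul_pos (by linarith) hb0
  obtain ⟨N, hN⟩ := exists_nat_ge (12 / κ)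
  rw [div_le_iff₀ hκ0] at hN
  refine ⟨N, fun K hK E hE ⟨B, hB⟩ ⟨L, hL⟩ hT => ?_⟩
  obtain ⟨S, hS1, hSB⟩ : ∃ S : ℝ, 1 ≤ S ∧ B ≤ S := ⟨max 1 B, le_max_left _ _, le_max_right _ _⟩
  have hS0 : 0 < S := by linarith
  obtain ⟨M, hM⟩ : ∃ M, M = 10 ^ 10 + 80 * K + |L| + S := ⟨_, rfl⟩
  have hL0 := abs_nonneg L
  have hLL := le_abs_self L
  have hev : ∀ c : ℝ, 0 < c → ∀ᶠ W in Filter.atTop, M ≤ c * W := fun c hc =>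
    (Filter.tendsto_id.const_mul_atTop hc).eventually_ge_atTop M
  obtain ⟨W, ⟨⟨⟨⟨⟨⟨⟨h0, h1⟩, h2⟩, h3⟩, h4⟩, h5⟩, h6⟩, h7⟩⟩ := ((((((((hev κ hκ0).and
    (hev _ c1)).and (hev _ c2)).and (hev _ c3)).and (hev _ c4)).and (hev _ c5)).and
    (hev _ c6)).and (hev 1 one_pos)).exists
  have hW : 0 ≤ W := by linarith
  obtain ⟨w, hw⟩ : ∃ w : ℕ → ℝ, w = fun q => b ^ q * W := ⟨_, rfl⟩
  have hw0 : w 0 = W := by simp [hw]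
  have hws : ∀ q, w (q + 1) = b * w q := fun q => by simp only [hw, pow_succ]; ring
  have hwW : ∀ q, W ≤ w q := fun q => by
    simp only [hw]; exact le_mul_of_one_le_left hW (one_le_pow₀ hb1.le)
  have hup : ∀ {c : ℝ} (q : ℕ), 0 < c → M ≤ c * W → M ≤ c * w q := fun q hc h =>
    h.trans (mul_le_mul_of_nonneg_left (hwW q) hc.le)
  have hwp : ∀ q, 0 ≤ w q := fun q => hW.trans (hwW q)
  obtain ⟨sg, hsg⟩ : ∃ sg : ℕ → ℝ, sg = fun q => S * exp (-β * (w q - W)) := ⟨_, rfl⟩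
  obtain ⟨la, hla⟩ : ∃ la : ℕ → ℝ, la = fun q => 5 * (⌈exp (w q)⌉₊ : ℝ) := ⟨_, rfl⟩
  obtain ⟨ep, hep⟩ : ∃ ep : ℕ → ℝ, ep = fun q => exp (-κ * w q) := ⟨_, rfl⟩
  have hsgp : ∀ q, 0 < sg q := fun q => by rw [hsg]; positivity
  have hepp : ∀ q, 0 < ep q := fun q => by rw [hep]; positivity
  have hl1 : ∀ q, 5 * exp (w q) ≤ la q := fun q => by rw [hla]; exact (ceil_exp_le (hwp q)).1
  have hl2 : ∀ q, la q ≤ 10 * exp (w q) := fun q => by rw [hla]; exact (ceil_exp_le (hwp q)).2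
  have hlap : ∀ q, 0 < la q := fun q => (by positivity : 0 < 5 * exp (w q)).trans_le (hl1 q)
  have hsg1 : ∀ q, exp (-β * w q) ≤ sg q := fun q => by
    rw [hsg]
    exact (exp_le_exp.2 (by nlinarith)).trans (le_mul_of_one_le_left (exp_pos _).le hS1)
  have htiny : ∀ q, la q ^ 10 * ep q ^ N ≤ exp (-w q) := fun q => by
    calc la q ^ 10 * ep q ^ N ≤ (10 * exp (w q)) ^ 10 * ep q ^ N :=
          mul_le_mul_of_nonneg_right (pow_le_pow_left₀ (hlap q).le (hl2 q) _)
            (pow_nonneg (hepp q).le _)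
      _ = 10 ^ 10 * exp (10 * w q - N * κ * w q) := by
          rw [mul_pow, hep]
          simp only [exp_pow']
          rw [mul_assoc, ← exp_add]; push_cast; ring_nf
      _ ≤ exp (-w q) := mul_exp_le (M := M) (by linarith) (by
          have := mul_le_mul_of_nonneg_right hN (hwp q)
          have := hup q one_pos h7
          linarith)
  refine ⟨{
    sg := sg, la := la, ep := ep, lai := fun q => ⌈exp (w q)⌉₊,
    sg_pos := hsgp, ep_pos := hepp,
    la_ge := fun q => by linarith [hl1 q, one_le_exp (hwp q)],
    la_eq := fun q => by rw [hla],
    ep_le := fun q => ?_, sg_le := fun q => ?_,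
    tiny := fun q => (htiny q).trans ((exp_le_exp.2 (by nlinarith [hwp q])).trans (hsg1 q)),
    tiny' := fun q => (htiny q).trans ?_,
    sg_sq := fun q => ?_, stress := fun q => ?_, vel := fun q => ?_, pres := fun q => ?_,
    E_nonneg := hE,
    E_le := fun t => ?_,
    E_lip := fun q t t' => (hL t t').trans (mul_le_mul_of_nonneg_right ?_ (abs_nonneg _)),
    E_supp := hT }, 10 * S * exp (ζ * W), by positivity, fun q => ?_⟩
  · rw [hep]
    have := mul_exp_le (C := 8) (A := -κ * w q) (B := 0) (M := M) (by linarith)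
      (by linarith [hup q hκ0 h0])
    rw [exp_zero] at this
    linarith
  · have e1 : sg q ≤ S := by
      rw [hsg]
      exact mul_le_of_le_one_right hS0.le (exp_le_one_iff.2 (by nlinarith [hwW q]))
    have := hup q one_pos h7
    have := add_one_le_exp (w q)
    linarith [hl1 q]
  · refine le_trans ?_ (pow_le_pow_left₀ (exp_pos _).le (hsg1 q) 2)
    rw [exp_pow']
    refine exp_le_exp.2 ?_
    push_cast
    nlinarith [hwp q]
  · have e := mul_exp_le (C := 8) (M := M) (A := 2 * (-β * (w (q + 1) - W)))
      (B := 2 * (-β * (w q - W))) (by linarith) (by rw [hws]; linarith [hup q c1 h1])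
    rw [hsg]
    simp only [mul_pow, exp_pow']
    push_cast
    have := mul_le_mul_of_nonneg_left e (sq_nonneg S)
    linarith
  · have e := mul_exp_le (C := 80 * K) (M := M) (A := 2 * (-β * (w q - W)) + -κ * w q)
      (B := 2 * (-β * (w (q + 1) - W))) (by linarith) (by rw [hws]; linarith [hup q c2 h2])
    rw [hsg, hep]
    simp only [mul_pow, exp_pow']
    push_cast
    rw [exp_add] at e
    have := mul_le_mul_of_nonneg_left e (sq_nonneg S)
    linarith
  · have e := mul_exp_le (C := 4 * K) (M := M) (A := -β * (w q - W) + w q)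
      (B := -β * (w (q + 1) - W) + w (q + 1) + 2 * (-κ * w (q + 1))) (by linarith)
      (by rw [hws]; linarith [hup q c3 h3])
    have f1 : 2 * K * (sg q * la q) ≤ 2 * K * (sg q * (10 * exp (w q))) := by
      have := hl2 q; have := hsgp q; gcongr
    have f2 : sg (q + 1) * (5 * exp (w (q + 1))) * ep (q + 1) ^ 2 ≤
        sg (q + 1) * la (q + 1) * ep (q + 1) ^ 2 := by
      have := hl1 (q + 1); have := hsgp (q + 1); gcongr
    refine f1.trans (le_trans ?_ f2)
    rw [hsg, hep]
    simp only [mul_pow, exp_pow']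
    push_cast
    rw [exp_add, exp_add, exp_add] at e
    have := mul_le_mul_of_nonneg_left e (show 0 ≤ 5 * S by positivity)
    linarith
  · have e := mul_exp_le (C := 4 * K) (M := M) (A := 2 * (-β * (w q - W)) + w q)
      (B := 2 * (-β * (w (q + 1) - W)) + w (q + 1) + -κ * w (q + 1)) (by linarith)
      (by rw [hws]; linarith [hup q c4 h4])
    have f1 : 2 * K * (sg q ^ 2 * la q) ≤ 2 * K * (sg q ^ 2 * (10 * exp (w q))) := by
      have := hl2 q; have := hsgp q; gcongr
    have f2 : sg (q + 1) ^ 2 * (5 * exp (w (q + 1))) * ep (q + 1) ≤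
        sg (q + 1) ^ 2 * la (q + 1) * ep (q + 1) := by
      have := hl1 (q + 1); have := hsgp (q + 1); have := (hepp (q + 1)).le; gcongr
    refine f1.trans (le_trans ?_ f2)
    rw [hsg, hep]
    simp only [mul_pow, exp_pow']
    push_cast
    rw [exp_add, exp_add, exp_add] at e
    have := mul_le_mul_of_nonneg_left e (show 0 ≤ 5 * S ^ 2 by positivity)
    linarith
  · rw [hsg]
    simp only [hw0, sub_self, mul_zero, exp_zero, mul_one]
    nlinarith [hB t]
  · have e := mul_exp_le (C := L) (M := M) (A := 0)
      (B := 3 * (-β * w q) + w q + 2 * (-κ * w q)) (by linarith)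
      (by linarith [hup q c5 h5])
    rw [exp_zero, mul_one] at e
    refine e.trans ?_
    rw [exp_add, exp_add]
    have g1 : exp (3 * (-β * w q)) ≤ sg q ^ 3 := by
      refine le_trans (le_of_eq ?_) (pow_le_pow_left₀ (exp_pos _).le (hsg1 q) 3)
      rw [exp_pow']; push_cast; rfl
    have g2 : exp (2 * (-κ * w q)) = ep q ^ 2 := by rw [hep, exp_pow']; push_cast; rfl
    rw [g2]
    have := hl1 q; have := exp_pos (w q); have := (hsgp q).le; have := (hepp q).le
    gcongr
    linarith
  · have hind : exp (-(β - ζ) * (w q - W)) ≤ (1 / 2) ^ q := by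
      induction q with
      | zero => simp [hw0]
      | succ q ih =>
        have e := mul_exp_le (C := 2) (M := M) (A := -(β - ζ) * (w (q + 1) - W))
          (B := -(β - ζ) * (w q - W)) (by linarith) (by rw [hws]; linarith [hup q c6 h6])
        rw [pow_succ]
        linarith
    have e1 : la q ^ ζ ≤ 10 * exp (ζ * w q) := by
      refine (rpow_le_rpow (hlap q).le (hl2 q) hζ.le).trans ?_
      rw [mul_rpow (by norm_num) (exp_pos _).le, ← exp_mul, mul_comm (w q)]
      refine mul_le_mul_of_nonneg_right ?_ (exp_pos _).le
      calc (10 : ℝ) ^ ζ ≤ 10 ^ (1 : ℝ) := rpow_le_rpow_of_exponent_le (by norm_num) (by linarith)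
        _ = 10 := rpow_one _
    calc sg q * la q ^ ζ ≤ sg q * (10 * exp (ζ * w q)) := mul_le_mul_of_nonneg_left e1 (hsgp q).le
      _ = 10 * S * exp (ζ * W) * exp (-(β - ζ) * (w q - W)) := by
        rw [hsg]
        have : exp (-β * (w q - W)) * exp (ζ * w q) =
            exp (ζ * W) * exp (-(β - ζ) * (w q - W)) := by
          rw [← exp_add, ← exp_add]; ring_nf
        linear_combination 10 * S * this
      _ ≤ _ := mul_le_mul_of_nonneg_left hind (by positivity)

/-! ### The sequence of approximate solutions -/

lemma dv_split (v : ℝ × E2) (f : PF ℝ) (z) :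
    dv v f z = v.1 * dt f z + (v.2 0 * d 0 f z + v.2 1 * d 1 f z) := by
  have h : v = v.1 • ((1 : ℝ), (0 : E2)) + (0, v.2) := by ext <;> simp
  conv_lhs => rw [h]
  rw [dv_add, dv_smul, dv_space]
  simp

lemma abs_sub_le_of_deriv_le (f : PF ℝ) {M : ℝ} (z z' : ℝ × E2)
    (ht : ∀ w, |(z'.1 - z.1) * dt f w| ≤ |z'.1 - z.1| * M) (hd : ∀ i w, |d i f w| ≤ M) :
    |f z' - f z| ≤ M * (2 * (|z'.1 - z.1| + ‖z'.2 - z.2‖)) := by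
  have hM : 0 ≤ M := (abs_nonneg _).trans (hd 0 z)
  have hc : ∀ i, |(z' - z).2 i| ≤ ‖z'.2 - z.2‖ := fun i => norm_le_pi_norm (z'.2 - z.2) i
  have h := abs_line_sub_le f (z' - z) (M * (2 * (|z'.1 - z.1| + ‖z'.2 - z.2‖))) z zero_le_one
    fun s _ => by
      rw [dv_split]
      refine (abs_add_le _ _).trans ((add_le_add (ht _) (abs_add_le _ _)).trans ?_)
      rw [abs_mul, abs_mul]
      have h0 := mul_le_mul (hc 0) (hd 0 (z + s • (z' - z))) (abs_nonneg _) (norm_nonneg _)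
      have h1 := mul_le_mul (hc 1) (hd 1 (z + s • (z' - z))) (abs_nonneg _) (norm_nonneg _)
      have h2 := mul_nonneg (abs_nonneg (z'.1 - z.1)) hM
      linarith
  simpa using h

lemma le_rpow_of_le {m a l D ζ : ℝ} (hζ : 0 < ζ) (hζ' : ζ ≤ 1) (ha : 0 ≤ a) (hl : 0 ≤ l)
    (hD : 0 ≤ D) (h1 : m ≤ a) (h2 : m ≤ a * (l * D)) : m ≤ a * l ^ ζ * D ^ ζ := by
  rw [mul_assoc, ← mul_rpow hl hD]
  rcases le_total 1 (l * D) with h | h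
  · exact h1.trans (le_mul_of_one_le_right ha (one_le_rpow h hζ.le))
  · exact h2.trans (mul_le_mul_of_nonneg_left
      (self_le_rpow_of_le_one (mul_nonneg hl hD) h hζ') ha)

lemma abs_transport_sub_le {A' A a b a' b' x y x' y' P P' R R' k m n U p ρ ρ' : ℝ}
    (h' : A' + (a' * x' + b' * y') + P' = R') (h : A + (a * x + b * y) + P = R)
    (ha : |a' - a| ≤ k) (hb : |b' - b| ≤ k) (hx : |x' - x| ≤ m) (hy : |y' - y| ≤ m)
    (hx' : |x'| ≤ n) (hy' : |y'| ≤ n) (hU : |a| ≤ U) (hU' : |b| ≤ U) (hP : |P' - P| ≤ p)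
    (hR' : |R'| ≤ ρ') (hR : |R| ≤ ρ) : |A' - A| ≤ 2 * (k * n + U * m) + p + ρ' + ρ := by
  have e : A' - A = -((a' - a) * x' + a * (x' - x)) - ((b' - b) * y' + b * (y' - y)) - (P' - P)
      + R' - R := by linear_combination h' - h
  have hm : ∀ {c d C D : ℝ}, |c| ≤ C → |d| ≤ D → |c * d| ≤ C * D := fun h1 h2 => by
    rw [abs_mul]; exact mul_le_mul h1 h2 (abs_nonneg _) ((abs_nonneg _).trans h1)
  have h1 := abs_le.1 (hm ha hx')
  have h2 := abs_le.1 (hm hU hx)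
  have h3 := abs_le.1 (hm hb hy')
  have h4 := abs_le.1 (hm hU' hy)
  rw [abs_le] at hP hR hR'
  rw [e, abs_le]
  constructor <;> linarith

/-- A sequence of Euler–Reynolds flows converging to an Euler flow. -/
structure Appr (E : ℝ → ℝ) (ζ : ℝ) where
  u : ℕ → Fin 2 → PF ℝ
  p : ℕ → PF ℝ
  r : ℕ → PF ℝ
  s : ℕ → PF ℝ
  C : ℝ
  C_pos : 0 < C
  u_zero : ∀ j, u 0 j = 0
  p_zero : p 0 = 0
  div_u : ∀ q, d 0 (u q 0) + d 1 (u q 1) = 0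
  eq0 : ∀ q, mat (u q) (u q 0) + d 0 (p q) = d 0 (r q) + d 1 (s q)
  eq1 : ∀ q, mat (u q) (u q 1) + d 1 (p q) = d 0 (s q) - d 1 (r q)
  u_sub : ∀ q i z, |u (q + 1) i z - u q i z| ≤ C * (1 / 2) ^ q
  u_hol : ∀ q i z z', |(u (q + 1) i z - u q i z) - (u (q + 1) i z' - u q i z')| ≤
    C * (|z.1 - z'.1| + ‖z.2 - z'.2‖) ^ ζ * (1 / 2) ^ q
  p_sub : ∀ q z, |p (q + 1) z - p q z| ≤ C * (1 / 2) ^ q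
  p_hol : ∀ q t x x', |(p (q + 1) (t, x) - p q (t, x)) - (p (q + 1) (t, x') - p q (t, x'))| ≤
    C * ‖x - x'‖ ^ (2 * ζ) * (1 / 2) ^ q
  r_le : ∀ q z, |r q z| ≤ C * (1 / 2) ^ q
  s_le : ∀ q z, |s q z| ≤ C * (1 / 2) ^ q
  energy : ∀ q t, |E t - mean (u q 0 ^ 2 + u q 1 ^ 2) (t, 0)| ≤ C * (1 / 2) ^ q

lemma abs_le_of_geometric {F : ℕ → ℝ} {B : ℝ} (h0 : F 0 = 0)
    (h : ∀ q, |F (q + 1) - F q| ≤ B * (1 / 2) ^ q) (q : ℕ) : |F q| ≤ 2 * B := by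
  have hB : 0 ≤ B := by simpa using (abs_nonneg _).trans (h 0)
  have : |F q| ≤ 2 * B - 2 * B * (1 / 2) ^ q := by
    induction q with
    | zero => simp [h0]
    | succ q ih =>
      have h1 := abs_le.1 (h q)
      rw [abs_le] at ih ⊢
      rw [pow_succ]
      constructor <;> linarith
  have h2 : 0 ≤ 2 * B * (1 / 2) ^ q := by positivity
  linarith

lemma Stp.Out.dt_sub_le {N : ℕ} {σ ρ : Stp N} {K U A : ℝ} (hK : 1 ≤ K)
    (o : σ.Out K ρ.u ρ.p ρ.r ρ.s) (hU : ∀ i z, |σ.u i z| ≤ U) (hA : σ.sg ≤ A) (i : Fin 2) (z) :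
    |dt (ρ.u i) z - dt (σ.u i) z| ≤ (4 * K ^ 2 * A + 2 * U * K + 3 * K * A + 2 * A) * (σ.sg * σ.la) := by
  have hs := σ.sg_pos
  have hl := σ.la_pos
  have he := σ.ep_pos
  have he1 := σ.ep_le
  have hU0 : 0 ≤ U := (abs_nonneg _).trans (hU 0 z)
  have hsl : 0 < σ.sg * σ.la := by positivity
  have hn : ∀ j k, |d j (ρ.u k) z| ≤ 2 * K * (σ.sg * σ.la) := fun j k => by
    have h1 := o.du_sub j k z
    have h2 : |d j (σ.u k) z| ≤ σ.sg * σ.la :=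
      (σ.du_le j k z).trans (mul_le_of_le_one_right hsl.le (pow_le_one₀ he.le he1))
    have h3 : σ.sg * σ.la ≤ K * (σ.sg * σ.la) := le_mul_of_one_le_left hsl.le hK
    rw [abs_le] at *
    constructor <;> linarith
  have hb : ∀ {X : ℝ}, X ≤ σ.sg ^ 2 * σ.la * σ.ep ^ 2 → X ≤ σ.sg * (σ.sg * σ.la) := fun h => by
    have : σ.sg ^ 2 * σ.la * σ.ep ^ 2 ≤ σ.sg ^ 2 * σ.la :=
      mul_le_of_le_one_right (by positivity) (pow_le_one₀ he.le he1)
    linarith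
  have hb' : ∀ {X : ℝ}, X ≤ K * (σ.sg ^ 2 * σ.ep * σ.la) → X ≤ K * (σ.sg * (σ.sg * σ.la)) :=
    fun h => h.trans (mul_le_mul_of_nonneg_left (by
      have : σ.sg ^ 2 * σ.la * σ.ep ≤ σ.sg ^ 2 * σ.la := mul_le_of_le_one_right (by positivity) he1
      linarith) (by linarith))
  have hp : ∀ j, |d j ρ.p z - d j σ.p z| ≤ K * (σ.sg * (σ.sg * σ.la)) := fun j =>
    (o.dp_sub j z).trans (le_of_eq (by ring))
  have key : ∀ {i : Fin 2} {R R' : ℝ}, mat ρ.u (ρ.u i) z + d i ρ.p z = R' →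
      mat σ.u (σ.u i) z + d i σ.p z = R → |R'| ≤ 2 * (K * (σ.sg * (σ.sg * σ.la))) →
      |R| ≤ 2 * (σ.sg * (σ.sg * σ.la)) → |dt (ρ.u i) z - dt (σ.u i) z| ≤
      (4 * K ^ 2 * A + 2 * U * K + 3 * K * A + 2 * A) * (σ.sg * σ.la) := fun {i R R'} h' h hR' hR => by
    rw [mat_apply] at h h'
    simp only [add_apply, mul_apply] at h h'
    refine (abs_transport_sub_le h' h (o.u_sub 0 z) (o.u_sub 1 z) (o.du_sub 0 i z) (o.du_sub 1 i z)
      (hn 0 i) (hn 1 i) (hU 0 z) (hU 1 z) (hp i) hR' hR).trans ?_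
    have := mul_le_mul_of_nonneg_left hA (show 0 ≤ (4 * K ^ 2 + 3 * K + 2) * (σ.sg * σ.la) by
      positivity)
    linarith
  have e0' := congrArg (fun f : PF ℝ => f z) o.eq0
  have e1' := congrArg (fun f : PF ℝ => f z) o.eq1
  have e0 := congrArg (fun f : PF ℝ => f z) σ.eq0
  have e1 := congrArg (fun f : PF ℝ => f z) σ.eq1
  simp only [add_apply, sub_apply] at e0 e1 e0' e1'
  have r0 := hb (σ.dr_le 0 z); have r1 := hb (σ.dr_le 1 z)
  have s0 := hb (σ.ds_le 0 z); have s1 := hb (σ.ds_le 1 z)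
  have r0' := hb' (o.drs_le 0 z).1; have r1' := hb' (o.drs_le 1 z).1
  have s0' := hb' (o.drs_le 0 z).2; have s1' := hb' (o.drs_le 1 z).2
  fin_cases i
  · exact key e0' e0 ((abs_add_le _ _).trans (by linarith)) ((abs_add_le _ _).trans (by linarith))
  · exact key e1' e1 ((abs_sub _ _).trans (by linarith)) ((abs_sub _ _).trans (by linarith))

set_option maxHeartbeats 1000000 in
theorem exists_appr {ζ : ℝ} (hζ : 0 < ζ) (hζ' : ζ < 1 / 5) {E : ℝ → ℝ} (hE : ∀ t, 0 ≤ E t)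
    (hB : ∃ B, ∀ t, E t ≤ B) (hL : ∃ L, ∀ t t', |E t - E t'| ≤ L * |t - t'|)
    (hT : ∃ T, ∀ t, T ≤ |t| → E t = 0) : Nonempty (Appr E ζ) := by
  obtain ⟨N, hN⟩ := exists_par hζ hζ'
  obtain ⟨K, hK, hstep⟩ := Stp.exists_out N
  obtain ⟨P, A, hA, hAq⟩ := hN K hK E hE hB hL hT
  obtain ⟨σ, hσ, hu0, hp0, ho⟩ := P.exists_seq hK hstep
  have hK0 : 0 < K := by linarith
  have hlaz : ∀ q, 1 ≤ (σ q).la ^ ζ := fun q => one_le_rpow (σ q).la_ge hζ.le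
  have hAq' : ∀ q, (σ q).sg * (σ q).la ^ ζ ≤ A * (1 / 2) ^ q := fun q => by
    rw [(hσ q).sg, (hσ q).la]; exact hAq q
  have hsgq : ∀ q, (σ q).sg ≤ A * (1 / 2) ^ q := fun q =>
    (le_mul_of_one_le_right (σ q).sg_pos.le (hlaz q)).trans (hAq' q)
  have hpow : ∀ q : ℕ, (1 / 2 : ℝ) ^ q ≤ 1 := fun q => pow_le_one₀ (by norm_num) (by norm_num)
  have hpow' : ∀ q : ℕ, (0 : ℝ) < (1 / 2) ^ q := fun q => by positivity
  have hsgA : ∀ q, (σ q).sg ≤ A := fun q => (hsgq q).trans (mul_le_of_le_one_right hA.le (hpow q))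
  have hsqa : ∀ {x : ℝ} (q : ℕ), 0 ≤ x → x ≤ A * (1 / 2) ^ q → x ^ 2 ≤ A ^ 2 * (1 / 2) ^ q :=
    fun {x} q h0 h => by
      calc x ^ 2 ≤ (A * (1 / 2) ^ q) ^ 2 := pow_le_pow_left₀ h0 h 2
        _ = A ^ 2 * (1 / 2) ^ q * (1 / 2) ^ q := by ring
        _ ≤ A ^ 2 * (1 / 2) ^ q := mul_le_of_le_one_right (by positivity) (hpow q)
  have hsg2 : ∀ q, (σ q).sg ^ 2 ≤ A ^ 2 * (1 / 2) ^ q := fun q => hsqa q (σ q).sg_pos.le (hsgq q)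
  have hU : ∀ q i z, |(σ q).u i z| ≤ 2 * (K * A) := fun q i z =>
    abs_le_of_geometric (F := fun q => (σ q).u i z) (B := K * A) (by simp [hu0]) (fun q =>
      ((ho q).u_sub i z).trans (by
        have := mul_le_mul_of_nonneg_left (hsgq q) hK0.le
        linarith)) q
  obtain ⟨M, hM⟩ : ∃ M, M = 4 * K ^ 2 * A + 2 * (2 * (K * A)) * K + 3 * K * A + 2 * A + K :=
    ⟨_, rfl⟩
  have hMK : K ≤ M := by rw [hM]; linarith [show 0 < 4 * K ^ 2 * A by positivity,
    show 0 < 2 * (2 * (K * A)) * K by positivity, show 0 < K * A by positivity]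
  have hM0 : 0 < M := by linarith
  obtain ⟨C, hC⟩ : ∃ C, C = 2 * M * A + 2 * K * A ^ 2 + 2 * A ^ 2 := ⟨_, rfl⟩
  have hC1 : 2 * M * A ≤ C := by rw [hC]; linarith [show 0 < 2 * K * A ^ 2 by positivity, sq_nonneg A]
  have hC2 : 2 * K * A ^ 2 ≤ C := by rw [hC]; linarith [show 0 < 2 * M * A by positivity, sq_nonneg A]
  have hC3 : 2 * A ^ 2 ≤ C := by
    rw [hC]; linarith [show 0 < 2 * M * A by positivity, show 0 < 2 * K * A ^ 2 by positivity]
  have hC0 : 0 < C := (by positivity : 0 < 2 * A ^ 2).trans_le hC3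
  have hrs : ∀ q (x : ℝ), |x| ≤ (σ q).sg ^ 2 / 80 → |x| ≤ C * (1 / 2) ^ q := fun q x h => by
    have := mul_le_mul_of_nonneg_right hC3 (hpow' q).le
    linarith [hsg2 q, sq_nonneg (σ q).sg]
  refine ⟨{ u := fun q => (σ q).u, p := fun q => (σ q).p, r := fun q => (σ q).r,
            s := fun q => (σ q).s, C := C, C_pos := hC0, u_zero := hu0, p_zero := hp0,
            div_u := fun q => (σ q).div_u, eq0 := fun q => (σ q).eq0, eq1 := fun q => (σ q).eq1,
            r_le := fun q z => hrs q _ ((σ q).r_le z),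
            s_le := fun q z => hrs q _ ((σ q).s_le z),
            u_sub := fun q i z => ?_, u_hol := fun q i z z' => ?_, p_sub := fun q z => ?_,
            p_hol := fun q t x x' => ?_, energy := fun q t => ?_ }⟩
  · have h1 := mul_le_mul hMK (hsgq q) (σ q).sg_pos.le hM0.le
    have h2 := mul_le_mul_of_nonneg_right hC1 (hpow' q).le
    have h3 : 0 < M * (A * (1 / 2) ^ q) := by positivity
    linarith [(ho q).u_sub i z]
  · have hs := (σ q).sg_pos
    have hl := (σ q).la_pos
    have hsl : 0 < (σ q).sg * (σ q).la := mul_pos hs hl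
    have hd := abs_sub_le_of_deriv_le ((σ (q + 1)).u i - (σ q).u i)
      (M := M * ((σ q).sg * (σ q).la)) z' z (fun w => by
        rw [abs_mul]
        refine mul_le_mul_of_nonneg_left ?_ (abs_nonneg _)
        rw [map_sub, sub_apply]
        refine ((ho q).dt_sub_le hK (hU q) (hsgA q) i w).trans (mul_le_mul_of_nonneg_right ?_ hsl.le)
        rw [hM]; linarith) (fun j w => by
        rw [map_sub, sub_apply]
        exact ((ho q).du_sub j i w).trans (mul_le_mul_of_nonneg_right hMK hsl.le))
    simp only [sub_apply] at hd
    have hD : 0 ≤ |z.1 - z'.1| + ‖z.2 - z'.2‖ := by positivity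
    have h0 : |(σ (q + 1)).u i z - (σ q).u i z - ((σ (q + 1)).u i z' - (σ q).u i z')| ≤
        2 * M * (σ q).sg := by
      have h1 := (ho q).u_sub i z; have h2 := (ho q).u_sub i z'
      have h3 := mul_le_mul_of_nonneg_right hMK hs.le
      exact (abs_sub _ _).trans (by linarith)
    have h1 := le_rpow_of_le hζ (by linarith) (by positivity) hl.le hD h0 (hd.trans (le_of_eq (by ring)))
    refine h1.trans ?_
    have h2 : 2 * M * (σ q).sg * (σ q).la ^ ζ ≤ C * (1 / 2) ^ q := by
      have h3 := mul_le_mul_of_nonneg_left (hAq' q) (show 0 ≤ 2 * M by positivity)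
      have h4 := mul_le_mul_of_nonneg_right hC1 (hpow' q).le
      linarith
    have := mul_le_mul_of_nonneg_right h2 (rpow_nonneg hD ζ)
    linarith
  · have h1 := mul_le_mul_of_nonneg_left (hsg2 q) hK0.le
    have h2 := mul_le_mul_of_nonneg_right hC2 (hpow' q).le
    have h3 : 0 < K * (A ^ 2 * (1 / 2) ^ q) := by positivity
    linarith [(ho q).p_sub z]
  · have hs := (σ q).sg_pos
    have hl := (σ q).la_pos
    have hd := abs_sub_le_of_deriv_le ((σ (q + 1)).p - (σ q).p)
      (M := K * ((σ q).sg ^ 2 * (σ q).la)) (t, x') (t, x) (fun w => by simp) (fun j w => by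
        rw [map_sub, sub_apply]
        exact (ho q).dp_sub j w)
    simp only [sub_apply, sub_self, abs_zero, zero_add] at hd
    have hD : 0 ≤ ‖x - x'‖ := norm_nonneg _
    have h0 : |(σ (q + 1)).p (t, x) - (σ q).p (t, x) - ((σ (q + 1)).p (t, x') - (σ q).p (t, x'))| ≤
        2 * K * (σ q).sg ^ 2 := by
      have h1 := (ho q).p_sub (t, x); have h2 := (ho q).p_sub (t, x')
      exact (abs_sub _ _).trans (by linarith)
    have h1 := le_rpow_of_le (ζ := 2 * ζ) (by linarith) (by linarith) (by positivity) hl.le hD h0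
      (hd.trans (le_of_eq (by ring)))
    refine h1.trans ?_
    have h2 : 2 * K * (σ q).sg ^ 2 * (σ q).la ^ (2 * ζ) ≤ C * (1 / 2) ^ q := by
      have h3 := mul_le_mul_of_nonneg_left
        (hsqa q (mul_nonneg hs.le (rpow_nonneg hl.le ζ)) (hAq' q)) (show 0 ≤ 2 * K by positivity)
      have h4 := mul_le_mul_of_nonneg_right hC2 (hpow' q).le
      have h5 : (σ q).la ^ (2 * ζ) = ((σ q).la ^ ζ) ^ 2 := by
        rw [mul_comm, rpow_mul hl.le]; norm_num
      rw [h5]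
      linarith [mul_pow (σ q).sg ((σ q).la ^ ζ) 2]
    have := mul_le_mul_of_nonneg_right h2 (rpow_nonneg hD (2 * ζ))
    linarith
  · have h1 := (σ q).g_eq t
    rw [(hσ q).E] at h1
    rw [← h1, abs_of_nonneg ((σ q).g_nonneg t)]
    have := mul_le_mul_of_nonneg_right hC3 (hpow' q).le
    linarith [(σ q).g_le t, hsg2 q]

/-! ### Passage to the limit -/

open Filter Topology

lemma exists_lim {X : Type*} {F : ℕ → X → ℝ} {B : ℝ}
    (h : ∀ q z, |F (q + 1) z - F q z| ≤ B * (1 / 2) ^ q) :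
    ∃ f : X → ℝ, ∀ z, Tendsto (fun q => F q z) atTop (𝓝 (f z)) := by
  choose f hf using fun z => cauchySeq_tendsto_of_complete
    (cauchySeq_of_le_geometric (f := fun q => F q z) (1 / 2) B (by norm_num) fun q => by
      rw [dist_comm, Real.dist_eq]; exact h q z)
  exact ⟨f, hf⟩

lemma tendsto_zero_of_geometric {F : ℕ → ℝ} {C : ℝ} (h : ∀ q, |F q| ≤ C * (1 / 2) ^ q) :
    Tendsto F atTop (𝓝 0) := by
  refine squeeze_zero_norm h ?_
  simpa using (tendsto_pow_atTop_nhds_zero_of_lt_one (show (0 : ℝ) ≤ 1 / 2 by norm_num)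
    (by norm_num)).const_mul C

abbrev cell : Set E2 := Set.Icc 0 (fun _ => 2 * π)

lemma volume_cell : volume cell < ⊤ := isCompact_Icc.measure_lt_top

lemma exists_bound_cell (f : PF ℝ) {T : ℝ} (h : ∀ t x, T ≤ |t| → f (t, x) = 0) :
    ∃ B, 0 ≤ B ∧ ∀ t, ∀ x ∈ cell, |f (t, x)| ≤ B := by
  obtain ⟨B, hB⟩ := ((isCompact_Icc (a := -T) (b := T)).prod (isCompact_Icc (a := (0 : E2))
    (b := fun _ => 2 * π))).exists_bound_of_continuousOn f.cont.continuousOn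
  refine ⟨max B 0, le_max_right _ _, fun t x hx => ?_⟩
  by_cases ht : T ≤ |t|
  · rw [h t x ht]; simp
  · exact (hB (t, x) ⟨abs_le.1 (not_le.1 ht).le, hx⟩).trans (le_max_left _ _)

lemma tendsto_integral_cell {G : ℕ → PF ℝ} {g : ℝ × E2 → ℝ} {B : ℝ} (t : ℝ)
    (hB : ∀ q, ∀ x ∈ cell, |G q (t, x)| ≤ B)
    (hG : ∀ x, Tendsto (fun q => G q (t, x)) atTop (𝓝 (g (t, x)))) :
    Tendsto (fun q => ∫ x in cell, G q (t, x)) atTop (𝓝 (∫ x in cell, g (t, x))) := by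
  refine tendsto_integral_of_dominated_convergence (fun _ => B) (fun q => ?_) ?_ (fun q => ?_) ?_
  · exact ((G q).cont.comp (by fun_prop : Continuous fun x : E2 => (t, x))).aestronglyMeasurable
  · exact integrableOn_const volume_cell.ne
  · exact (ae_restrict_iff' measurableSet_Icc).2 (ae_of_all _ fun x hx => hB q x hx)
  · exact ae_of_all _ hG

lemma tendsto_integral_integral_cell {G : ℕ → PF ℝ} {g : ℝ × E2 → ℝ} {B T : ℝ}
    (hB : ∀ q t, ∀ x ∈ cell, |G q (t, x)| ≤ B) (hT : ∀ q t x, T ≤ |t| → G q (t, x) = 0)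
    (hG : ∀ z, Tendsto (fun q => G q z) atTop (𝓝 (g z))) :
    Tendsto (fun q => ∫ t, ∫ x in cell, G q (t, x)) atTop (𝓝 (∫ t, ∫ x in cell, g (t, x))) := by
  refine tendsto_integral_of_dominated_convergence
    ((Set.Icc (-T) T).indicator fun _ => B * volume.real cell) (fun q => ?_) ?_ (fun q => ?_) ?_
  · simp_rw [integral_box]
    exact (((mean (G q)).cont.comp (by fun_prop : Continuous fun t : ℝ => (t, (0 : E2)))).const_mul
      _).aestronglyMeasurable
  · exact (integrableOn_const isCompact_Icc.measure_lt_top.ne).integrable_indicator measurableSet_Icc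
  · refine ae_of_all _ fun t => ?_
    by_cases ht : T ≤ |t|
    · simp only [hT q t _ ht, integral_zero, norm_zero]
      refine Set.indicator_nonneg (fun _ _ => ?_) _
      exact mul_nonneg ((abs_nonneg _).trans (hB q t 0 ⟨le_rfl, fun _ => by positivity⟩))
        measureReal_nonneg
    · rw [Set.indicator_of_mem (show t ∈ Set.Icc (-T) T from abs_le.1 (not_le.1 ht).le)]
      exact norm_setIntegral_le_of_norm_le_const volume_cell fun x hx => hB q t x hx
  · exact ae_of_all _ fun t => tendsto_integral_cell t (fun q x hx => hB q t x hx) fun x => hG _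

lemma integral_integral_cell_dt (f : PF ℝ) {T : ℝ} (hT : ∀ t x, T ≤ |t| → f (t, x) = 0) :
    ∫ t, ∫ x in cell, dt f (t, x) = 0 := by
  simp_rw [integral_box]
  rw [integral_const_mul]
  have hc : ∀ F : PF ℝ, Continuous fun t : ℝ => F (t, 0) := fun F => F.cont.comp (by fun_prop)
  have hd : ∀ t, HasDerivAt (fun t => mean f (t, 0)) (mean (dt f) (t, 0)) t := fun t => by
    have := hasDerivAt_line (mean f) (0, 0) (1, 0) t
    rw [dv_mean] at this
    simpa using this
  have hs : HasCompactSupport fun t => mean f (t, 0) :=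
    HasCompactSupport.of_support_subset_isCompact (isCompact_Icc (a := -T) (b := T)) fun t ht => by
      by_contra h
      refine ht ?_
      have := abs_mean_le f t (M := 0) (fun x => by
        rw [hT t x (not_lt.1 fun hlt => h (abs_le.1 hlt.le)), abs_zero]) 0
      exact abs_nonpos_iff.1 this
  have hs' : HasCompactSupport fun t => mean (dt f) (t, 0) := by
    have := hs.deriv
    rwa [funext fun t => (hd t).deriv] at this
  rw [integral_eq_zero_of_hasDerivAt_of_integrable hd ((hc _).integrable_of_hasCompactSupport hs')
    ((hc _).integrable_of_hasCompactSupport hs), mul_zero]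

lemma dv_eq_zero_of_lt {f : PF ℝ} {T : ℝ} (hT : ∀ t x, T ≤ |t| → f (t, x) = 0) (v : ℝ × E2)
    (t : ℝ) (x : E2) (ht : T < |t|) : dv v f (t, x) = 0 := by
  have h : (f : ℝ × E2 → ℝ) =ᶠ[𝓝 (t, x)] fun _ => 0 := by
    filter_upwards [(isOpen_lt continuous_const (continuous_abs.comp continuous_fst)).mem_nhds
      (show T < |(t, x).1| from ht)] with z hz
    exact hT z.1 z.2 (le_of_lt hz)
  rw [dv_apply, h.fderiv_eq]
  simp

open Filter Topology

namespace Appr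
variable {E : ℝ → ℝ} {ζ : ℝ} (a : Appr E ζ)

/-- The integrand of the weak form of the momentum equation. -/
def wk (q : ℕ) (Φ : Fin 2 → PF ℝ) : PF ℝ :=
  (a.u q 0 * dt (Φ 0) + a.u q 1 * dt (Φ 1)) +
  (a.u q 0 * a.u q 0 * d 0 (Φ 0) + a.u q 0 * a.u q 1 * d 1 (Φ 0) +
    (a.u q 1 * a.u q 0 * d 0 (Φ 1) + a.u q 1 * a.u q 1 * d 1 (Φ 1))) +
  a.p q * (d 0 (Φ 0) + d 1 (Φ 1)) -
  (a.r q * (d 0 (Φ 0) - d 1 (Φ 1)) + a.s q * (d 0 (Φ 1) + d 1 (Φ 0)))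

lemma wk_eq (q : ℕ) (Φ : Fin 2 → PF ℝ) : a.wk q Φ = dt (a.u q 0 * Φ 0 + a.u q 1 * Φ 1) +
    d 0 (a.u q 0 * (a.u q 0 * Φ 0 + a.u q 1 * Φ 1) + a.p q * Φ 0 - (a.r q * Φ 0 + a.s q * Φ 1)) +
    d 1 (a.u q 1 * (a.u q 0 * Φ 0 + a.u q 1 * Φ 1) + a.p q * Φ 1 - (a.s q * Φ 0 - a.r q * Φ 1)) := by
  have h0 := a.eq0 q
  have h1 := a.eq1 q
  have h2 := a.div_u q
  rw [mat_apply] at h0 h1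
  simp only [wk, map_add, map_sub, Derivation.leibniz, smul_eq_mul]
  linear_combination -(Φ 0) * h0 - Φ 1 * h1 - (a.u q 0 * Φ 0 + a.u q 1 * Φ 1) * h2

lemma integral_wk (q : ℕ) {Φ : Fin 2 → PF ℝ} {T : ℝ} (hT : ∀ i t x, T ≤ |t| → Φ i (t, x) = 0) :
    ∫ t, ∫ x in cell, a.wk q Φ (t, x) = 0 := by
  have h := integral_integral_cell_dt (a.u q 0 * Φ 0 + a.u q 1 * Φ 1) (T := T) fun t x ht => by
    simp [hT _ t x ht]
  simp_rw [integral_box] at h ⊢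
  rw [wk_eq]
  simpa only [map_add mean, mean_d, add_zero] using h

lemma abs_u_le (q : ℕ) (i : Fin 2) (z) : |a.u q i z| ≤ 2 * a.C :=
  abs_le_of_geometric (F := fun q => a.u q i z) (by simp [a.u_zero]) (fun q => a.u_sub q i z) q

lemma abs_p_le (q : ℕ) (z) : |a.p q z| ≤ 2 * a.C :=
  abs_le_of_geometric (F := fun q => a.p q z) (by simp [a.p_zero]) (fun q => a.p_sub q z) q

lemma abs_r_le (q : ℕ) (z) : |a.r q z| ≤ a.C :=
  (a.r_le q z).trans (mul_le_of_le_one_right a.C_pos.le (pow_le_one₀ (by norm_num) (by norm_num)))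

lemma abs_s_le (q : ℕ) (z) : |a.s q z| ≤ a.C :=
  (a.s_le q z).trans (mul_le_of_le_one_right a.C_pos.le (pow_le_one₀ (by norm_num) (by norm_num)))

lemma exists_bound_dv {f : PF ℝ} {T : ℝ} (hT : ∀ t x, T ≤ |t| → f (t, x) = 0) (v : ℝ × E2) :
    ∃ B, 0 ≤ B ∧ ∀ t, ∀ x ∈ cell, |dv v f (t, x)| ≤ B :=
  exists_bound_cell (dv v f) (T := T + 1) fun t x ht => dv_eq_zero_of_lt hT v t x (by linarith)

lemma abs_mul_le' {x y A B : ℝ} (h : |x| ≤ A) (h' : |y| ≤ B) : |x * y| ≤ A * B := by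
  rw [abs_mul]; exact mul_le_mul h h' (abs_nonneg _) ((abs_nonneg _).trans h)

lemma abs_add_le' {x y A B : ℝ} (h : |x| ≤ A) (h' : |y| ≤ B) : |x + y| ≤ A + B :=
  (abs_add_le _ _).trans (add_le_add h h')

lemma abs_sub_le' {x y A B : ℝ} (h : |x| ≤ A) (h' : |y| ≤ B) : |x - y| ≤ A + B :=
  (abs_sub _ _).trans (add_le_add h h')

theorem weak_momentum {u : Fin 2 → ℝ × E2 → ℝ} {p : ℝ × E2 → ℝ}
    (hu : ∀ i z, Tendsto (fun q => a.u q i z) atTop (𝓝 (u i z)))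
    (hp : ∀ z, Tendsto (fun q => a.p q z) atTop (𝓝 (p z)))
    {Φ : Fin 2 → PF ℝ} {T : ℝ} (hT : ∀ i t x, T ≤ |t| → Φ i (t, x) = 0) :
    ∫ t, ∫ x in cell, ((u 0 (t, x) * dt (Φ 0) (t, x) + u 1 (t, x) * dt (Φ 1) (t, x)) +
      (u 0 (t, x) * u 0 (t, x) * d 0 (Φ 0) (t, x) + u 0 (t, x) * u 1 (t, x) * d 1 (Φ 0) (t, x) +
        (u 1 (t, x) * u 0 (t, x) * d 0 (Φ 1) (t, x) + u 1 (t, x) * u 1 (t, x) * d 1 (Φ 1) (t, x))) +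
      p (t, x) * (d 0 (Φ 0) (t, x) + d 1 (Φ 1) (t, x))) = 0 := by
  have hr : ∀ z, Tendsto (fun q => a.r q z) atTop (𝓝 0) := fun z =>
    tendsto_zero_of_geometric fun q => a.r_le q z
  have hs : ∀ z, Tendsto (fun q => a.s q z) atTop (𝓝 0) := fun z =>
    tendsto_zero_of_geometric fun q => a.s_le q z
  have hc : ∀ (v : ℝ × E2) i z, Tendsto (fun _ : ℕ => dv v (Φ i) z) atTop (𝓝 (dv v (Φ i) z)) :=
    fun v i z => tendsto_const_nhds
  choose B hB0 hB using fun (v : ℝ × E2) i => exists_bound_dv (hT i) v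
  have hbd : ∀ q t, ∀ x ∈ cell, |a.wk q Φ (t, x)| ≤
      (2 * a.C * B (1, 0) 0 + 2 * a.C * B (1, 0) 1) +
      (2 * a.C * (2 * a.C) * B (0, e2 0) 0 + 2 * a.C * (2 * a.C) * B (0, e2 1) 0 +
        (2 * a.C * (2 * a.C) * B (0, e2 0) 1 + 2 * a.C * (2 * a.C) * B (0, e2 1) 1)) +
      2 * a.C * (B (0, e2 0) 0 + B (0, e2 1) 1) +
      (a.C * (B (0, e2 0) 0 + B (0, e2 1) 1) + a.C * (B (0, e2 0) 1 + B (0, e2 1) 0)) := by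
    intro q t x hx
    have h : ∀ v i, |dv v (Φ i) (t, x)| ≤ B v i := fun v i => hB v i t x hx
    have h0 := a.abs_u_le q 0 (t, x)
    have h1 := a.abs_u_le q 1 (t, x)
    refine abs_sub_le' (abs_add_le' (abs_add_le' ?_ ?_) ?_) ?_
    · exact abs_add_le' (abs_mul_le' h0 (h _ _)) (abs_mul_le' h1 (h _ _))
    · exact abs_add_le' (abs_add_le' (abs_mul_le' (abs_mul_le' h0 h0) (h _ _))
        (abs_mul_le' (abs_mul_le' h0 h1) (h _ _))) (abs_add_le'
        (abs_mul_le' (abs_mul_le' h1 h0) (h _ _)) (abs_mul_le' (abs_mul_le' h1 h1) (h _ _)))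
    · exact abs_mul_le' (a.abs_p_le q _) (abs_add_le' (h _ _) (h _ _))
    · exact abs_add_le' (abs_mul_le' (a.abs_r_le q _) (abs_sub_le' (h _ _) (h _ _)))
        (abs_mul_le' (a.abs_s_le q _) (abs_add_le' (h _ _) (h _ _)))
  have hvan : ∀ q t x, T + 1 ≤ |t| → a.wk q Φ (t, x) = 0 := by
    intro q t x ht
    have h : ∀ v i, dv v (Φ i) (t, x) = 0 := fun v i =>
      dv_eq_zero_of_lt (hT i) v t x (by linarith)
    simp [wk, h]
  have hlim := tendsto_integral_integral_cell (G := fun q => a.wk q Φ) (T := T + 1) hbd hvan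
    fun z => (((((hu 0 z).mul (hc (1, 0) 0 z)).add ((hu 1 z).mul (hc (1, 0) 1 z))).add
      (((((hu 0 z).mul (hu 0 z)).mul (hc (0, e2 0) 0 z)).add
        (((hu 0 z).mul (hu 1 z)).mul (hc (0, e2 1) 0 z))).add
      ((((hu 1 z).mul (hu 0 z)).mul (hc (0, e2 0) 1 z)).add
        (((hu 1 z).mul (hu 1 z)).mul (hc (0, e2 1) 1 z))))).add
      ((hp z).mul ((hc (0, e2 0) 0 z).add (hc (0, e2 1) 1 z)))).sub
      (((hr z).mul ((hc (0, e2 0) 0 z).sub (hc (0, e2 1) 1 z))).add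
        ((hs z).mul ((hc (0, e2 0) 1 z).add (hc (0, e2 1) 0 z))))
  simp only [fun q => a.integral_wk q hT, zero_mul, add_zero, sub_zero] at hlim
  exact tendsto_nhds_unique hlim tendsto_const_nhds

theorem weak_div {u : Fin 2 → ℝ × E2 → ℝ}
    (hu : ∀ i z, Tendsto (fun q => a.u q i z) atTop (𝓝 (u i z)))
    {Ψ : PF ℝ} {T : ℝ} (hT : ∀ t x, T ≤ |t| → Ψ (t, x) = 0) :
    ∫ t, ∫ x in cell, (u 0 (t, x) * d 0 Ψ (t, x) + u 1 (t, x) * d 1 Ψ (t, x)) = 0 := by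
  obtain ⟨B0, hB0, hB0'⟩ := exists_bound_dv hT (0, e2 0)
  obtain ⟨B1, hB1, hB1'⟩ := exists_bound_dv hT (0, e2 1)
  have hlim := tendsto_integral_integral_cell (T := T + 1)
    (G := fun q => a.u q 0 * d 0 Ψ + a.u q 1 * d 1 Ψ) (B := 2 * a.C * B0 + 2 * a.C * B1)
    (fun q t x hx => abs_add_le' (abs_mul_le' (a.abs_u_le q 0 _) (hB0' t x hx))
      (abs_mul_le' (a.abs_u_le q 1 _) (hB1' t x hx)))
    (fun q t x ht => by
      have h : ∀ v, dv v Ψ (t, x) = 0 := fun v => dv_eq_zero_of_lt hT v t x (by linarith)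
      simp [h])
    fun z => ((hu 0 z).mul (tendsto_const_nhds (x := d 0 Ψ z))).add
      ((hu 1 z).mul (tendsto_const_nhds (x := d 1 Ψ z)))
  have hz : ∀ q t, ∫ x in cell, (a.u q 0 * d 0 Ψ + a.u q 1 * d 1 Ψ) (t, x) = 0 := fun q t => by
    have h : a.u q 0 * d 0 Ψ + a.u q 1 * d 1 Ψ = d 0 (a.u q 0 * Ψ) + d 1 (a.u q 1 * Ψ) := by
      simp only [Derivation.leibniz, smul_eq_mul]
      linear_combination -Ψ * a.div_u q
    rw [integral_box, h, map_add, mean_d, mean_d]; simp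
  simp only [hz, integral_zero] at hlim
  exact tendsto_nhds_unique hlim tendsto_const_nhds

theorem energy_lim {u : Fin 2 → ℝ × E2 → ℝ}
    (hu : ∀ i z, Tendsto (fun q => a.u q i z) atTop (𝓝 (u i z))) (t : ℝ) :
    ∫ x in cell, (u 0 (t, x) ^ 2 + u 1 (t, x) ^ 2) = (2 * π) ^ 2 * E t := by
  have hlim := tendsto_integral_cell (G := fun q => a.u q 0 ^ 2 + a.u q 1 ^ 2)
    (g := fun z => u 0 z ^ 2 + u 1 z ^ 2)
    (B := (2 * a.C) ^ 2 + (2 * a.C) ^ 2) t (fun q x _ => by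
      rw [add_apply, pow_apply, pow_apply]
      refine abs_add_le' ?_ ?_ <;> rw [abs_pow] <;>
      exact pow_le_pow_left₀ (abs_nonneg _) (a.abs_u_le q _ _) 2)
    fun x => by
      simp only [add_apply, pow_apply]
      exact ((hu 0 _).pow 2).add ((hu 1 _).pow 2)
  simp_rw [integral_box] at hlim
  refine tendsto_nhds_unique hlim (Tendsto.const_mul _ ?_)
  have h := tendsto_zero_of_geometric fun q => a.energy q t
  have h2 := (tendsto_const_nhds (x := E t)).sub h
  simpa using h2

lemma hol_u {u : Fin 2 → ℝ × E2 → ℝ}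
    (hu : ∀ i z, Tendsto (fun q => a.u q i z) atTop (𝓝 (u i z))) (i : Fin 2) (z z') :
    |u i z - u i z'| ≤ 2 * a.C * (|z.1 - z'.1| + ‖z.2 - z'.2‖) ^ ζ := by
  refine le_of_tendsto ((hu i z).sub (hu i z')).abs (Eventually.of_forall fun q => ?_)
  rw [mul_assoc]
  refine abs_le_of_geometric (F := fun q => a.u q i z - a.u q i z') (by simp [a.u_zero]) (fun q => ?_) q
  rw [sub_sub_sub_comm]
  exact a.u_hol q i z z'

lemma hol_p {p : ℝ × E2 → ℝ} (hp : ∀ z, Tendsto (fun q => a.p q z) atTop (𝓝 (p z))) (t : ℝ)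
    (x x' : E2) : |p (t, x) - p (t, x')| ≤ 2 * a.C * ‖x - x'‖ ^ (2 * ζ) := by
  refine le_of_tendsto ((hp (t, x)).sub (hp (t, x'))).abs (Eventually.of_forall fun q => ?_)
  rw [mul_assoc]
  refine abs_le_of_geometric (F := fun q => a.p q (t, x) - a.p q (t, x')) (by simp [a.p_zero])
    (fun q => ?_) q
  rw [sub_sub_sub_comm]
  exact a.p_hol q t x x'

end Appr

open Filter Topology

lemma deriv_time (f : PF ℝ) (t : ℝ) (x : E2) : deriv (fun s => f (s, x)) t = dt f (t, x) := by
  simpa using (hasDerivAt_line f (0, x) (1, 0) t).deriv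

lemma pd2_eq (f : PF ℝ) (i : Fin 2) (t : ℝ) (x : E2) :
    pd2 i (fun y => f (t, y)) x = d i f (t, x) := by
  have h : HasFDerivAt (fun y => f (t, y)) _ x := (f.diff (t, x)).comp x (hasFDerivAt_prodMk_right t x)
  rw [pd2, h.fderiv, dv_apply]
  simp

lemma exists_appr_of_energy (e : ℝ → ℝ) (he_smooth : ContDiff ℝ ∞ e) (he_supp : HasCompactSupport e)
    (he_nonneg : ∀ t, 0 ≤ e t) {ζ : ℝ} (hζ : 0 < ζ) (hζ' : ζ < 1 / 5) :
    Nonempty (Appr (fun t => e t / (2 * π) ^ 2) ζ) := by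
  refine exists_appr hζ hζ' (fun t => by have := he_nonneg t; positivity) ?_ ?_ ?_
  · obtain ⟨B, hB⟩ := he_supp.exists_bound_of_continuous he_smooth.continuous
    exact ⟨B / (2 * π) ^ 2, fun t => by gcongr; exact (le_abs_self _).trans (hB t)⟩
  · obtain ⟨L, hL⟩ := ContDiff.lipschitzWith_of_hasCompactSupport he_supp he_smooth (by simp)
    refine ⟨L / (2 * π) ^ 2, fun t t' => ?_⟩
    rw [← sub_div, abs_div, abs_of_nonneg (by positivity : (0 : ℝ) ≤ (2 * π) ^ 2), div_mul_eq_mul_div]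
    gcongr
    simpa [Real.dist_eq] using hL.dist_le_mul t t'
  · obtain ⟨T, hT⟩ := he_supp.isCompact.isBounded.subset_closedBall 0
    refine ⟨T + 1, fun t ht => ?_⟩
    have : e t = 0 := by
      refine image_eq_zero_of_notMem_tsupport fun h => ?_
      have := hT h
      rw [mem_closedBall_zero_iff, Real.norm_eq_abs] at this
      linarith
    simp [this]

end PF

/-- **Non-uniqueness and anomalous energy profiles for 2D Euler.**
Given a smooth, compactly supported, non-negative energy profile `e` and `ζ ∈ (0,1/5)`,
there exist `u ∈ C^ζ(ℝ × 𝕋²; ℝ²)` and `p ∈ L^∞(ℝ; C^{2ζ}(𝕋²))` solving the 2D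
incompressible Euler equations distributionally, with energy profile `e`. -/
theorem euler2d_convex_integration
    (e : ℝ → ℝ) (he_smooth : ContDiff ℝ (⊤ : ℕ∞) e) (he_supp : HasCompactSupport e)
    (he_nonneg : ∀ t, 0 ≤ e t) (ζ : ℝ) (hζ : ζ ∈ Set.Ioo (0 : ℝ) (1 / 5)) :
    ∃ (u : ℝ → (Fin 2 → ℝ) → (Fin 2 → ℝ)) (p : ℝ → (Fin 2 → ℝ) → ℝ),
      (∀ t, Periodic2 (u t)) ∧
      (∀ t, Periodic2 (p t)) ∧
      -- u ∈ C^ζ(ℝ × 𝕋²; ℝ²): bounded and ζ-Hölder jointly in time and space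
      (∃ C : ℝ, 0 < C ∧
        (∀ t x, ‖u t x‖ ≤ C) ∧
        (∀ t t' x x', ‖u t x - u t' x'‖ ≤ C * (|t - t'| + ‖x - x'‖) ^ ζ)) ∧
      -- p ∈ L^∞(ℝ; C^{2ζ}(𝕋²))
      (∃ C : ℝ, 0 < C ∧ ∀ t,
        (∀ x, |p t x| ≤ C) ∧
        (∀ x x', |p t x - p t x'| ≤ C * ‖x - x'‖ ^ (2 * ζ))) ∧
      -- momentum equation in the sense of distributions
      (∀ φ : ℝ → (Fin 2 → ℝ) → (Fin 2 → ℝ),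
        ContDiff ℝ (⊤ : ℕ∞) (fun q : ℝ × (Fin 2 → ℝ) => φ q.1 q.2) →
        (∀ t, Periodic2 (φ t)) →
        (∃ T : ℝ, ∀ t, T ≤ |t| → ∀ x, φ t x = 0) →
        (∫ t : ℝ, ∫ x in box2,
            ((∑ i, u t x i * deriv (fun s => φ s x i) t) +
              (∑ i, ∑ j, u t x i * u t x j * pd2 j (fun y => φ t y i) x) +
              p t x * ∑ i, pd2 i (fun y => φ t y i) x)) = 0) ∧
      -- incompressibility in the sense of distributions
      (∀ ψ : ℝ → (Fin 2 → ℝ) → ℝ,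
        ContDiff ℝ (⊤ : ℕ∞) (fun q : ℝ × (Fin 2 → ℝ) => ψ q.1 q.2) →
        (∀ t, Periodic2 (ψ t)) →
        (∃ T : ℝ, ∀ t, T ≤ |t| → ∀ x, ψ t x = 0) →
        (∫ t : ℝ, ∫ x in box2, ∑ i, u t x i * pd2 i (ψ t) x) = 0) ∧
      -- prescribed energy profile
      (∀ t, (∫ x in box2, ∑ i, (u t x i) ^ 2) = e t) := by
  obtain ⟨a⟩ := PF.exists_appr_of_energy e he_smooth he_supp he_nonneg hζ.1 hζ.2
  choose u hu using fun i => PF.exists_lim (F := fun q z => a.u q i z) (fun q z => a.u_sub q i z)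
  obtain ⟨p, hp⟩ := PF.exists_lim (F := fun q z => a.p q z) a.p_sub
  have hC := a.C_pos
  refine ⟨fun t x i => u i (t, x), fun t x => p (t, x), fun t x j => ?_, fun t x j => ?_,
    ⟨2 * a.C, by linarith, fun t x => ?_, fun t t' x x' => ?_⟩,
    ⟨2 * a.C, by linarith, fun t => ⟨fun x => ?_, fun x x' => a.hol_p hp t x x'⟩⟩,
    fun φ hφ hper ⟨T, hT⟩ => ?_, fun ψ hψ hper ⟨T, hT⟩ => ?_, fun t => ?_⟩
  · funext i
    refine tendsto_nhds_unique (hu i _) ?_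
    simpa only [PF.per] using hu i (t, x)
  · refine tendsto_nhds_unique (hp _) ?_
    simpa only [PF.per] using hp (t, x)
  · refine (pi_norm_le_iff_of_nonneg (by linarith)).2 fun i => ?_
    exact le_of_tendsto (hu i (t, x)).abs (Filter.Eventually.of_forall fun q => a.abs_u_le q i _)
  · refine (pi_norm_le_iff_of_nonneg (by positivity)).2 fun i => ?_
    exact a.hol_u hu i (t, x) (t', x')
  · exact le_of_tendsto (hp (t, x)).abs (Filter.Eventually.of_forall fun q => a.abs_p_le q _)
  · let Φ : Fin 2 → PF ℝ := fun i => PF.mk (fun z => φ z.1 z.2 i) (contDiff_pi.1 hφ i)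
      fun t x j => congrFun (hper t x j) i
    have h := a.weak_momentum hu hp (Φ := Φ) (T := T) fun i t x ht => congrFun (hT t ht x) i
    have ht : ∀ i t x, deriv (fun s => φ s x i) t = PF.dt (Φ i) (t, x) := fun i => PF.deriv_time (Φ i)
    have hx : ∀ i j t x, pd2 j (fun y => φ t y i) x = PF.d j (Φ i) (t, x) := fun i j =>
      PF.pd2_eq (Φ i) j
    simp only [Fin.sum_univ_two, ht, hx]
    exact h
  · let Ψ : PF ℝ := PF.mk (fun z => ψ z.1 z.2) hψ fun t x j => hper t x j
    have h := a.weak_div hu (Ψ := Ψ) (T := T) fun t x ht => hT t ht x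
    have hx : ∀ j t x, pd2 j (ψ t) x = PF.d j Ψ (t, x) := fun j => PF.pd2_eq Ψ j
    simp only [Fin.sum_univ_two, hx]
    exact h
  · simp only [Fin.sum_univ_two]
    refine (a.energy_lim hu t).trans ?_
    field_simp

end
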